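/- There exists a real constant c such that for every A > 0 there exist x₀ = x₀(A) and C = C(A) with the following property: for all real x > x₀ and all real Q with 1 ≤ Q ≤ x, |V(x,Q) − Q x log Q + c Q x| ≤ C (Q^{5/4} x^{3/4} + x² (log x)^{−A}). -/

import Mathlib

open Finset

/-- `ψ(x;q,a) = Σ_{n ≤ x, n ≡ a (mod q)} Λ(n)`. -/
noncomputable def psi (x : ℝ) (q a : ℕ) : ℝ :=
  ∑ n ∈ (Finset.Icc 1 ⌊x⌋₊).filter (fun n => n % q = a % q),
    ArithmeticFunction.vonMangoldt n

/-- `V(x,Q) = Σ_{q ≤ Q} Σ_{1 ≤ a ≤ q, gcd(a,q)=1} |ψ(x;q,a) − x/φ(q)|²`. -/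
noncomputable def V (x Q : ℝ) : ℝ :=
  ∑ q ∈ Finset.Icc 1 ⌊Q⌋₊,
    ∑ a ∈ (Finset.Icc 1 q).filter (fun a => Nat.gcd a q = 1),
      (psi x q a - x / (Nat.totient q : ℝ)) ^ 2

namespace Hooley

/-- A bounded sequence with mean value `κ` and bounded discrepancy. -/
structure Balanced (a : ℕ → ℂ) (κ : ℂ) (B : ℝ) : Prop where
  norm_le : ∀ n, ‖a n‖ ≤ 1
  mean_le : ‖κ‖ ≤ 1
  one_le : 1 ≤ B
  sum_le : ∀ N : ℕ, ‖∑ n ∈ Icc 1 N, a n - κ * N‖ ≤ B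

/-- The discrepancy `∑_{n ≤ u} a n - κ u`. -/
noncomputable def discr (a : ℕ → ℂ) (κ : ℂ) (u : ℝ) : ℂ := ∑ n ∈ Icc 1 ⌊u⌋₊, a n - κ * u

/-- The part of the Dirichlet series of `a` that is regular in `0 < re s`. -/
noncomputable def regPart (a : ℕ → ℂ) (κ : ℂ) (s : ℂ) : ℂ :=
  κ + s * mellin (Set.indicator (Set.Ioi 1) (discr a κ)) (-s)

variable {a : ℕ → ℂ} {κ : ℂ} {B : ℝ}

lemma Balanced.norm_discr_le (h : Balanced a κ B) {u : ℝ} (hu : 0 ≤ u) :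
    ‖discr a κ u‖ ≤ B + 1 := by
  have h1 : discr a κ u = (∑ n ∈ Icc 1 ⌊u⌋₊, a n - κ * (⌊u⌋₊ : ℝ)) - κ * ((u - ⌊u⌋₊ : ℝ) : ℂ) := by
    unfold discr; push_cast; ring
  rw [h1]
  refine (norm_sub_le _ _).trans (add_le_add (by simpa using h.sum_le ⌊u⌋₊) ?_)
  rw [norm_mul, Complex.norm_real, Real.norm_eq_abs, abs_of_nonneg (by linarith [Nat.floor_le hu])]
  have h2 := Nat.lt_floor_add_one u
  have h3 := h.mean_le
  have h4 := Nat.floor_le hu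
  nlinarith [norm_nonneg κ]

lemma measurable_discr (a : ℕ → ℂ) (κ : ℂ) : Measurable (discr a κ) := by
  unfold discr
  refine Measurable.sub ?_ (by fun_prop)
  exact (measurable_from_top (f := fun n : ℕ => ∑ n ∈ Icc 1 n, a n)).comp Nat.measurable_floor

lemma Balanced.norm_indicator_le (h : Balanced a κ B) (u : ℝ) :
    ‖Set.indicator (Set.Ioi 1) (discr a κ) u‖ ≤ B + 1 := by
  by_cases hu : u ∈ Set.Ioi (1 : ℝ)
  · rw [Set.indicator_of_mem hu]
    exact h.norm_discr_le (by have : (1 : ℝ) < u := hu; linarith)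
  · rw [Set.indicator_of_notMem hu]
    have := h.one_le
    simp; linarith

lemma Balanced.mellin_hyps (h : Balanced a κ B) :
    MeasureTheory.LocallyIntegrableOn (Set.indicator (Set.Ioi 1) (discr a κ)) (Set.Ioi 0) ∧
    (Set.indicator (Set.Ioi 1) (discr a κ)) =O[Filter.atTop] (fun x : ℝ => x ^ (-(0 : ℝ))) ∧
    ∀ b : ℝ, (Set.indicator (Set.Ioi 1) (discr a κ)) =O[nhdsWithin 0 (Set.Ioi 0)]
      (fun x : ℝ => x ^ (-b)) := by
  refine ⟨?_, ?_, ?_⟩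
  · refine MeasureTheory.LocallyIntegrable.locallyIntegrableOn ?_ _
    have : MeasureTheory.LocallyIntegrable (fun _ : ℝ => (B + 1 : ℝ)) :=
      MeasureTheory.locallyIntegrable_const _
    refine this.mono ((measurable_discr a κ).indicator measurableSet_Ioi).aestronglyMeasurable ?_
    filter_upwards with u
    exact (h.norm_indicator_le u).trans (le_abs_self _)
  · refine Asymptotics.IsBigO.of_bound (B + 1) ?_
    filter_upwards with u
    simpa using h.norm_indicator_le u
  · intro b
    refine Asymptotics.IsBigO.of_bound 0 ?_
    have : Set.Iio (1 : ℝ) ∈ nhdsWithin (0 : ℝ) (Set.Ioi 0) :=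
      mem_nhdsWithin_of_mem_nhds (Iio_mem_nhds one_pos)
    filter_upwards [this] with u hu
    rw [Set.indicator_of_notMem (by simpa using le_of_lt hu)]
    simp

lemma Balanced.differentiableAt_regPart (h : Balanced a κ B) {s : ℂ} (hs : 0 < s.re) :
    DifferentiableAt ℂ (regPart a κ) s := by
  obtain ⟨h1, h2, h3⟩ := h.mellin_hyps
  unfold regPart
  have h4 : DifferentiableAt ℂ (mellin (Set.indicator (Set.Ioi 1) (discr a κ))) (-s) :=
    mellin_differentiableAt_of_isBigO_rpow h1 h2 (by simpa using hs) (h3 (-s.re - 1)) (by simp)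
  have h5 : DifferentiableAt ℂ (fun z => mellin (Set.indicator (Set.Ioi 1) (discr a κ)) (-z)) s :=
    h4.comp s (f := fun z : ℂ => -z) differentiableAt_id.neg
  fun_prop

lemma mellin_indicator_eq (a : ℕ → ℂ) (κ s : ℂ) :
    mellin (Set.indicator (Set.Ioi 1) (discr a κ)) (-s) =
      ∫ u in Set.Ioi (1 : ℝ), discr a κ u * (u : ℂ) ^ (-s - 1) := by
  unfold mellin
  have : ∀ u : ℝ, (u : ℂ) ^ (-s - 1) • Set.indicator (Set.Ioi 1) (discr a κ) u =
      Set.indicator (Set.Ioi 1) (fun u : ℝ => discr a κ u * (u : ℂ) ^ (-s - 1)) u := by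
    intro u
    by_cases hu : u ∈ Set.Ioi (1 : ℝ)
    · simp only [Set.indicator_of_mem hu, smul_eq_mul, mul_comm]
    · simp only [Set.indicator_of_notMem hu, smul_zero]
  simp_rw [this]
  rw [MeasureTheory.setIntegral_indicator measurableSet_Ioi]
  congr 2
  ext u
  simp only [Set.mem_inter_iff, Set.mem_Ioi]
  exact ⟨fun h => h.2, fun h => ⟨by linarith, h⟩⟩

lemma Balanced.integrableOn (h : Balanced a κ B) {s : ℂ} (hs : 0 < s.re) {c : ℝ} (hc : 0 < c) :
    MeasureTheory.IntegrableOn (fun u : ℝ => discr a κ u * (u : ℂ) ^ (-s - 1)) (Set.Ioi c) := by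
  have h1 : MeasureTheory.IntegrableOn (fun u : ℝ => (B + 1) * u ^ (-s.re - 1)) (Set.Ioi c) :=
    (integrableOn_Ioi_rpow_of_lt (by linarith) hc).const_mul _
  refine MeasureTheory.Integrable.mono' h1 ?_ ?_
  · refine ((measurable_discr a κ).mul ?_).aestronglyMeasurable
    fun_prop
  · refine (MeasureTheory.ae_restrict_iff' measurableSet_Ioi).2 (Filter.Eventually.of_forall ?_)
    intro u hu
    have hu0 : 0 < u := lt_trans hc hu
    rw [norm_mul, Complex.norm_cpow_eq_rpow_re_of_pos hu0]
    have := h.norm_discr_le hu0.le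
    simp only [Complex.sub_re, Complex.neg_re, Complex.one_re]
    gcongr

lemma Balanced.norm_tail_le (h : Balanced a κ B) {s : ℂ} (hs : 0 < s.re) {c : ℝ} (hc : 0 < c) :
    ‖∫ u in Set.Ioi c, discr a κ u * (u : ℂ) ^ (-s - 1)‖ ≤ (B + 1) * (c ^ (-s.re) / s.re) := by
  have h1 : MeasureTheory.IntegrableOn (fun u : ℝ => (B + 1) * u ^ (-s.re - 1)) (Set.Ioi c) :=
    (integrableOn_Ioi_rpow_of_lt (by linarith) hc).const_mul _
  refine (MeasureTheory.norm_integral_le_of_norm_le h1 ?_).trans ?_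
  · refine (MeasureTheory.ae_restrict_iff' measurableSet_Ioi).2 (Filter.Eventually.of_forall ?_)
    intro u hu
    have hu0 : 0 < u := lt_trans hc hu
    rw [norm_mul, Complex.norm_cpow_eq_rpow_re_of_pos hu0]
    have := h.norm_discr_le hu0.le
    simp only [Complex.sub_re, Complex.neg_re, Complex.one_re]
    gcongr
  · rw [MeasureTheory.integral_const_mul, integral_Ioi_rpow_of_lt (by linarith) hc]
    simp only [sub_add_cancel]
    rw [neg_div_neg_eq]

lemma Balanced.lseries_eq (h : Balanced a κ B) {s : ℂ} (hs : 1 < s.re) :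
    LSeries a s = κ / (s - 1) + regPart a κ s := by
  have hs1 : s - 1 ≠ 0 := by
    intro h0; have := congrArg Complex.re h0; simp at this; linarith
  have h1 : LSeriesSummable a s :=
    LSeriesSummable_of_bounded_of_one_lt_re (m := 1) (fun n _ => h.norm_le n) hs
  have h2 : (fun n : ℕ => ∑ k ∈ Icc 1 n, a k) =O[Filter.atTop] fun n : ℕ => (n : ℝ) ^ (1 : ℝ) := by
    refine Asymptotics.IsBigO.of_bound 1 (Filter.Eventually.of_forall fun n => ?_)
    rw [Real.rpow_one, one_mul]
    refine (norm_sum_le _ _).trans ?_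
    refine (sum_le_sum (fun k _ => h.norm_le k)).trans ?_
    simp
  rw [LSeries_eq_mul_integral a zero_le_one hs h1 h2, regPart, mellin_indicator_eq]
  have h3 : ∀ u : ℝ, u ∈ Set.Ioi (1 : ℝ) → (∑ k ∈ Icc 1 ⌊u⌋₊, a k) * (u : ℂ) ^ (-(s + 1)) =
      discr a κ u * (u : ℂ) ^ (-s - 1) + κ * (u : ℂ) ^ (-s) := by
    intro u hu
    have hu0 : (u : ℂ) ≠ 0 := by
      have : (1 : ℝ) < u := hu
      exact_mod_cast (by linarith : u ≠ 0)
    unfold discr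
    have : (u : ℂ) ^ (-s) = u * (u : ℂ) ^ (-s - 1) := by
      rw [Complex.cpow_sub _ _ hu0, Complex.cpow_one]; field_simp
    rw [this, show -(s + 1) = -s - 1 by ring]; ring
  rw [MeasureTheory.setIntegral_congr_fun measurableSet_Ioi h3, MeasureTheory.integral_add
    (h.integrableOn (by linarith) one_pos)
    ((integrableOn_Ioi_cpow_of_lt (by simpa using hs) one_pos).const_mul _),
    MeasureTheory.integral_const_mul, integral_Ioi_cpow_of_lt (by simpa using hs) one_pos]
  have : -s + 1 ≠ 0 := by
    intro h0; apply hs1; linear_combination -h0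
  simp only [Complex.ofReal_one, Complex.one_cpow]
  field_simp
  ring

lemma Balanced.regPart_eq (h : Balanced a κ B) {s : ℂ} (hs : 0 < s.re) {N : ℕ} (hN : 1 ≤ N) :
    regPart a κ s = ∑ n ∈ Icc 1 N, a n * (n : ℂ) ^ (-s) - discr a κ N * (N : ℂ) ^ (-s)
      - κ * (∫ u in (1 : ℝ)..N, (u : ℂ) ^ (-s))
      + s * ∫ u in Set.Ioi (N : ℝ), discr a κ u * (u : ℂ) ^ (-s - 1) := by
  have hN' : (1 : ℝ) ≤ N := by exact_mod_cast hN
  have hN0 : (N : ℂ) ≠ 0 := by exact_mod_cast (by omega : N ≠ 0)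
  have hs0 : s ≠ 0 := by rintro rfl; simp at hs
  have e1 := intervalIntegral.integral_interval_add_Ioi (h.integrableOn hs one_pos)
    (h.integrableOn hs (by linarith : (0 : ℝ) < N))
  rw [regPart, mellin_indicator_eq, ← e1]
  set c : ℕ → ℂ := fun n => if n = 0 then 0 else a n with hc
  have hsum : ∀ n : ℕ, ∑ k ∈ Icc 0 n, c k = ∑ k ∈ Icc 1 n, a k := by
    intro n
    have : Icc 0 n = insert 0 (Icc 1 n) := by ext k; simp; omega
    rw [this, sum_insert (by simp)]
    simp only [hc, if_true, zero_add]
    exact sum_congr rfl fun k hk => by simp at hk; simp [show k ≠ 0 by omega]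
  have hd : ∀ u ∈ Set.Icc (1 : ℝ) N, HasDerivAt (fun u : ℝ => (u : ℂ) ^ (-s)) (-s * (u : ℂ) ^ (-s - 1)) u := by
    intro u hu
    have hu0 : u ≠ 0 := by linarith [hu.1]
    have := (hasDerivAt_ofReal_cpow_const' hu0 (r := -s - 1) (by
      intro h0; apply hs0; linear_combination -h0)).const_mul (-s)
    simp only [sub_add_cancel] at this
    refine this.congr_of_eventuallyEq (Filter.Eventually.of_forall fun v => ?_)
    field_simp
  have hcont : ContinuousOn (fun u : ℝ => -s * (u : ℂ) ^ (-s - 1)) (Set.Icc (1 : ℝ) N) := by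
    refine continuousOn_const.mul ?_
    intro u hu
    refine (Complex.continuousAt_ofReal_cpow_const _ _ (Or.inr (by linarith [hu.1]))).continuousWithinAt
  have h_int : MeasureTheory.IntegrableOn (deriv fun u : ℝ => (u : ℂ) ^ (-s)) (Set.Icc (1 : ℝ) N) := by
    refine (hcont.integrableOn_Icc).congr_fun (fun u hu => ((hd u hu).deriv).symm) measurableSet_Icc
  have abel := sum_mul_eq_sub_integral_mul₀' c (f := fun u : ℝ => (u : ℂ) ^ (-s)) (by simp [hc]) N
    (fun u hu => (hd u hu).differentiableAt) h_int
  have hL : ∑ k ∈ Icc 0 N, ((k : ℝ) : ℂ) ^ (-s) * c k = ∑ n ∈ Icc 1 N, a n * (n : ℂ) ^ (-s) := by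
    have : Icc 0 N = insert 0 (Icc 1 N) := by ext k; simp; omega
    rw [this, sum_insert (by simp)]
    simp only [hc, if_true, mul_zero, zero_add]
    exact sum_congr rfl fun k hk => by simp at hk; simp [show k ≠ 0 by omega, mul_comm]
  rw [hL] at abel
  have hI : ∫ t in Set.Ioc (1 : ℝ) N, deriv (fun u : ℝ => (u : ℂ) ^ (-s)) t * ∑ k ∈ Icc 0 ⌊t⌋₊, c k
      = -s * ((∫ u in (1 : ℝ)..N, discr a κ u * (u : ℂ) ^ (-s - 1)) +
        κ * ∫ u in (1 : ℝ)..N, (u : ℂ) ^ (-s)) := by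
    rw [← intervalIntegral.integral_const_mul, ← intervalIntegral.integral_add,
      ← intervalIntegral.integral_const_mul, intervalIntegral.integral_of_le hN']
    · refine MeasureTheory.setIntegral_congr_fun measurableSet_Ioc fun u hu => ?_
      have hu0 : (u : ℂ) ≠ 0 := by exact_mod_cast (by linarith [hu.1] : u ≠ 0)
      have e2 : (u : ℂ) ^ (-s) = u * (u : ℂ) ^ (-s - 1) := by
        rw [Complex.cpow_sub _ _ hu0, Complex.cpow_one]; field_simp
      rw [(hd u ⟨hu.1.le, hu.2⟩).deriv, hsum, e2, discr]
      ring
    · refine (intervalIntegrable_iff_integrableOn_Ioc_of_le hN').2 ?_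
      exact (h.integrableOn hs one_pos).mono_set Set.Ioc_subset_Ioi_self
    · refine ((ContinuousOn.intervalIntegrable ?_).const_mul _)
      rw [Set.uIcc_of_le hN']
      intro u hu
      exact (hd u hu).continuousAt.continuousWithinAt
  rw [hI, hsum] at abel
  have hP : (1 - s) * (∫ u in (1 : ℝ)..N, (u : ℂ) ^ (-s)) = N * (N : ℂ) ^ (-s) - 1 := by
    by_cases h1 : s = 1
    · subst h1
      simp [Complex.cpow_neg_one, hN0]
    · rw [integral_cpow (Or.inr ⟨fun h0 => h1 (by linear_combination -h0), by
        rw [Set.uIcc_of_le hN']; simp⟩)]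
      have : -s + 1 ≠ 0 := fun h0 => h1 (by linear_combination -h0)
      rw [show (1 - s) = -s + 1 by ring, mul_div_cancel₀ _ this, Complex.cpow_add _ _ (by simpa using hN0)]
      simp [mul_comm]
  simp only [discr, Nat.floor_natCast, Complex.ofReal_natCast] at abel ⊢
  linear_combination -abel + κ * hP

lemma Balanced.norm_regPart_le (h : Balanced a κ B) {ε : ℝ} (hε : 0 < ε) (hε' : ε ≤ 1 / 3) {s : ℂ}
    (hs : 1 - ε ≤ s.re) : ‖regPart a κ s‖ ≤ 14 / ε * (B * (1 + ‖s‖)) ^ (2 * ε) := by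
  have hs0 : 0 < s.re := by linarith
  set M : ℝ := B * (1 + ‖s‖) with hM
  have hB := h.one_le
  have hM1 : 1 ≤ M := by nlinarith [norm_nonneg s]
  set N : ℕ := ⌈M⌉₊ with hNdef
  have hMN : M ≤ N := Nat.le_ceil M
  have hN1' : (1 : ℝ) ≤ N := hM1.trans hMN
  have hN1 : 1 ≤ N := by exact_mod_cast hN1'
  have hN0 : (0 : ℝ) < N := by linarith
  have hN2 : (N : ℝ) ≤ 2 * M := by linarith [Nat.ceil_lt_add_one (by linarith : 0 ≤ M)]
  have hlog : Real.log N ≤ (N : ℝ) ^ ε / ε := Real.log_le_rpow_div hN0.le hε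
  have hNε : 1 ≤ (N : ℝ) ^ ε := Real.one_le_rpow hN1' hε.le
  have hlog0 : 0 ≤ Real.log N := Real.log_nonneg hN1'
  set P : ℝ := (N : ℝ) ^ ε with hP
  have hterm : ∀ u : ℝ, 1 ≤ u → u ≤ N → u ^ (-s.re) ≤ P * u⁻¹ := by
    intro u hu1 hu2
    have hu0 : 0 < u := by linarith
    calc u ^ (-s.re) ≤ u ^ (ε - 1) := Real.rpow_le_rpow_of_exponent_le hu1 (by linarith)
      _ = u ^ ε * u⁻¹ := by rw [Real.rpow_sub hu0, Real.rpow_one]; rfl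
      _ ≤ P * u⁻¹ := by rw [hP]; gcongr
  have hre : (-s).re = -s.re := rfl
  have b1 : ‖∑ n ∈ Icc 1 N, a n * (n : ℂ) ^ (-s)‖ ≤ P * (1 + Real.log N) := by
    refine (norm_sum_le _ _).trans ?_
    have : ∀ n ∈ Icc 1 N, ‖a n * (n : ℂ) ^ (-s)‖ ≤ P * (n : ℝ)⁻¹ := by
      intro n hn
      rw [mem_Icc] at hn
      rw [norm_mul, Complex.norm_natCast_cpow_of_pos (by omega), hre]
      have h1 := hterm n (by exact_mod_cast hn.1) (by exact_mod_cast hn.2)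
      have h2 := h.norm_le n
      have h3 : 0 ≤ (n : ℝ) ^ (-s.re) := by positivity
      nlinarith
    refine (sum_le_sum this).trans ?_
    rw [← mul_sum]
    refine mul_le_mul_of_nonneg_left ?_ (by linarith)
    have h4 := harmonic_le_one_add_log N
    rw [harmonic_eq_sum_Icc] at h4
    push_cast at h4
    exact h4
  have hpow : ‖(N : ℂ) ^ (-s)‖ ≤ P * (N : ℝ)⁻¹ := by
    rw [Complex.norm_natCast_cpow_of_pos (by omega), hre]
    exact hterm N hN1' le_rfl
  have b2 : ‖discr a κ N * (N : ℂ) ^ (-s)‖ ≤ P := by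
    rw [norm_mul]
    have h1 : ‖discr a κ N‖ ≤ B := by simpa [discr] using h.sum_le N
    have h2 : B ≤ N := by nlinarith [norm_nonneg s]
    calc ‖discr a κ N‖ * ‖(N : ℂ) ^ (-s)‖ ≤ N * (P * (N : ℝ)⁻¹) := by gcongr; exact h1.trans h2
      _ = P := by field_simp
  have b3 : ‖κ * (∫ u in (1 : ℝ)..N, (u : ℂ) ^ (-s))‖ ≤ P * Real.log N := by
    rw [norm_mul]
    have h1 : ‖∫ u in (1 : ℝ)..N, (u : ℂ) ^ (-s)‖ ≤ ∫ u in (1 : ℝ)..N, P * u⁻¹ := by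
      refine intervalIntegral.norm_integral_le_of_norm_le hN1' (Filter.Eventually.of_forall ?_) ?_
      · intro u hu
        rw [Complex.norm_cpow_eq_rpow_re_of_pos (by linarith [hu.1]), hre]
        exact hterm u hu.1.le hu.2
      · refine ContinuousOn.intervalIntegrable ?_
        rw [Set.uIcc_of_le hN1']
        exact continuousOn_const.mul (continuousOn_inv₀.mono fun u hu => by
          have := hu.1; simp; linarith)
    rw [intervalIntegral.integral_const_mul, integral_inv_of_pos one_pos hN0, div_one] at h1
    have h2 : 0 ≤ P * Real.log N := by positivity
    have := h.mean_le
    nlinarith [norm_nonneg κ, norm_nonneg (∫ u in (1 : ℝ)..N, (u : ℂ) ^ (-s))]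
  have b4 : ‖s * ∫ u in Set.Ioi (N : ℝ), discr a κ u * (u : ℂ) ^ (-s - 1)‖ ≤ 3 * P := by
    rw [norm_mul]
    have h1 := h.norm_tail_le hs0 hN0
    have h2 : (N : ℝ) ^ (-s.re) / s.re ≤ P * (N : ℝ)⁻¹ * (3 / 2) := by
      rw [div_le_iff₀ hs0]
      have h3 := hterm N hN1' le_rfl
      have h4 : 0 ≤ P * (N : ℝ)⁻¹ := by positivity
      nlinarith
    have h5 : ‖s‖ * (B + 1) ≤ 2 * N := by nlinarith [norm_nonneg s]
    calc ‖s‖ * ‖∫ u in Set.Ioi (N : ℝ), discr a κ u * (u : ℂ) ^ (-s - 1)‖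
        ≤ ‖s‖ * ((B + 1) * (P * (N : ℝ)⁻¹ * (3 / 2))) := by
          gcongr
          exact h1.trans (by gcongr)
      _ = (‖s‖ * (B + 1)) * (P * (N : ℝ)⁻¹ * (3 / 2)) := by ring
      _ ≤ (2 * N) * (P * (N : ℝ)⁻¹ * (3 / 2)) := by gcongr
      _ = 3 * P := by field_simp
  rw [h.regPart_eq hs0 hN1]
  have hPP : P * P = (N : ℝ) ^ (2 * ε) := by rw [hP, ← Real.rpow_add hN0]; ring_nf
  have hfin : (N : ℝ) ^ (2 * ε) ≤ 2 * M ^ (2 * ε) := by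
    calc (N : ℝ) ^ (2 * ε) ≤ (2 * M) ^ (2 * ε) := by gcongr
      _ = 2 ^ (2 * ε) * M ^ (2 * ε) := Real.mul_rpow (by norm_num) (by linarith)
      _ ≤ 2 ^ (1 : ℝ) * M ^ (2 * ε) := by
        gcongr
        · norm_num
        · linarith
      _ = 2 * M ^ (2 * ε) := by norm_num
  have hie : 3 ≤ 1 / ε := by rw [le_div_iff₀ hε]; linarith
  have hl : P * Real.log N ≤ 1 / ε * (P * P) := by
    calc P * Real.log N ≤ P * (P / ε) := by gcongr
      _ = 1 / ε * (P * P) := by ring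
  have hPP1 : P ≤ P * P := by nlinarith
  calc _ ≤ P * (1 + Real.log N) + P + P * Real.log N + 3 * P := by
        refine (norm_add_le _ _).trans (add_le_add ?_ b4)
        refine (norm_sub_le _ _).trans (add_le_add ?_ b3)
        exact (norm_sub_le _ _).trans (add_le_add b1 b2)
    _ ≤ 7 * (1 / ε) * (P * P) := by nlinarith
    _ ≤ 7 * (1 / ε) * (2 * M ^ (2 * ε)) := by rw [hPP]; gcongr
    _ = 14 / ε * M ^ (2 * ε) := by ring

/-- The half-plane `0 < re s` is preconnected. -/
lemma isPreconnected_re_pos : IsPreconnected {s : ℂ | 0 < s.re} :=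
  (convex_halfSpace_re_gt 0).isPreconnected

lemma isOpen_re_pos : IsOpen {s : ℂ | 0 < s.re} := isOpen_lt continuous_const Complex.continuous_re

lemma Balanced.eq_regPart (h : Balanced a κ B) {f : ℂ → ℂ} (hf : Differentiable ℂ f)
    (hfa : ∀ s : ℂ, 1 < s.re → f s = LSeries a s - κ / (s - 1)) {s : ℂ} (hs : 0 < s.re) :
    f s = regPart a κ s := by
  have h1 : AnalyticOnNhd ℂ f {s : ℂ | 0 < s.re} := fun z _ => hf.analyticAt z
  have h2 : AnalyticOnNhd ℂ (regPart a κ) {s : ℂ | 0 < s.re} :=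
    DifferentiableOn.analyticOnNhd
      (fun z hz => (h.differentiableAt_regPart hz).differentiableWithinAt) isOpen_re_pos
  refine h1.eqOn_of_preconnected_of_eventuallyEq h2 isPreconnected_re_pos
    (z₀ := 2) (by simp) ?_ hs
  have : {s : ℂ | 1 < s.re} ∈ nhds (2 : ℂ) :=
    (isOpen_lt continuous_const Complex.continuous_re).mem_nhds (by simp)
  filter_upwards [this] with z hz
  rw [hfa z hz, h.lseries_eq hz]; ring

lemma balanced_one : Balanced 1 1 1 where
  norm_le := by simp
  mean_le := by simp
  one_le := le_rfl
  sum_le := by simp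

lemma riemannZeta₀_eq_regPart {s : ℂ} (hs : 0 < s.re) : riemannZeta₀ s = regPart 1 1 s := by
  refine balanced_one.eq_regPart differentiable_riemannZeta₀ (fun s hs => ?_) hs
  rw [LSeries_one_eq_riemannZeta hs]
  have : s ≠ 1 := by rintro rfl; simp at hs
  rw [riemannZeta_eq_inv_sub_add this]
  ring

/-- A periodic sequence with zero mean is balanced. -/
lemma sum_Icc_periodic_zero {q : ℕ} (hq : 0 < q) (f : ℕ → ℂ) (hf : ∀ n, f (n + q) = f n)
    (h0 : ∑ n ∈ range q, f n = 0) (h1 : ∀ n, ‖f n‖ ≤ 2) (N : ℕ) :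
    ‖∑ n ∈ Icc 1 N, f n‖ ≤ 2 * q := by
  have hblock : ∀ m, ∑ n ∈ range (q * m), f n = 0 := by
    intro m
    induction m with
    | zero => simp
    | succ m ih =>
      rw [Nat.mul_succ, sum_range_add, ih, zero_add, ← h0]
      refine sum_congr rfl fun n _ => ?_
      clear ih
      induction m with
      | zero => simp
      | succ m ih => rw [← ih, Nat.mul_succ, show q * m + q + n = q * m + n + q by ring, hf]
  have e1 : ∑ n ∈ Icc 1 N, f n = ∑ n ∈ range (N + 1), f n - f 0 := by
    rw [sum_range_eq_add_Ico _ (by omega)]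
    have : Icc 1 N = Ico 1 (N + 1) := by rfl
    rw [this]; ring
  have e2 : N + 1 = q * ((N + 1) / q) + (N + 1) % q := (Nat.div_add_mod _ _).symm
  have hper : ∀ m n, f (q * m + n) = f n := by
    intro m n
    induction m with
    | zero => simp
    | succ m ih => rw [← ih, Nat.mul_succ, show q * m + q + n = q * m + n + q by ring, hf]
  have hlt := Nat.mod_lt (N + 1) hq
  rw [e1, e2, sum_range_add, hblock, zero_add]
  simp_rw [hper]
  rcases Nat.eq_zero_or_pos ((N + 1) % q) with h3 | h3
  · rw [h3]; simp only [range_zero, sum_empty, zero_sub, norm_neg]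
    have : (1 : ℝ) ≤ q := by exact_mod_cast hq
    linarith [h1 0]
  · rw [sum_range_eq_add_Ico _ h3, add_sub_cancel_left]
    refine (norm_sum_le _ _).trans ((sum_le_sum fun n _ => h1 n).trans ?_)
    simp only [sum_const, Nat.card_Ico, nsmul_eq_mul]
    have : (((N + 1) % q - 1 : ℕ) : ℝ) ≤ q := by exact_mod_cast (by omega)
    nlinarith

/-- The mean value of a Dirichlet character. -/
noncomputable def charMean {q : ℕ} (χ : DirichletCharacter ℂ q) : ℂ :=
  open scoped Classical in if χ = 1 then (q.totient : ℂ) / q else 0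

lemma charMean_of_ne {q : ℕ} {χ : DirichletCharacter ℂ q} (h : χ ≠ 1) : charMean χ = 0 := by
  simp [charMean, h]

lemma balanced_char {q : ℕ} [NeZero q] (χ : DirichletCharacter ℂ q) :
    Balanced (fun n => χ n) (charMean χ) (2 * q) := by
  have hq : 0 < q := Nat.pos_of_ne_zero (NeZero.ne q)
  have hq1 : (1 : ℝ) ≤ q := by exact_mod_cast hq
  have hmean : ‖charMean χ‖ ≤ 1 := by
    unfold charMean
    split_ifs
    · rw [norm_div, Complex.norm_natCast, Complex.norm_natCast]
      exact div_le_one_of_le₀ (by exact_mod_cast Nat.totient_le q) (by positivity)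
    · simp
  have hsum : ∑ n ∈ range q, χ n = charMean χ * q := by
    have e : ∑ n ∈ range q, χ n = ∑ x : ZMod q, χ x := by
      refine sum_bij' (fun n _ => (n : ZMod q)) (fun x _ => x.val) ?_ ?_ ?_ ?_ ?_
      · simp
      · intro x _; simpa using ZMod.val_lt x
      · intro n hn; rw [ZMod.val_natCast]; exact Nat.mod_eq_of_lt (by simpa using hn)
      · intro x _; simp
      · simp
    rw [e]
    unfold charMean
    split_ifs with h
    · subst h
      rw [MulChar.sum_one_eq_card_units, ZMod.card_units_eq_totient]
      have : (q : ℂ) ≠ 0 := by exact_mod_cast hq.ne'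
      field_simp
    · rw [zero_mul]; exact MulChar.sum_eq_zero_of_ne_one h
  refine ⟨fun n => χ.norm_le_one _, hmean, by linarith, fun N => ?_⟩
  have := sum_Icc_periodic_zero hq (fun n => χ n - charMean χ) (fun n => by simp)
    (by rw [sum_sub_distrib, hsum]; simp [mul_comm])
    (fun n => (norm_sub_le _ _).trans (by linarith [χ.norm_le_one (n : ZMod q)])) N
  rw [sum_sub_distrib] at this
  simpa [mul_comm] using this

lemma lfunction_eq_regPart {q : ℕ} [NeZero q] {χ : DirichletCharacter ℂ q} (hχ : χ ≠ 1) {s : ℂ}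
    (hs : 0 < s.re) : χ.LFunction s = regPart (fun n => χ n) 0 s := by
  have hb := balanced_char χ
  rw [charMean_of_ne hχ] at hb
  refine hb.eq_regPart (DirichletCharacter.differentiable_LFunction hχ) (fun s hs => ?_) hs
  rw [DirichletCharacter.LFunction_eq_LSeries _ hs]; simp

end Hooley

namespace Hooley

variable {a : ℕ → ℂ} {κ : ℂ} {B : ℝ}

/-- The size of `s` relative to the modulus `q`. -/
noncomputable def cond (q : ℕ) (s : ℂ) : ℝ := q * (|s.im| + 2)

lemma two_le_cond {q : ℕ} (hq : 1 ≤ q) (s : ℂ) : 2 ≤ cond q s := by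
  unfold cond
  have : (1 : ℝ) ≤ q := by exact_mod_cast hq
  nlinarith [abs_nonneg s.im]

lemma cond_le_two_mul {q : ℕ} {s w : ℂ} (h : ‖w - s‖ ≤ 1) : cond q w ≤ 2 * cond q s := by
  unfold cond
  have h1 : |w.im| ≤ |s.im| + 1 := by
    have h2 : |w.im - s.im| ≤ 1 := by
      have := Complex.abs_im_le_norm (w - s)
      simp only [Complex.sub_im] at this
      linarith
    have := abs_sub_abs_le_abs_sub w.im s.im
    linarith
  have h3 : (0 : ℝ) ≤ q := by positivity
  nlinarith [abs_nonneg s.im]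

lemma Balanced.norm_regPart_le_cond {q : ℕ} (hq : 1 ≤ q) (h : Balanced a κ (2 * q)) {ε : ℝ}
    (hε : 0 < ε) (hε' : ε ≤ 1 / 3) {s : ℂ} (hs : 1 - ε ≤ s.re) (hs' : s.re ≤ 4) :
    ‖regPart a κ s‖ ≤ 140 / ε * cond q s ^ (2 * ε) := by
  refine (h.norm_regPart_le hε hε' hs).trans ?_
  have hc := two_le_cond hq s
  have h1 : 2 * q * (1 + ‖s‖) ≤ 10 * cond q s := by
    unfold cond
    have h2 : ‖s‖ ≤ 4 + |s.im| := by
      refine (Complex.norm_le_abs_re_add_abs_im s).trans ?_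
      have : |s.re| ≤ 4 := abs_le.2 ⟨by linarith, hs'⟩
      linarith
    have h3 : (0 : ℝ) ≤ q := by positivity
    nlinarith [abs_nonneg s.im]
  calc 14 / ε * (2 * q * (1 + ‖s‖)) ^ (2 * ε) ≤ 14 / ε * (10 * cond q s) ^ (2 * ε) := by
        gcongr
    _ = 14 / ε * ((10 : ℝ) ^ (2 * ε) * cond q s ^ (2 * ε)) := by
        rw [Real.mul_rpow (by norm_num) (by linarith)]
    _ ≤ 14 / ε * ((10 : ℝ) ^ (1 : ℝ) * cond q s ^ (2 * ε)) := by
        gcongr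
        · norm_num
        · linarith
    _ = 140 / ε * cond q s ^ (2 * ε) := by norm_num; ring

lemma norm_lfunction_le {q : ℕ} [NeZero q] {χ : DirichletCharacter ℂ q} (hχ : χ ≠ 1) {ε : ℝ}
    (hε : 0 < ε) (hε' : ε ≤ 1 / 3) {s : ℂ} (hs : 1 - ε ≤ s.re) (hs' : s.re ≤ 4) :
    ‖χ.LFunction s‖ ≤ 140 / ε * cond q s ^ (2 * ε) := by
  have hb := balanced_char χ
  rw [charMean_of_ne hχ] at hb
  rw [lfunction_eq_regPart hχ (by linarith)]
  exact hb.norm_regPart_le_cond (Nat.pos_of_ne_zero (NeZero.ne q)) hε hε' hs hs'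

lemma norm_riemannZeta₀_le {ε : ℝ} (hε : 0 < ε) (hε' : ε ≤ 1 / 3) {s : ℂ} (hs : 1 - ε ≤ s.re)
    (hs₂ : s.re ≤ 4) : ‖riemannZeta₀ s‖ ≤ 140 / ε * cond 1 s ^ (2 * ε) := by
  rw [riemannZeta₀_eq_regPart (by linarith)]
  have hb : Balanced 1 1 (2 * (1 : ℕ)) :=
    { balanced_one with one_le := by norm_num, sum_le := by simp }
  exact hb.norm_regPart_le_cond le_rfl hε hε' hs hs₂

/-- A function with a polynomial bound in a strip has a polynomially bounded derivative in a
smaller strip. -/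
lemma norm_deriv_le_of_cond {q : ℕ} (hq : 1 ≤ q) {f : ℂ → ℂ} {ε K : ℝ} (hε : 0 < ε)
    (hε' : ε ≤ 1 / 3) (hK : 0 ≤ K)
    (hf : ∀ s : ℂ, 1 - ε ≤ s.re → DifferentiableAt ℂ f s)
    (hb : ∀ s : ℂ, 1 - ε ≤ s.re → s.re ≤ 4 → ‖f s‖ ≤ K * cond q s ^ (2 * ε)) {s : ℂ}
    (hs : 1 - ε / 2 ≤ s.re) (hs' : s.re ≤ 3) :
    ‖deriv f s‖ ≤ 4 * K / ε * cond q s ^ (2 * ε) := by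
  have hball : ∀ z ∈ Metric.closedBall s (ε / 2), 1 - ε ≤ z.re ∧ z.re ≤ 4 ∧ ‖z - s‖ ≤ 1 := by
    intro z hz
    rw [Metric.mem_closedBall, dist_eq_norm] at hz
    have h1 := (Complex.abs_re_le_norm (z - s)).trans hz
    rw [Complex.sub_re, abs_le] at h1
    exact ⟨by linarith, by linarith, by linarith⟩
  have hc := two_le_cond hq s
  have key : ‖deriv f s‖ ≤ (2 * K * cond q s ^ (2 * ε)) / (ε / 2) := by
    refine Complex.norm_deriv_le_of_forall_mem_sphere_norm_le (by positivity) ?_ ?_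
    · refine DifferentiableOn.diffContOnCl_ball (U := Metric.closedBall s (ε / 2)) ?_ subset_rfl
      exact fun z hz => (hf z (hball z hz).1).differentiableWithinAt
    · intro z hz
      obtain ⟨h1, h2, h3⟩ := hball z (Metric.sphere_subset_closedBall hz)
      refine (hb z h1 h2).trans ?_
      have hcz := two_le_cond hq z
      have h4 : cond q z ^ (2 * ε) ≤ 2 * cond q s ^ (2 * ε) := by
        calc cond q z ^ (2 * ε) ≤ (2 * cond q s) ^ (2 * ε) := by
              gcongr
              exact cond_le_two_mul h3
          _ = 2 ^ (2 * ε) * cond q s ^ (2 * ε) := Real.mul_rpow (by norm_num) (by linarith)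
          _ ≤ 2 ^ (1 : ℝ) * cond q s ^ (2 * ε) := by
            gcongr
            · norm_num
            · linarith
          _ = 2 * cond q s ^ (2 * ε) := by norm_num
      nlinarith
  refine key.trans (le_of_eq ?_)
  field_simp
  ring

/-- The deduction of a lower bound from a 3-4-1 inequality and a Lipschitz bound. -/
lemma lower_bound_of_341 {L : ℝ → ℂ} {X Y K : ℝ} (hX : 1 ≤ X) (hY : 1 ≤ Y) (hK : 1 ≤ K)
    (h1 : ∀ x : ℝ, 1 < x → x ≤ 2 → 1 ≤ (K / (x - 1)) ^ 3 * ‖L x‖ ^ 4 * Y)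
    (h2 : ∀ x y : ℝ, 1 < x → x ≤ 2 → 1 < y → y ≤ 2 → ‖L x - L y‖ ≤ X * |x - y|) {x : ℝ}
    (hx : 1 < x) (hx' : x ≤ 2) : 1 / (16 * K ^ 3 * X ^ 3 * Y) ≤ ‖L x‖ := by
  set δ : ℝ := 1 / (16 * K ^ 3 * X ^ 4 * Y) with hδ
  have hD : 0 < 16 * K ^ 3 * X ^ 4 * Y := by positivity
  have hδ0 : 0 < δ := by positivity
  have hδ1 : δ ≤ 1 := by
    rw [hδ, div_le_one hD]
    have e1 : 1 ≤ K ^ 3 := one_le_pow₀ hK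
    have e2 : 1 ≤ X ^ 4 := one_le_pow₀ hX
    have e3 : 1 ≤ K ^ 3 * X ^ 4 := by nlinarith
    nlinarith
  have hδX : 1 / (16 * K ^ 3 * X ^ 3 * Y) = δ * X := by rw [hδ]; field_simp
  have hbig : ∀ y : ℝ, 1 + δ ≤ y → y ≤ 2 → 2 * δ * X ≤ ‖L y‖ := by
    intro y hy hy'
    have e1 := h1 y (by linarith) hy'
    by_contra hcon
    push Not at hcon
    have e2 : ‖L y‖ ^ 4 < (2 * δ * X) ^ 4 := by gcongr
    have e3 : (K / (y - 1)) ^ 3 ≤ (K / δ) ^ 3 := by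
      have : 0 < y - 1 := by linarith
      gcongr
      linarith
    have e4 : (K / (y - 1)) ^ 3 * ‖L y‖ ^ 4 * Y < (K / δ) ^ 3 * (2 * δ * X) ^ 4 * Y := by
      have : 0 < (K / δ) ^ 3 := by positivity
      have h5 : (K / (y - 1)) ^ 3 * ‖L y‖ ^ 4 ≤ (K / δ) ^ 3 * ‖L y‖ ^ 4 := by gcongr
      have h6 : (K / δ) ^ 3 * ‖L y‖ ^ 4 < (K / δ) ^ 3 * (2 * δ * X) ^ 4 := by gcongr
      have h7 := h5.trans_lt h6
      gcongr
    have e5 : (K / δ) ^ 3 * (2 * δ * X) ^ 4 * Y = δ * (16 * K ^ 3 * X ^ 4 * Y) := by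
      field_simp; norm_num
    rw [e5, hδ, one_div, inv_mul_cancel₀ hD.ne'] at e4
    linarith
  rw [hδX]
  rcases le_or_gt (1 + δ) x with h | h
  · have := hbig x h hx'
    nlinarith
  · have e1 := hbig (1 + δ) le_rfl (by linarith)
    have e2 := h2 (1 + δ) x (by linarith) (by linarith) hx hx'
    rw [abs_of_nonneg (by linarith)] at e2
    have e3 : ‖L (1 + δ)‖ ≤ ‖L (1 + δ) - L x‖ + ‖L x‖ := by
      simpa using norm_add_le (L (1 + δ) - L x) (L x)
    nlinarith

/-- Upper bound for Dirichlet series of characters to the right of the line `re s = 1`. -/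
lemma exists_norm_lseries_le : ∃ K : ℝ, 1 ≤ K ∧ ∀ (q : ℕ) (χ : DirichletCharacter ℂ q) (s : ℂ),
    1 < s.re → s.re ≤ 2 → ‖LSeries (fun n => χ n) s‖ ≤ K / (s.re - 1) := by
  refine ⟨10000, by norm_num, fun q χ s hx hx' => ?_⟩
  set x : ℝ := s.re with hxs
  have hx1 : 1 < (x : ℂ).re := by simpa using hx
  have h1 : ‖LSeries (fun n => χ n) s‖ ≤ ‖riemannZeta x‖ := by
    have s1 : LSeriesSummable 1 (x : ℂ) :=
      LSeriesSummable_of_bounded_of_one_lt_re (m := 1) (fun n _ => by simp) hx1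
    have e : ∀ n : ℕ, LSeries.term 1 (x : ℂ) n = ((‖LSeries.term 1 (x : ℂ) n‖ : ℝ) : ℂ) := by
      intro n
      rcases Nat.eq_zero_or_pos n with rfl | hn
      · simp
      · rw [LSeries.term_of_ne_zero hn.ne', norm_div, Complex.norm_natCast_cpow_of_pos hn]
        simp [Complex.ofReal_cpow (Nat.cast_nonneg n)]
    have e2 : LSeries 1 (x : ℂ) = ((∑' n, ‖LSeries.term 1 (x : ℂ) n‖ : ℝ) : ℂ) := by
      rw [Complex.ofReal_tsum]
      exact tsum_congr e
    rw [← LSeries_one_eq_riemannZeta hx1, e2, Complex.norm_real, Real.norm_eq_abs]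
    refine le_trans ?_ (le_abs_self _)
    refine tsum_of_norm_bounded s1.norm.hasSum fun n => ?_
    rw [LSeries.norm_term_eq, LSeries.norm_term_eq]
    split_ifs
    · rfl
    · have := χ.norm_le_one n
      simp only [Pi.one_apply, norm_one, Complex.ofReal_re]
      gcongr
  refine h1.trans ?_
  have hne : (x : ℂ) ≠ 1 := by exact_mod_cast hx.ne'
  have h2 := norm_riemannZeta₀_le (ε := 1 / 3) (s := x) (by norm_num) le_rfl (by simp; linarith)
    (by simp; linarith)
  have h3 : cond 1 (x : ℂ) ^ (2 * (1 / 3) : ℝ) ≤ 2 := by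
    unfold cond
    simp only [Complex.ofReal_im, abs_zero, Nat.cast_one, one_mul, zero_add]
    calc (2 : ℝ) ^ (2 * (1 / 3) : ℝ) ≤ 2 ^ (1 : ℝ) := by
          apply Real.rpow_le_rpow_of_exponent_le <;> norm_num
      _ = 2 := by norm_num
  rw [riemannZeta_eq_inv_sub_add hne]
  have h4 : ‖((x : ℂ) - 1)⁻¹‖ = 1 / (x - 1) := by
    rw [norm_inv, ← Complex.ofReal_one, ← Complex.ofReal_sub, Complex.norm_real, Real.norm_eq_abs,
      abs_of_pos (by linarith), one_div]
  have h5 : 1 ≤ 1 / (x - 1) := by rw [le_div_iff₀ (by linarith)]; linarith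
  calc ‖((x : ℂ) - 1)⁻¹ + riemannZeta₀ x‖ ≤ 1 / (x - 1) + 840 := by
        refine (norm_add_le _ _).trans (add_le_add h4.le (h2.trans ?_))
        nlinarith
    _ ≤ 10000 * (1 / (x - 1)) := by linarith
    _ = 10000 / (x - 1) := by ring

lemma norm_lipschitz {f : ℂ → ℂ} {t X : ℝ}
    (hf : ∀ x : ℝ, 1 < x → x ≤ 2 → DifferentiableAt ℂ f (x + t * Complex.I))
    (hX : ∀ x : ℝ, 1 < x → x ≤ 2 → ‖deriv f (x + t * Complex.I)‖ ≤ X) (x y : ℝ) (hx : 1 < x)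
    (hx' : x ≤ 2) (hy : 1 < y) (hy' : y ≤ 2) :
    ‖f (x + t * Complex.I) - f (y + t * Complex.I)‖ ≤ X * |x - y| := by
  have hconv : Convex ℝ (Set.Ioc (1 : ℝ) 2 ×ℂ {t}) := 
    ((convex_Ioc (1 : ℝ) 2).linear_preimage Complex.reLm).inter
      ((convex_singleton t).linear_preimage Complex.imLm)
  have hmem : ∀ z ∈ (Set.Ioc (1 : ℝ) 2 ×ℂ {t}), 1 < z.re ∧ z.re ≤ 2 ∧ z = z.re + t * Complex.I := by
    rintro z ⟨h1, h2⟩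
    refine ⟨h1.1, h1.2, ?_⟩
    simp only [Set.mem_preimage, Set.mem_singleton_iff] at h2
    rw [← h2, Complex.re_add_im]
  have := hconv.norm_image_sub_le_of_norm_deriv_le (f := f) (C := X) (x := y + t * Complex.I)
    (y := x + t * Complex.I) (𝕜 := ℂ)
    (fun z hz => by
      obtain ⟨h1, h2, h3⟩ := hmem z hz
      rw [h3]; exact hf _ h1 h2)
    (fun z hz => by
      obtain ⟨h1, h2, h3⟩ := hmem z hz
      rw [h3]; exact hX _ h1 h2)
    (by simp [Complex.mem_reProdIm, hy, hy']) (by simp [Complex.mem_reProdIm, hx, hx'])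
  refine this.trans (le_of_eq ?_)
  rw [add_sub_add_right_eq_sub, ← Complex.ofReal_sub, Complex.norm_real, Real.norm_eq_abs]

lemma one_le_341 {K : ℝ} (hK : ∀ (q : ℕ) (χ : DirichletCharacter ℂ q) (s : ℂ),
    1 < s.re → s.re ≤ 2 → ‖LSeries (fun n => χ n) s‖ ≤ K / (s.re - 1)) {q : ℕ}
    (χ : DirichletCharacter ℂ q) {x t Y : ℝ} (hx : 1 < x) (hx' : x ≤ 2)
    (hY : ‖LSeries (fun n => (χ ^ 2) n) (x + (2 * t : ℝ) * Complex.I)‖ ≤ Y) :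
    1 ≤ (K / (x - 1)) ^ 3 * ‖LSeries (fun n => χ n) (x + t * Complex.I)‖ ^ 4 * Y := by
  have h := χ.norm_LSeries_product_ge_one (x := x - 1) (by linarith) t
  have e1 : (1 : ℂ) + ((x - 1 : ℝ) : ℂ) = x := by push_cast; ring
  have e2 : (x : ℂ) + Complex.I * t = x + t * Complex.I := by ring
  have e3 : (x : ℂ) + 2 * Complex.I * t = x + (2 * t : ℝ) * Complex.I := by push_cast; ring
  rw [e1, e2, e3, norm_mul, norm_mul, norm_pow, norm_pow] at h
  refine h.trans ?_
  have := hK q 1 x (by simpa using hx) (by simpa using hx')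
  simp only [Complex.ofReal_re] at this
  have h0 : 0 ≤ K / (x - 1) := (norm_nonneg _).trans this
  generalize K / (x - 1) = k at *
  gcongr

lemma lower_bound_char {K : ℝ} (hK1 : 1 ≤ K) (hK : ∀ (q : ℕ) (χ : DirichletCharacter ℂ q) (s : ℂ),
    1 < s.re → s.re ≤ 2 → ‖LSeries (fun n => χ n) s‖ ≤ K / (s.re - 1)) {q : ℕ} [NeZero q]
    {χ : DirichletCharacter ℂ q} (hχ : χ ≠ 1) {t X Y : ℝ} (hX1 : 1 ≤ X) (hY1 : 1 ≤ Y)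
    (hX : ∀ x : ℝ, 1 < x → x ≤ 2 → ‖deriv χ.LFunction (x + t * Complex.I)‖ ≤ X)
    (hY : ∀ x : ℝ, 1 < x → x ≤ 2 →
      ‖LSeries (fun n => (χ ^ 2) n) (x + (2 * t : ℝ) * Complex.I)‖ ≤ Y)
    {x : ℝ} (hx : 1 < x) (hx' : x ≤ 2) :
    1 / (16 * K ^ 3 * X ^ 3 * Y) ≤ ‖χ.LFunction (x + t * Complex.I)‖ := by
  refine lower_bound_of_341 (L := fun x : ℝ => χ.LFunction (x + t * Complex.I)) hX1 hY1 hK1 ?_ ?_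
    hx hx'
  · intro y hy hy'
    have := one_le_341 hK χ (t := t) hy hy' (hY y hy hy')
    rwa [← DirichletCharacter.LFunction_eq_LSeries _ (by simpa using hy)] at this
  · exact norm_lipschitz (fun x _ _ => (DirichletCharacter.differentiable_LFunction hχ) _) hX

end Hooley

namespace Hooley

open scoped ComplexOrder in
/-- Estermann's lower bound for the residue at `1` of a Dirichlet series `ζ(s) G(s)` with
non-negative coefficients. -/
lemma estermann : ∃ C₀ : ℝ, 1 ≤ C₀ ∧ ∀ (G : ℂ → ℂ) (a : ℕ → ℂ) (M : ℝ), Differentiable ℂ G →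
    0 ≤ a → a 1 = 1 →
    (∀ s : ℂ, 1 < s.re → LSeriesSummable a s ∧ LSeries a s = riemannZeta s * G s) →
    (∀ s : ℂ, ‖s - 2‖ ≤ 4 / 3 → ‖G s‖ ≤ M) → 1 ≤ M →
    ∀ β : ℝ, 7 / 8 < β → β < 1 → (riemannZeta β * G β).re ≤ 0 →
    (1 - β) / 6 * (C₀ * M) ^ (-(6 * (1 - β))) ≤ (G 1).re := by
  refine ⟨13 * 1406, by norm_num, fun G a M hG ha ha1 hLs hGM hM β hβ hβ1 hneg => ?_⟩
  set B : ℝ := 1406 * M with hB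
  have hdG : Differentiable ℂ (dslope G 1) := by
    intro z
    have := (Complex.differentiableOn_dslope (f := G) (c := 1) Filter.univ_mem).2 hG.differentiableOn
    exact this.differentiableAt Filter.univ_mem
  set H : ℂ → ℂ := fun s => riemannZeta₀ s * G s + dslope G 1 s with hH
  have hHd : Differentiable ℂ H := (differentiable_riemannZeta₀.mul hG).add hdG
  have hHeq : ∀ s : ℂ, s ≠ 1 → H s = riemannZeta s * G s - G 1 * (s - 1)⁻¹ := by
    intro s hs
    have : s - 1 ≠ 0 := sub_ne_zero.2 hs
    simp only [hH, riemannZeta_eq_inv_sub_add hs, dslope_of_ne _ hs, slope_def_field]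
    field_simp
    ring
  -- bound on the circle
  have hHb : ∀ z ∈ Metric.sphere (2 : ℂ) (4 / 3), ‖H z‖ ≤ B := by
    intro z hz
    rw [mem_sphere_iff_norm] at hz
    have hr := (Complex.abs_re_le_norm (z - 2)).trans hz.le
    have hi := (Complex.abs_im_le_norm (z - 2)).trans hz.le
    simp only [Complex.sub_re, Complex.sub_im, Complex.re_ofNat, Complex.im_ofNat, sub_zero] at hr hi
    rw [abs_le] at hr
    have h1 := norm_riemannZeta₀_le (ε := 1 / 3) (s := z) (by norm_num) le_rfl (by linarith)
      (by linarith)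
    have h2 : cond 1 z ^ (2 * (1 / 3) : ℝ) ≤ 10 / 3 := by
      have hc : cond 1 z ≤ 10 / 3 := by unfold cond; push_cast; linarith
      have hc2 := two_le_cond (q := 1) le_rfl z
      calc cond 1 z ^ (2 * (1 / 3) : ℝ) ≤ cond 1 z ^ (1 : ℝ) := by
            apply Real.rpow_le_rpow_of_exponent_le <;> linarith
        _ ≤ 10 / 3 := by rwa [Real.rpow_one]
    have h3 : (1 / 3 : ℝ) ≤ ‖z - 1‖ := by
      have : ‖z - 2‖ ≤ ‖z - 1‖ + ‖(1 : ℂ)‖ := by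
        rw [show z - 2 = (z - 1) - 1 by ring]; exact norm_sub_le _ _
      rw [hz, norm_one] at this
      linarith
    have hz1 : z ≠ 1 := by rintro rfl; norm_num at h3
    have h4 : ‖dslope G 1 z‖ ≤ 6 * M := by
      rw [dslope_of_ne _ hz1, slope_def_field, norm_div, div_le_iff₀ (by linarith)]
      have e1 := hGM z hz.le
      have e2 := hGM 1 (by norm_num)
      have e3 := norm_sub_le (G z) (G 1)
      nlinarith
    have h5 : ‖riemannZeta₀ z‖ ≤ 1400 := by linarith
    have h6 := hGM z hz.le
    calc ‖H z‖ ≤ ‖riemannZeta₀ z‖ * ‖G z‖ + ‖dslope G 1 z‖ := by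
          rw [← norm_mul]; exact norm_add_le _ _
      _ ≤ 1400 * M + 6 * M := by gcongr
      _ ≤ B := by rw [hB]; linarith
  set c : ℕ → ℂ := fun n => (n.factorial : ℂ)⁻¹ * iteratedDeriv n H 2 with hc
  have hcb : ∀ n, ‖c n‖ ≤ B * (3 / 4) ^ n := by
    intro n
    have := Complex.norm_iteratedDeriv_le_of_forall_mem_sphere_norm_le n (c := 2) (R := 4 / 3)
      (by norm_num) hHd.diffContOnCl hHb
    have hf : (0 : ℝ) < n.factorial := by exact_mod_cast n.factorial_pos
    simp only [hc, norm_mul, norm_inv, Complex.norm_natCast]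
    rw [inv_mul_le_iff₀ hf]
    refine this.trans (le_of_eq ?_)
    rw [show (3 / 4 : ℝ) = (4 / 3)⁻¹ by norm_num, inv_pow]
    ring
  set L : ℝ := (G 1).re with hL
  have habs : LSeries.abscissaOfAbsConv a < ((2 : ℝ) : EReal) := by
    have : LSeries.abscissaOfAbsConv a ≤ ((1 : ℝ) : EReal) :=
      LSeries.abscissaOfAbsConv_le_of_forall_lt_LSeriesSummable fun y hy =>
        (hLs y (by simpa using hy)).1
    exact this.trans_lt (by exact_mod_cast one_lt_two)
  have hid : ∀ n, iteratedDeriv n H 2 =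
      iteratedDeriv n (LSeries a) 2 - G 1 * ((-1) ^ n * n.factorial) := by
    intro n
    have e1 : H =ᶠ[nhds 2] (LSeries a - fun s => G 1 * (s - 1)⁻¹) := by
      have : {s : ℂ | 1 < s.re} ∈ nhds (2 : ℂ) :=
        (isOpen_lt continuous_const Complex.continuous_re).mem_nhds (by simp)
      filter_upwards [this] with s hs
      have hs1 : s ≠ 1 := by rintro rfl; simp at hs
      rw [hHeq s hs1, Pi.sub_apply, (hLs s hs).2]
    have d1 : ContDiffAt ℂ n (fun s : ℂ => (s - 1)⁻¹) 2 :=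
      ContDiffAt.inv (contDiffAt_id.sub contDiffAt_const) (by norm_num)
    have d2 : ContDiffAt ℂ n (LSeries a) 2 :=
      (LSeries_analyticOnNhd a 2 (by simpa using habs)).contDiffAt
    rw [e1.iteratedDeriv_eq, iteratedDeriv_sub d2 (contDiffAt_const.mul d1),
      iteratedDeriv_const_mul _ d1, iteratedDeriv_comp_sub_const n (fun z : ℂ => z⁻¹) 1]
    have e2 : iteratedDeriv n (fun z : ℂ => z⁻¹) ((2 : ℂ) - 1) = (-1) ^ n * n.factorial := by
      rw [iteratedDeriv_eq_iterate]
      have := iter_deriv_inv n ((2 : ℂ) - 1)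
      rw [show (2 : ℂ) - 1 = 1 by norm_num, one_zpow, mul_one] at this
      rw [show (2 : ℂ) - 1 = 1 by norm_num]
      exact this
    simp only [e2]
  have hpos : ∀ n, 0 ≤ ((-1) ^ n * iteratedDeriv n (LSeries a) 2).re := by
    intro n
    have := LSeries.iteratedDeriv_alternating ha habs n
    exact (Complex.le_def.1 this).1
  have hsign : ∀ n, ((-1) ^ n * c n).re =
      (n.factorial : ℝ)⁻¹ * ((-1) ^ n * iteratedDeriv n (LSeries a) 2).re - L := by
    intro n
    have hf : (n.factorial : ℂ) ≠ 0 := by exact_mod_cast n.factorial_ne_zero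
    have : (-1) ^ n * c n =
        ((n.factorial : ℝ)⁻¹ : ℝ) * ((-1) ^ n * iteratedDeriv n (LSeries a) 2) - G 1 := by
      have h1 : ((-1 : ℂ) ^ n) * (-1) ^ n = 1 := by rw [← mul_pow]; simp
      simp only [hc, hid]
      push_cast
      field_simp
      linear_combination -(n.factorial : ℂ) * G 1 * h1
    rw [this, Complex.sub_re, Complex.re_ofReal_mul]
  have hlow : ∀ n, -L ≤ ((-1) ^ n * c n).re := by
    intro n
    rw [hsign]
    have := hpos n
    have : 0 ≤ (n.factorial : ℝ)⁻¹ * ((-1) ^ n * iteratedDeriv n (LSeries a) 2).re := by positivity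
    linarith
  have hlow0 : 1 - L ≤ ((-1) ^ 0 * c 0).re := by
    rw [hsign]
    simp only [Nat.factorial_zero, Nat.cast_one, inv_one, pow_zero, one_mul, iteratedDeriv_zero]
    have h2 := (hLs 2 (by simp)).1
    have h3 : (LSeries a 2).re = ∑' n, (LSeries.term a 2 n).re := Complex.re_tsum h2
    have h4 : (LSeries.term a 2 1).re ≤ ∑' n, (LSeries.term a 2 n).re := by
      refine (Complex.hasSum_re h2.hasSum).summable.le_tsum 1 fun n _ => ?_
      rcases Nat.eq_zero_or_pos n with rfl | hn
      · simp
      · rw [LSeries.term_of_ne_zero hn.ne']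
        have h5 := Complex.le_def.1 (ha n)
        have h6 : (n : ℂ) ^ (2 : ℂ) = ((n ^ 2 : ℝ) : ℂ) := by
          rw [Complex.cpow_ofNat]; push_cast; rfl
        rw [h6, Complex.div_ofReal_re]
        have : 0 ≤ (a n).re := by simpa using h5.1
        positivity
    have h7 : (LSeries.term a 2 1).re = 1 := by
      rw [LSeries.term_of_ne_zero one_ne_zero, ha1]; simp
    linarith
  set y : ℝ := 2 - β with hy
  have hy1 : 1 < y := by rw [hy]; linarith
  have hy2 : y < 9 / 8 := by rw [hy]; linarith
  -- Taylor expansion at `β`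
  have htay : HasSum (fun n => ((-1) ^ n * c n).re * y ^ n) (H β).re := by
    have h1 := Complex.hasSum_re (Complex.hasSum_taylorSeries_of_entire hHd 2 β)
    convert h1 using 1
    funext n
    have e1 : ((β : ℂ) - 2) ^ n = (-1) ^ n * ((y ^ n : ℝ) : ℂ) := by
      rw [hy]; push_cast; rw [← mul_pow]; ring_nf
    have e2 : ((-1) ^ n * c n).re * y ^ n = (((y ^ n : ℝ) : ℂ) * ((-1) ^ n * c n)).re := by
      rw [Complex.re_ofReal_mul, mul_comm]
    rw [e2, e1, hc]
    simp only [smul_eq_mul]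
    congr 1
    ring
  have hHβ : (H β).re ≤ L / (1 - β) := by
    have hb1 : (β : ℂ) ≠ 1 := by exact_mod_cast hβ1.ne
    rw [hHeq _ hb1, Complex.sub_re]
    have : (G 1 * ((β : ℂ) - 1)⁻¹).re = -(L / (1 - β)) := by
      have e1 : ((β : ℂ) - 1)⁻¹ = (((β - 1)⁻¹ : ℝ) : ℂ) := by push_cast; rfl
      rw [e1, mul_comm, Complex.re_ofReal_mul, ← hL, ← neg_sub 1 β, inv_neg]
      ring
    linarith
  set r : ℝ := 27 / 32 with hr
  have key : ∀ m : ℕ, 1 ≤ m → 13 * B * r ^ m ≤ 1 → (1 - β) / 2 ≤ L * y ^ m := by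
    intro m hm hmB
    have h1 : ∀ n, -(B * r ^ n) ≤ ((-1) ^ n * c n).re * y ^ n := by
      intro n
      have e1 : |((-1) ^ n * c n).re| ≤ B * (3 / 4) ^ n := by
        refine (Complex.abs_re_le_norm _).trans ?_
        rw [norm_mul, norm_pow, norm_neg, norm_one, one_pow, one_mul]
        exact hcb n
      have e2 : (3 / 4 : ℝ) ^ n * y ^ n ≤ r ^ n := by
        rw [← mul_pow, hr]
        gcongr
        linarith
      have e3 := (abs_le.1 e1).1
      have e4 : 0 ≤ y ^ n := by positivity
      have hB0 : 0 ≤ B := by rw [hB]; linarith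
      nlinarith
    have h2 : -(B * r ^ m * (32 / 5)) ≤ ∑' n, ((-1) ^ (n + m) * c (n + m)).re * y ^ (n + m) := by
      have e1 : HasSum (fun n => -(B * r ^ (n + m))) (-(B * r ^ m * (32 / 5))) := by
        have := ((hasSum_geometric_of_lt_one (r := r) (by norm_num) (by norm_num)).mul_left
          (B * r ^ m)).neg
        rw [show (1 - r)⁻¹ = 32 / 5 by norm_num] at this
        have e2 : (fun n => -(B * r ^ (n + m))) = fun n => -(B * r ^ m * r ^ n) := by
          funext n; rw [pow_add]; ring
        rw [e2]; exact this
      rw [← e1.tsum_eq]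
      exact e1.summable.tsum_le_tsum (fun n => h1 (n + m)) ((summable_nat_add_iff m).2 htay.summable)
    have h3 := htay.summable.sum_add_tsum_nat_add m
    rw [htay.tsum_eq] at h3
    have h4 : 1 - L * ((y ^ m - 1) / (y - 1)) ≤
        ∑ n ∈ range m, ((-1) ^ n * c n).re * y ^ n := by
      have e1 : (y ^ m - 1) / (y - 1) = ∑ n ∈ range m, y ^ n := (geom_sum_eq hy1.ne' m).symm
      obtain ⟨k, rfl⟩ : ∃ k, m = k + 1 := ⟨m - 1, by omega⟩
      rw [e1, sum_range_succ', sum_range_succ']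
      have e2 : ∀ n ∈ range k, -L * y ^ (n + 1) ≤ ((-1) ^ (n + 1) * c (n + 1)).re * y ^ (n + 1) :=
        fun n _ => mul_le_mul_of_nonneg_right (hlow _) (by positivity)
      have e3 := sum_le_sum e2
      rw [← mul_sum] at e3
      rw [pow_zero y, mul_one, mul_add]
      linarith
    have h5 : y - 1 = 1 - β := by rw [hy]; ring
    rw [h5] at h4
    have h6 : 1 - L * ((y ^ m - 1) / (1 - β)) - 1 / 2 ≤ L / (1 - β) := by linarith
    have h7 : 1 / 2 ≤ L * y ^ m / (1 - β) := by
      have : L * ((y ^ m - 1) / (1 - β)) = L * y ^ m / (1 - β) - L / (1 - β) := by ring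
      linarith
    rw [le_div_iff₀ (by linarith)] at h7
    linarith
  have hlogB : 0 ≤ Real.log (13 * B) := Real.log_nonneg (by rw [hB]; linarith)
  set m : ℕ := ⌊6 * Real.log (13 * B)⌋₊ + 1 with hm
  have hB0 : 0 < 13 * B := by rw [hB]; linarith
  have hm1 : 6 * Real.log (13 * B) ≤ m := by
    rw [hm]; push_cast; exact (Nat.lt_floor_add_one _).le
  have hm2 : (m : ℝ) ≤ 6 * Real.log (13 * B) + 1 := by
    rw [hm]; push_cast; linarith [Nat.floor_le (by linarith : 0 ≤ 6 * Real.log (13 * B))]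
  have hrm : 13 * B * r ^ m ≤ 1 := by
    have e1' : r ≤ Real.exp (-(1 / 6)) := by
      refine le_of_pow_le_pow_left₀ (n := 6) (by norm_num) (Real.exp_pos _).le ?_
      rw [← Real.exp_nat_mul, show ((6 : ℕ) : ℝ) * -(1 / 6) = -1 by norm_num, Real.exp_neg,
        le_inv_comm₀ (by positivity) (Real.exp_pos _)]
      refine Real.exp_one_lt_d9.le.trans ?_
      rw [hr]; norm_num
    have e2 : r ^ m ≤ Real.exp (-Real.log (13 * B)) := by
      calc r ^ m ≤ Real.exp (-(1 / 6)) ^ m := by gcongr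
        _ = Real.exp (m * (-(1 / 6))) := (Real.exp_nat_mul _ _).symm
        _ ≤ _ := by apply Real.exp_le_exp.2; linarith
    rw [Real.exp_neg, Real.exp_log hB0] at e2
    calc 13 * B * r ^ m ≤ 13 * B * (13 * B)⁻¹ := by gcongr
      _ = 1 := mul_inv_cancel₀ hB0.ne'
  have hfin := key m (by omega) hrm
  have hym : y ^ m ≤ 3 * (13 * B) ^ (6 * (1 - β)) := by
    have e1 : y ≤ Real.exp (1 - β) := by
      have := Real.add_one_le_exp (1 - β)
      rw [hy]; linarith
    calc y ^ m ≤ Real.exp (1 - β) ^ m := by gcongr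
      _ = Real.exp (m * (1 - β)) := (Real.exp_nat_mul _ _).symm
      _ ≤ Real.exp (1 + Real.log (13 * B) * (6 * (1 - β))) := by
        apply Real.exp_le_exp.2
        nlinarith
      _ = Real.exp 1 * (13 * B) ^ (6 * (1 - β)) := by
        rw [Real.exp_add, Real.rpow_def_of_pos hB0]
      _ ≤ 3 * (13 * B) ^ (6 * (1 - β)) := by
        gcongr
        exact Real.exp_one_lt_d9.le.trans (by norm_num)
  have hL0 : 0 < L := by
    by_contra h
    push Not at h
    have : 0 < y ^ m := by positivity
    nlinarith
  have hcon : (1 - β) / 2 ≤ L * (3 * (13 * B) ^ (6 * (1 - β))) := hfin.trans (by gcongr)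
  have hCM : 13 * 1406 * M = 13 * B := by rw [hB]; ring
  rw [hCM, Real.rpow_neg hB0.le]
  have hp : 0 < (13 * B) ^ (6 * (1 - β)) := by positivity
  rw [← div_eq_mul_inv, div_le_iff₀ hp]
  linarith

end Hooley

namespace Hooley

open ArithmeticFunction DirichletCharacter

/-- The Dirichlet coefficients of `ζ(s) L(s, χ) L(s, ψ) L(s, χψ)`. -/
noncomputable def fourMul {q : ℕ} (χ ψ : DirichletCharacter ℂ q) : ArithmeticFunction ℂ :=
  zetaMul χ * (toArithmeticFunction (ψ ·) * toArithmeticFunction ((χ * ψ) ·))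

lemma fourMul_comm {q : ℕ} (χ ψ : DirichletCharacter ℂ q) : fourMul χ ψ = fourMul ψ χ := by
  unfold fourMul zetaMul
  rw [mul_comm χ ψ]
  ring

lemma isMultiplicative_fourMul {q : ℕ} (χ ψ : DirichletCharacter ℂ q) :
    (fourMul χ ψ).IsMultiplicative :=
  (isMultiplicative_zetaMul χ).mul
    ((isMultiplicative_toArithmeticFunction ψ).mul (isMultiplicative_toArithmeticFunction (χ * ψ)))

lemma toArithmeticFunction_prime_pow {q : ℕ} (χ : DirichletCharacter ℂ q) {p : ℕ} (hp : p.Prime)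
    (k : ℕ) : toArithmeticFunction (χ ·) (p ^ k) = χ p ^ k := by
  rw [← apply_eq_toArithmeticFunction_apply χ (pow_ne_zero k hp.ne_zero)]
  simp

lemma mul_prime_pow (f g : ArithmeticFunction ℂ) {p : ℕ} (hp : p.Prime) (k : ℕ) :
    (f * g) (p ^ k) = ∑ j ∈ range (k + 1), f (p ^ j) * g (p ^ (k - j)) := by
  rw [ArithmeticFunction.mul_apply, Nat.sum_divisorsAntidiagonal (f := fun a b => f a * g b),
    Nat.sum_divisors_prime_pow hp]
  refine sum_congr rfl fun j hj => ?_
  rw [Nat.pow_div (by simpa [Nat.lt_succ_iff] using hj) hp.pos]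

open scoped ComplexOrder in
lemma fourMul_prime_pow_nonneg {q : ℕ} {χ ψ : DirichletCharacter ℂ q} (hχ : χ ^ 2 = 1)
    (hψ : ψ ^ 2 = 1) {p : ℕ} (hp : p.Prime) (k : ℕ) : 0 ≤ fourMul χ ψ (p ^ k) := by
  have hB : ∀ χ ψ : DirichletCharacter ℂ q, ∀ k,
      (toArithmeticFunction (ψ ·) * toArithmeticFunction ((χ * ψ) ·)) (p ^ k) =
        ψ p ^ k * zetaMul χ (p ^ k) := by
    intro χ ψ k
    rw [zetaMul, mul_prime_pow _ _ hp, coe_zeta_mul_apply, Nat.sum_divisors_prime_pow hp, mul_sum,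
      ← sum_range_reflect]
    refine sum_congr rfl fun j hj => ?_
    have hj' : j ≤ k := by simpa [Nat.lt_succ_iff] using hj
    rw [toArithmeticFunction_prime_pow _ hp, toArithmeticFunction_prime_pow _ hp,
      toArithmeticFunction_prime_pow _ hp]
    have e1 : k + 1 - 1 - j = k - j := by omega
    have e2 : k - (k - j) = j := by omega
    rw [e1, e2, MulChar.mul_apply, mul_pow, mul_comm (χ p ^ j), ← mul_assoc, ← pow_add,
      show k - j + j = k by omega]
  have main : ∀ χ ψ : DirichletCharacter ℂ q, χ ^ 2 = 1 → (ψ p = 0 ∨ ψ p = 1) →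
      0 ≤ fourMul χ ψ (p ^ k) := by
    intro χ ψ hχ h
    have h0 : 0 ≤ ψ p := by rcases h with h | h <;> simp [h]
    rw [fourMul, mul_prime_pow _ _ hp]
    refine sum_nonneg fun j _ => ?_
    rw [hB]
    exact mul_nonneg (zetaMul_prime_pow_nonneg hχ hp _)
      (mul_nonneg (pow_nonneg h0 _) (zetaMul_prime_pow_nonneg hχ hp _))
  rcases MulChar.isQuadratic_iff_sq_eq_one.mpr hψ p with h | h | h
  · exact main χ ψ hχ (.inl h)
  · exact main χ ψ hχ (.inr h)
  rcases MulChar.isQuadratic_iff_sq_eq_one.mpr hχ p with h' | h' | h'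
  · rw [fourMul_comm]; exact main ψ χ hψ (.inl h')
  · rw [fourMul_comm]; exact main ψ χ hψ (.inr h')
  have hz : ∀ k, zetaMul χ (p ^ k) = if _root_.Even k then 1 else 0 := by
    intro k
    rw [zetaMul, coe_zeta_mul_apply, Nat.sum_divisors_prime_pow hp]
    simp only [toArithmeticFunction_prime_pow _ hp, h', neg_one_geom_sum, Nat.even_add_one]
    split_ifs <;> rfl
  rw [fourMul, mul_prime_pow _ _ hp]
  refine sum_nonneg fun j _ => ?_
  rw [hB, hz, hz, h]
  by_cases h1 : _root_.Even (k - j)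
  · rw [h1.neg_one_pow]
    split_ifs <;> simp
  · simp [h1]

open scoped ComplexOrder in
lemma fourMul_nonneg {q : ℕ} {χ ψ : DirichletCharacter ℂ q} (hχ : χ ^ 2 = 1)
    (hψ : ψ ^ 2 = 1) (n : ℕ) : 0 ≤ fourMul χ ψ n := by
  rcases eq_or_ne n 0 with rfl | hn
  · simp
  · rw [(isMultiplicative_fourMul χ ψ).multiplicative_factorization _ hn]
    exact prod_nonneg fun p hp =>
      fourMul_prime_pow_nonneg hχ hψ (Nat.prime_of_mem_primeFactors hp) _

lemma lseries_toArithmeticFunction {q : ℕ} [NeZero q] (χ : DirichletCharacter ℂ q) {s : ℂ}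
    (hs : 1 < s.re) : LSeriesSummable (toArithmeticFunction (χ ·)) s ∧
      LSeries (toArithmeticFunction (χ ·)) s = χ.LFunction s := by
  have h1 : ∀ n : ℕ, n ≠ 0 → χ n = toArithmeticFunction (χ ·) n := fun n hn =>
    apply_eq_toArithmeticFunction_apply χ hn
  refine ⟨(LSeriesSummable_congr s fun {n} hn => h1 n hn).1 (χ.LSeriesSummable_of_one_lt_re hs), ?_⟩
  rw [LFunction_eq_LSeries χ hs]
  exact (LSeries_congr (fun {n} hn => h1 n hn) s).symm

lemma lseries_zetaMul {q : ℕ} [NeZero q] (χ : DirichletCharacter ℂ q) {s : ℂ}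
    (hs : 1 < s.re) : LSeriesSummable (zetaMul χ) s ∧
      LSeries (zetaMul χ) s = riemannZeta s * χ.LFunction s := by
  obtain ⟨h1, h2⟩ := lseries_toArithmeticFunction χ hs
  refine ⟨LSeriesSummable_zetaMul χ hs, ?_⟩
  have h3 : LSeriesSummable (fun n => ((ArithmeticFunction.zeta : ArithmeticFunction ℂ) n)) s :=
    LSeriesSummable_zeta_iff.mpr hs
  have h4 := LSeries_mul' h3 h1
  rw [h2] at h4
  refine h4.trans ?_
  congr 1
  exact LSeries_zeta_eq_riemannZeta hs

lemma lseries_fourMul {q : ℕ} [NeZero q] (χ ψ : DirichletCharacter ℂ q) {s : ℂ}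
    (hs : 1 < s.re) : LSeriesSummable (fourMul χ ψ) s ∧ LSeries (fourMul χ ψ) s =
      riemannZeta s * (χ.LFunction s * (ψ.LFunction s * (χ * ψ).LFunction s)) := by
  obtain ⟨h1, h2⟩ := lseries_zetaMul χ hs
  obtain ⟨h3, h4⟩ := lseries_toArithmeticFunction ψ hs
  obtain ⟨h5, h6⟩ := lseries_toArithmeticFunction (χ * ψ) hs
  refine ⟨LSeriesSummable_mul h1 (LSeriesSummable_mul h3 h5), ?_⟩
  rw [fourMul, LSeries_mul' h1 (LSeriesSummable_mul h3 h5), LSeries_mul' h3 h5, h2, h4, h6]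
  ring

/-- The `L`-function of a quadratic character is real on the real axis. -/
lemma lfunction_im_eq_zero {q : ℕ} [NeZero q] {χ : DirichletCharacter ℂ q} (hχ : χ ≠ 1)
    (hχ2 : χ ^ 2 = 1) {x : ℝ} (hx : 0 < x) : (χ.LFunction x).im = 0 := by
  have hr : ∀ n : ℕ, (χ n).im = 0 := by
    intro n
    rcases MulChar.isQuadratic_iff_sq_eq_one.mpr hχ2 n with h | h | h <;> simp [h]
  rw [lfunction_eq_regPart hχ (by simpa using hx), regPart, mellin_indicator_eq]
  have : ∀ u ∈ Set.Ioi (1 : ℝ), discr (fun n => χ n) 0 u * (u : ℂ) ^ (-(x : ℂ) - 1) =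
      (((discr (fun n => χ n) 0 u).re * u ^ (-x - 1) : ℝ) : ℂ) := by
    intro u hu
    have hu0 : 0 ≤ u := (zero_lt_one.trans hu).le
    have e1 : discr (fun n => χ n) 0 u = ((discr (fun n => χ n) 0 u).re : ℂ) := by
      apply Complex.ext
      · simp
      · simp [discr, hr]
    rw [e1, Complex.ofReal_re, Complex.ofReal_mul, Complex.ofReal_cpow hu0]
    push_cast
    rfl
  rw [MeasureTheory.setIntegral_congr_fun measurableSet_Ioi this, integral_complex_ofReal, zero_add,
    ← Complex.ofReal_mul, Complex.ofReal_im]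

end Hooley

namespace Hooley

open DirichletCharacter

lemma prod_one_sub_inv_ge (S : Finset ℕ) (hS : ∀ n ∈ S, 2 ≤ n) :
    1 / ((#S : ℝ) + 1) ≤ ∏ n ∈ S, (1 - 1 / (n : ℝ)) := by
  induction S using Finset.induction_on_max with
  | empty => simp
  | insert m T hT ih =>
    have hm : m ∉ T := fun h => lt_irrefl _ (hT m h)
    rw [prod_insert hm, card_insert_of_notMem hm]
    have ih' := ih fun n hn => hS n (mem_insert_of_mem hn)
    have hsub : insert m T ⊆ Icc 2 m := by
      intro n hn
      rw [mem_Icc]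
      refine ⟨hS n hn, ?_⟩
      rcases mem_insert.1 hn with rfl | h
      · exact le_rfl
      · exact (hT n h).le
    have hc := card_le_card hsub
    rw [card_insert_of_notMem hm, Nat.card_Icc] at hc
    have hm2 := hS m (mem_insert_self _ _)
    have hc' : (#T : ℝ) + 2 ≤ m := by exact_mod_cast (by omega : #T + 2 ≤ m)
    have h1 : ((#T : ℝ) + 1) / (#T + 2) ≤ 1 - 1 / m := by
      have : (1 : ℝ) / m ≤ 1 / (#T + 2) := one_div_le_one_div_of_le (by positivity) hc'
      have e : ((#T : ℝ) + 1) / (#T + 2) = 1 - 1 / (#T + 2) := by field_simp; ring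
      linarith
    calc 1 / (((#T + 1 : ℕ) : ℝ) + 1) = ((#T : ℝ) + 1) / (#T + 2) * (1 / (#T + 1)) := by
          push_cast; field_simp; ring
      _ ≤ _ := by
          refine mul_le_mul h1 ih' (by positivity) ?_
          exact le_trans (by positivity) h1

lemma two_pow_card_primeFactors_le {q : ℕ} (hq : q ≠ 0) : 2 ^ #q.primeFactors ≤ q := by
  calc 2 ^ #q.primeFactors ≤ ∏ p ∈ q.primeFactors, p :=
        Finset.pow_card_le_prod _ _ _ fun p hp => (Nat.prime_of_mem_primeFactors hp).two_le
    _ ≤ q := Nat.le_of_dvd (Nat.pos_of_ne_zero hq) (Nat.prod_primeFactors_dvd q)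

lemma card_primeFactors_add_one_le {q : ℕ} (hq : q ≠ 0) {ε : ℝ} (hε : 0 < ε) (hε1 : ε ≤ 1) :
    (#q.primeFactors : ℝ) + 1 ≤ 3 / ε * (q : ℝ) ^ ε := by
  have hq1 : (1 : ℝ) ≤ q := by exact_mod_cast Nat.one_le_iff_ne_zero.2 hq
  have h1 : (#q.primeFactors : ℝ) * Real.log 2 ≤ Real.log q := by
    rw [← Real.log_pow]
    apply Real.log_le_log (by positivity)
    exact_mod_cast two_pow_card_primeFactors_le hq
  have h2 := Real.log_le_rpow_div (by linarith : (0 : ℝ) ≤ q) hε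
  have h3 : (1 : ℝ) ≤ (q : ℝ) ^ ε := Real.one_le_rpow hq1 hε.le
  have h4 := Real.log_two_gt_d9
  have h5 : (#q.primeFactors : ℝ) ≤ 2 / ε * (q : ℝ) ^ ε := by
    have e : 2 / ε * (q : ℝ) ^ ε = 2 * ((q : ℝ) ^ ε / ε) := by ring
    have : (0 : ℝ) ≤ #q.primeFactors := by positivity
    rw [e]; nlinarith
  have h6 : 1 ≤ 1 / ε * (q : ℝ) ^ ε := by
    have : 1 ≤ 1 / ε := by rw [le_div_iff₀ hε]; linarith
    nlinarith
  have e : 3 / ε * (q : ℝ) ^ ε = 2 / ε * (q : ℝ) ^ ε + 1 / ε * (q : ℝ) ^ ε := by ring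
  linarith

lemma totient_div_eq {q : ℕ} (hq : q ≠ 0) :
    (q.totient : ℝ) / q = ∏ p ∈ q.primeFactors, (1 - 1 / (p : ℝ)) := by
  have h := Nat.totient_eq_mul_prod_factors q
  have h' : (q.totient : ℝ) = q * ∏ p ∈ q.primeFactors, (1 - (p : ℝ)⁻¹) := by
    have := congrArg (fun x : ℚ => (x : ℝ)) h
    push_cast at this
    exact this
  have hq0 : (q : ℝ) ≠ 0 := by exact_mod_cast hq
  rw [h', mul_div_cancel_left₀ _ hq0]
  simp

/-- `q ≤ φ(q) (ω(q) + 1)`. -/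
lemma le_totient_mul {q : ℕ} (hq : q ≠ 0) :
    (q : ℝ) ≤ q.totient * ((#q.primeFactors : ℝ) + 1) := by
  have h := prod_one_sub_inv_ge q.primeFactors
    fun p hp => (Nat.prime_of_mem_primeFactors hp).two_le
  rw [← totient_div_eq hq, div_le_div_iff₀ (by positivity) (by positivity)] at h
  linarith

lemma norm_euler_factor_bounds {q : ℕ} (χ : DirichletCharacter ℂ q) {p : ℕ} (hp : p.Prime) :
    1 - 1 / (p : ℝ) ≤ ‖1 - χ p * (p : ℂ) ^ (-(1 : ℂ))‖ ∧ ‖1 - χ p * (p : ℂ) ^ (-(1 : ℂ))‖ ≤ 2 := by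
  have hp1 : (1 : ℝ) ≤ p := by exact_mod_cast hp.one_le
  have h1 : ‖χ p * (p : ℂ) ^ (-(1 : ℂ))‖ ≤ 1 / p := by
    rw [Complex.cpow_neg_one, norm_mul, norm_inv, Complex.norm_natCast, ← one_div]
    have := χ.norm_le_one p
    have h0 : (0 : ℝ) ≤ 1 / p := by positivity
    nlinarith
  have h2 := norm_sub_norm_le (1 : ℂ) (χ p * (p : ℂ) ^ (-(1 : ℂ)))
  have h3 := norm_sub_le (1 : ℂ) (χ p * (p : ℂ) ^ (-(1 : ℂ)))
  rw [norm_one] at h2 h3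
  have h4 : 1 / (p : ℝ) ≤ 1 := by rw [div_le_one (by linarith)]; exact hp1
  exact ⟨by linarith, by linarith⟩

lemma norm_euler_prod_le {q₁ q₂ : ℕ} (h₁ : q₁ ≠ 0) (h₂ : q₂ ≠ 0) (χ : DirichletCharacter ℂ q₂) :
    ‖∏ p ∈ (q₁ * q₂).primeFactors, (1 - χ p * (p : ℂ) ^ (-(1 : ℂ)))‖ ≤ 2 ^ #q₁.primeFactors := by
  rw [norm_prod, Nat.primeFactors_mul h₁ h₂, ← union_sdiff_self_eq_union,
    prod_union disjoint_sdiff, ← mul_one (2 ^ _)]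
  refine mul_le_mul ?_ ?_ (prod_nonneg fun _ _ => norm_nonneg _) (by positivity)
  · rw [← prod_const]
    exact prod_le_prod (fun _ _ => norm_nonneg _) fun p hp =>
      (norm_euler_factor_bounds χ (Nat.prime_of_mem_primeFactors hp)).2
  · refine prod_le_one (fun _ _ => norm_nonneg _) fun p hp => le_of_eq ?_
    have hp' := (mem_sdiff.1 hp).1
    have : χ p = 0 := by
      apply χ.map_nonunit
      rw [ZMod.isUnit_iff_coprime, Nat.Prime.coprime_iff_not_dvd (Nat.prime_of_mem_primeFactors hp')]
      exact fun h => h (Nat.dvd_of_mem_primeFactors hp')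
    simp [this]

lemma norm_euler_prod_ge {q N : ℕ} (χ : DirichletCharacter ℂ q) :
    1 / ((#N.primeFactors : ℝ) + 1) ≤
      ‖∏ p ∈ N.primeFactors, (1 - χ p * (p : ℂ) ^ (-(1 : ℂ)))‖ := by
  refine (prod_one_sub_inv_ge _ fun p hp => (Nat.prime_of_mem_primeFactors hp).two_le).trans ?_
  rw [norm_prod]
  refine prod_le_prod (fun p hp => ?_) fun p hp =>
    (norm_euler_factor_bounds χ (Nat.prime_of_mem_primeFactors hp)).1
  have hp1 : (1 : ℝ) ≤ p := by exact_mod_cast (Nat.prime_of_mem_primeFactors hp).one_le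
  rw [sub_nonneg, div_le_one (by linarith)]
  exact hp1

lemma norm_lfunction_le_ball {q : ℕ} [NeZero q] {χ : DirichletCharacter ℂ q} (hχ : χ ≠ 1) {s : ℂ}
    (hs : ‖s - 2‖ ≤ 4 / 3) : ‖χ.LFunction s‖ ≤ 1400 * q := by
  have hr := (Complex.abs_re_le_norm (s - 2)).trans hs
  have hi := (Complex.abs_im_le_norm (s - 2)).trans hs
  simp only [Complex.sub_re, Complex.sub_im, Complex.re_ofNat, Complex.im_ofNat, sub_zero] at hr hi
  rw [abs_le] at hr
  have hq : 1 ≤ q := Nat.one_le_iff_ne_zero.2 (NeZero.ne q)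
  have h1 := norm_lfunction_le hχ (ε := 1 / 3) (by norm_num) le_rfl (s := s) (by linarith)
    (by linarith)
  have hq' : (1 : ℝ) ≤ q := by exact_mod_cast hq
  have hc : cond q s ≤ 10 / 3 * q := by unfold cond; nlinarith
  have hc2 := two_le_cond hq s
  have h2 : cond q s ^ (2 * (1 / 3) : ℝ) ≤ 10 / 3 * q := by
    calc cond q s ^ (2 * (1 / 3) : ℝ) ≤ cond q s ^ (1 : ℝ) := by
          apply Real.rpow_le_rpow_of_exponent_le <;> linarith
      _ ≤ _ := by rwa [Real.rpow_one]
  linarith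

lemma norm_lfunction_one_le {q : ℕ} [NeZero q] {χ : DirichletCharacter ℂ q} (hχ : χ ≠ 1) {ε : ℝ}
    (hε : 0 < ε) (hε' : ε ≤ 1 / 3) : ‖χ.LFunction 1‖ ≤ 140 / ε * (2 * q : ℝ) ^ (2 * ε) := by
  have h := norm_lfunction_le hχ hε hε' (s := 1) (by simp; linarith) (by norm_num)
  rwa [show cond q 1 = 2 * q by simp [cond]; ring] at h

end Hooley

namespace Hooley

open DirichletCharacter

lemma rpow_neg_ge_of_exponent {D q a ε : ℝ} {k : ℕ} (hD : 1 ≤ D) (hq : 1 ≤ q)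
    (ha1 : a ≤ 1) (hε : k * a ≤ ε) : D⁻¹ * q ^ (-ε) ≤ (D * q ^ k) ^ (-a) := by
  have hq0 : 0 < q := by linarith
  rw [Real.mul_rpow (by linarith) (by positivity), ← Real.rpow_natCast, ← Real.rpow_mul hq0.le,
    ← Real.rpow_neg_one]
  refine mul_le_mul ?_ ?_ (by positivity) (by positivity)
  · exact Real.rpow_le_rpow_of_exponent_le hD (by linarith)
  · exact Real.rpow_le_rpow_of_exponent_le hq (by linarith)

/-- Siegel's bound under the assumption that no quadratic character is negative at a fixed `β`. -/
lemma siegel_of_nonneg {ε β : ℝ} (hβ : 7 / 8 < β) (hβ1 : β < 1) (hβε : 6 * (1 - β) ≤ ε)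
    (hβ2 : 840 * (1 - β) ≤ 1) (h6 : 6 * (1 - β) ≤ 1)
    (h : ∀ (q : ℕ) [NeZero q] (χ : DirichletCharacter ℂ q), χ ≠ 1 → χ ^ 2 = 1 →
      0 ≤ (χ.LFunction β).re) :
    ∃ c : ℝ, 0 < c ∧ ∀ (q : ℕ) [NeZero q] (χ : DirichletCharacter ℂ q), χ ≠ 1 → χ ^ 2 = 1 →
      c * (q : ℝ) ^ (-ε) ≤ ‖χ.LFunction 1‖ := by
  obtain ⟨C₀, hC₀, hE⟩ := estermann
  refine ⟨(1 - β) / 6 * (C₀ * 1400)⁻¹, by have : 0 < 1 - β := by linarith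
                                          positivity, ?_⟩
  intro q _ χ hχ hχ2
  have hq : (1 : ℝ) ≤ q := by exact_mod_cast Nat.one_le_iff_ne_zero.2 (NeZero.ne q)
  have hz : (riemannZeta β).re ≤ 0 := by
    have hb1 : (β : ℂ) ≠ 1 := by exact_mod_cast hβ1.ne
    have h1 := norm_riemannZeta₀_le (ε := 1 / 3) (s := (β : ℂ)) (by norm_num) le_rfl
      (by simp; linarith) (by simp; linarith)
    have hc : cond 1 (β : ℂ) = 2 := by simp [cond]
    have h2 : (2 : ℝ) ^ (2 * (1 / 3) : ℝ) ≤ 2 := by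
      calc (2 : ℝ) ^ (2 * (1 / 3) : ℝ) ≤ (2 : ℝ) ^ (1 : ℝ) := by
            apply Real.rpow_le_rpow_of_exponent_le <;> norm_num
        _ = 2 := Real.rpow_one _
    rw [hc] at h1
    have h3 := Complex.re_le_norm (riemannZeta₀ β)
    have h4 : riemannZeta β = (((β - 1)⁻¹ : ℝ) : ℂ) + riemannZeta₀ β := by
      rw [riemannZeta_eq_inv_sub_add hb1]; push_cast; rfl
    rw [h4, Complex.add_re, Complex.ofReal_re]
    have h5 : (β - 1)⁻¹ ≤ -840 := by
      rw [← neg_sub, inv_neg, neg_le_neg_iff, le_inv_comm₀ (by norm_num) (by linarith)]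
      linarith
    linarith
  have := hE χ.LFunction (zetaMul χ) (1400 * q) (differentiable_LFunction hχ)
    (fun n => zetaMul_nonneg hχ2 n) (isMultiplicative_zetaMul χ).map_one
    (fun s hs => lseries_zetaMul χ hs) (fun s hs => norm_lfunction_le_ball hχ hs) (by linarith)
    β hβ hβ1 (by
      rw [Complex.mul_re, lfunction_im_eq_zero hχ hχ2 (by linarith), mul_zero, sub_zero]
      exact mul_nonpos_of_nonpos_of_nonneg hz (h q χ hχ hχ2))
  refine le_trans ?_ (this.trans (Complex.re_le_norm _))
  rw [mul_assoc ((1 - β) / 6)]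
  refine mul_le_mul_of_nonneg_left ?_ (by linarith)
  have := rpow_neg_ge_of_exponent (D := C₀ * 1400) (q := q) (k := 1) (a := 6 * (1 - β)) (ε := ε)
    (by linarith) hq h6 (by push_cast; linarith)
  rwa [pow_one, mul_assoc C₀] at this

/-- Siegel's bound under the assumption that some quadratic character has a zero near `1`. -/
lemma siegel_of_zero {ε β : ℝ} (hβ : 7 / 8 < β) (hβ1 : β < 1) (hε : 0 < ε) (hε1 : ε ≤ 1)
    (hβε : 36 * (1 - β) ≤ ε) {q₁ : ℕ} [NeZero q₁] {χ₁ : DirichletCharacter ℂ q₁} (hχ₁ : χ₁ ≠ 1)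
    (hχ₁2 : χ₁ ^ 2 = 1) (h0 : χ₁.LFunction β = 0) :
    ∃ c : ℝ, 0 < c ∧ ∀ (q : ℕ) [NeZero q] (χ : DirichletCharacter ℂ q), χ ≠ 1 → χ ^ 2 = 1 →
      c * (q : ℝ) ^ (-ε) ≤ ‖χ.LFunction 1‖ := by
  obtain ⟨C₀, hC₀, hE⟩ := estermann
  have hq₁ : q₁ ≠ 0 := NeZero.ne q₁
  have hq₁1 : (1 : ℝ) ≤ q₁ := by exact_mod_cast Nat.one_le_iff_ne_zero.2 hq₁
  set w : ℝ := 2 ^ #q₁.primeFactors with hw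
  have hw0 : 0 < w := by positivity
  set D : ℝ := C₀ * (1400 * q₁) ^ 3 with hD
  have hD1 : 1 ≤ D := by
    rw [hD]
    have : (1 : ℝ) ≤ (1400 * q₁) ^ 3 := one_le_pow₀ (by linarith)
    nlinarith
  set E : ℝ := 140 / (ε / 8) * (2 * q₁) ^ (2 * (ε / 8)) with hE'
  have hE0 : 0 < E := by positivity
  set c₁ : ℝ := (1 - β) / 6 * D⁻¹ / (E ^ 2 * w) with hc₁
  have hb : 0 < 1 - β := by linarith
  have hc₁0 : 0 < c₁ := by positivity
  set l : ℝ := ‖χ₁.LFunction 1‖ with hl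
  have hl0 : 0 < l := norm_pos_iff.2 (χ₁.LFunction_apply_one_ne_zero hχ₁)
  set c₂ : ℝ := l / (w * (3 / ε * q₁ ^ ε)) with hc₂
  have hc₂0 : 0 < c₂ := by positivity
  refine ⟨min c₁ c₂, lt_min hc₁0 hc₂0, ?_⟩
  intro q _ χ hχ hχ2
  have hq : q ≠ 0 := NeZero.ne q
  have hq1 : (1 : ℝ) ≤ q := by exact_mod_cast Nat.one_le_iff_ne_zero.2 hq
  have hqp : 0 < (q : ℝ) ^ (-ε) := by positivity
  have : NeZero (q₁ * q) := ⟨mul_ne_zero hq₁ hq⟩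
  set ψ₁ := changeLevel (Nat.dvd_mul_right q₁ q) χ₁ with hψ₁
  set ψ := changeLevel (Nat.dvd_mul_left q q₁) χ with hψ
  have hψ₁1 : ψ₁ ≠ 1 := fun h => hχ₁ ((changeLevel_eq_one_iff _).1 h)
  have hψ1 : ψ ≠ 1 := fun h => hχ ((changeLevel_eq_one_iff _).1 h)
  have hψ₁2 : ψ₁ ^ 2 = 1 := by rw [hψ₁, ← map_pow, hχ₁2, map_one]
  have hψ2 : ψ ^ 2 = 1 := by rw [hψ, ← map_pow, hχ2, map_one]
  have hL₁ := LFunction_changeLevel (Nat.dvd_mul_right q₁ q) χ₁ (s := 1) (.inl hχ₁)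
  have hL := LFunction_changeLevel (Nat.dvd_mul_left q q₁) χ (s := 1) (.inl hχ)
  rw [← hψ₁] at hL₁
  rw [← hψ] at hL
  have hLw : ‖ψ.LFunction 1‖ ≤ ‖χ.LFunction 1‖ * w := by
    rw [hL, norm_mul]
    exact mul_le_mul_of_nonneg_left (norm_euler_prod_le hq₁ hq χ) (norm_nonneg _)
  by_cases h12 : ψ₁ * ψ = 1
  · have heq : ψ = ψ₁ := by
      calc ψ = ψ₁ ^ 2 * ψ := by rw [hψ₁2, one_mul]
        _ = ψ₁ * (ψ₁ * ψ) := by rw [pow_two, mul_assoc]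
        _ = ψ₁ := by rw [h12, mul_one]
    have h1 : l * (1 / ((#(q₁ * q).primeFactors : ℝ) + 1)) ≤ ‖ψ.LFunction 1‖ := by
      rw [heq, hL₁, norm_mul]
      exact mul_le_mul_of_nonneg_left (norm_euler_prod_ge χ₁) hl0.le
    have h2 := card_primeFactors_add_one_le (NeZero.ne (q₁ * q)) hε hε1
    push_cast at h2
    rw [Real.mul_rpow (by linarith) (by linarith), ← mul_assoc] at h2
    have hqε : 0 < (q : ℝ) ^ ε := by positivity
    have h3 : l * (1 / (3 / ε * q₁ ^ ε * q ^ ε)) ≤ l * (1 / ((#(q₁ * q).primeFactors : ℝ) + 1)) := by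
      gcongr
    have h4 : c₂ * (q : ℝ) ^ (-ε) * w = l * (1 / (3 / ε * q₁ ^ ε * q ^ ε)) := by
      rw [hc₂, Real.rpow_neg (by linarith)]
      field_simp
    have h5 : c₂ * (q : ℝ) ^ (-ε) ≤ ‖χ.LFunction 1‖ := by
      refine le_of_mul_le_mul_right ?_ hw0
      rw [h4]; linarith
    exact le_trans (mul_le_mul_of_nonneg_right (min_le_right _ _) hqp.le) h5
  · set G : ℂ → ℂ := fun s => ψ₁.LFunction s * (ψ.LFunction s * (ψ₁ * ψ).LFunction s) with hG
    have hN : ((q₁ * q : ℕ) : ℝ) = q₁ * q := by push_cast; rfl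
    have hball : ∀ s : ℂ, ‖s - 2‖ ≤ 4 / 3 → ‖G s‖ ≤ (1400 * (q₁ * q)) ^ 3 := by
      intro s hs
      have e1 := norm_lfunction_le_ball hψ₁1 hs
      have e2 := norm_lfunction_le_ball hψ1 hs
      have e3 := norm_lfunction_le_ball h12 hs
      rw [hN] at e1 e2 e3
      rw [hG, norm_mul, norm_mul]
      calc _ ≤ (1400 * (q₁ * q : ℝ)) * ((1400 * (q₁ * q)) * (1400 * (q₁ * q))) := by gcongr
        _ = _ := by ring
    have hM1 : (1 : ℝ) ≤ (1400 * (q₁ * q)) ^ 3 := one_le_pow₀ (by nlinarith)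
    have hG0 : G β = 0 := by
      have := LFunction_changeLevel (Nat.dvd_mul_right q₁ q) χ₁ (s := β) (.inl hχ₁)
      rw [h0, zero_mul] at this
      simp only [hG]
      rw [this, zero_mul]
    have key := hE G (fourMul ψ₁ ψ) _ ((differentiable_LFunction hψ₁1).mul
      ((differentiable_LFunction hψ1).mul (differentiable_LFunction h12)))
      (fun n => fourMul_nonneg hψ₁2 hψ2 n) (isMultiplicative_fourMul _ _).map_one
      (fun s hs => lseries_fourMul _ _ hs) hball hM1 β hβ hβ1 (by rw [hG0]; simp)
    have e1 : (1 - β) / 6 * (D⁻¹ * (q : ℝ) ^ (-(ε / 2))) ≤ ‖G 1‖ := by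
      refine le_trans ?_ (key.trans (Complex.re_le_norm _))
      refine mul_le_mul_of_nonneg_left ?_ (by linarith)
      have := rpow_neg_ge_of_exponent (D := D) (q := q) (k := 3) (a := 6 * (1 - β)) (ε := ε / 2)
        hD1 hq1 (by linarith) (by push_cast; linarith)
      refine this.trans (le_of_eq ?_)
      congr 1
      rw [hD]; ring
    have hup : ∀ θ : DirichletCharacter ℂ (q₁ * q), θ ≠ 1 →
        ‖θ.LFunction 1‖ ≤ E * (q : ℝ) ^ (ε / 4) := by
      intro θ hθ
      refine (norm_lfunction_one_le hθ (ε := ε / 8) (by linarith) (by linarith)).trans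
        (le_of_eq ?_)
      rw [hN, ← mul_assoc 2, Real.mul_rpow (by positivity) (by positivity), hE', mul_assoc]
      ring_nf
    have e2 : ‖G 1‖ ≤ E ^ 2 * (q : ℝ) ^ (ε / 2) * (‖χ.LFunction 1‖ * w) := by
      rw [hG, norm_mul, norm_mul]
      calc _ ≤ (E * (q : ℝ) ^ (ε / 4)) * ((‖χ.LFunction 1‖ * w) * (E * (q : ℝ) ^ (ε / 4))) := by
            gcongr
            · exact hup _ hψ₁1
            · exact hup _ h12
        _ = E ^ 2 * ((q : ℝ) ^ (ε / 4) * (q : ℝ) ^ (ε / 4)) * (‖χ.LFunction 1‖ * w) := by ring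
        _ = _ := by rw [← Real.rpow_add (by linarith)]; ring_nf
    have h5 : c₁ * (q : ℝ) ^ (-ε) ≤ ‖χ.LFunction 1‖ := by
      have hqε : 0 < (q : ℝ) ^ (ε / 2) := by positivity
      refine le_of_mul_le_mul_right ?_ (by positivity : 0 < E ^ 2 * (q : ℝ) ^ (ε / 2) * w)
      have e3 : (q : ℝ) ^ (-ε) * (q : ℝ) ^ (ε / 2) = (q : ℝ) ^ (-(ε / 2)) := by
        rw [← Real.rpow_add (by linarith)]; ring_nf
      calc c₁ * (q : ℝ) ^ (-ε) * (E ^ 2 * (q : ℝ) ^ (ε / 2) * w) =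
          (c₁ * (E ^ 2 * w)) * ((q : ℝ) ^ (-ε) * (q : ℝ) ^ (ε / 2)) := by ring
        _ = (1 - β) / 6 * (D⁻¹ * (q : ℝ) ^ (-(ε / 2))) := by
          rw [e3, hc₁, div_mul_cancel₀ _ (by positivity)]; ring
        _ ≤ _ := by linarith
    exact le_trans (mul_le_mul_of_nonneg_right (min_le_left _ _) hqp.le) h5

/-- **Siegel's theorem**. -/
theorem siegel {ε : ℝ} (hε : 0 < ε) :
    ∃ c : ℝ, 0 < c ∧ ∀ (q : ℕ) [NeZero q] (χ : DirichletCharacter ℂ q), χ ≠ 1 → χ ^ 2 = 1 →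
      c * (q : ℝ) ^ (-ε) ≤ ‖χ.LFunction 1‖ := by
  wlog hε1 : ε ≤ 1 generalizing ε
  · obtain ⟨c, hc, h⟩ := this one_pos le_rfl
    refine ⟨c, hc, fun q _ χ hχ hχ2 => le_trans ?_ (h q χ hχ hχ2)⟩
    have hq1 : (1 : ℝ) ≤ q := by exact_mod_cast Nat.one_le_iff_ne_zero.2 (NeZero.ne q)
    exact mul_le_mul_of_nonneg_left
      (Real.rpow_le_rpow_of_exponent_le hq1 (by linarith)) hc.le
  set β : ℝ := 1 - ε / 2000 with hβ
  by_cases h : ∀ (q : ℕ) [NeZero q] (χ : DirichletCharacter ℂ q), χ ≠ 1 → χ ^ 2 = 1 →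
      0 ≤ (χ.LFunction β).re
  · exact siegel_of_nonneg (β := β) (by linarith) (by linarith) (by linarith) (by linarith)
      (by linarith) h
  · push Not at h
    obtain ⟨q₁, _, χ₁, hχ₁, hχ₁2, hneg⟩ := h
    have hlim : Filter.Tendsto (fun x : ℝ => (χ₁.LFunction x).re) Filter.atTop (nhds 1) := by
      have h1 := LSeries.tendsto_atTop (f := fun n => χ₁ n) (by
        refine lt_of_le_of_lt (LSeries.abscissaOfAbsConv_le_of_forall_lt_LSeriesSummable (x := 1)
          fun y hy => χ₁.LSeriesSummable_of_one_lt_re (by simpa using hy)) (EReal.coe_lt_top 1))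
      have h2 := (Complex.continuous_re.tendsto _).comp h1
      simp only [Nat.cast_one, map_one, Complex.one_re] at h2
      refine h2.congr' ?_
      filter_upwards [Filter.eventually_gt_atTop 1] with x hx
      rw [Function.comp_apply, LFunction_eq_LSeries χ₁ (by simpa using hx)]
    obtain ⟨b, hb0, hb1⟩ := ((hlim.eventually (lt_mem_nhds one_pos)).and
      (Filter.eventually_gt_atTop 1)).exists
    have hcont : ContinuousOn (fun x : ℝ => (χ₁.LFunction x).re) (Set.Icc β b) :=
      (Complex.continuous_re.comp ((differentiable_LFunction hχ₁).continuous.comp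
        Complex.continuous_ofReal)).continuousOn
    obtain ⟨z, hz, hz0⟩ := intermediate_value_Icc (by linarith) hcont ⟨hneg.le, hb0.le⟩
    have hz1 : χ₁.LFunction z = 0 :=
      Complex.ext hz0 (by rw [lfunction_im_eq_zero hχ₁ hχ₁2 (by linarith [hz.1])]; rfl)
    have hz2 : z < 1 := by
      by_contra hcon
      exact χ₁.LFunction_ne_zero_of_one_le_re (.inl hχ₁) (s := z) (by simpa using hcon) hz1
    exact siegel_of_zero (β := z) (by linarith [hz.1]) hz2 hε hε1 (by linarith [hz.1]) hχ₁ hχ₁2 hz1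

end Hooley

namespace Hooley

lemma cond_rpow_facts {T e : ℝ} (hT : 2 ≤ T) (he : 0 < e) : 1 ≤ T ^ e ∧ T ^ (2 * e) = (T ^ e) ^ 2 ∧
    T ^ (-(9 * e)) = ((T ^ e) ^ 9)⁻¹ := by
  have hT0 : 0 ≤ T := by linarith
  refine ⟨Real.one_le_rpow (by linarith) he.le, ?_, ?_⟩
  · rw [← Real.rpow_natCast, ← Real.rpow_mul hT0]; push_cast; ring_nf
  · rw [← Real.rpow_natCast, ← Real.rpow_mul hT0, ← Real.rpow_neg hT0]; push_cast; ring_nf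

lemma two_mul_rpow_le {T e : ℝ} (hT : 2 ≤ T) (he' : e ≤ 1 / 3) :
    (2 * T) ^ (2 * e) ≤ 2 * T ^ (2 * e) := by
  rw [Real.mul_rpow (by norm_num) (by linarith)]
  refine mul_le_mul_of_nonneg_right ?_ (by positivity)
  calc (2 : ℝ) ^ (2 * e) ≤ (2 : ℝ) ^ (1 : ℝ) :=
        Real.rpow_le_rpow_of_exponent_le (by norm_num) (by linarith)
    _ = 2 := Real.rpow_one _

lemma cond_mono_im {q : ℕ} {s w : ℂ} (h : |w.im| ≤ |s.im|) : cond q w ≤ cond q s := by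
  unfold cond; gcongr

lemma norm_deriv_lfunction_le {q : ℕ} [NeZero q] {χ : DirichletCharacter ℂ q} (hχ : χ ≠ 1) {e : ℝ}
    (he : 0 < e) (he' : e ≤ 1 / 3) {s : ℂ} (hs : 1 - e / 2 ≤ s.re) (hs' : s.re ≤ 3) :
    ‖deriv χ.LFunction s‖ ≤ 4 * (140 / e) / e * cond q s ^ (2 * e) :=
  norm_deriv_le_of_cond (Nat.one_le_iff_ne_zero.2 (NeZero.ne q)) he he' (by positivity)
    (fun s _ => DirichletCharacter.differentiable_LFunction hχ s)
    (fun _ h1 h2 => norm_lfunction_le hχ he he' h1 h2) hs hs'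

lemma exists_lower_bound_char {e : ℝ} (he : 0 < e) (he' : e ≤ 1 / 3) : ∃ c : ℝ, 0 < c ∧
    ∀ (q : ℕ) [NeZero q] (χ : DirichletCharacter ℂ q), χ ≠ 1 → ∀ s : ℂ, 1 < s.re → s.re ≤ 2 →
      c * cond q s ^ (-(9 * e)) ≤ ‖χ.LFunction s‖ := by
  obtain ⟨c₁, hc₁, hS⟩ := siegel he
  obtain ⟨K, hK1, hK⟩ := exists_norm_lseries_le
  set C₁ : ℝ := 4 * (140 / e) / e with hC₁
  have hC₁1 : 1 ≤ C₁ := by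
    rw [hC₁, le_div_iff₀ he, ← mul_div_assoc, le_div_iff₀ he]; nlinarith
  set C₂ : ℝ := 2 * C₁ / c₁ + 280 / e with hC₂
  have h280 : 1 ≤ 280 / e := by rw [le_div_iff₀ he]; linarith
  have hC₂1 : 1 ≤ C₂ := by
    have : 0 < 2 * C₁ / c₁ := by positivity
    linarith
  set c₃ : ℝ := 1 / (16 * K ^ 3 * C₁ ^ 3 * C₂) with hc₃
  set c₄ : ℝ := min (c₁ / 2) (c₁ / (4 * C₁ * K)) with hc₄
  refine ⟨min c₃ c₄, by positivity, ?_⟩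
  intro q _ χ hχ s hs hs'
  have hq : 1 ≤ q := Nat.one_le_iff_ne_zero.2 (NeZero.ne q)
  have hq1 : (1 : ℝ) ≤ q := by exact_mod_cast hq
  have hT := two_le_cond hq s
  set T := cond q s with hTdef
  obtain ⟨hP1, hP2, hP9⟩ := cond_rpow_facts hT he
  rw [hP9]
  set P := T ^ e with hP
  set x := s.re with hx
  set t := s.im with ht
  have hsxt : s = x + t * Complex.I := (Complex.re_add_im s).symm
  have hcond : ∀ y : ℝ, cond q (y + t * Complex.I) = T := by
    intro y; rw [hTdef]; simp [cond, ht]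
  have hX : ∀ y : ℝ, 1 < y → y ≤ 2 → ‖deriv χ.LFunction (y + t * Complex.I)‖ ≤ C₁ * P ^ 2 := by
    intro y hy hy'
    have := norm_deriv_lfunction_le hχ he he' (s := y + t * Complex.I) (by simp; linarith)
      (by simp; linarith)
    rwa [hcond, hP2] at this
  have hcond2 : ∀ y : ℝ, cond q (y + (2 * t : ℝ) * Complex.I) ^ (2 * e) ≤ 2 * P ^ 2 := by
    intro y
    refine le_trans ?_ ((two_mul_rpow_le hT he').trans_eq (by rw [hP2]))
    apply Real.rpow_le_rpow (by linarith [two_le_cond hq (y + (2 * t : ℝ) * Complex.I)]) _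
      (by linarith)
    rw [hTdef]
    unfold cond
    simp only [Complex.add_im, Complex.ofReal_im, Complex.mul_im,
      Complex.ofReal_re, Complex.I_im, Complex.I_re, mul_one, mul_zero, add_zero, zero_add,
      abs_mul, abs_two, ← ht]
    nlinarith
  have hP23 : P ^ 2 ≤ P ^ 3 := pow_le_pow_right₀ hP1 (by norm_num)
  have hXY : (∀ y : ℝ, 1 < y → y ≤ 2 →
      ‖LSeries (fun n => (χ ^ 2) n) (y + (2 * t : ℝ) * Complex.I)‖ ≤ C₂ * P ^ 3) →
      min c₃ c₄ * (P ^ 9)⁻¹ ≤ ‖χ.LFunction s‖ := by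
    intro hY
    have := lower_bound_char hK1 hK hχ (t := t) (X := C₁ * P ^ 2) (Y := C₂ * P ^ 3)
      (by nlinarith [one_le_pow₀ (n := 2) hP1]) (by nlinarith [one_le_pow₀ (n := 3) hP1])
      hX hY hs hs'
    rw [← hsxt] at this
    refine le_trans ?_ this
    have e1 : 1 / (16 * K ^ 3 * (C₁ * P ^ 2) ^ 3 * (C₂ * P ^ 3)) = c₃ * (P ^ 9)⁻¹ := by
      rw [hc₃]; field_simp
    rw [e1]
    gcongr
    exact min_le_left _ _
  by_cases h2 : χ ^ 2 = 1
  · set η : ℝ := c₁ / (4 * C₁ * P ^ 3) with hη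
    have hη0 : 0 < η := by positivity
    by_cases hη' : η ≤ |t|
    · apply hXY
      intro y hy hy'
      have hb := balanced_char (χ ^ 2)
      set z : ℂ := y + (2 * t : ℝ) * Complex.I with hz
      have hzr : z.re = y := by simp [hz]
      have hzi : z.im = 2 * t := by simp [hz]
      rw [hb.lseries_eq (by rw [hzr]; exact hy)]
      have e1 := hb.norm_regPart_le_cond hq he he' (s := z) (by linarith) (by linarith)
      have e2 : ‖charMean (χ ^ 2) / (z - 1)‖ ≤ 1 / (2 * η) := by
        rw [norm_div]
        refine div_le_div₀ zero_le_one hb.mean_le (by positivity) ?_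
        have := Complex.abs_im_le_norm (z - 1)
        rw [Complex.sub_im, hzi, Complex.one_im, sub_zero, abs_mul, abs_two] at this
        linarith
      have e3 : 1 / (2 * η) = 2 * C₁ / c₁ * P ^ 3 := by
        rw [hη]; field_simp; ring
      have e4 : 140 / e * cond q z ^ (2 * e) ≤ 280 / e * P ^ 3 := by
        calc 140 / e * cond q z ^ (2 * e) ≤ 140 / e * (2 * P ^ 2) := by gcongr; exact hcond2 y
          _ ≤ 140 / e * (2 * P ^ 3) := by gcongr
          _ = _ := by ring
      calc _ ≤ ‖charMean (χ ^ 2) / (z - 1)‖ + ‖regPart (fun n => (χ ^ 2) n) (charMean (χ ^ 2)) z‖ :=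
            norm_add_le _ _
        _ ≤ 2 * C₁ / c₁ * P ^ 3 + 280 / e * P ^ 3 := by linarith
        _ = C₂ * P ^ 3 := by rw [hC₂]; ring
    · push Not at hη'
      have hl : c₁ * P⁻¹ ≤ ‖χ.LFunction 1‖ := by
        refine le_trans ?_ (hS q χ hχ h2)
        rw [Real.rpow_neg (by linarith)]
        gcongr
        rw [hP]
        apply Real.rpow_le_rpow (by linarith) _ he.le
        rw [hTdef]; unfold cond; nlinarith [abs_nonneg s.im]
      have hP10 : (P ^ 9)⁻¹ ≤ P⁻¹ :=
        inv_anti₀ (by positivity) (le_self_pow₀ hP1 (by norm_num))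
      have hP30 : (P ^ 9)⁻¹ ≤ (P ^ 3)⁻¹ :=
        inv_anti₀ (by positivity) (pow_le_pow_right₀ hP1 (by norm_num))
      have hcc : min c₃ c₄ ≤ c₄ := min_le_right _ _
      by_cases hxη : x - 1 ≤ η
      · have hconv : Convex ℝ {z : ℂ | z ∈ Set.Icc (1 : ℝ) 2 ×ℂ Set.Icc (-|t|) |t|} :=
          ((convex_Icc (1 : ℝ) 2).linear_preimage Complex.reLm).inter
            ((convex_Icc (-|t|) |t|).linear_preimage Complex.imLm)
        have e1 := hconv.norm_image_sub_le_of_norm_deriv_le (f := χ.LFunction) (C := C₁ * P ^ 2)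
          (x := s) (y := 1) (𝕜 := ℂ)
          (fun z _ => DirichletCharacter.differentiable_LFunction hχ z)
          (fun z hz => by
            obtain ⟨h3, h4⟩ := Complex.mem_reProdIm.1 hz
            refine (norm_deriv_lfunction_le hχ he he' (by linarith [h3.1])
              (by linarith [h3.2])).trans ?_
            rw [← hP2]
            gcongr
            · linarith [two_le_cond hq z]
            · exact cond_mono_im (abs_le.2 h4))
          (Complex.mem_reProdIm.2 ⟨⟨hs.le, hs'⟩, ⟨neg_abs_le _, le_abs_self _⟩⟩)
          (Complex.mem_reProdIm.2 ⟨by simp, by simp⟩)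
        have e2 : ‖(1 : ℂ) - s‖ ≤ 2 * η := by
          refine (Complex.norm_le_abs_re_add_abs_im _).trans ?_
          simp only [Complex.sub_re, Complex.one_re, Complex.sub_im, Complex.one_im, zero_sub,
            abs_neg, ← hx, ← ht]
          rw [abs_sub_comm, abs_of_nonneg (by linarith)]
          linarith
        have e3 : C₁ * P ^ 2 * (2 * η) = c₁ / 2 * P⁻¹ := by
          rw [hη]; field_simp; norm_num
        have e4 : C₁ * P ^ 2 * ‖(1 : ℂ) - s‖ ≤ c₁ / 2 * P⁻¹ := by
          rw [← e3]; gcongr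
        have e5 := norm_sub_norm_le (χ.LFunction 1) (χ.LFunction s)
        have e6 : c₁ / 2 * P⁻¹ ≤ ‖χ.LFunction s‖ := by linarith
        refine le_trans ?_ e6
        exact mul_le_mul (hcc.trans (min_le_left _ _)) hP10 (by positivity) (by positivity)
      · push Not at hxη
        have e1 := one_le_341 hK χ (t := t) (Y := K / (x - 1)) hs hs' (by
          have := hK q (χ ^ 2) (x + (2 * t : ℝ) * Complex.I) (by simpa using hs) (by simpa using hs')
          simpa using this)
        rw [← hsxt, ← DirichletCharacter.LFunction_eq_LSeries _ hs] at e1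
        have e2 : 1 ≤ (K / (x - 1) * ‖χ.LFunction s‖) ^ 4 := by
          calc (1 : ℝ) ≤ _ := e1
            _ = _ := by ring
        have hx0 : 0 < x - 1 := by linarith
        have e3 : 1 ≤ K / (x - 1) * ‖χ.LFunction s‖ := by
          by_contra hcon
          push Not at hcon
          exact absurd e2 (not_le.2 (pow_lt_one₀ (by positivity) hcon (by norm_num)))
        have e4 : (x - 1) / K ≤ ‖χ.LFunction s‖ := by
          rw [div_le_iff₀ (by linarith)]
          rw [div_mul_eq_mul_div, le_div_iff₀ hx0] at e3
          linarith
        have e5 : c₁ / (4 * C₁ * K) * (P ^ 3)⁻¹ = η / K := by rw [hη]; field_simp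
        calc min c₃ c₄ * (P ^ 9)⁻¹ ≤ c₁ / (4 * C₁ * K) * (P ^ 3)⁻¹ :=
              mul_le_mul (hcc.trans (min_le_right _ _)) hP30 (by positivity) (by positivity)
          _ = η / K := e5
          _ ≤ (x - 1) / K := by gcongr
          _ ≤ _ := e4
  · apply hXY
    intro y hy hy'
    rw [← DirichletCharacter.LFunction_eq_LSeries _ (by simpa using hy)]
    refine (norm_lfunction_le h2 he he' (by simp; linarith) (by simp; linarith)).trans ?_
    calc 140 / e * cond q (y + (2 * t : ℝ) * Complex.I) ^ (2 * e) ≤ 140 / e * (2 * P ^ 2) := by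
          gcongr; exact hcond2 y
      _ = 280 / e * P ^ 2 := by ring
      _ ≤ C₂ * P ^ 3 := by
          have : 280 / e ≤ C₂ := by
            have : 0 < 2 * C₁ / c₁ := by positivity
            linarith
          gcongr

end Hooley

namespace Hooley

/-- The function `(s - 1) ζ(s) / (s + 1)`, which is regular and bounded by small powers near the
line `re s = 1`. -/
noncomputable def zreg (s : ℂ) : ℂ := 1 / (s + 1) + (s - 1) / (s + 1) * riemannZeta₀ s

lemma add_one_ne_zero_of_re {s : ℂ} (hs : 0 < s.re) : s + 1 ≠ 0 := by
  intro h
  have := congrArg Complex.re h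
  simp at this
  linarith

lemma zreg_eq {s : ℂ} (hs : 0 < s.re) (hs1 : s ≠ 1) :
    zreg s = (s - 1) / (s + 1) * riemannZeta s := by
  have h1 := add_one_ne_zero_of_re hs
  have h2 : s - 1 ≠ 0 := sub_ne_zero.2 hs1
  rw [zreg, riemannZeta_eq_inv_sub_add hs1]
  field_simp

lemma differentiableAt_zreg {s : ℂ} (hs : 0 < s.re) : DifferentiableAt ℂ zreg s := by
  have h1 := add_one_ne_zero_of_re hs
  have h2 := differentiable_riemannZeta₀ s
  unfold zreg
  fun_prop (disch := assumption)

lemma norm_zreg_le {e : ℝ} (he : 0 < e) (he' : e ≤ 1 / 3) {s : ℂ} (hs : 1 - e ≤ s.re)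
    (hs' : s.re ≤ 4) : ‖zreg s‖ ≤ 141 / e * cond 1 s ^ (2 * e) := by
  have h1 := norm_riemannZeta₀_le he he' hs hs'
  have hT := two_le_cond le_rfl s
  obtain ⟨hP1, hP2, -⟩ := cond_rpow_facts hT he
  have h2 : 1 ≤ ‖s + 1‖ := by
    have := Complex.re_le_norm (s + 1)
    simp only [Complex.add_re, Complex.one_re] at this
    linarith
  have h3 : ‖s - 1‖ ≤ ‖s + 1‖ := by
    rw [Complex.norm_def, Complex.norm_def]
    apply Real.sqrt_le_sqrt
    simp only [Complex.normSq_apply, Complex.add_re, Complex.sub_re, Complex.one_re, Complex.add_im,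
      Complex.sub_im, Complex.one_im, sub_zero, add_zero]
    nlinarith
  have h4 : ‖1 / (s + 1)‖ ≤ 1 := by
    rw [norm_div, norm_one]; exact div_le_one_of_le₀ h2 (norm_nonneg _)
  have h5 : ‖(s - 1) / (s + 1)‖ ≤ 1 := by
    rw [norm_div]; exact div_le_one_of_le₀ h3 (norm_nonneg _)
  have h6 : 1 ≤ 1 / e * cond 1 s ^ (2 * e) := by
    rw [hP2]
    have : 1 ≤ 1 / e := by rw [le_div_iff₀ he]; linarith
    nlinarith
  calc ‖zreg s‖ ≤ ‖1 / (s + 1)‖ + ‖(s - 1) / (s + 1)‖ * ‖riemannZeta₀ s‖ := by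
        rw [zreg, ← norm_mul]; exact norm_add_le _ _
    _ ≤ 1 + 1 * (140 / e * cond 1 s ^ (2 * e)) := by gcongr
    _ ≤ 141 / e * cond 1 s ^ (2 * e) := by
        have : 141 / e * cond 1 s ^ (2 * e) = 140 / e * cond 1 s ^ (2 * e) +
          1 / e * cond 1 s ^ (2 * e) := by ring
        linarith

lemma exists_lower_bound_zreg_low : ∃ c : ℝ, 0 < c ∧ ∀ s : ℂ, 1 ≤ s.re → s.re ≤ 2 → |s.im| ≤ 1 →
    c ≤ ‖zreg s‖ := by
  have hK : IsCompact (Set.Icc (1 : ℝ) 2 ×ℂ Set.Icc (-1 : ℝ) 1) :=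
    isCompact_Icc.reProdIm isCompact_Icc
  have hne : (Set.Icc (1 : ℝ) 2 ×ℂ Set.Icc (-1 : ℝ) 1).Nonempty :=
    ⟨1, Complex.mem_reProdIm.2 ⟨by simp, by simp⟩⟩
  obtain ⟨s₀, h₀, hmin⟩ := hK.exists_isMinOn (f := fun s => ‖zreg s‖) hne (by
    intro s hs
    have h1 := (Complex.mem_reProdIm.1 hs).1.1
    exact ((differentiableAt_zreg (by linarith)).continuousAt.norm).continuousWithinAt)
  refine ⟨‖zreg s₀‖, ?_, fun s h1 h2 h3 => hmin (Complex.mem_reProdIm.2 ⟨⟨h1, h2⟩, abs_le.1 h3⟩)⟩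
  rw [norm_pos_iff]
  have h1 := (Complex.mem_reProdIm.1 h₀).1.1
  by_cases hs : s₀ = 1
  · rw [hs]; norm_num [zreg]
  · rw [zreg_eq (by linarith) hs]
    exact mul_ne_zero (div_ne_zero (sub_ne_zero.2 hs) (add_one_ne_zero_of_re (by linarith)))
      (riemannZeta_ne_zero_of_one_le_re h1)

lemma exists_lower_bound_zreg {e : ℝ} (he : 0 < e) (he' : e ≤ 1 / 3) : ∃ c : ℝ, 0 < c ∧
    ∀ s : ℂ, 1 < s.re → s.re ≤ 2 → c * cond 1 s ^ (-(9 * e)) ≤ ‖zreg s‖ := by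
  obtain ⟨c₀, hc₀, hlow⟩ := exists_lower_bound_zreg_low
  obtain ⟨K, hK1, hK⟩ := exists_norm_lseries_le
  set C₁ : ℝ := 4 * (140 / e) / e with hC₁
  have hC₁1 : 1 ≤ C₁ := by
    rw [hC₁, le_div_iff₀ he, ← mul_div_assoc, le_div_iff₀ he]; nlinarith
  have h280 : 1 ≤ 281 / e := by rw [le_div_iff₀ he]; linarith
  have h1e : 1 ≤ 1 / e := by rw [le_div_iff₀ he]; linarith
  set c₁ : ℝ := 1 / (16 * K ^ 3 * (2 * C₁) ^ 3 * (281 / e)) with hc₁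
  refine ⟨min c₀ (c₁ / 3), by positivity, ?_⟩
  intro s hs hs'
  have hT := two_le_cond le_rfl s
  set T := cond 1 s with hTdef
  obtain ⟨hP1, hP2, hP9⟩ := cond_rpow_facts hT he
  rw [hP9]
  set P := T ^ e with hP
  have hP91 : (P ^ 9)⁻¹ ≤ 1 := inv_le_one_of_one_le₀ (one_le_pow₀ hP1)
  have hP90 : 0 < (P ^ 9)⁻¹ := by positivity
  have hcm : 0 < min c₀ (c₁ / 3) := by positivity
  by_cases ht1 : |s.im| ≤ 1
  · refine le_trans ?_ (hlow s hs.le hs' ht1)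
    calc min c₀ (c₁ / 3) * (P ^ 9)⁻¹ ≤ min c₀ (c₁ / 3) * 1 := by gcongr
      _ ≤ c₀ := by rw [mul_one]; exact min_le_left _ _
  push Not at ht1
  set x := s.re with hx
  set t := s.im with ht
  have hsxt : s = x + t * Complex.I := (Complex.re_add_im s).symm
  have hcond : ∀ y : ℝ, cond 1 (y + t * Complex.I) = T := by
    intro y; rw [hTdef]; simp [cond, ht]
  have him : ∀ y u : ℝ, 1 < |u| → 1 ≤ ‖(y + u * Complex.I : ℂ) - 1‖ := by
    intro y u hu
    have := Complex.abs_im_le_norm ((y + u * Complex.I : ℂ) - 1)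
    simp at this
    linarith
  have hne : ∀ y u : ℝ, 1 < |u| → (y + u * Complex.I : ℂ) ≠ 1 := by
    intro y u hu h
    have := him y u hu
    rw [h, sub_self, norm_zero] at this
    linarith
  have hP21 : 1 ≤ P ^ 2 := one_le_pow₀ hP1
  have hX : ∀ y : ℝ, 1 < y → y ≤ 2 →
      ‖deriv riemannZeta (y + t * Complex.I)‖ ≤ 2 * C₁ * P ^ 2 := by
    intro y hy hy'
    set z : ℂ := y + t * Complex.I with hz
    have e0 : riemannZeta =ᶠ[nhds z] fun w => (w - 1)⁻¹ + riemannZeta₀ w := by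
      filter_upwards [isOpen_ne.mem_nhds (hne y t ht1)] with w hw
      exact riemannZeta_eq_inv_sub_add hw
    have hz1 : z - 1 ≠ 0 := sub_ne_zero.2 (hne y t ht1)
    have e1 : HasDerivAt (fun w : ℂ => (w - 1)⁻¹ + riemannZeta₀ w)
        (-1 / (z - 1) ^ 2 + deriv riemannZeta₀ z) z :=
      (((hasDerivAt_id z).sub_const 1).fun_inv hz1).add
        (differentiable_riemannZeta₀ z).hasDerivAt
    rw [e0.deriv_eq, e1.deriv]
    have e2 := norm_deriv_le_of_cond (q := 1) le_rfl he he' (by positivity)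
      (fun w _ => differentiable_riemannZeta₀ w) (fun _ h1 h2 => norm_riemannZeta₀_le he he' h1 h2)
      (s := z) (by simp [hz]; linarith) (by simp [hz]; linarith)
    rw [hcond, hP2] at e2
    have e3 : ‖-1 / (z - 1) ^ 2‖ ≤ 1 := by
      rw [norm_div, norm_neg, norm_one, norm_pow]
      exact div_le_one_of_le₀ (one_le_pow₀ (him y t ht1)) (by positivity)
    calc _ ≤ ‖-1 / (z - 1) ^ 2‖ + ‖deriv riemannZeta₀ z‖ := norm_add_le _ _
      _ ≤ 1 + C₁ * P ^ 2 := by linarith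
      _ ≤ 2 * C₁ * P ^ 2 := by nlinarith
  have hY : ∀ y : ℝ, 1 < y → y ≤ 2 → ‖LSeries (fun n => ((1 : DirichletCharacter ℂ 1) ^ 2) n)
      (y + (2 * t : ℝ) * Complex.I)‖ ≤ 281 / e * P ^ 2 := by
    intro y hy hy'
    set z : ℂ := y + (2 * t : ℝ) * Complex.I with hz
    have hu : 1 < |2 * t| := by rw [abs_mul, abs_two]; linarith
    have hzr : z.re = y := by simp [hz]
    have e0 : LSeries (fun n => ((1 : DirichletCharacter ℂ 1) ^ 2) n) z = riemannZeta z := by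
      rw [one_pow, ← DirichletCharacter.LFunction_eq_LSeries _ (by rw [hzr]; exact hy),
        DirichletCharacter.LFunction_modOne_eq]
    rw [e0, riemannZeta_eq_inv_sub_add (hne y _ hu)]
    have e1 := norm_riemannZeta₀_le he he' (s := z) (by linarith) (by linarith)
    have e2 : cond 1 z ^ (2 * e) ≤ 2 * P ^ 2 := by
      refine le_trans ?_ ((two_mul_rpow_le hT he').trans_eq (by rw [hP2]))
      apply Real.rpow_le_rpow (by linarith [two_le_cond le_rfl z]) _ (by linarith)
      rw [hTdef]
      have hzi : z.im = 2 * t := by simp [hz]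
      unfold cond
      rw [hzi, abs_mul, abs_two, ← ht]
      push_cast
      linarith
    have e3 : ‖(z - 1)⁻¹‖ ≤ 1 := by
      rw [norm_inv]; exact inv_le_one_of_one_le₀ (him y _ hu)
    calc _ ≤ ‖(z - 1)⁻¹‖ + ‖riemannZeta₀ z‖ := norm_add_le _ _
      _ ≤ 1 + 140 / e * (2 * P ^ 2) := by
        refine add_le_add e3 (e1.trans ?_); gcongr
      _ ≤ 1 / e * P ^ 2 + 140 / e * (2 * P ^ 2) := by nlinarith
      _ = 281 / e * P ^ 2 := by ring
  have key := lower_bound_of_341 (L := fun x : ℝ => riemannZeta (x + t * Complex.I))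
    (X := 2 * C₁ * P ^ 2) (Y := 281 / e * P ^ 2) (by nlinarith) (by nlinarith) hK1
    (fun y hy hy' => by
      have := one_le_341 hK (1 : DirichletCharacter ℂ 1) (t := t) hy hy' (hY y hy hy')
      rwa [← DirichletCharacter.LFunction_eq_LSeries _ (by simpa using hy),
        DirichletCharacter.LFunction_modOne_eq] at this)
    (norm_lipschitz (fun y _ _ => differentiableAt_riemannZeta (hne y t ht1)) hX) hs hs'
  simp only [← hsxt] at key
  have hs1 : s ≠ 1 := by rw [hsxt]; exact hne x t ht1
  rw [zreg_eq (by linarith) hs1, norm_mul]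
  have e1 : 1 / 3 ≤ ‖(s - 1) / (s + 1)‖ := by
    have h1 : 1 ≤ ‖s - 1‖ := by rw [hsxt]; exact him x t ht1
    have h2 : ‖s + 1‖ ≤ ‖s - 1‖ + 2 := by
      have := norm_add_le (s - 1) 2
      rw [show s - 1 + 2 = s + 1 by ring] at this
      simpa using this
    have h3 : 0 < ‖s + 1‖ := norm_pos_iff.2 (add_one_ne_zero_of_re (by linarith))
    rw [norm_div, le_div_iff₀ h3]
    linarith
  have e2 : c₁ * (P ^ 9)⁻¹ ≤ ‖riemannZeta s‖ := by
    refine le_trans ?_ key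
    have : 1 / (16 * K ^ 3 * (2 * C₁ * P ^ 2) ^ 3 * (281 / e * P ^ 2)) = c₁ * (P ^ 8)⁻¹ := by
      rw [hc₁]; field_simp
    rw [this]
    gcongr
    norm_num
  calc min c₀ (c₁ / 3) * (P ^ 9)⁻¹ ≤ c₁ / 3 * (P ^ 9)⁻¹ := by gcongr; exact min_le_right _ _
    _ = 1 / 3 * (c₁ * (P ^ 9)⁻¹) := by ring
    _ ≤ _ := by gcongr

end Hooley

namespace Hooley

/-- Upper and lower bounds by small powers of the conductor near the line `re s = 1` bound the
derivatives of the logarithmic derivative to the right of that line. -/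
lemma exists_iteratedDeriv_logDeriv_le (k : ℕ) {e K c : ℝ} (he : 0 < e)
    (hek : 11 * e * (k + 1) ≤ 1 / 2) (hK : 1 ≤ K) (hc : 0 < c) (hc1 : c ≤ 1) :
    ∃ C : ℝ, 0 < C ∧ ∀ (q : ℕ) (f : ℂ → ℂ), 1 ≤ q →
      (∀ s : ℂ, 1 - e ≤ s.re → DifferentiableAt ℂ f s) →
      (∀ s : ℂ, 1 - e ≤ s.re → s.re ≤ 4 → ‖f s‖ ≤ K * cond q s ^ (2 * e)) →
      (∀ s : ℂ, 1 < s.re → s.re ≤ 2 → c * cond q s ^ (-(9 * e)) ≤ ‖f s‖) →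
      ∀ s : ℂ, 1 < s.re → s.re ≤ 2 →
        ‖iteratedDeriv k (fun z => deriv f z / f z) s‖ ≤ C * cond q s ^ ((1 : ℝ) / 2) := by
  have he' : e ≤ 1 / 3 := by nlinarith [(Nat.cast_nonneg k : (0 : ℝ) ≤ k)]
  refine ⟨k.factorial * (16 * K / (c * e)) ^ (k + 1), by positivity, ?_⟩
  intro q f hq hd hub hlb s hs hs'
  have hT := two_le_cond hq s
  set T := cond q s with hTdef
  obtain ⟨hP1, hP2, hP9⟩ := cond_rpow_facts hT he
  set P := T ^ e with hP
  have hP0 : 0 < P := by linarith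
  set r : ℝ := c * e / (16 * K * P ^ 11) with hr
  have hr0 : 0 < r := by positivity
  have hre : r ≤ e / 2 := by
    rw [hr, div_le_iff₀ (by positivity)]
    have h1 : 1 ≤ P ^ 11 := one_le_pow₀ hP1
    have h2 : 1 ≤ K * P ^ 11 := by nlinarith
    nlinarith
  have hball : ∀ z ∈ Metric.closedBall s r, 1 - e / 2 ≤ z.re ∧ z.re ≤ 3 ∧ ‖z - s‖ ≤ r := by
    intro z hz
    rw [Metric.mem_closedBall, dist_eq_norm] at hz
    have h1 := (Complex.abs_re_le_norm (z - s)).trans hz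
    rw [Complex.sub_re, abs_le] at h1
    exact ⟨by linarith, by linarith, hz⟩
  have hder : ∀ z ∈ Metric.closedBall s r, ‖deriv f z‖ ≤ 8 * K / e * P ^ 2 := by
    intro z hz
    obtain ⟨h1, h2, h3⟩ := hball z hz
    refine (norm_deriv_le_of_cond hq he he' (by linarith) hd hub h1 h2).trans ?_
    have h4 : cond q z ^ (2 * e) ≤ 2 * P ^ 2 := by
      rw [← hP2]
      refine le_trans ?_ (two_mul_rpow_le hT he')
      have := two_le_cond hq z
      exact Real.rpow_le_rpow (by linarith) (cond_le_two_mul (by linarith)) (by linarith)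
    calc 4 * K / e * cond q z ^ (2 * e) ≤ 4 * K / e * (2 * P ^ 2) := by gcongr
      _ = _ := by ring
  have hlow : ∀ z ∈ Metric.closedBall s r, c / 2 * (P ^ 9)⁻¹ ≤ ‖f z‖ := by
    intro z hz
    have h1 := (convex_closedBall s r).norm_image_sub_le_of_norm_deriv_le (𝕜 := ℂ)
      (fun w hw => hd w (by linarith [(hball w hw).1])) hder
      (Metric.mem_closedBall_self hr0.le) hz
    have h2 : 8 * K / e * P ^ 2 * ‖z - s‖ ≤ c / 2 * (P ^ 9)⁻¹ := by
      calc 8 * K / e * P ^ 2 * ‖z - s‖ ≤ 8 * K / e * P ^ 2 * r := by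
            gcongr
            exact (hball z hz).2.2
        _ = c / 2 * (P ^ 9)⁻¹ := by rw [hr]; field_simp; norm_num
    have h3 := hlb s hs hs'
    rw [← hTdef, hP9] at h3
    have h4 := norm_sub_norm_le (f s) (f z)
    rw [norm_sub_rev] at h4
    linarith
  have hpos : ∀ z ∈ Metric.closedBall s r, f z ≠ 0 := by
    intro z hz h0
    have := hlow z hz
    rw [h0, norm_zero] at this
    have : 0 < c / 2 * (P ^ 9)⁻¹ := by positivity
    linarith
  have hdd : DifferentiableOn ℂ (deriv f) {z | 1 - e < z.re} :=
    DifferentiableOn.deriv (fun z hz => (hd z (le_of_lt hz)).differentiableWithinAt)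
      (isOpen_lt continuous_const Complex.continuous_re)
  have key : ‖iteratedDeriv k (fun z => deriv f z / f z) s‖ ≤ k.factorial * (1 / r) / r ^ k := by
    refine Complex.norm_iteratedDeriv_le_of_forall_mem_sphere_norm_le k hr0 ?_ ?_
    · refine DifferentiableOn.diffContOnCl_ball (U := Metric.closedBall s r) ?_ subset_rfl
      intro z hz
      have h1 := (hball z hz).1
      refine DifferentiableWithinAt.div ?_ (hd z (by linarith)).differentiableWithinAt (hpos z hz)
      exact (hdd.differentiableAt ((isOpen_lt continuous_const Complex.continuous_re).mem_nhds
        (by change 1 - e < z.re; linarith))).differentiableWithinAt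
    · intro z hz
      have hz' := Metric.sphere_subset_closedBall hz
      have h1 : 0 < c / 2 * (P ^ 9)⁻¹ := by positivity
      rw [norm_div]
      calc ‖deriv f z‖ / ‖f z‖ ≤ (8 * K / e * P ^ 2) / (c / 2 * (P ^ 9)⁻¹) :=
            div_le_div₀ (by positivity) (hder z hz') h1 (hlow z hz')
        _ = 1 / r := by rw [hr]; field_simp; norm_num
  refine key.trans ?_
  have h1 : k.factorial * (1 / r) / r ^ k =
      k.factorial * (16 * K / (c * e)) ^ (k + 1) * (P ^ (11 * (k + 1))) := by
    have : 1 / r = 16 * K / (c * e) * P ^ 11 := by rw [hr]; field_simp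
    rw [pow_mul, mul_assoc, ← mul_pow, ← this, pow_succ, one_div, inv_pow]
    field_simp
  rw [h1]
  refine mul_le_mul_of_nonneg_left ?_ (by positivity)
  rw [hP, ← Real.rpow_natCast, ← Real.rpow_mul (by linarith)]
  refine Real.rpow_le_rpow_of_exponent_le (by linarith) ?_
  push_cast
  linarith

open LSeries in
lemma iterate_logMul_apply (f : ℕ → ℂ) (k n : ℕ) :
    logMul^[k] f n = f n * (Real.log n : ℂ) ^ k := by
  induction k generalizing f with
  | zero => simp
  | succ k ih =>
    rw [Function.iterate_succ_apply, ih, logMul, Complex.natCast_log, pow_succ]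
    ring

lemma norm_lseries_log_pow (f : ℕ → ℂ) (k : ℕ) {s : ℂ}
    (h : LSeries.abscissaOfAbsConv f < s.re) :
    ‖LSeries (fun n => f n * (Real.log n : ℂ) ^ k) s‖ = ‖iteratedDeriv k (LSeries f) s‖ := by
  rw [LSeries_iteratedDeriv k h, norm_mul, norm_pow, norm_neg, norm_one, one_pow, one_mul]
  congr 2
  funext n
  exact (iterate_logMul_apply f k n).symm

lemma lseriesSummable_log_pow {f : ℕ → ℂ} {k : ℕ} {s : ℂ}
    (h : LSeries.abscissaOfAbsConv f < s.re) :
    LSeriesSummable (fun n => f n * (Real.log n : ℂ) ^ k) s := by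
  have h1 := LSeriesSummable_of_abscissaOfAbsConv_lt_re (f := LSeries.logMul^[k] f) (s := s)
    (by rwa [LSeries.absicssaOfAbsConv_logPowMul])
  convert h1 using 1
  funext n
  exact (iterate_logMul_apply f k n).symm

/-- The von Mangoldt function twisted by a character. -/
noncomputable def twist {q : ℕ} (χ : DirichletCharacter ℂ q) (n : ℕ) : ℂ :=
  χ n * ArithmeticFunction.vonMangoldt n

lemma abscissa_twist_le {q : ℕ} (χ : DirichletCharacter ℂ q) :
    LSeries.abscissaOfAbsConv (twist χ) ≤ 1 := by
  refine LSeries.abscissaOfAbsConv_le_of_forall_lt_LSeriesSummable' fun y hy => ?_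
  exact DirichletCharacter.LSeriesSummable_twist_vonMangoldt χ (by rw [Complex.ofReal_re]; exact_mod_cast hy)

lemma abscissa_lt {f : ℕ → ℂ} (h : LSeries.abscissaOfAbsConv f ≤ 1) {s : ℂ} (hs : 1 < s.re) :
    LSeries.abscissaOfAbsConv f < s.re := h.trans_lt (by exact_mod_cast hs)

lemma re_gt_mem_nhds {s : ℂ} (hs : 1 < s.re) : {z : ℂ | 1 < z.re} ∈ nhds s :=
  (isOpen_lt continuous_const Complex.continuous_re).mem_nhds hs

lemma lseries_twist_eq {q : ℕ} [NeZero q] (χ : DirichletCharacter ℂ q) {s : ℂ} (hs : 1 < s.re) :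
    LSeries (twist χ) s = -(deriv χ.LFunction s / χ.LFunction s) := by
  have h1 := DirichletCharacter.LSeries_twist_vonMangoldt_eq χ hs
  rw [← χ.LFunction_eq_LSeries hs] at h1
  have h2 : deriv (LSeries (fun n => χ n)) s = deriv χ.LFunction s := by
    refine Filter.EventuallyEq.deriv_eq ?_
    filter_upwards [re_gt_mem_nhds hs] with z hz using (χ.LFunction_eq_LSeries hz).symm
  rw [h2] at h1
  rw [← neg_div]
  exact h1

lemma exists_norm_lseries_twist_le (k : ℕ) : ∃ C : ℝ, 0 < C ∧ ∀ (q : ℕ) [NeZero q]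
    (χ : DirichletCharacter ℂ q), χ ≠ 1 → ∀ s : ℂ, 1 < s.re → s.re ≤ 2 →
      ‖LSeries (fun n => twist χ n * (Real.log n : ℂ) ^ k) s‖ ≤ C * cond q s ^ ((1 : ℝ) / 2) := by
  set e : ℝ := 1 / (22 * (k + 1)) with he
  have hk : (0 : ℝ) < 22 * (k + 1) := by positivity
  have he0 : 0 < e := by positivity
  have he1 : 11 * e * (k + 1) ≤ 1 / 2 := by rw [he]; apply le_of_eq; field_simp; norm_num
  have he' : e ≤ 1 / 3 := by nlinarith [(Nat.cast_nonneg k : (0 : ℝ) ≤ k)]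
  obtain ⟨c, hc, hlb⟩ := exists_lower_bound_char he0 he'
  obtain ⟨C, hC, h⟩ := exists_iteratedDeriv_logDeriv_le k (e := e) (K := 140 / e) (c := min c 1) he0
    he1 (by rw [le_div_iff₀ he0]; linarith) (by positivity) (min_le_right _ _)
  refine ⟨C, hC, ?_⟩
  intro q _ χ hχ s hs hs'
  have hq : 1 ≤ q := Nat.one_le_iff_ne_zero.2 (NeZero.ne q)
  rw [norm_lseries_log_pow _ _ (abscissa_lt (abscissa_twist_le χ) hs)]
  have h1 : iteratedDeriv k (LSeries (twist χ)) s =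
      iteratedDeriv k (fun z => -(deriv χ.LFunction z / χ.LFunction z)) s := by
    refine Filter.EventuallyEq.iteratedDeriv_eq k ?_
    filter_upwards [re_gt_mem_nhds hs] with z hz using lseries_twist_eq χ hz
  rw [h1, iteratedDeriv_fun_neg, norm_neg]
  refine h q χ.LFunction hq (fun z _ => DirichletCharacter.differentiable_LFunction hχ z)
    (fun z h1 h2 => norm_lfunction_le hχ he0 he' h1 h2) (fun z h1 h2 => ?_) s hs hs'
  refine le_trans ?_ (hlb q χ hχ z h1 h2)
  have := two_le_cond hq z
  gcongr
  exact min_le_left _ _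

/-- The coefficients `Λ(n) - 1`. -/
noncomputable def centered (n : ℕ) : ℂ := ArithmeticFunction.vonMangoldt n - 1

lemma abscissa_centered_le : LSeries.abscissaOfAbsConv centered ≤ 1 := by
  refine LSeries.abscissaOfAbsConv_le_of_forall_lt_LSeriesSummable' fun y hy => ?_
  have hy' : 1 < (y : ℂ).re := by rw [Complex.ofReal_re]; exact_mod_cast hy
  exact (ArithmeticFunction.LSeriesSummable_vonMangoldt hy').sub
    ((LSeriesSummable_one_iff (s := (y : ℂ))).2 hy')

lemma lseries_centered_eq {s : ℂ} (hs : 1 < s.re) :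
    LSeries centered s = -(deriv zreg s / zreg s) - (1 / (s + 1) + riemannZeta₀ s) := by
  have hs1 : s ≠ 1 := by rintro rfl; simp at hs
  have h0 : LSeries centered s = LSeries (fun n => (ArithmeticFunction.vonMangoldt n : ℂ)) s -
      LSeries 1 s :=
    LSeries_sub (ArithmeticFunction.LSeriesSummable_vonMangoldt hs)
      ((LSeriesSummable_one_iff (s := s)).2 hs)
  rw [h0, ArithmeticFunction.LSeries_vonMangoldt_eq_deriv_riemannZeta_div hs,
    LSeries_one_eq_riemannZeta hs]
  have hz := riemannZeta_ne_zero_of_one_lt_re hs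
  have hp := add_one_ne_zero_of_re (s := s) (by linarith)
  have hm : s - 1 ≠ 0 := sub_ne_zero.2 hs1
  have hd : deriv zreg s = 2 / (s + 1) ^ 2 * riemannZeta s + (s - 1) / (s + 1) * deriv riemannZeta s := by
    have h1 : zreg =ᶠ[nhds s] fun z => (z - 1) / (z + 1) * riemannZeta z := by
      filter_upwards [re_gt_mem_nhds hs] with z hz
      refine zreg_eq (by have hz' : 1 < z.re := hz; linarith) ?_
      rintro rfl
      simp at hz
    rw [h1.deriv_eq]
    have h2 : HasDerivAt (fun z : ℂ => (z - 1) / (z + 1))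
        ((1 * (s + 1) - (s - 1) * 1) / (s + 1) ^ 2) s :=
      ((hasDerivAt_id s).sub_const 1).div ((hasDerivAt_id s).add_const 1) hp
    refine (h2.mul (differentiableAt_riemannZeta hs1).hasDerivAt).deriv.trans ?_
    congr 3
    ring
  rw [hd, zreg_eq (by linarith) hs1]
  have h3 : riemannZeta₀ s = riemannZeta s - (s - 1)⁻¹ := by
    rw [riemannZeta_eq_inv_sub_add hs1]; ring
  rw [h3]
  field_simp
  ring

lemma exists_norm_lseries_centered_le (k : ℕ) : ∃ C : ℝ, 0 < C ∧ ∀ s : ℂ, 1 < s.re → s.re ≤ 2 →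
      ‖LSeries (fun n => centered n * (Real.log n : ℂ) ^ k) s‖ ≤ C * cond 1 s ^ ((1 : ℝ) / 2) := by
  set e : ℝ := 1 / (22 * (k + 1)) with he
  have hk : (0 : ℝ) < 22 * (k + 1) := by positivity
  have he0 : 0 < e := by positivity
  have he1 : 11 * e * (k + 1) ≤ 1 / 2 := by rw [he]; apply le_of_eq; field_simp; norm_num
  have he' : e ≤ 1 / 22 := by nlinarith [(Nat.cast_nonneg k : (0 : ℝ) ≤ k)]
  obtain ⟨c, hc, hlb⟩ := exists_lower_bound_zreg he0 (by linarith)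
  obtain ⟨C, hC, h⟩ := exists_iteratedDeriv_logDeriv_le k (e := e) (K := 141 / e) (c := min c 1) he0
    he1 (by rw [le_div_iff₀ he0]; linarith) (by positivity) (min_le_right _ _)
  set D : ℝ := k.factorial * (142 / e * 2) / e ^ k with hD
  refine ⟨C + D, by positivity, ?_⟩
  intro s hs hs'
  have hT := two_le_cond le_rfl s
  rw [norm_lseries_log_pow _ _ (abscissa_lt abscissa_centered_le hs)]
  have hopen : IsOpen {z : ℂ | 1 < z.re} := isOpen_lt continuous_const Complex.continuous_re
  have hg : ∀ z : ℂ, 0 < z.re →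
      DifferentiableAt ℂ (fun z : ℂ => 1 / (z + 1) + riemannZeta₀ z) z := by
    intro z hz
    have h1 := add_one_ne_zero_of_re hz
    have h2 := differentiable_riemannZeta₀ z
    fun_prop (disch := assumption)
  have hzne : ∀ z ∈ {z : ℂ | 1 < z.re}, zreg z ≠ 0 := by
    intro z hz
    have hz1 : z ≠ 1 := by rintro rfl; simp at hz
    have hz' : 1 < z.re := hz
    rw [zreg_eq (by linarith) hz1]
    exact mul_ne_zero (div_ne_zero (sub_ne_zero.2 hz1) (add_one_ne_zero_of_re (by linarith)))
      (riemannZeta_ne_zero_of_one_lt_re hz)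
  have hzd : DifferentiableOn ℂ zreg {z : ℂ | 1 < z.re} := fun z hz =>
    (differentiableAt_zreg (by have hz' : 1 < z.re := hz; linarith)).differentiableWithinAt
  have h1 : iteratedDeriv k (LSeries centered) s = iteratedDeriv k
      ((fun z => -(deriv zreg z / zreg z)) - fun z => (1 / (z + 1) + riemannZeta₀ z)) s := by
    refine Filter.EventuallyEq.iteratedDeriv_eq k ?_
    filter_upwards [re_gt_mem_nhds hs] with z hz using lseries_centered_eq hz
  have hcd1 : ContDiffAt ℂ k (fun z => -(deriv zreg z / zreg z)) s :=
    ((((hzd.deriv hopen).div hzd hzne).neg).contDiffOn hopen).contDiffAt (re_gt_mem_nhds hs)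
  have hcd2 : ContDiffAt ℂ k (fun z => 1 / (z + 1) + riemannZeta₀ z) s := by
    refine (DifferentiableOn.contDiffOn (s := {z : ℂ | 1 < z.re}) ?_ hopen).contDiffAt
      (re_gt_mem_nhds hs)
    exact fun z hz => (hg z (by have hz' : 1 < z.re := hz; linarith)).differentiableWithinAt
  rw [h1, iteratedDeriv_sub hcd1 hcd2, iteratedDeriv_fun_neg, add_mul]
  refine (norm_sub_le _ _).trans (add_le_add ?_ ?_)
  · rw [norm_neg]
    refine h 1 zreg le_rfl (fun z hz => differentiableAt_zreg (by linarith))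
      (fun z h1 h2 => norm_zreg_le he0 (by linarith) h1 h2) (fun z h1 h2 => ?_) s hs hs'
    refine le_trans ?_ (hlb z h1 h2)
    have := two_le_cond le_rfl z
    gcongr
    exact min_le_left _ _
  · have hball : ∀ z ∈ Metric.closedBall s e, 1 - e ≤ z.re ∧ z.re ≤ 4 ∧ ‖z - s‖ ≤ 1 := by
      intro z hz
      rw [Metric.mem_closedBall, dist_eq_norm] at hz
      have h1 := (Complex.abs_re_le_norm (z - s)).trans hz
      rw [Complex.sub_re, abs_le] at h1
      exact ⟨by linarith, by linarith, by linarith⟩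
    have key : ‖iteratedDeriv k (fun z => 1 / (z + 1) + riemannZeta₀ z) s‖ ≤
        k.factorial * (142 / e * (2 * cond 1 s ^ (2 * e))) / e ^ k := by
      refine Complex.norm_iteratedDeriv_le_of_forall_mem_sphere_norm_le k he0 ?_ ?_
      · refine DifferentiableOn.diffContOnCl_ball (U := Metric.closedBall s e) ?_ subset_rfl
        exact fun z hz => (hg z (by linarith [(hball z hz).1])).differentiableWithinAt
      · intro z hz
        obtain ⟨h1, h2, h3⟩ := hball z (Metric.sphere_subset_closedBall hz)
        have hTz := two_le_cond le_rfl z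
        have h4 : cond 1 z ^ (2 * e) ≤ 2 * cond 1 s ^ (2 * e) :=
          le_trans (Real.rpow_le_rpow (by linarith) (cond_le_two_mul h3) (by linarith))
            (two_mul_rpow_le hT (by linarith))
        have h5 : ‖1 / (z + 1)‖ ≤ 1 / e * cond 1 z ^ (2 * e) := by
          have h6 : 1 ≤ ‖z + 1‖ := by
            refine le_trans ?_ (Complex.re_le_norm _)
            simp only [Complex.add_re, Complex.one_re]
            linarith
          have h7 : 1 ≤ cond 1 z ^ (2 * e) := Real.one_le_rpow (by linarith) (by linarith)
          have h8 : 1 ≤ 1 / e := by rw [le_div_iff₀ he0]; linarith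
          rw [norm_div, norm_one]
          calc 1 / ‖z + 1‖ ≤ 1 := by rw [div_le_one (by linarith)]; exact h6
            _ ≤ _ := by nlinarith
        calc ‖1 / (z + 1) + riemannZeta₀ z‖ ≤ 1 / e * cond 1 z ^ (2 * e) +
              140 / e * cond 1 z ^ (2 * e) :=
              norm_add_le_of_le h5 (norm_riemannZeta₀_le he0 (by linarith) h1 h2)
          _ = 141 / e * cond 1 z ^ (2 * e) := by ring
          _ ≤ 142 / e * (2 * cond 1 s ^ (2 * e)) := by gcongr; norm_num
    refine key.trans ?_
    have h6 : cond 1 s ^ (2 * e) ≤ cond 1 s ^ ((1 : ℝ) / 2) :=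
      Real.rpow_le_rpow_of_exponent_le (by linarith) (by linarith)
    calc k.factorial * (142 / e * (2 * cond 1 s ^ (2 * e))) / e ^ k = D * cond 1 s ^ (2 * e) := by
          rw [hD]; ring
      _ ≤ _ := by gcongr

end Hooley

namespace Hooley

/-- The Perron kernel `s ↦ 1 / (s (s + 1))`. -/
noncomputable def perronKernel (s : ℂ) : ℂ := 1 / s - 1 / (s + 1)

/-- The smooth cutoff `u ↦ max (1 - u) 0` on the positive reals. -/
noncomputable def cutoff (u : ℝ) : ℂ := (max (1 - u) 0 : ℝ)

lemma hasMellin_cutoff {s : ℂ} (hs : 0 < s.re) : HasMellin cutoff s (perronKernel s) := by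
  have h1 := hasMellin_one_Ioc hs
  have h2 := hasMellin_cpow_Ioc 1 (s := s) (by simp; linarith)
  have h3 := hasMellin_sub h1.1 h2.1
  rw [h1.2, h2.2] at h3
  have h4 : Set.EqOn cutoff (fun t => Set.indicator (Set.Ioc (0 : ℝ) 1) (fun _ => (1 : ℂ)) t -
      Set.indicator (Set.Ioc (0 : ℝ) 1) (fun t : ℝ => (t : ℂ) ^ (1 : ℂ)) t) (Set.Ioi 0) := by
    intro t ht
    simp only [cutoff, Complex.cpow_one]
    by_cases h : t ≤ 1
    · have h' : t ∈ Set.Ioc (0 : ℝ) 1 := ⟨ht, h⟩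
      rw [Set.indicator_of_mem h', Set.indicator_of_mem h', max_eq_left (by linarith)]
      simp
    · rw [Set.indicator_of_notMem (fun h' => h h'.2), Set.indicator_of_notMem (fun h' => h h'.2),
        max_eq_right (by linarith)]
      simp
  refine ⟨?_, ?_⟩
  · refine MeasureTheory.IntegrableOn.congr_fun h3.1 (fun t ht => ?_) measurableSet_Ioi
    simp only
    rw [h4 ht]
  · rw [perronKernel, ← h3.2]
    refine MeasureTheory.setIntegral_congr_fun measurableSet_Ioi (fun t ht => ?_)
    simp only
    rw [h4 ht]

lemma norm_perronKernel_le {σ : ℝ} (hσ : 1 ≤ σ) (t : ℝ) :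
    ‖perronKernel (σ + t * Complex.I)‖ ≤ 1 / (1 + t ^ 2) := by
  have key : ∀ b : ℝ, 1 ≤ b → Real.sqrt (1 + t ^ 2) ≤ ‖(b + t * Complex.I : ℂ)‖ := by
    intro b hb
    rw [Complex.norm_add_mul_I]
    exact Real.sqrt_le_sqrt (by nlinarith)
  have h1 := key σ hσ
  have h2 := key (σ + 1) (by linarith)
  have h0 : 0 < Real.sqrt (1 + t ^ 2) := Real.sqrt_pos.2 (by positivity)
  have hz1 : (σ + t * Complex.I : ℂ) ≠ 0 := norm_pos_iff.1 (by linarith)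
  have h3 : (σ + t * Complex.I + 1 : ℂ) = ((σ + 1 : ℝ) : ℂ) + t * Complex.I := by push_cast; ring
  have hz2 : (σ + t * Complex.I + 1 : ℂ) ≠ 0 := by rw [h3]; exact norm_pos_iff.1 (by linarith)
  have h4 : perronKernel (σ + t * Complex.I) =
      1 / ((σ + t * Complex.I) * (σ + t * Complex.I + 1)) := by
    rw [perronKernel]; field_simp; ring
  rw [h4, norm_div, norm_one, norm_mul]
  refine one_div_le_one_div_of_le (by positivity) ?_
  rw [← Real.mul_self_sqrt (show 0 ≤ 1 + t ^ 2 by positivity), h3]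
  exact mul_le_mul h1 h2 h0.le (norm_nonneg _)

lemma continuous_perronKernel_line {σ : ℝ} (hσ : 1 ≤ σ) :
    Continuous fun t : ℝ => perronKernel (σ + t * Complex.I) := by
  have hz : ∀ b : ℝ, 1 ≤ b → ∀ t : ℝ, (b + t * Complex.I : ℂ) ≠ 0 := by
    intro b hb t h
    have := congrArg Complex.re h
    simp at this
    linarith
  have h3 : ∀ t : ℝ, (σ + t * Complex.I + 1 : ℂ) ≠ 0 := by
    intro t
    have := hz (σ + 1) (by linarith) t
    push_cast at this
    convert this using 1
    ring
  have h4 := hz σ hσ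
  unfold perronKernel
  fun_prop (disch := assumption)

lemma integrable_perronKernel_line {σ : ℝ} (hσ : 1 ≤ σ) :
    MeasureTheory.Integrable fun t : ℝ => perronKernel (σ + t * Complex.I) := by
  refine MeasureTheory.Integrable.mono' integrable_inv_one_add_sq
    (continuous_perronKernel_line hσ).aestronglyMeasurable (Filter.Eventually.of_forall fun t => ?_)
  rw [← one_div]
  exact norm_perronKernel_le hσ t

lemma cutoff_eq_integral {σ u : ℝ} (hσ : 1 ≤ σ) (hu : 0 < u) :
    cutoff u = (1 / (2 * Real.pi) : ℝ) •
      ∫ t : ℝ, (u : ℂ) ^ (-(σ + t * Complex.I)) * perronKernel (σ + t * Complex.I) := by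
  have hre : ∀ t : ℝ, 0 < (σ + t * Complex.I : ℂ).re := by intro t; simp; linarith
  have h1 : ∀ t : ℝ, mellin cutoff (σ + t * Complex.I) = perronKernel (σ + t * Complex.I) :=
    fun t => (hasMellin_cutoff (hre t)).2
  have h := mellinInv_mellin_eq σ cutoff hu
    (by simpa using (hasMellin_cutoff (s := σ) (by simpa using by linarith)).1)
    (by simpa only [Complex.VerticalIntegrable, h1] using integrable_perronKernel_line hσ)
    (by unfold cutoff; fun_prop)
  rw [← h, mellinInv]
  simp only [h1, smul_eq_mul, neg_add]

/-- A smoothed Perron formula bound. -/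
lemma exists_perron_bound : ∃ C : ℝ, 0 < C ∧ ∀ (a : ℕ → ℂ) (M x : ℝ), 0 ≤ M → 3 ≤ x →
    (∀ s : ℂ, 1 < s.re → LSeriesSummable a s) →
    (∀ s : ℂ, 1 < s.re → s.re ≤ 2 → ‖LSeries a s‖ ≤ M * (|s.im| + 2) ^ ((1 : ℝ) / 2)) →
    ‖∑ n ∈ Icc 1 ⌊x⌋₊, a n * (1 - n / x : ℝ)‖ ≤ C * M * x := by
  set w : ℝ → ℝ := fun t => (1 + ‖t‖ ^ 2) ^ (-(3 / 2 : ℝ) / 2) with hw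
  have hwi : MeasureTheory.Integrable w := integrable_rpow_neg_one_add_norm_sq (by simp; norm_num)
  have hw0 : ∀ t, 0 ≤ w t := fun t => by positivity
  refine ⟨2 * Real.exp 1 * (∫ t, w t) + 1, ?_, ?_⟩
  · have := MeasureTheory.integral_nonneg (μ := MeasureTheory.volume) (f := w) hw0
    positivity
  intro a M x hM hx hs hF
  have hx0 : 0 < x := by linarith
  have hlog : 1 ≤ Real.log x := by
    rw [Real.le_log_iff_exp_le hx0]
    have := Real.exp_one_lt_d9
    linarith
  set σ : ℝ := 1 + 1 / Real.log x with hσdef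
  have hσ1 : 1 < σ := by
    have : 0 < 1 / Real.log x := by positivity
    linarith
  have hσ2 : σ ≤ 2 := by
    have : 1 / Real.log x ≤ 1 := by rw [div_le_one (by linarith)]; exact hlog
    linarith
  have hxσ : x ^ σ = Real.exp 1 * x := by
    rw [hσdef, Real.rpow_add hx0, Real.rpow_one, Real.rpow_def_of_pos hx0,
      mul_one_div_cancel (by linarith), mul_comm]
  have hre : ∀ t : ℝ, (σ + t * Complex.I : ℂ).re = σ := by intro t; simp
  have him : ∀ t : ℝ, (σ + t * Complex.I : ℂ).im = t := by intro t; simp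
  -- the integrand attached to `n`
  set G : ℕ → ℝ → ℂ := fun n t => LSeries.term a (σ + t * Complex.I) n *
    ((x : ℂ) ^ (σ + t * Complex.I : ℂ) * perronKernel (σ + t * Complex.I)) with hG
  have hxnorm : ∀ t : ℝ, ‖(x : ℂ) ^ (σ + t * Complex.I : ℂ)‖ = x ^ σ := by
    intro t
    rw [Complex.norm_cpow_eq_rpow_re_of_pos hx0, hre]
  have hterm : ∀ n (t : ℝ), ‖LSeries.term a (σ + t * Complex.I) n‖ = ‖LSeries.term a σ n‖ := by
    intro n t
    rw [LSeries.norm_term_eq, LSeries.norm_term_eq, hre, Complex.ofReal_re]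
  have hcx : Continuous fun t : ℝ => (x : ℂ) ^ (σ + t * Complex.I : ℂ) := by
    have : (x : ℂ) ≠ 0 := by exact_mod_cast hx0.ne'
    exact Continuous.const_cpow (by fun_prop) (Or.inl this)
  have hct : ∀ n, Continuous fun t : ℝ => LSeries.term a (σ + t * Complex.I) n := by
    intro n
    rcases eq_or_ne n 0 with rfl | hn
    · simpa using continuous_const
    · simp only [LSeries.term_of_ne_zero hn]
      have h0 : (n : ℂ) ≠ 0 := by exact_mod_cast hn
      refine continuous_const.div (Continuous.const_cpow (by fun_prop) (Or.inl h0)) fun t => ?_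
      rw [Complex.cpow_ne_zero_iff]
      exact Or.inl h0
  have hGi : ∀ n, MeasureTheory.Integrable (G n) := by
    intro n
    refine MeasureTheory.Integrable.mono' (g := fun t => (‖LSeries.term a σ n‖ * x ^ σ) * (1 + t ^ 2)⁻¹)
      (integrable_inv_one_add_sq.const_mul _)
      ((hct n).mul (hcx.mul (continuous_perronKernel_line hσ1.le))).aestronglyMeasurable
      (Filter.Eventually.of_forall fun t => ?_)
    simp only [hG]
    rw [norm_mul, norm_mul, hterm, hxnorm, ← one_div, mul_assoc]
    gcongr
    exact norm_perronKernel_le hσ1.le t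
  have hGn : ∀ n, ∫ t, ‖G n t‖ = ‖LSeries.term a σ n‖ *
      (x ^ σ * ∫ t : ℝ, ‖perronKernel (σ + t * Complex.I)‖) := by
    intro n
    rw [← MeasureTheory.integral_const_mul, ← MeasureTheory.integral_const_mul]
    refine MeasureTheory.integral_congr_ae (Filter.Eventually.of_forall fun t => ?_)
    simp only [hG]
    rw [norm_mul, norm_mul, hterm, hxnorm]
  have hsum : Summable fun n => ∫ t, ‖G n t‖ := by
    simp only [hGn]
    exact ((hs σ (by simpa using hσ1)).norm).mul_right _
  have h_int := MeasureTheory.hasSum_integral_of_summable_integral_norm hGi hsum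
  have hGint : ∀ n, ((1 / (2 * Real.pi) : ℝ) : ℂ) * ∫ t, G n t =
      if n = 0 then 0 else a n * cutoff (n / x) := by
    intro n
    rcases eq_or_ne n 0 with rfl | hn
    · simp [hG]
    · have hn0 : (0 : ℝ) < n := by positivity
      rw [if_neg hn, cutoff_eq_integral hσ1.le (div_pos hn0 hx0), Complex.real_smul, mul_left_comm]
      congr 1
      rw [← MeasureTheory.integral_const_mul]
      refine MeasureTheory.integral_congr_ae (Filter.Eventually.of_forall fun t => ?_)
      simp only [hG]
      rw [LSeries.term_of_ne_zero hn, Complex.ofReal_div, Complex.div_cpow_ofReal_nonneg hn0.le hx0.le,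
        Complex.cpow_neg, Complex.cpow_neg, Complex.ofReal_natCast]
      have h0 : (n : ℂ) ^ (σ + t * Complex.I : ℂ) ≠ 0 := by
        rw [Ne, Complex.cpow_eq_zero_iff]
        exact fun h => hn (by exact_mod_cast h.1)
      have h1 : (x : ℂ) ^ (σ + t * Complex.I : ℂ) ≠ 0 := by
        rw [Ne, Complex.cpow_eq_zero_iff]
        exact fun h => hx0.ne' (by exact_mod_cast h.1)
      field_simp
  have hLHS : ∑ n ∈ Icc 1 ⌊x⌋₊, a n * (1 - n / x : ℝ) =
      ∑' n, if n = 0 then 0 else a n * cutoff (n / x) := by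
    rw [tsum_eq_sum (s := Icc 1 ⌊x⌋₊)]
    · refine sum_congr rfl fun n hn => ?_
      rw [mem_Icc] at hn
      have h1 : (n : ℝ) / x ≤ 1 := by
        rw [div_le_one hx0]
        exact (Nat.le_floor_iff hx0.le).1 hn.2
      rw [if_neg (by omega), cutoff, max_eq_left (by linarith)]
    · intro n hn
      split_ifs with h0
      · rfl
      · have h1 : ⌊x⌋₊ < n := by
          by_contra hcon
          exact hn (mem_Icc.2 ⟨by omega, by omega⟩)
        have h2 : 1 < (n : ℝ) / x := by
          rw [one_lt_div hx0]
          exact (Nat.floor_lt hx0.le).1 h1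
        rw [cutoff, max_eq_right (by linarith)]
        simp
  have hfin : ∑ n ∈ Icc 1 ⌊x⌋₊, a n * (1 - n / x : ℝ) = ((1 / (2 * Real.pi) : ℝ) : ℂ) *
      ∫ t : ℝ, LSeries a (σ + t * Complex.I) *
        ((x : ℂ) ^ (σ + t * Complex.I : ℂ) * perronKernel (σ + t * Complex.I)) := by
    rw [hLHS, ← tsum_congr hGint, tsum_mul_left, h_int.tsum_eq]
    congr 2
    funext t
    rw [LSeries, ← tsum_mul_right]
  rw [hfin, norm_mul, Complex.norm_real]
  have hbound : ‖∫ t : ℝ, LSeries a (σ + t * Complex.I) *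
      ((x : ℂ) ^ (σ + t * Complex.I : ℂ) * perronKernel (σ + t * Complex.I))‖ ≤
      ∫ t, (2 * M * x ^ σ) * w t := by
    refine MeasureTheory.norm_integral_le_of_norm_le (hwi.const_mul _)
      (Filter.Eventually.of_forall fun t => ?_)
    rw [norm_mul, norm_mul, hxnorm]
    have h1 := hF (σ + t * Complex.I) (by rw [hre]; exact hσ1) (by rw [hre]; exact hσ2)
    rw [him] at h1
    have h2 := norm_perronKernel_le hσ1.le t
    have h3 : (|t| + 2) ^ ((1 : ℝ) / 2) ≤ 2 * (1 + t ^ 2) ^ ((1 : ℝ) / 4) := by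
      have e1 : (|t| + 2) ^ ((1 : ℝ) / 2) = ((|t| + 2) ^ 2) ^ ((1 : ℝ) / 4) := by
        rw [← Real.rpow_natCast, ← Real.rpow_mul (by positivity)]; norm_num
      have e2 : (2 : ℝ) = 16 ^ ((1 : ℝ) / 4) := by
        rw [show (16 : ℝ) = 2 ^ (4 : ℝ) by norm_num, ← Real.rpow_mul (by norm_num)]; norm_num
      rw [e1]
      have e3 : 2 * (1 + t ^ 2) ^ ((1 : ℝ) / 4) = (16 * (1 + t ^ 2)) ^ ((1 : ℝ) / 4) := by
        rw [Real.mul_rpow (by norm_num) (by positivity), ← e2]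
      rw [e3]
      refine Real.rpow_le_rpow (by positivity) ?_ (by norm_num)
      nlinarith [sq_abs t, sq_nonneg (|t| - 2)]
    have h4 : (1 + t ^ 2) ^ ((1 : ℝ) / 4) * (1 / (1 + t ^ 2)) = w t := by
      have hp : 0 < 1 + t ^ 2 := by positivity
      rw [hw]
      simp only [Real.norm_eq_abs, sq_abs]
      rw [one_div (1 + t ^ 2), ← Real.rpow_neg_one (1 + t ^ 2), ← Real.rpow_add hp]
      norm_num
    calc ‖LSeries a (σ + t * Complex.I)‖ * (x ^ σ * ‖perronKernel (σ + t * Complex.I)‖)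
        ≤ (M * (2 * (1 + t ^ 2) ^ ((1 : ℝ) / 4))) * (x ^ σ * (1 / (1 + t ^ 2))) := by
          gcongr
          exact h1.trans (by gcongr)
      _ = (2 * M * x ^ σ) * ((1 + t ^ 2) ^ ((1 : ℝ) / 4) * (1 / (1 + t ^ 2))) := by ring
      _ = _ := by rw [h4]
  rw [MeasureTheory.integral_const_mul, hxσ] at hbound
  have hpi : ‖1 / (2 * Real.pi)‖ ≤ 1 := by
    rw [Real.norm_of_nonneg (by positivity), div_le_one (by positivity)]
    have := Real.pi_gt_three
    linarith
  have hMx : 0 ≤ M * x := by positivity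
  calc _ ≤ 1 * (2 * M * (Real.exp 1 * x) * ∫ t, w t) :=
        mul_le_mul hpi hbound (norm_nonneg _) zero_le_one
    _ ≤ _ := by nlinarith

end Hooley

namespace Hooley

open ArithmeticFunction (vonMangoldt)

/-- The prime powers up to `N` that are not coprime to `q` are few. -/
lemma card_primePow_not_coprime_le (N q : ℕ) (hq : q ≠ 0) :
    #{n ∈ Icc 1 N | IsPrimePow n ∧ ¬ n.Coprime q} ≤ #q.primeFactors * (Nat.log 2 N + 1) := by
  have h : {n ∈ Icc 1 N | IsPrimePow n ∧ ¬ n.Coprime q} ⊆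
      (q.primeFactors ×ˢ range (Nat.log 2 N + 1)).image fun p => p.1 ^ p.2 := by
    intro n hn
    simp only [mem_filter, mem_Icc] at hn
    obtain ⟨⟨h1, h2⟩, h3, h4⟩ := hn
    obtain ⟨p, k, hp, hk, rfl⟩ := (isPrimePow_nat_iff _).1 h3
    rw [mem_image]
    refine ⟨(p, k), ?_, rfl⟩
    rw [mem_product, Nat.mem_primeFactors, mem_range, Nat.lt_succ_iff]
    refine ⟨⟨hp, ?_, hq⟩, ?_⟩
    · by_contra hcon
      exact h4 (Nat.Coprime.pow_left k ((Nat.Prime.coprime_iff_not_dvd hp).2 hcon))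
    · exact Nat.le_log_of_pow_le (by norm_num) ((Nat.pow_le_pow_left hp.two_le k).trans h2)
  refine (card_le_card h).trans (card_image_le.trans ?_)
  rw [card_product, card_range]

lemma natLog_two_add_one_le {y : ℝ} (hy : 3 ≤ y) : (Nat.log 2 ⌊y⌋₊ + 1 : ℝ) ≤ 3 * Real.log y := by
  have hlog : 1 ≤ Real.log y := by
    rw [Real.le_log_iff_exp_le (by linarith)]
    have := Real.exp_one_lt_d9
    linarith
  have h1 := Real.natLog_le_logb ⌊y⌋₊ 2
  have h2 : Real.log (⌊y⌋₊ : ℝ) ≤ Real.log y :=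
    Real.log_le_log (by exact_mod_cast Nat.floor_pos.2 (by linarith)) (Nat.floor_le (by linarith))
  have h3 : Real.logb (2 : ℕ) (⌊y⌋₊ : ℝ) ≤ 2 * Real.log y := by
    rw [Real.logb, Nat.cast_ofNat, div_le_iff₀ (Real.log_pos (by norm_num))]
    have := Real.log_two_gt_d9
    nlinarith
  linarith

lemma log_le_log_of_mem {y : ℝ} (hy : 1 ≤ y) {n : ℕ} (hn : n ∈ Icc 1 ⌊y⌋₊) :
    0 ≤ Real.log n ∧ Real.log n ≤ Real.log y := by
  rw [mem_Icc] at hn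
  have h1 : (1 : ℝ) ≤ n := by exact_mod_cast hn.1
  exact ⟨Real.log_nonneg h1,
    Real.log_le_log (by linarith) ((Nat.le_floor_iff (by linarith)).1 hn.2)⟩

lemma sum_not_coprime_le (k q : ℕ) (hq : q ≠ 0) {y : ℝ} (hy : 3 ≤ y) :
    ∑ n ∈ Icc 1 ⌊y⌋₊ with ¬ n.Coprime q, vonMangoldt n * Real.log n ^ k ≤
      #q.primeFactors * (3 * Real.log y ^ (k + 2)) := by
  have hlog : 0 ≤ Real.log y := Real.log_nonneg (by linarith)
  calc ∑ n ∈ Icc 1 ⌊y⌋₊ with ¬ n.Coprime q, vonMangoldt n * Real.log n ^ k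
      = ∑ n ∈ Icc 1 ⌊y⌋₊ with IsPrimePow n ∧ ¬ n.Coprime q, vonMangoldt n * Real.log n ^ k := by
        symm
        refine sum_subset (fun n hn => ?_) (fun n hn hn' => ?_)
        · simp only [mem_filter] at hn ⊢
          exact ⟨hn.1, hn.2.2⟩
        · simp only [mem_filter] at hn hn'
          rw [ArithmeticFunction.vonMangoldt_eq_zero_iff.2 (fun h => hn' ⟨hn.1, h, hn.2⟩), zero_mul]
    _ ≤ ∑ n ∈ Icc 1 ⌊y⌋₊ with IsPrimePow n ∧ ¬ n.Coprime q, Real.log y ^ (k + 1) := by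
        refine sum_le_sum fun n hn => ?_
        obtain ⟨h1, h2⟩ := log_le_log_of_mem (by linarith) (mem_filter.1 hn).1
        rw [pow_succ']
        exact mul_le_mul (ArithmeticFunction.vonMangoldt_le_log.trans h2)
          (pow_le_pow_left₀ h1 h2 k) (pow_nonneg h1 k) hlog
    _ = #{n ∈ Icc 1 ⌊y⌋₊ | IsPrimePow n ∧ ¬ n.Coprime q} * Real.log y ^ (k + 1) := by
        rw [sum_const, nsmul_eq_mul]
    _ ≤ (#q.primeFactors * (Nat.log 2 ⌊y⌋₊ + 1) : ℕ) * Real.log y ^ (k + 1) := by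
        gcongr
        exact card_primePow_not_coprime_le _ q hq
    _ ≤ #q.primeFactors * (3 * Real.log y) * Real.log y ^ (k + 1) := by
        push_cast
        gcongr
        exact natLog_two_add_one_le hy
    _ = _ := by ring

/-- The centred coefficients `1_{n ≡ a (q)} Λ(n) - 1 / φ(q)`. -/
noncomputable def apCoeff (q a n : ℕ) : ℝ :=
  (if n % q = a % q then vonMangoldt n else 0) - 1 / (Nat.totient q : ℝ)

lemma apCoeff_eq {q a : ℕ} [NeZero q] (ha : a.Coprime q) (n : ℕ) : (apCoeff q a n : ℂ) =
    (1 / (Nat.totient q : ℂ)) * (∑ χ : DirichletCharacter ℂ q with χ ≠ 1,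
      χ (a : ZMod q)⁻¹ * twist χ n + centered n -
        (if ¬ n.Coprime q then (vonMangoldt n : ℂ) else 0)) := by
  have hφ : (Nat.totient q : ℂ) ≠ 0 := by
    exact_mod_cast (Nat.totient_pos.2 (Nat.pos_of_ne_zero (NeZero.ne q))).ne'
  have hu : IsUnit (a : ZMod q) := (ZMod.isUnit_iff_coprime a q).2 ha
  have h1 := DirichletCharacter.sum_char_inv_mul_char_eq ℂ hu (n : ZMod q)
  have h2 : ∑ χ : DirichletCharacter ℂ q, χ (a : ZMod q)⁻¹ * twist χ n =
      if n % q = a % q then (Nat.totient q : ℂ) * vonMangoldt n else 0 := by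
    simp only [twist, ← mul_assoc, ← sum_mul, h1]
    have h3 : ((a : ZMod q) = n) ↔ n % q = a % q := by
      rw [ZMod.natCast_eq_natCast_iff']
      exact eq_comm
    simp only [h3, ite_mul, zero_mul]
  have h4 := sum_filter_add_sum_filter_not univ (fun χ : DirichletCharacter ℂ q => χ ≠ 1)
    (fun χ => χ (a : ZMod q)⁻¹ * twist χ n)
  have h5 : ∑ χ : DirichletCharacter ℂ q with ¬ χ ≠ 1, χ (a : ZMod q)⁻¹ * twist χ n =
      vonMangoldt n - if ¬ n.Coprime q then (vonMangoldt n : ℂ) else 0 := by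
    have : (univ.filter fun χ : DirichletCharacter ℂ q => ¬ χ ≠ 1) = {1} := by
      ext χ; simp
    rw [this, sum_singleton, twist]
    have hinv : IsUnit (a : ZMod q)⁻¹ := by
      rw [isUnit_iff_exists]
      exact ⟨a, ZMod.inv_mul_of_unit _ hu, ZMod.mul_inv_of_unit _ hu⟩
    rw [MulChar.one_apply hinv, one_mul]
    by_cases hn : n.Coprime q
    · rw [MulChar.one_apply ((ZMod.isUnit_iff_coprime n q).2 hn)]
      simp [hn]
    · rw [MulChar.map_nonunit _ (fun h => hn ((ZMod.isUnit_iff_coprime n q).1 h))]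
      simp [hn]
  rw [h5, h2] at h4
  have h6 : ∑ χ : DirichletCharacter ℂ q with χ ≠ 1, χ (a : ZMod q)⁻¹ * twist χ n =
      (if n % q = a % q then (Nat.totient q : ℂ) * vonMangoldt n else 0) -
      (vonMangoldt n - if ¬ n.Coprime q then (vonMangoldt n : ℂ) else 0) := by
    rw [← h4]; ring
  rw [h6, apCoeff, centered]
  push_cast
  split_ifs <;> field_simp <;> push_cast <;> ring

lemma log_pow_le_factorial_mul {y : ℝ} (hy : 1 ≤ y) (m : ℕ) :
    Real.log y ^ m ≤ m.factorial * y := by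
  have h := Real.pow_div_factorial_le_exp (x := Real.log y) (Real.log_nonneg hy) m
  rw [Real.exp_log (by linarith), div_le_iff₀ (by positivity)] at h
  linarith

lemma exists_smoothed_ap_bound (k : ℕ) : ∃ C : ℝ, 0 < C ∧ ∀ (q a : ℕ) (y : ℝ), 1 ≤ q →
    a.Coprime q → 3 ≤ y →
    |∑ n ∈ Icc 1 ⌊y⌋₊, apCoeff q a n * Real.log n ^ k * (1 - n / y)| ≤ C * q * y := by
  obtain ⟨C₀, hC₀, hperron⟩ := exists_perron_bound
  obtain ⟨C₁, hC₁, htwist⟩ := exists_norm_lseries_twist_le k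
  obtain ⟨C₂, hC₂, hcent⟩ := exists_norm_lseries_centered_le k
  refine ⟨C₀ * C₁ + C₀ * C₂ + 3 * (k + 2).factorial, by positivity, ?_⟩
  intro q a y hq ha hy
  have : NeZero q := ⟨by omega⟩
  have hq1 : (1 : ℝ) ≤ q := by exact_mod_cast hq
  have hφ1 : (1 : ℝ) ≤ Nat.totient q := by exact_mod_cast Nat.totient_pos.2 hq
  have hsq : (q : ℝ) ^ ((1 : ℝ) / 2) ≤ q := by
    calc (q : ℝ) ^ ((1 : ℝ) / 2) ≤ (q : ℝ) ^ (1 : ℝ) :=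
          Real.rpow_le_rpow_of_exponent_le hq1 (by norm_num)
      _ = q := Real.rpow_one _
  set S : (ℕ → ℂ) → ℂ := fun f => ∑ n ∈ Icc 1 ⌊y⌋₊, f n * (Real.log n : ℂ) ^ k * (1 - n / y : ℝ)
    with hS
  have hT : ∀ χ : DirichletCharacter ℂ q, χ ≠ 1 → ‖S (twist χ)‖ ≤ C₀ * C₁ * q * y := by
    intro χ hχ
    refine (hperron _ (C₁ * q ^ ((1 : ℝ) / 2)) y (by positivity) hy
      (fun s hs => lseriesSummable_log_pow (abscissa_lt (abscissa_twist_le χ) hs))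
      (fun s h1 h2 => (htwist q χ hχ s h1 h2).trans (le_of_eq ?_))).trans ?_
    · rw [cond, Real.mul_rpow (by positivity) (by positivity), mul_assoc]
    · calc C₀ * (C₁ * q ^ ((1 : ℝ) / 2)) * y ≤ C₀ * (C₁ * q) * y := by gcongr
        _ = _ := by ring
  have hE : ‖S centered‖ ≤ C₀ * C₂ * y := by
    refine (hperron _ C₂ y (by positivity) hy
      (fun s hs => lseriesSummable_log_pow (abscissa_lt abscissa_centered_le hs))
      (fun s h1 h2 => (hcent s h1 h2).trans (le_of_eq ?_)))
    rw [cond, Nat.cast_one, one_mul]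
  have hN : ‖S fun n => if ¬ n.Coprime q then (vonMangoldt n : ℂ) else 0‖ ≤
      3 * (k + 2).factorial * q * y := by
    have h1 : ‖S fun n => if ¬ n.Coprime q then (vonMangoldt n : ℂ) else 0‖ ≤
        ∑ n ∈ Icc 1 ⌊y⌋₊ with ¬ n.Coprime q, vonMangoldt n * Real.log n ^ k := by
      rw [sum_filter]
      refine norm_sum_le_of_le _ fun n hn => ?_
      have hl := (log_le_log_of_mem (by linarith) hn).1
      have h0 : (0 : ℝ) ≤ n / y := by positivity
      have h1' : (n : ℝ) / y ≤ 1 := by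
        rw [div_le_one (by linarith)]
        exact (Nat.le_floor_iff (by linarith)).1 (mem_Icc.1 hn).2
      by_cases h : n.Coprime q
      · simp [h]
      · simp only [h, not_false_eq_true, if_true]
        rw [norm_mul, norm_mul, norm_pow, Complex.norm_real, Complex.norm_real, Complex.norm_real,
          Real.norm_of_nonneg hl, Real.norm_of_nonneg ArithmeticFunction.vonMangoldt_nonneg,
          Real.norm_of_nonneg (by linarith)]
        refine mul_le_of_le_one_right ?_ (by linarith)
        have := ArithmeticFunction.vonMangoldt_nonneg (n := n)
        positivity
    refine h1.trans ((sum_not_coprime_le k q (by omega) hy).trans ?_)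
    have h2 := log_pow_le_factorial_mul (by linarith : 1 ≤ y) (k + 2)
    have h3 : (#q.primeFactors : ℝ) ≤ q := by
      have : #q.primeFactors ≤ #(Icc 1 q) := card_le_card fun p hp => by
        rw [Nat.mem_primeFactors] at hp
        exact mem_Icc.2 ⟨hp.1.one_le, Nat.le_of_dvd (by omega) hp.2.1⟩
      rw [Nat.card_Icc] at this
      exact_mod_cast this
    have h4 : 0 ≤ Real.log y := Real.log_nonneg (by linarith)
    calc (#q.primeFactors : ℝ) * (3 * Real.log y ^ (k + 2)) ≤
          q * (3 * ((k + 2).factorial * y)) := by gcongr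
      _ = _ := by ring
  have hid : ((∑ n ∈ Icc 1 ⌊y⌋₊, apCoeff q a n * Real.log n ^ k * (1 - n / y) : ℝ) : ℂ) =
      (1 / (Nat.totient q : ℂ)) * (∑ χ : DirichletCharacter ℂ q with χ ≠ 1,
        χ (a : ZMod q)⁻¹ * S (twist χ) + S centered -
        S fun n => if ¬ n.Coprime q then (vonMangoldt n : ℂ) else 0) := by
    simp only [hS]
    rw [Complex.ofReal_sum]
    simp only [mul_sum]
    rw [sum_comm, ← sum_add_distrib, ← sum_sub_distrib, mul_sum]
    refine sum_congr rfl fun n _ => ?_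
    push_cast
    rw [apCoeff_eq ha]
    have hfac : ∀ L W : ℂ, ∑ χ : DirichletCharacter ℂ q with χ ≠ 1,
        χ (a : ZMod q)⁻¹ * (twist χ n * L * W) =
        (∑ χ : DirichletCharacter ℂ q with χ ≠ 1, χ (a : ZMod q)⁻¹ * twist χ n) * (L * W) := by
      intro L W
      rw [sum_mul]
      exact sum_congr rfl fun χ _ => by ring
    rw [hfac]
    ring
  rw [← Real.norm_eq_abs, ← Complex.norm_real, hid, norm_mul, norm_div, norm_one,
    Complex.norm_natCast]
  have hsumχ : ‖∑ χ : DirichletCharacter ℂ q with χ ≠ 1, χ (a : ZMod q)⁻¹ * S (twist χ)‖ ≤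
      Nat.totient q * (C₀ * C₁ * q * y) := by
    calc _ ≤ ∑ χ : DirichletCharacter ℂ q with χ ≠ 1, C₀ * C₁ * q * y := by
          refine norm_sum_le_of_le _ fun χ hχ => ?_
          rw [norm_mul]
          calc _ ≤ 1 * (C₀ * C₁ * q * y) :=
                mul_le_mul (χ.norm_le_one _) (hT χ (mem_filter.1 hχ).2) (norm_nonneg _) zero_le_one
            _ = _ := one_mul _
      _ ≤ ∑ χ : DirichletCharacter ℂ q, C₀ * C₁ * q * y :=
          sum_le_sum_of_subset_of_nonneg (filter_subset _ _) fun _ _ _ => by positivity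
      _ = _ := by
          rw [sum_const, nsmul_eq_mul, card_univ, ← Nat.card_eq_fintype_card,
            DirichletCharacter.card_eq_totient_of_hasEnoughRootsOfUnity]
  have htot := norm_sub_le_of_le (norm_add_le_of_le hsumχ hE) hN
  have hy0 : 0 < y := by linarith
  set φ : ℝ := (Nat.totient q : ℝ)
  calc _ ≤ 1 / φ * (φ * (C₀ * C₁ * q * y) + C₀ * C₂ * y + 3 * (k + 2).factorial * q * y) := by
        gcongr
    _ ≤ 1 / φ * (φ * (C₀ * C₁ * q * y) + φ * (C₀ * C₂ * q * y) +
          φ * (3 * (k + 2).factorial * q * y)) := by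
        have h1 : C₀ * C₂ * y ≤ C₀ * C₂ * q * y := by
          have : 0 ≤ C₀ * C₂ * y := by positivity
          nlinarith
        refine mul_le_mul_of_nonneg_left (add_le_add_three le_rfl ?_ ?_) (by positivity)
        · exact h1.trans (le_mul_of_one_le_left (by positivity) hφ1)
        · exact le_mul_of_one_le_left (by positivity) hφ1
    _ = _ := by field_simp

end Hooley

namespace Hooley

open ArithmeticFunction (vonMangoldt)

lemma sum_ramp_eq (b : ℕ → ℝ) {z : ℝ} (hz : 0 ≤ z) {N : ℕ} (hN : ⌊z⌋₊ ≤ N) :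
    ∑ n ∈ Icc 1 ⌊z⌋₊, b n * (z - n) = ∑ n ∈ Icc 1 N, b n * max (z - n) 0 := by
  rw [← sum_subset (Icc_subset_Icc_right hN)]
  · refine sum_congr rfl fun n hn => ?_
    have := (Nat.le_floor_iff hz).1 (mem_Icc.1 hn).2
    rw [max_eq_left (by linarith)]
  · intro n hn hn'
    have h1 : ⌊z⌋₊ < n := by
      by_contra hcon
      exact hn' (mem_Icc.2 ⟨(mem_Icc.1 hn).1, by omega⟩)
    have := (Nat.floor_lt hz).1 h1
    rw [max_eq_right (by linarith), mul_zero]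

lemma card_floor_interval_le {p r : ℝ} (hp : 0 ≤ p) (hpr : p ≤ r) (N : ℕ) :
    (#{n ∈ Icc 1 N | p < (n : ℕ) ∧ (n : ℝ) ≤ r} : ℝ) ≤ r - p + 1 := by
  have h1 : {n ∈ Icc 1 N | p < (n : ℕ) ∧ (n : ℝ) ≤ r} ⊆ Ioc ⌊p⌋₊ ⌊r⌋₊ := by
    intro n hn
    simp only [mem_filter] at hn
    exact mem_Ioc.2 ⟨(Nat.floor_lt hp).2 hn.2.1, Nat.le_floor hn.2.2⟩
  have h2 := card_le_card h1
  rw [Nat.card_Ioc] at h2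
  have h3 : ⌊p⌋₊ ≤ ⌊r⌋₊ := Nat.floor_le_floor hpr
  have h4 : (#{n ∈ Icc 1 N | p < (n : ℕ) ∧ (n : ℝ) ≤ r} : ℝ) ≤ (⌊r⌋₊ - ⌊p⌋₊ : ℕ) := by
    exact_mod_cast h2
  rw [Nat.cast_sub h3] at h4
  have := Nat.floor_le (hp.trans hpr)
  have := Nat.lt_floor_add_one p
  linarith

/-- A weighted sum with weights in `[0, h]` supported on an interval of length `h` is bounded
below when the coefficients are. -/
lemma sum_window_ge {b w : ℕ → ℝ} {L p h : ℝ} (hL : 0 ≤ L) (hp : 0 ≤ p) (hh : 0 ≤ h) {N : ℕ}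
    (hb : ∀ n ∈ Icc 1 N, -L ≤ b n) (hw0 : ∀ n, 0 ≤ w n) (hw : ∀ n, w n ≤ h)
    (hsupp : ∀ n : ℕ, ¬(p < n ∧ (n : ℝ) ≤ p + h) → w n = 0) :
    -(L * h * (h + 1)) ≤ ∑ n ∈ Icc 1 N, b n * w n := by
  have h1 : ∑ n ∈ Icc 1 N, b n * w n = ∑ n ∈ Icc 1 N with p < (n : ℕ) ∧ (n : ℝ) ≤ p + h, b n * w n := by
    rw [sum_filter]
    refine sum_congr rfl fun n _ => ?_
    split_ifs with hn
    · rfl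
    · rw [hsupp n hn, mul_zero]
  have h2 := card_floor_interval_le hp (by linarith : p ≤ p + h) N
  rw [h1]
  calc -(L * h * (h + 1)) ≤ ∑ n ∈ Icc 1 N with p < (n : ℕ) ∧ (n : ℝ) ≤ p + h, -(L * h) := by
        rw [sum_const, nsmul_eq_mul]
        have : 0 ≤ L * h := by positivity
        nlinarith
    _ ≤ _ := by
        refine sum_le_sum fun n hn => ?_
        have e1 := hb n (mem_filter.1 hn).1
        have e2 := hw0 n
        have e3 := hw n
        nlinarith

/-- A Tauberian inequality for coefficients bounded below. -/
lemma tauberian {b : ℕ → ℝ} {E L y h : ℝ} (hL : 0 ≤ L) (hh : 0 < h) (hy : h ≤ y)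
    (hb : ∀ n ∈ Icc 1 ⌊y + h⌋₊, -L ≤ b n)
    (h1 : |∑ n ∈ Icc 1 ⌊y - h⌋₊, b n * (y - h - n)| ≤ E)
    (h2 : |∑ n ∈ Icc 1 ⌊y⌋₊, b n * (y - n)| ≤ E)
    (h3 : |∑ n ∈ Icc 1 ⌊y + h⌋₊, b n * (y + h - n)| ≤ E) :
    |∑ n ∈ Icc 1 ⌊y⌋₊, b n| ≤ 2 * E / h + L * (h + 1) := by
  set N := ⌊y + h⌋₊
  rw [sum_ramp_eq b (by linarith) (N := N) (Nat.floor_le_floor (by linarith))] at h1 h2 h3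
  have hB : ∑ n ∈ Icc 1 ⌊y⌋₊, b n = ∑ n ∈ Icc 1 N, b n * (if (n : ℝ) ≤ y then 1 else 0) := by
    rw [← sum_subset (Icc_subset_Icc_right (Nat.floor_le_floor (by linarith : y ≤ y + h)))]
    · refine sum_congr rfl fun n hn => ?_
      rw [if_pos ((Nat.le_floor_iff (by linarith)).1 (mem_Icc.1 hn).2), mul_one]
    · intro n hn hn'
      rw [if_neg, mul_zero]
      exact fun hcon => hn' (mem_Icc.2 ⟨(mem_Icc.1 hn).1, Nat.le_floor hcon⟩)
  have key : h * |∑ n ∈ Icc 1 ⌊y⌋₊, b n| ≤ 2 * E + L * h * (h + 1) := by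
    have hup := sum_window_ge (b := b) (L := L) (p := y) (h := h) (N := N)
      (w := fun n => max (y + h - n) 0 - max (y - n) 0 - h * if (n : ℝ) ≤ y then 1 else 0) hL
      (by linarith) hh.le hb
      (fun n => by
        split_ifs with hn
        · rw [max_eq_left (by linarith), max_eq_left (by linarith)]; linarith
        · rw [max_eq_right (by linarith : y - n ≤ 0)]
          have := le_max_right (y + h - n) 0
          linarith)
      (fun n => by
        split_ifs with hn
        · rw [max_eq_left (by linarith), max_eq_left (by linarith)]; linarith
        · rw [max_eq_right (by linarith : y - n ≤ 0)]
          have := max_le (by linarith : y + h - n ≤ h) hh.le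
          linarith)
      (fun n hn => by
        split_ifs with hn'
        · rw [max_eq_left (by linarith), max_eq_left (by linarith)]; linarith
        · have : ¬ (n : ℝ) ≤ y + h := fun h' => hn ⟨by linarith, h'⟩
          rw [max_eq_right (by linarith), max_eq_right (by linarith)]; linarith)
    have hlo := sum_window_ge (b := b) (L := L) (p := y - h) (h := h) (N := N)
      (w := fun n => (h * if (n : ℝ) ≤ y then 1 else 0) - (max (y - n) 0 - max (y - h - n) 0)) hL
      (by linarith) hh.le hb
      (fun n => by
        split_ifs with hn
        · rw [max_eq_left (by linarith : 0 ≤ y - n)]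
          have := le_max_left (y - h - n) 0
          linarith
        · rw [max_eq_right (by linarith), max_eq_right (by linarith)]; linarith)
      (fun n => by
        split_ifs with hn
        · rw [max_eq_left (by linarith : 0 ≤ y - n)]
          have := max_le (by linarith : y - h - n ≤ y - n) (by linarith : 0 ≤ y - n)
          linarith
        · rw [max_eq_right (by linarith), max_eq_right (by linarith)]; linarith)
      (fun n hn => by
        split_ifs with hn'
        · have : ¬ (y - h < n) := fun h' => hn ⟨h', by linarith⟩
          rw [max_eq_left (by linarith), max_eq_left (by linarith)]; linarith
        · rw [max_eq_right (by linarith), max_eq_right (by linarith)]; linarith)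
    simp only [mul_sub, sum_sub_distrib] at hup hlo
    have e1 : ∑ n ∈ Icc 1 N, b n * (h * if (n : ℝ) ≤ y then 1 else 0) =
        h * ∑ n ∈ Icc 1 ⌊y⌋₊, b n := by
      rw [hB, mul_sum]
      exact sum_congr rfl fun n _ => by ring
    rw [e1] at hup hlo
    rw [abs_le] at h1 h2 h3
    rw [← abs_of_pos hh, ← abs_mul, abs_of_pos hh, abs_le]
    constructor <;> linarith
  rw [← mul_le_mul_iff_right₀ hh]
  refine key.trans (le_of_eq ?_)
  field_simp

lemma neg_one_le_apCoeff {q : ℕ} (hq : 1 ≤ q) (a n : ℕ) : -1 ≤ apCoeff q a n := by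
  have hφ1 : (1 : ℝ) ≤ Nat.totient q := by exact_mod_cast Nat.totient_pos.2 hq
  have h1 : 1 / (Nat.totient q : ℝ) ≤ 1 := by rw [div_le_one (by linarith)]; exact hφ1
  have h2 := ArithmeticFunction.vonMangoldt_nonneg (n := n)
  unfold apCoeff
  split_ifs <;> linarith

lemma exists_log_weighted_ap_bound {m : ℕ} (hm : 1 ≤ m) : ∃ C : ℝ, 0 < C ∧ ∀ (q a : ℕ) (y : ℝ),
    1 ≤ q → a.Coprime q → 8 ≤ y →
    |∑ n ∈ Icc 1 ⌊y⌋₊, apCoeff q a n * Real.log n ^ (2 * m)| ≤ C * q * (y * Real.log y ^ m) := by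
  obtain ⟨C, hC, hD⟩ := exists_smoothed_ap_bound (2 * m)
  refine ⟨8 * C + 4 ^ m * (1 + m.factorial), by positivity, ?_⟩
  intro q a y hq ha hy
  have hy0 : 0 < y := by linarith
  have hq1 : (1 : ℝ) ≤ q := by exact_mod_cast hq
  have hlog : 2 ≤ Real.log y := by
    have h1 : Real.log 8 ≤ Real.log y := Real.log_le_log (by norm_num) hy
    have h2 : Real.log 8 = 3 * Real.log 2 := by
      rw [show (8 : ℝ) = 2 ^ 3 by norm_num, Real.log_pow]; norm_num
    have := Real.log_two_gt_d9
    linarith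
  set l := Real.log y with hl
  have hlm : 2 ≤ l ^ m := by
    calc (2 : ℝ) ≤ l ^ 1 := by simpa using hlog
      _ ≤ l ^ m := pow_le_pow_right₀ (by linarith) hm
  set h : ℝ := y / l ^ m with hh
  have hh0 : 0 < h := by positivity
  have hhy : h ≤ y / 2 := by rw [hh]; gcongr
  have hm1 : 1 ≤ m.factorial * h := by
    have := log_pow_le_factorial_mul (by linarith : 1 ≤ y) m
    rw [hh, ← mul_div_assoc, le_div_iff₀ (by positivity)]
    linarith
  have hU : ∀ z : ℝ, 3 ≤ z → z ≤ 2 * y →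
      |∑ n ∈ Icc 1 ⌊z⌋₊, apCoeff q a n * Real.log n ^ (2 * m) * (z - n)| ≤ 4 * C * q * y ^ 2 := by
    intro z hz hz'
    have h1 : ∑ n ∈ Icc 1 ⌊z⌋₊, apCoeff q a n * Real.log n ^ (2 * m) * (z - n) =
        z * ∑ n ∈ Icc 1 ⌊z⌋₊, apCoeff q a n * Real.log n ^ (2 * m) * (1 - n / z) := by
      rw [mul_sum]
      refine sum_congr rfl fun n _ => ?_
      field_simp
    rw [h1, abs_mul, abs_of_pos (by linarith)]
    calc z * |_| ≤ (2 * y) * (C * q * (2 * y)) := by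
          refine mul_le_mul hz' ((hD q a z hq ha hz).trans ?_) (abs_nonneg _) (by linarith)
          gcongr
      _ = _ := by ring
  have hlog2 : Real.log (2 * y) ≤ 2 * l := by
    rw [Real.log_mul (by norm_num) hy0.ne']
    have := Real.log_two_lt_d9
    linarith
  have hT := tauberian (b := fun n => apCoeff q a n * Real.log n ^ (2 * m)) (y := y) (h := h)
    (L := (2 * l) ^ (2 * m)) (E := 4 * C * q * y ^ 2) (by positivity) hh0 (by linarith)
    (fun n hn => by
      obtain ⟨e1, e2⟩ := log_le_log_of_mem (by linarith) hn
      have e3 : Real.log (y + h) ≤ Real.log (2 * y) := Real.log_le_log (by linarith) (by linarith)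
      have e4 : Real.log n ^ (2 * m) ≤ (2 * l) ^ (2 * m) :=
        pow_le_pow_left₀ e1 (by linarith) _
      have e5 := neg_one_le_apCoeff hq a n
      have e6 : 0 ≤ Real.log n ^ (2 * m) := pow_nonneg e1 _
      nlinarith)
    (hU _ (by linarith) (by linarith)) (hU _ (by linarith) (by linarith))
    (hU _ (by linarith) (by linarith))
  refine hT.trans ?_
  have e1 : 2 * (4 * C * q * y ^ 2) / h = 8 * C * q * (y * l ^ m) := by
    rw [hh]; field_simp; ring
  have e2 : (2 * l) ^ (2 * m) * (h + 1) ≤ 4 ^ m * (1 + m.factorial) * (y * l ^ m) := by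
    calc (2 * l) ^ (2 * m) * (h + 1) ≤ (2 * l) ^ (2 * m) * (h + m.factorial * h) := by gcongr
      _ = 4 ^ m * (1 + m.factorial) * (y * l ^ m) := by
        have h4 : (2 : ℝ) ^ (2 * m) = 4 ^ m := by rw [pow_mul]; norm_num
        have h5 : l ^ (2 * m) = l ^ m * l ^ m := by rw [two_mul, pow_add]
        rw [hh, mul_pow, h4, h5]
        field_simp
  rw [e1, add_mul, add_mul]
  refine add_le_add le_rfl (e2.trans ?_)
  rw [mul_assoc _ (q : ℝ)]
  refine mul_le_mul_of_nonneg_left ?_ (by positivity)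
  exact le_mul_of_one_le_left (by positivity) hq1

/-- Abel's inequality for antitone weights. -/
lemma abs_sum_antitone_mul_le {w c : ℕ → ℝ} {M : ℝ} (N : ℕ) (hw0 : ∀ n, 0 ≤ w n)
    (hw : ∀ n, w (n + 1) ≤ w n) (hM : ∀ n ≤ N, |∑ i ∈ range n, c i| ≤ M) :
    |∑ i ∈ range N, w i * c i| ≤ w 0 * M := by
  have h1 : ∀ n, ∑ i ∈ range n, w i * c i = w n * ∑ i ∈ range n, c i +
      ∑ i ∈ range n, (w i - w (i + 1)) * ∑ j ∈ range (i + 1), c j := by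
    intro n
    induction n with
    | zero => simp
    | succ n ih =>
      rw [sum_range_succ (fun i => w i * c i), ih,
        sum_range_succ (fun i => (w i - w (i + 1)) * ∑ j ∈ range (i + 1), c j), sum_range_succ c n]
      ring
  rw [h1 N]
  refine (abs_add_le _ _).trans ?_
  have h2 : |∑ i ∈ range N, (w i - w (i + 1)) * ∑ j ∈ range (i + 1), c j| ≤
      ∑ i ∈ range N, (w i - w (i + 1)) * M := by
    refine (abs_sum_le_sum_abs _ _).trans (sum_le_sum fun i hi => ?_)
    have := hw i
    rw [abs_mul, abs_of_nonneg (by linarith)]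
    exact mul_le_mul_of_nonneg_left (hM _ (by have := mem_range.1 hi; omega)) (by linarith)
  rw [← sum_mul, sum_range_sub'] at h2
  rw [abs_mul, abs_of_nonneg (hw0 N)]
  have h3 := mul_le_mul_of_nonneg_left (hM N le_rfl) (hw0 N)
  linarith

end Hooley

namespace Hooley
open ArithmeticFunction (vonMangoldt)

lemma sum_Icc_one_add (f : ℕ → ℝ) (N j : ℕ) :
    ∑ n ∈ Icc 1 (N + j), f n = ∑ n ∈ Icc 1 N, f n + ∑ i ∈ range j, f (N + 1 + i) := by
  induction j with
  | zero => simp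
  | succ j ih =>
    rw [sum_range_succ, ← add_assoc N j 1, sum_Icc_succ_top (by omega), ih, add_assoc]
    congr 3
    ring

lemma psi_sub_eq (x : ℝ) (q a : ℕ) :
    psi x q a - x / (q.totient : ℝ) =
      ∑ n ∈ Icc 1 ⌊x⌋₊, apCoeff q a n - (x - ⌊x⌋₊) / q.totient := by
  simp only [psi, apCoeff]
  rw [sum_sub_distrib, sum_filter, sum_const, Nat.card_Icc, nsmul_eq_mul]
  simp only [Nat.add_sub_cancel]
  ring

lemma abs_apCoeff_le {q : ℕ} (hq : 1 ≤ q) (a n : ℕ) :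
    |apCoeff q a n| ≤ vonMangoldt n + 1 := by
  have h1 := neg_one_le_apCoeff hq a n
  have h2 : 0 ≤ vonMangoldt n := ArithmeticFunction.vonMangoldt_nonneg
  have h3 : (0 : ℝ) ≤ 1 / (q.totient : ℝ) := by positivity
  rw [abs_le]
  constructor
  · linarith
  · unfold apCoeff
    split_ifs <;> linarith

lemma sum_abs_apCoeff_le {q : ℕ} (hq : 1 ≤ q) (a : ℕ) {y : ℝ} (hy : 1 ≤ y) :
    ∑ n ∈ Icc 1 ⌊y⌋₊, |apCoeff q a n| ≤ y * (Real.log y + 1) := by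
  have h : ∀ n ∈ Icc 1 ⌊y⌋₊, |apCoeff q a n| ≤ Real.log y + 1 := fun n hn =>
    (abs_apCoeff_le hq a n).trans (by
      have := ArithmeticFunction.vonMangoldt_le_log (n := n)
      have := (log_le_log_of_mem hy hn).2
      linarith)
  refine (sum_le_card_nsmul _ _ _ h).trans ?_
  rw [nsmul_eq_mul, Nat.card_Icc, Nat.add_sub_cancel]
  exact mul_le_mul_of_nonneg_right (Nat.floor_le (by linarith))
    (by have := Real.log_nonneg hy; linarith)

lemma abs_sub_floor_div_totient_le {q : ℕ} {x : ℝ} (hq : 1 ≤ q) (hx : 0 ≤ x) :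
    |(x - ⌊x⌋₊) / (q.totient : ℝ)| ≤ 1 := by
  have h1 : (1 : ℝ) ≤ q.totient := by exact_mod_cast Nat.totient_pos.2 hq
  have h2 := Nat.floor_le hx
  have h3 := (Nat.lt_floor_add_one x).le
  rw [abs_of_nonneg (div_nonneg (by linarith) (by linarith)), div_le_one (by linarith)]
  linarith

/-- The Siegel–Walfisz theorem. -/
theorem siegel_walfisz (A : ℕ) : ∃ C : ℝ, 0 < C ∧ ∀ x : ℝ, 3 ≤ x → ∀ q : ℕ, 1 ≤ q →
    (q : ℝ) ≤ Real.log x ^ A → ∀ a : ℕ, Nat.Coprime a q →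
      |psi x q a - x / (q.totient : ℝ)| ≤ C * x / Real.log x ^ A := by
  obtain ⟨K, hK, hB⟩ := exists_log_weighted_ap_bound (m := 2 * A + 1) (by omega)
  set m := 2 * A + 1 with hm
  refine ⟨2 * K * 4 ^ m + 2 * 2 ^ (A + 1) * (A + 1).factorial + A.factorial + 6 * 5 ^ A,
    by positivity, fun x hx q hq hqA a ha => ?_⟩
  have hx0 : 0 < x := by linarith
  have hL1 : 1 ≤ Real.log x := by
    rw [Real.le_log_iff_exp_le hx0]
    have := Real.exp_one_lt_d9
    linarith
  set L := Real.log x with hL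
  have hL0 : 0 < L := by linarith
  have hfl := abs_sub_floor_div_totient_le hq hx0.le
  rw [psi_sub_eq]
  have hA1 : 1 ≤ A.factorial * x / L ^ A := by
    rw [le_div_iff₀ (by positivity)]
    simpa using log_pow_le_factorial_mul (by linarith : 1 ≤ x) A
  rcases lt_or_ge x 64 with hx64 | hx64
  · have hL5 : L ≤ 5 := by
      have h1 : L ≤ Real.log 64 := Real.log_le_log hx0 hx64.le
      have h2 : Real.log 64 = 6 * Real.log 2 := by
        rw [show (64 : ℝ) = 2 ^ 6 by norm_num, Real.log_pow]; norm_num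
      have := Real.log_two_lt_d9
      linarith
    have h1 : |∑ n ∈ Icc 1 ⌊x⌋₊, apCoeff q a n| ≤ 6 * x := by
      refine (abs_sum_le_sum_abs _ _).trans ((sum_abs_apCoeff_le hq a (by linarith)).trans ?_)
      rw [mul_comm]
      gcongr
      linarith
    have h2 : 6 * x ≤ 6 * 5 ^ A * x / L ^ A := by
      rw [le_div_iff₀ (by positivity)]
      have : L ^ A ≤ 5 ^ A := by gcongr
      nlinarith
    calc _ ≤ |∑ n ∈ Icc 1 ⌊x⌋₊, apCoeff q a n| + |(x - ⌊x⌋₊) / (q.totient : ℝ)| := abs_sub _ _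
      _ ≤ 6 * 5 ^ A * x / L ^ A + A.factorial * x / L ^ A := by linarith
      _ ≤ _ := by
        rw [← add_div, ← add_mul]
        gcongr ?_ * x / L ^ A
        have : 0 ≤ 2 * K * 4 ^ m + 2 * 2 ^ (A + 1) * (A + 1).factorial := by positivity
        linarith
  · have hsq : 8 ≤ √x := by
      rw [show (8 : ℝ) = √64 by rw [show (64 : ℝ) = 8 ^ 2 by norm_num]; simp]
      exact Real.sqrt_le_sqrt hx64
    have hss : √x * √x = x := Real.mul_self_sqrt hx0.le
    have hsx : √x ≤ x := by nlinarith
    have hlog : L = 2 * Real.log √x := by rw [Real.log_sqrt hx0.le]; ring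
    set N₀ := ⌊√x⌋₊ with hN₀
    have hN₀8 : 8 ≤ N₀ := Nat.le_floor (by simpa using hsq)
    obtain ⟨j, hj⟩ : ∃ j, ⌊x⌋₊ = N₀ + j := Nat.exists_eq_add_of_le (Nat.floor_mono hsx)
    have hBn : ∀ n : ℕ, 8 ≤ n → n ≤ ⌊x⌋₊ →
        |∑ k ∈ Icc 1 n, apCoeff q a k * Real.log k ^ (2 * m)| ≤ K * q * (x * L ^ m) := by
      intro n hn hn'
      have hnx : (n : ℝ) ≤ x := (Nat.le_floor_iff hx0.le).1 hn'
      have h8 : (8 : ℝ) ≤ n := by exact_mod_cast hn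
      have h := hB q a n hq ha h8
      rw [Nat.floor_natCast] at h
      refine h.trans ?_
      have h1 : 0 ≤ Real.log n := Real.log_nonneg (by linarith)
      have h2 : Real.log n ≤ L := Real.log_le_log (by linarith) hnx
      gcongr
    have hlogpos : ∀ i : ℕ, L / 2 ≤ Real.log ((N₀ + 1 + i : ℕ) : ℝ) := by
      intro i
      have h1 : √x ≤ ((N₀ + 1 + i : ℕ) : ℝ) := by
        have := (Nat.lt_floor_add_one √x).le
        push_cast
        have : (0 : ℝ) ≤ i := by positivity
        linarith
      have := Real.log_le_log (by linarith) h1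
      linarith
    have hmain := abs_sum_antitone_mul_le (w := fun i => (Real.log ((N₀ + 1 + i : ℕ) : ℝ) ^ (2 * m))⁻¹)
      (c := fun i => apCoeff q a (N₀ + 1 + i) * Real.log ((N₀ + 1 + i : ℕ) : ℝ) ^ (2 * m))
      (M := 2 * (K * q * (x * L ^ m))) j
      (fun i => by
        have := hlogpos i
        have : 0 ≤ Real.log ((N₀ + 1 + i : ℕ) : ℝ) := by linarith
        positivity)
      (fun i => by
        have h1 := hlogpos i
        have h2 : Real.log ((N₀ + 1 + i : ℕ) : ℝ) ≤ Real.log ((N₀ + 1 + (i + 1) : ℕ) : ℝ) :=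
          Real.log_le_log (by positivity) (by push_cast; linarith)
        have h3 : 0 < Real.log ((N₀ + 1 + i : ℕ) : ℝ) := by linarith
        have h4 : 0 < Real.log ((N₀ + 1 + i : ℕ) : ℝ) ^ (2 * m) := by positivity
        exact inv_anti₀ h4 (pow_le_pow_left₀ h3.le h2 _))
      (fun n hn => by
        have h1 := sum_Icc_one_add (fun k => apCoeff q a k * Real.log k ^ (2 * m)) N₀ n
        have h2 := hBn N₀ hN₀8 (by omega)
        have h3 := hBn (N₀ + n) (by omega) (by omega)
        rw [h1] at h3
        rw [abs_le] at h2 h3 ⊢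
        constructor <;> linarith [h2.1, h2.2, h3.1, h3.2])
    have hsum : ∑ i ∈ range j, (Real.log ((N₀ + 1 + i : ℕ) : ℝ) ^ (2 * m))⁻¹ *
        (apCoeff q a (N₀ + 1 + i) * Real.log ((N₀ + 1 + i : ℕ) : ℝ) ^ (2 * m)) =
        ∑ i ∈ range j, apCoeff q a (N₀ + 1 + i) := by
      refine sum_congr rfl fun i _ => ?_
      have h1 := hlogpos i
      have h3 : 0 < Real.log ((N₀ + 1 + i : ℕ) : ℝ) := by linarith
      field_simp
    rw [hsum] at hmain
    have hw0 : (Real.log ((N₀ + 1 + 0 : ℕ) : ℝ) ^ (2 * m))⁻¹ ≤ 4 ^ m / L ^ (2 * m) := by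
      have h1 := hlogpos 0
      calc (Real.log ((N₀ + 1 + 0 : ℕ) : ℝ) ^ (2 * m))⁻¹ ≤ ((L / 2) ^ (2 * m))⁻¹ := by
            gcongr
        _ = _ := by
          rw [div_pow, inv_div, pow_mul 2]
          norm_num
    have hpart2 : |∑ i ∈ range j, apCoeff q a (N₀ + 1 + i)| ≤ 2 * K * 4 ^ m * x / L ^ A := by
      refine hmain.trans ((mul_le_mul_of_nonneg_right hw0 (by positivity)).trans ?_)
      have h1 : (q : ℝ) * L ^ A ≤ L ^ m := by
        calc (q : ℝ) * L ^ A ≤ L ^ A * L ^ A := by gcongr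
          _ = L ^ (2 * A) := by rw [two_mul, pow_add]
          _ ≤ L ^ m := pow_le_pow_right₀ hL1 (by omega)
      rw [div_mul_eq_mul_div, div_le_div_iff₀ (by positivity) (by positivity), show L ^ (2 * m) = L ^ m * L ^ m by rw [two_mul, pow_add]]
      calc 4 ^ m * (2 * (K * q * (x * L ^ m))) * L ^ A =
            4 ^ m * (2 * (K * (x * L ^ m))) * (q * L ^ A) := by ring
        _ ≤ 4 ^ m * (2 * (K * (x * L ^ m))) * L ^ m := by gcongr
        _ = _ := by ring
    have hpart1 : |∑ n ∈ Icc 1 N₀, apCoeff q a n| ≤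
        2 * 2 ^ (A + 1) * (A + 1).factorial * x / L ^ A := by
      refine (abs_sum_le_sum_abs _ _).trans ((sum_abs_apCoeff_le hq a (by linarith)).trans ?_)
      have h1 := log_pow_le_factorial_mul (by linarith : 1 ≤ √x) (A + 1)
      have h2 : L ^ (A + 1) ≤ 2 ^ (A + 1) * ((A + 1).factorial * √x) := by
        rw [hlog, mul_pow]; gcongr
      rw [le_div_iff₀ (by positivity)]
      calc √x * (Real.log √x + 1) * L ^ A ≤ √x * (2 * L) * L ^ A := by
            gcongr
            linarith
        _ = 2 * √x * L ^ (A + 1) := by ring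
        _ ≤ 2 * √x * (2 ^ (A + 1) * ((A + 1).factorial * √x)) := by gcongr
        _ = 2 * 2 ^ (A + 1) * (A + 1).factorial * (√x * √x) := by ring
        _ = _ := by rw [hss]
    rw [hj, sum_Icc_one_add, ← hj]
    calc _ ≤ |∑ n ∈ Icc 1 N₀, apCoeff q a n| + |∑ i ∈ range j, apCoeff q a (N₀ + 1 + i)| +
          |(x - ⌊x⌋₊) / (q.totient : ℝ)| :=
          (abs_sub _ _).trans (add_le_add (abs_add_le _ _) le_rfl)
      _ ≤ 2 * 2 ^ (A + 1) * (A + 1).factorial * x / L ^ A + 2 * K * 4 ^ m * x / L ^ A +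
          A.factorial * x / L ^ A := by linarith
      _ ≤ _ := by
        rw [← add_div, ← add_div, ← add_mul, ← add_mul]
        gcongr ?_ * x / L ^ A
        have : (0 : ℝ) ≤ 6 * 5 ^ A := by positivity
        linarith

end Hooley

namespace Hooley

/-- The additive character `e(t) = exp (2πit)`. -/
noncomputable def expChar (t : ℝ) : ℂ := Complex.exp (((2 * Real.pi * t : ℝ) : ℂ) * Complex.I)

lemma norm_expChar (t : ℝ) : ‖expChar t‖ = 1 := Complex.norm_exp_ofReal_mul_I _

lemma expChar_add (s t : ℝ) : expChar (s + t) = expChar s * expChar t := by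
  rw [expChar, expChar, expChar, ← Complex.exp_add]
  congr 1
  push_cast
  ring

lemma expChar_zero : expChar 0 = 1 := by simp [expChar]

lemma conj_expChar (t : ℝ) : (starRingEnd ℂ) (expChar t) = expChar (-t) := by
  rw [expChar, expChar, ← Complex.exp_conj]
  congr 1
  rw [map_mul, Complex.conj_ofReal, Complex.conj_I]
  push_cast
  ring

lemma expChar_eq_one_iff {t : ℝ} : expChar t = 1 ↔ ∃ k : ℤ, t = k := by
  rw [expChar, Complex.exp_eq_one_iff]
  refine exists_congr fun k => ?_
  have hpi := Real.pi_ne_zero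
  constructor
  · intro h
    have h2 : ((2 * Real.pi * t : ℝ) : ℂ) = ((k * (2 * Real.pi) : ℝ) : ℂ) := by
      apply mul_right_cancel₀ Complex.I_ne_zero
      rw [h]
      push_cast
      ring
    have h3 := Complex.ofReal_injective h2
    have : 2 * Real.pi * (t - k) = 0 := by linarith
    have := (mul_eq_zero.1 this).resolve_left (by positivity)
    linarith
  · rintro rfl
    push_cast
    ring

lemma expChar_intCast (k : ℤ) : expChar k = 1 := expChar_eq_one_iff.2 ⟨k, rfl⟩

lemma expChar_natCast_mul (n : ℕ) (t : ℝ) : expChar (n * t) = expChar t ^ n := by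
  induction n with
  | zero => simp [expChar_zero]
  | succ n ih => rw [pow_succ, ← ih, ← expChar_add]; congr 1; push_cast; ring

lemma norm_sum_expChar_le_card (N : ℕ) (t : ℝ) : ‖∑ n ∈ Icc 1 N, expChar (n * t)‖ ≤ N := by
  refine (norm_sum_le _ _).trans ?_
  simp [norm_expChar]

lemma norm_expChar_sub_one (t : ℝ) : ‖expChar t - 1‖ = 2 * |Real.sin (Real.pi * t)| := by
  rw [expChar, mul_comm, Complex.norm_exp_I_mul_ofReal_sub_one, norm_mul, Real.norm_eq_abs,
    Real.norm_eq_abs, abs_two]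
  congr 3
  ring

lemma four_mul_min_le_norm {t : ℝ} (h0 : 0 ≤ t) (h1 : t ≤ 1) :
    4 * min t (1 - t) ≤ ‖expChar t - 1‖ := by
  rw [norm_expChar_sub_one]
  have hpi := Real.pi_pos
  have key : ∀ u : ℝ, 0 ≤ u → u ≤ 1 / 2 → 4 * u ≤ 2 * |Real.sin (Real.pi * u)| := by
    intro u hu hu'
    have h := Real.mul_le_sin (x := Real.pi * u) (by positivity) (by nlinarith)
    have h2 : 2 / Real.pi * (Real.pi * u) = 2 * u := by field_simp
    have := le_abs_self (Real.sin (Real.pi * u))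
    linarith
  rcases le_total t (1 / 2) with ht | ht
  · exact (mul_le_mul_of_nonneg_left (min_le_left _ _) (by norm_num)).trans (key t h0 ht)
  · have h := key (1 - t) (by linarith) (by linarith)
    rw [show Real.pi * (1 - t) = Real.pi - Real.pi * t by ring, Real.sin_pi_sub] at h
    exact (mul_le_mul_of_nonneg_left (min_le_right _ _) (by norm_num)).trans h

lemma norm_sum_expChar_le (N : ℕ) {t : ℝ} (h0 : 0 < t) (h1 : t < 1) :
    ‖∑ n ∈ Icc 1 N, expChar (n * t)‖ ≤ (t⁻¹ + (1 - t)⁻¹) / 2 := by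
  have hg : (∑ n ∈ Icc 1 N, expChar (n * t)) * (expChar t - 1) =
      expChar t ^ (N + 1) - expChar t := by
    simp only [expChar_natCast_mul]
    induction N with
    | zero => simp
    | succ N ih => rw [sum_Icc_succ_top (by omega), add_mul, ih]; ring
  have hn : ‖expChar t ^ (N + 1) - expChar t‖ ≤ 2 := by
    refine (norm_sub_le _ _).trans ?_
    rw [norm_pow, norm_expChar, one_pow]
    norm_num
  rw [← hg, norm_mul] at hn
  have hm := four_mul_min_le_norm h0.le h1.le
  set S := ‖∑ n ∈ Icc 1 N, expChar (n * t)‖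
  have hmin : 0 < min t (1 - t) := lt_min h0 (by linarith)
  have h3 : S * min t (1 - t) ≤ 1 / 2 := by
    have := mul_le_mul_of_nonneg_left hm (norm_nonneg (∑ n ∈ Icc 1 N, expChar (n * t)))
    change S * _ ≤ S * _ at this
    linarith
  have h4 : S ≤ (min t (1 - t))⁻¹ / 2 := by
    rw [inv_eq_one_div, div_div, le_div_iff₀ (by positivity)]
    linarith
  refine h4.trans (div_le_div_of_nonneg_right ?_ (by norm_num))
  have e1 : 0 < t⁻¹ := by positivity
  have e2 : 0 < (1 - t)⁻¹ := by
    have : 0 < 1 - t := by linarith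
    positivity
  rcases le_total t (1 - t) with h | h
  · rw [min_eq_left h]; linarith
  · rw [min_eq_right h]; linarith

/-- `α` is `δ`-spaced modulo one on `R`. -/
def SpacedOn {ι : Type*} (R : Finset ι) (α : ι → ℝ) (δ : ℝ) : Prop :=
  ∀ r ∈ R, ∀ s ∈ R, r ≠ s → ∀ k : ℤ, δ ≤ |α r - α s + k|

lemma sum_inv_fract_le {ι : Type*} [DecidableEq ι] {R : Finset ι} {α : ι → ℝ} {δ : ℝ} (hδ : 0 < δ)
    (h : SpacedOn R α δ) {r : ι} (hr : r ∈ R) :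
    ∑ s ∈ R.erase r, (Int.fract (α s - α r))⁻¹ ≤ δ⁻¹ * harmonic ⌊δ⁻¹⌋₊ := by
  have ht : ∀ s ∈ R.erase r, δ ≤ Int.fract (α s - α r) := by
    intro s hs
    have := h s (mem_of_mem_erase hs) r hr (ne_of_mem_erase hs) (-⌊α s - α r⌋)
    rw [Int.cast_neg, ← sub_eq_add_neg, Int.self_sub_floor, abs_of_nonneg (Int.fract_nonneg _)] at this
    exact this
  set J : ι → ℕ := fun s => ⌊Int.fract (α s - α r) / δ⌋₊ with hJ
  have hJ1 : ∀ s ∈ R.erase r, 1 ≤ J s := fun s hs =>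
    Nat.le_floor (by rw [Nat.cast_one, le_div_iff₀ hδ]; linarith [ht s hs])
  have hinj : Set.InjOn J (R.erase r : Finset ι) := by
    intro s hs s' hs' hss
    by_contra hne
    have h1 := h s (mem_of_mem_erase hs) s' (mem_of_mem_erase hs') hne
      (⌊α s' - α r⌋ - ⌊α s - α r⌋)
    have h2 : α s - α s' + ((⌊α s' - α r⌋ - ⌊α s - α r⌋ : ℤ) : ℝ) =
        Int.fract (α s - α r) - Int.fract (α s' - α r) := by
      unfold Int.fract
      push_cast
      ring
    rw [h2] at h1
    have p1 : 0 ≤ Int.fract (α s - α r) / δ := div_nonneg (Int.fract_nonneg _) hδ.le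
    have p2 : 0 ≤ Int.fract (α s' - α r) / δ := div_nonneg (Int.fract_nonneg _) hδ.le
    have a1 := Nat.floor_le p1
    have a2 := Nat.lt_floor_add_one (Int.fract (α s - α r) / δ)
    have b1 := Nat.floor_le p2
    have b2 := Nat.lt_floor_add_one (Int.fract (α s' - α r) / δ)
    have hc : (⌊Int.fract (α s - α r) / δ⌋₊ : ℝ) = ⌊Int.fract (α s' - α r) / δ⌋₊ := by
      exact_mod_cast hss
    have h3 : |Int.fract (α s - α r) / δ - Int.fract (α s' - α r) / δ| < 1 := by
      rw [abs_lt]; constructor <;> linarith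
    rw [← sub_div, abs_div, abs_of_pos hδ, div_lt_one hδ] at h3
    linarith
  calc ∑ s ∈ R.erase r, (Int.fract (α s - α r))⁻¹ ≤ ∑ s ∈ R.erase r, δ⁻¹ * ((J s : ℝ))⁻¹ := by
        refine sum_le_sum fun s hs => ?_
        have h1 : (J s : ℝ) * δ ≤ Int.fract (α s - α r) := by
          rw [← le_div_iff₀ hδ]
          exact Nat.floor_le (div_nonneg (Int.fract_nonneg _) hδ.le)
        have h2 : (0 : ℝ) < J s := by exact_mod_cast hJ1 s hs
        rw [← mul_inv]
        exact inv_anti₀ (by positivity) (by linarith)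
    _ = ∑ j ∈ (R.erase r).image J, δ⁻¹ * (j : ℝ)⁻¹ := (sum_image hinj (f := fun j : ℕ => δ⁻¹ * (j : ℝ)⁻¹)).symm
    _ ≤ ∑ j ∈ Icc 1 ⌊δ⁻¹⌋₊, δ⁻¹ * (j : ℝ)⁻¹ := by
        refine sum_le_sum_of_subset_of_nonneg ?_ fun j _ _ => by positivity
        intro j hj
        obtain ⟨s, hs, rfl⟩ := mem_image.1 hj
        refine mem_Icc.2 ⟨hJ1 s hs, Nat.floor_mono ?_⟩
        rw [div_le_iff₀ hδ, inv_mul_cancel₀ hδ.ne']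
        exact (Int.fract_lt_one _).le
    _ = δ⁻¹ * harmonic ⌊δ⁻¹⌋₊ := by
        rw [← mul_sum, harmonic_eq_sum_Icc]
        push_cast
        rfl

lemma sum_norm_sum_expChar_le {ι : Type*} [DecidableEq ι] {R : Finset ι} {α : ι → ℝ} {δ : ℝ}
    (hδ : 0 < δ) (h : SpacedOn R α δ) (N : ℕ) {r : ι} (hr : r ∈ R) :
    ∑ s ∈ R, ‖∑ n ∈ Icc 1 N, expChar (n * (α s - α r))‖ ≤ N + δ⁻¹ * harmonic ⌊δ⁻¹⌋₊ := by
  have h1 : ∀ s ∈ R.erase r, ‖∑ n ∈ Icc 1 N, expChar (n * (α s - α r))‖ ≤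
      ((Int.fract (α s - α r))⁻¹ + (Int.fract (-α s - -α r))⁻¹) / 2 := by
    intro s hs
    have h0 : 0 < Int.fract (α s - α r) := by
      have := h s (mem_of_mem_erase hs) r hr (ne_of_mem_erase hs) (-⌊α s - α r⌋)
      rw [Int.cast_neg, ← sub_eq_add_neg, Int.self_sub_floor,
        abs_of_nonneg (Int.fract_nonneg _)] at this
      linarith
    have h2 : ∀ n : ℕ, expChar (n * (α s - α r)) = expChar (n * Int.fract (α s - α r)) := by
      intro n
      have : (n : ℝ) * (α s - α r) =
          n * Int.fract (α s - α r) + ((n * ⌊α s - α r⌋ : ℤ) : ℝ) := by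
        push_cast
        rw [← mul_add, Int.fract_add_floor]
      rw [this, expChar_add, expChar_intCast, mul_one]
    simp only [h2]
    refine (norm_sum_expChar_le N h0 (Int.fract_lt_one _)).trans (le_of_eq ?_)
    rw [show -α s - -α r = -(α s - α r) by ring, Int.fract_neg h0.ne']
  have h' : SpacedOn R (fun s => -α s) δ := by
    intro a ha b hb hab k
    have := h a ha b hb hab (-k)
    rwa [← abs_neg, show -(-α a - -α b + (k : ℝ)) = α a - α b + ((-k : ℤ) : ℝ) by push_cast; ring]
  rw [← add_sum_erase R _ hr]
  refine add_le_add (norm_sum_expChar_le_card _ _) ((sum_le_sum h1).trans ?_)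
  rw [← sum_div, sum_add_distrib]
  have e1 := sum_inv_fract_le hδ h hr
  have e2 := sum_inv_fract_le hδ h' hr
  linarith

/-- The large sieve inequality, up to a logarithm. -/
theorem large_sieve {ι : Type*} [DecidableEq ι] {R : Finset ι} {α : ι → ℝ} {δ : ℝ} (hδ : 0 < δ)
    (h : SpacedOn R α δ) (N : ℕ) (a : ℕ → ℂ) :
    ∑ r ∈ R, ‖∑ n ∈ Icc 1 N, a n * expChar (n * α r)‖ ^ 2 ≤
      (N + δ⁻¹ * harmonic ⌊δ⁻¹⌋₊) * ∑ n ∈ Icc 1 N, ‖a n‖ ^ 2 := by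
  set Δ : ℝ := N + δ⁻¹ * harmonic ⌊δ⁻¹⌋₊ with hΔ
  set S : ι → ℂ := fun r => ∑ n ∈ Icc 1 N, a n * expChar (n * α r) with hS
  set T : ℝ := ∑ r ∈ R, ‖S r‖ ^ 2 with hT
  set b : ℕ → ℂ := fun n => ∑ r ∈ R, (starRingEnd ℂ) (S r) * expChar (n * α r) with hb
  have hT0 : 0 ≤ T := sum_nonneg fun _ _ => by positivity
  have h1 : (T : ℂ) = ∑ n ∈ Icc 1 N, a n * b n := by
    rw [hT, hb]
    simp only [mul_sum]
    rw [sum_comm]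
    push_cast
    refine sum_congr rfl fun r _ => ?_
    rw [← Complex.conj_mul']
    nth_rewrite 2 [hS]
    rw [mul_sum]
    exact sum_congr rfl fun n _ => by ring
  have h2 : T ^ 2 ≤ (∑ n ∈ Icc 1 N, ‖a n‖ ^ 2) * ∑ n ∈ Icc 1 N, ‖b n‖ ^ 2 := by
    have e1 : T ≤ ∑ n ∈ Icc 1 N, ‖a n‖ * ‖b n‖ := by
      calc T = ‖(T : ℂ)‖ := by rw [Complex.norm_real, Real.norm_of_nonneg hT0]
        _ ≤ _ := by
          rw [h1]
          exact (norm_sum_le _ _).trans (le_of_eq (sum_congr rfl fun n _ => norm_mul _ _))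
    exact (pow_le_pow_left₀ hT0 e1 2).trans (sum_mul_sq_le_sq_mul_sq _ _ _)
  have h3 : ∑ n ∈ Icc 1 N, ‖b n‖ ^ 2 ≤ Δ * T := by
    have e1 : ((∑ n ∈ Icc 1 N, ‖b n‖ ^ 2 : ℝ) : ℂ) = ∑ r ∈ R, ∑ s ∈ R,
        S r * (starRingEnd ℂ) (S s) * ∑ n ∈ Icc 1 N, expChar (n * (α s - α r)) := by
      push_cast
      simp only [← Complex.conj_mul', hb, map_sum, map_mul, Complex.conj_conj, sum_mul, mul_sum,
        conj_expChar]
      symm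
      rw [sum_comm, sum_comm (s := Icc 1 N)]
      refine sum_congr rfl fun r _ => ?_
      rw [sum_comm]
      refine sum_congr rfl fun n _ => sum_congr rfl fun s _ => ?_
      rw [mul_sub, sub_eq_add_neg, expChar_add]
      ring
    have e2 : ∑ n ∈ Icc 1 N, ‖b n‖ ^ 2 ≤ ∑ r ∈ R, ∑ s ∈ R,
        ((‖S r‖ ^ 2 + ‖S s‖ ^ 2) / 2) * ‖∑ n ∈ Icc 1 N, expChar (n * (α s - α r))‖ := by
      have e0 : 0 ≤ ∑ n ∈ Icc 1 N, ‖b n‖ ^ 2 := sum_nonneg fun _ _ => by positivity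
      calc ∑ n ∈ Icc 1 N, ‖b n‖ ^ 2 = ‖((∑ n ∈ Icc 1 N, ‖b n‖ ^ 2 : ℝ) : ℂ)‖ := by
            rw [Complex.norm_real, Real.norm_of_nonneg e0]
        _ ≤ _ := by
          rw [e1]
          refine (norm_sum_le _ _).trans (sum_le_sum fun r _ => (norm_sum_le _ _).trans
            (sum_le_sum fun s _ => ?_))
          rw [norm_mul, norm_mul, RCLike.norm_conj]
          refine mul_le_mul_of_nonneg_right ?_ (norm_nonneg _)
          nlinarith [sq_nonneg (‖S r‖ - ‖S s‖)]
    have e3 : ∀ r s, ‖∑ n ∈ Icc 1 N, expChar (n * (α s - α r))‖ =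
        ‖∑ n ∈ Icc 1 N, expChar (n * (α r - α s))‖ := by
      intro r s
      rw [← RCLike.norm_conj, map_sum]
      simp only [conj_expChar]
      congr 1
      exact sum_congr rfl fun n _ => by congr 1; ring
    have e4 : ∑ r ∈ R, ∑ s ∈ R,
        ((‖S r‖ ^ 2 + ‖S s‖ ^ 2) / 2) * ‖∑ n ∈ Icc 1 N, expChar (n * (α s - α r))‖ =
        ∑ r ∈ R, ‖S r‖ ^ 2 * ∑ s ∈ R, ‖∑ n ∈ Icc 1 N, expChar (n * (α s - α r))‖ := by
      have f1 : ∑ r ∈ R, ∑ s ∈ R, ‖S s‖ ^ 2 * ‖∑ n ∈ Icc 1 N, expChar (n * (α s - α r))‖ =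
          ∑ r ∈ R, ∑ s ∈ R, ‖S r‖ ^ 2 * ‖∑ n ∈ Icc 1 N, expChar (n * (α s - α r))‖ := by
        rw [sum_comm]
        exact sum_congr rfl fun r _ => sum_congr rfl fun s _ => by rw [e3]
      simp only [add_div, add_mul, sum_add_distrib, div_mul_eq_mul_div, ← sum_div]
      rw [f1, add_halves]
      simp only [mul_sum]
    rw [e4] at e2
    refine e2.trans ?_
    rw [hT, mul_sum]
    refine sum_le_sum fun r hr => ?_
    rw [mul_comm]
    exact mul_le_mul_of_nonneg_right (sum_norm_sum_expChar_le hδ h N hr) (by positivity)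
  rcases hT0.eq_or_lt with h0 | h0
  · rw [← h0]
    have : (0 : ℝ) ≤ harmonic ⌊δ⁻¹⌋₊ := by
      exact_mod_cast sum_nonneg fun _ _ => by positivity
    have hΔ0 : 0 ≤ Δ := by positivity
    exact mul_nonneg hΔ0 (sum_nonneg fun _ _ => by positivity)
  · have hn : 0 ≤ ∑ n ∈ Icc 1 N, ‖a n‖ ^ 2 := sum_nonneg fun _ _ => by positivity
    have := h2.trans (mul_le_mul_of_nonneg_left h3 hn)
    rw [pow_two] at this
    have h5 : T * T ≤ (Δ * ∑ n ∈ Icc 1 N, ‖a n‖ ^ 2) * T := by linarith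
    exact le_of_mul_le_mul_right h5 h0

end Hooley

namespace Hooley
open ArithmeticFunction (vonMangoldt)

/-- Grouping the fractions with denominator `q` by their reduced denominators. -/
lemma sum_range_div_eq {M : Type*} [AddCommMonoid M] {q : ℕ} (hq : 0 < q) (f : ℝ → M) :
    ∑ b ∈ range q, f (b / q) =
      ∑ d ∈ q.divisors, ∑ b ∈ range d with b.Coprime d, f (b / d) := by
  rw [sum_sigma']
  refine sum_bij' (fun b _ => (⟨q / b.gcd q, b / b.gcd q⟩ : Σ _ : ℕ, ℕ))
    (fun p _ => p.2 * (q / p.1)) ?_ ?_ ?_ ?_ ?_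
  · intro b hb
    have hg : 0 < b.gcd q := Nat.gcd_pos_of_pos_right _ hq
    have hb' := mem_range.1 hb
    simp only [mem_sigma, Nat.mem_divisors, mem_filter, mem_range]
    exact ⟨⟨Nat.div_dvd_of_dvd (Nat.gcd_dvd_right _ _), hq.ne'⟩,
      Nat.div_lt_div_of_lt_of_dvd (Nat.gcd_dvd_right _ _) hb', Nat.coprime_div_gcd_div_gcd hg⟩
  · rintro ⟨d, b⟩ hp
    simp only [mem_sigma, Nat.mem_divisors, mem_filter, mem_range] at hp ⊢
    obtain ⟨⟨⟨g, rfl⟩, hq0⟩, hb, hc⟩ := hp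
    have hd : 0 < d := by omega
    rw [Nat.mul_div_cancel_left _ hd]
    exact Nat.mul_lt_mul_of_pos_right hb (Nat.pos_of_mul_pos_left hq)
  · intro b hb
    have hg : 0 < b.gcd q := Nat.gcd_pos_of_pos_right _ hq
    simp only
    rw [Nat.div_div_self (Nat.gcd_dvd_right _ _) hq.ne', Nat.div_mul_cancel (Nat.gcd_dvd_left _ _)]
  · rintro ⟨d, b⟩ hp
    simp only [mem_sigma, Nat.mem_divisors, mem_filter, mem_range] at hp ⊢
    obtain ⟨⟨⟨g, rfl⟩, hq0⟩, hb, hc⟩ := hp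
    have hd : 0 < d := by omega
    have hg : 0 < g := Nat.pos_of_mul_pos_left hq
    rw [Nat.mul_div_cancel_left _ hd, Nat.gcd_mul_right, hc.gcd_eq_one, one_mul,
      Nat.mul_div_cancel _ hg, Nat.mul_div_cancel _ hg]
  · intro b hb
    have hg : 0 < b.gcd q := Nat.gcd_pos_of_pos_right _ hq
    rw [Nat.cast_div (Nat.gcd_dvd_left _ _) (by positivity),
      Nat.cast_div (Nat.gcd_dvd_right _ _) (by positivity)]
    congr 1
    have : ((b.gcd q : ℕ) : ℝ) ≠ 0 := by positivity
    field_simp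

lemma sum_expChar_div {q : ℕ} (hq : 0 < q) (k : ℤ) :
    ∑ a ∈ range q, expChar (k * (a / q)) = if (q : ℤ) ∣ k then (q : ℂ) else 0 := by
  have hq0 : (q : ℝ) ≠ 0 := by positivity
  have h1 : ∀ a : ℕ, expChar (k * (a / q)) = expChar (k / q) ^ a := by
    intro a
    rw [← expChar_natCast_mul]
    congr 1
    ring
  simp only [h1]
  split_ifs with h
  · obtain ⟨m, rfl⟩ := h
    have : expChar (((q : ℤ) * m : ℤ) / (q : ℝ)) = 1 := by
      rw [expChar_eq_one_iff]
      refine ⟨m, ?_⟩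
      push_cast
      field_simp
    rw [this]
    simp
  · have hne : expChar ((k : ℝ) / q) ≠ 1 := by
      intro hh
      obtain ⟨m, hm⟩ := expChar_eq_one_iff.1 hh
      apply h
      refine ⟨m, ?_⟩
      rw [div_eq_iff hq0] at hm
      have : (k : ℝ) = ((q * m : ℤ) : ℝ) := by rw [hm]; push_cast; ring
      exact_mod_cast this
    rw [geom_sum_eq hne, ← expChar_natCast_mul, mul_div_cancel₀ _ hq0, expChar_intCast]
    simp

lemma parseval {q : ℕ} (hq : 0 < q) (g : ℕ → ℂ) :
    ∑ a ∈ range q, ‖g a‖ ^ 2 =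
      1 / q * ∑ b ∈ range q, ‖∑ a ∈ range q, g a * expChar (a * (b / q))‖ ^ 2 := by
  have hq0 : (q : ℂ) ≠ 0 := by exact_mod_cast hq.ne'
  apply Complex.ofReal_injective
  push_cast
  simp only [← Complex.conj_mul', map_sum, map_mul, sum_mul, mul_sum, conj_expChar]
  symm
  have h1 : ∀ b ∈ range q, (∑ a ∈ range q, ∑ a' ∈ range q, 1 / (q : ℂ) *
      ((starRingEnd ℂ) (g a') * expChar (-(a' * (b / q))) * (g a * expChar (a * (b / q))))) =
      ∑ a ∈ range q, ∑ a' ∈ range q, 1 / (q : ℂ) * ((starRingEnd ℂ) (g a') * g a) *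
        expChar (((a - a' : ℤ) : ℝ) * (b / q)) := by
    intro b _
    refine sum_congr rfl fun a _ => sum_congr rfl fun a' _ => ?_
    have : ((a - a' : ℤ) : ℝ) * (b / q) = -(a' * (b / q)) + a * (b / q) := by push_cast; ring
    rw [this, expChar_add]
    ring
  rw [sum_congr rfl h1, sum_comm]
  refine sum_congr rfl fun a ha => ?_
  rw [sum_comm]
  simp only [← mul_sum, sum_expChar_div hq]
  rw [sum_eq_single a]
  · simp only [sub_self, dvd_zero, if_true]
    field_simp
  · intro a' ha' hne
    rw [if_neg, mul_zero]
    intro hd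
    have h2 := mem_range.1 ha
    have h3 := mem_range.1 ha'
    have := Int.eq_zero_of_abs_lt_dvd hd (by rw [abs_lt]; constructor <;> omega)
    omega
  · exact fun h => absurd ha h

/-- Ramanujan's sum `c_d(b)`. -/
noncomputable def ramanujanSum (d b : ℕ) : ℂ :=
  ∑ a ∈ range d with a.Coprime d, expChar (b * (a / d))

lemma ramanujanSum_eq_moebius {d b : ℕ} (hd : 0 < d) (hb : b.Coprime d) :
    ramanujanSum d b = ArithmeticFunction.moebius d := by
  have h := (ArithmeticFunction.sum_eq_iff_sum_mul_moebius_eq_on (R := ℂ)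
    (f := fun n => ramanujanSum n b) (g := fun n => if n = 1 then 1 else 0)
    {n | b.Coprime n} (fun m n hmn hn => Nat.Coprime.coprime_dvd_right hmn hn)).1 ?_ d hd hb
  · rw [← h, Nat.sum_divisorsAntidiagonal (f := fun i j => (ArithmeticFunction.moebius i : ℂ) *
      if j = 1 then 1 else 0)]
    rw [sum_eq_single d]
    · simp [Nat.div_self hd]
    · intro e he hne
      have := Nat.mem_divisors.1 he
      rw [if_neg, mul_zero]
      intro h1
      apply hne
      have := Nat.div_mul_cancel this.1
      rw [h1, one_mul] at this
      exact this
    · intro hh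
      exact absurd (Nat.mem_divisors_self d hd.ne') hh
  · intro n hn hbn
    have e := sum_range_div_eq hn (fun t => expChar (((b : ℤ) : ℝ) * t))
    rw [sum_expChar_div hn] at e
    simp only [ramanujanSum]
    rw [show (∑ i ∈ n.divisors, ∑ a ∈ range i with a.Coprime i, expChar ((b : ℝ) * (a / i))) =
      ∑ d ∈ n.divisors, ∑ a ∈ range d with a.Coprime d, expChar (((b : ℤ) : ℝ) * (a / d)) from rfl,
      ← e]
    by_cases h1 : n = 1
    · simp [h1]
    · rw [if_neg, if_neg h1]
      intro hdvd
      have := Int.natCast_dvd_natCast.1 hdvd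
      exact h1 (Nat.Coprime.eq_one_of_dvd hbn.symm this)

end Hooley

namespace Hooley
open ArithmeticFunction (vonMangoldt)

lemma norm_ramanujanSum_le_one {d b : ℕ} (hd : 0 < d) (hb : b.Coprime d) :
    ‖ramanujanSum d b‖ ≤ 1 := by
  rw [ramanujanSum_eq_moebius hd hb]
  rw [Complex.norm_intCast]
  exact_mod_cast ArithmeticFunction.abs_moebius_le_one

lemma sum_coprime_eq_sum_units {M : Type*} [AddCommMonoid M] {q : ℕ} [NeZero q] (f : ℕ → M) :
    ∑ a ∈ range q with a.Coprime q, f a = ∑ u : (ZMod q)ˣ, f (u : ZMod q).val := by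
  symm
  refine sum_bij (fun u _ => (u : ZMod q).val) ?_ ?_ ?_ ?_
  · intro u _
    exact mem_filter.2 ⟨mem_range.2 (ZMod.val_lt _), ZMod.val_coe_unit_coprime u⟩
  · intro u _ v _ h
    exact Units.ext (ZMod.val_injective q h)
  · intro a ha
    obtain ⟨h1, h2⟩ := mem_filter.1 ha
    refine ⟨ZMod.unitOfCoprime a h2, mem_univ _, ?_⟩
    rw [ZMod.coe_unitOfCoprime, ZMod.val_natCast, Nat.mod_eq_of_lt (mem_range.1 h1)]
  · intros; rfl

lemma expChar_mod_mul_div {d : ℕ} (hd : 0 < d) (a b : ℕ) :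
    expChar ((b : ℝ) * ((a % d : ℕ) / d)) = expChar (a * (b / d)) := by
  have h : (a : ℝ) = (a % d : ℕ) + d * (a / d : ℕ) := by exact_mod_cast (Nat.mod_add_div a d).symm
  have hd0 : (d : ℝ) ≠ 0 := by positivity
  have : (a : ℝ) * (b / d) = (b : ℝ) * ((a % d : ℕ) / d) + ((b * (a / d : ℕ) : ℕ) : ℤ) := by
    rw [h]
    generalize a / d = k
    push_cast
    field_simp
  rw [this, expChar_add, expChar_intCast, mul_one]

lemma sum_coprime_expChar_div_totient {q d : ℕ} (hq : 0 < q) (hd : d ∣ q) (b : ℕ) :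
    (∑ a ∈ range q with a.Coprime q, expChar (a * (b / d))) / (q.totient : ℂ) =
      ramanujanSum d b / d.totient := by
  have hd0 : 0 < d := Nat.pos_of_dvd_of_pos hd hq
  have : NeZero q := ⟨hq.ne'⟩
  have : NeZero d := ⟨hd0.ne'⟩
  have hsurj := ZMod.unitsMap_surjective hd
  have hfib : ∀ v : (ZMod d)ˣ, #{u : (ZMod q)ˣ | ZMod.unitsMap hd u = v} =
      #{u : (ZMod q)ˣ | ZMod.unitsMap hd u = 1} := fun v =>
    MonoidHom.card_fiber_eq_of_mem_range _ (hsurj v) (hsurj 1)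
  have hsum : ∀ f : (ZMod d)ˣ → ℂ, ∑ u : (ZMod q)ˣ, f (ZMod.unitsMap hd u) =
      #{u : (ZMod q)ˣ | ZMod.unitsMap hd u = 1} * ∑ v, f v := by
    intro f
    rw [← sum_fiberwise (s := univ) (g := fun u : (ZMod q)ˣ => ZMod.unitsMap hd u), mul_sum]
    refine sum_congr rfl fun v _ => ?_
    rw [← hfib v, ← nsmul_eq_mul, ← sum_const]
    refine sum_congr rfl fun u hu => ?_
    rw [(mem_filter.1 hu).2]
  have h1 : (q.totient : ℂ) = #{u : (ZMod q)ˣ | ZMod.unitsMap hd u = 1} * d.totient := by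
    have := hsum fun _ => 1
    simpa [ZMod.card_units_eq_totient] using this
  have h2 : ∑ a ∈ range q with a.Coprime q, expChar (a * (b / d)) =
      #{u : (ZMod q)ˣ | ZMod.unitsMap hd u = 1} * ramanujanSum d b := by
    rw [ramanujanSum, sum_coprime_eq_sum_units, sum_coprime_eq_sum_units, ← hsum]
    refine sum_congr rfl fun u _ => ?_
    rw [ZMod.unitsMap_val, ZMod.cast_eq_val, ZMod.val_natCast, expChar_mod_mul_div hd0]
  have hq1 : (q.totient : ℂ) ≠ 0 := by exact_mod_cast (Nat.totient_pos.2 hq).ne'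
  have hd1 : (d.totient : ℂ) ≠ 0 := by exact_mod_cast (Nat.totient_pos.2 hd0).ne'
  have hk : (#{u : (ZMod q)ˣ | ZMod.unitsMap hd u = 1} : ℂ) ≠ 0 := by
    intro h
    rw [h, zero_mul] at h1
    exact hq1 h1
  rw [h1, h2, mul_div_mul_left _ _ hk]

/-- The exponential sum `∑_{n ≤ x} Λ(n) e(nθ)`. -/
noncomputable def primeExpSum (x θ : ℝ) : ℂ :=
  ∑ n ∈ Icc 1 ⌊x⌋₊, (vonMangoldt n : ℂ) * expChar (n * θ)

/-- The squared discrepancy of `∑ Λ(n) e(nb/d)` from its main term. -/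
noncomputable def discSq (x : ℝ) (d b : ℕ) : ℝ :=
  ‖primeExpSum x (b / d) - x * (ramanujanSum d b / d.totient)‖ ^ 2

lemma sum_psi_mul_expChar (x : ℝ) {q : ℕ} (hq : 0 < q) (b : ℕ) :
    ∑ a ∈ range q, (psi x q a : ℂ) * expChar (a * (b / q)) = primeExpSum x (b / q) := by
  simp only [psi, primeExpSum]
  push_cast
  rw [← sum_fiberwise_of_maps_to (s := Icc 1 ⌊x⌋₊) (t := range q) (g := fun n => n % q)
    (fun n _ => mem_range.2 (Nat.mod_lt _ hq))]
  refine sum_congr rfl fun a ha => ?_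
  rw [Nat.mod_eq_of_lt (mem_range.1 ha), sum_mul]
  refine sum_congr rfl fun n hn => ?_
  have h := (mem_filter.1 hn).2
  rw [← expChar_mod_mul_div hq n b, h]
  congr 2
  ring

lemma sum_Icc_one_eq_sum_range {M : Type*} [AddCommMonoid M] {q : ℕ} (hq : 0 < q) {f : ℕ → M}
    (h : f q = f 0) : ∑ a ∈ Icc 1 q, f a = ∑ a ∈ range q, f a := by
  obtain ⟨m, rfl⟩ : ∃ m, q = m + 1 := ⟨q - 1, by omega⟩
  rw [sum_Icc_succ_top (by omega), h, sum_range_succ']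
  congr 1
  rw [range_eq_Ico, sum_Ico_add' f 0 m 1]
  rfl

lemma sum_sq_psi_le (x : ℝ) {q : ℕ} (hq : 0 < q) :
    ∑ a ∈ (Icc 1 q).filter (fun a => Nat.gcd a q = 1), (psi x q a - x / (q.totient : ℝ)) ^ 2 ≤
      1 / q * ∑ d ∈ q.divisors, ∑ b ∈ range d with b.Coprime d, discSq x d b := by
  have h0 : ∑ a ∈ (Icc 1 q).filter (fun a => Nat.gcd a q = 1),
      (psi x q a - x / (q.totient : ℝ)) ^ 2 ≤ ∑ a ∈ range q,
        ‖(psi x q a : ℂ) - if Nat.gcd a q = 1 then (x : ℂ) * (1 / (q.totient : ℂ)) else 0‖ ^ 2 := by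
    rw [sum_filter, sum_Icc_one_eq_sum_range hq]
    · refine sum_le_sum fun a _ => ?_
      split_ifs with h
      · rw [mul_one_div, ← Complex.ofReal_natCast, ← Complex.ofReal_div, ← Complex.ofReal_sub, Complex.norm_real,
          Real.norm_eq_abs, sq_abs]
      · positivity
    · have : psi x q q = psi x q 0 := by unfold psi; rw [Nat.mod_self, Nat.zero_mod]
      simp only [Nat.gcd_self, Nat.gcd_zero_left, this]
  refine h0.trans (le_of_eq ?_)
  rw [parseval hq]
  congr 1
  have h1 : ∀ b ∈ range q, ‖∑ a ∈ range q, ((psi x q a : ℂ) -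
      if Nat.gcd a q = 1 then (x : ℂ) * (1 / (q.totient : ℂ)) else 0) * expChar (a * (b / q))‖ ^ 2 =
      ‖primeExpSum x (b / q) - x * ((∑ a ∈ range q with a.Coprime q, expChar (a * (b / q))) /
        (q.totient : ℂ))‖ ^ 2 := by
    intro b _
    simp only [sub_mul, sum_sub_distrib, ite_mul, zero_mul]
    rw [sum_psi_mul_expChar x hq, ← sum_filter, ← mul_sum]
    congr 3
    unfold Nat.Coprime
    ring
  rw [sum_congr rfl h1, sum_range_div_eq hq (fun t => ‖primeExpSum x t -
    x * ((∑ a ∈ range q with a.Coprime q, expChar (a * t)) / (q.totient : ℂ))‖ ^ 2)]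
  refine sum_congr rfl fun d hd => sum_congr rfl fun b _ => ?_
  rw [sum_coprime_expChar_div_totient hq (Nat.dvd_of_mem_divisors hd), discSq]

end Hooley

namespace Hooley
open ArithmeticFunction (vonMangoldt)

lemma one_le_log_of_three_le {x : ℝ} (hx : 3 ≤ x) : 1 ≤ Real.log x := by
  rw [Real.le_log_iff_exp_le (by linarith)]
  have := Real.exp_one_lt_d9
  linarith

lemma card_primeFactors_add_one_le_log {q : ℕ} (hq : q ≠ 0) {x : ℝ} (hx : 3 ≤ x) (hqx : (q : ℝ) ≤ x) :
    (#q.primeFactors : ℝ) + 1 ≤ 3 * Real.log x := by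
  have hq1 : (1 : ℝ) ≤ q := by exact_mod_cast Nat.one_le_iff_ne_zero.2 hq
  have h1 : (#q.primeFactors : ℝ) * Real.log 2 ≤ Real.log x := by
    rw [← Real.log_pow]
    apply Real.log_le_log (by positivity)
    refine le_trans ?_ hqx
    exact_mod_cast two_pow_card_primeFactors_le hq
  have := Real.log_two_gt_d9
  have := one_le_log_of_three_le hx
  have : (0 : ℝ) ≤ #q.primeFactors := by positivity
  nlinarith

lemma inv_totient_le {q : ℕ} (hq : q ≠ 0) {x : ℝ} (hx : 3 ≤ x) (hqx : (q : ℝ) ≤ x) :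
    1 / (q.totient : ℝ) ≤ 3 * Real.log x / q := by
  have h1 := le_totient_mul hq
  have h2 := card_primeFactors_add_one_le_log hq hx hqx
  have h3 : (0 : ℝ) < q.totient := by exact_mod_cast Nat.totient_pos.2 (Nat.pos_of_ne_zero hq)
  have h4 : (0 : ℝ) < q := by exact_mod_cast Nat.pos_of_ne_zero hq
  rw [div_le_div_iff₀ h3 h4, one_mul, mul_comm]
  exact h1.trans (mul_le_mul_of_nonneg_left h2 h3.le)

/-- The Farey fractions of order `Q`, as pairs of denominator and numerator. -/
def fareyPairs (Q : ℕ) : Finset (Σ _ : ℕ, ℕ) :=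
  (Icc 1 Q).sigma fun d => (range d).filter fun b => b.Coprime d

lemma spacedOn_fareyPairs (Q : ℕ) :
    SpacedOn (fareyPairs Q) (fun p => (p.2 : ℝ) / p.1) ((Q : ℝ) ^ 2)⁻¹ := by
  rintro ⟨d, b⟩ hr ⟨d', b'⟩ hs hne k
  simp only [fareyPairs, mem_sigma, mem_Icc, mem_filter, mem_range] at hr hs
  obtain ⟨⟨hd1, hdQ⟩, hb, hc⟩ := hr
  obtain ⟨⟨hd1', hdQ'⟩, hb', hc'⟩ := hs
  simp only
  have hd0 : (0 : ℝ) < d := by exact_mod_cast hd1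
  have hd0' : (0 : ℝ) < d' := by exact_mod_cast hd1'
  set m : ℤ := b * d' - b' * d + k * (d * d') with hm
  have heq : (b : ℝ) / d - b' / d' + k = m / (d * d') := by
    rw [hm]; push_cast; field_simp
  have hm0 : m ≠ 0 := by
    intro h0
    rw [h0, Int.cast_zero, zero_div] at heq
    have f1 : (0 : ℝ) ≤ (b : ℝ) / d := by positivity
    have f2 : (b : ℝ) / d < 1 := by rw [div_lt_one hd0]; exact_mod_cast hb
    have f3 : (0 : ℝ) ≤ (b' : ℝ) / d' := by positivity
    have f4 : (b' : ℝ) / d' < 1 := by rw [div_lt_one hd0']; exact_mod_cast hb'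
    have k1 : (-1 : ℝ) < k := by linarith
    have k2 : (k : ℝ) < 1 := by linarith
    have hk : k = 0 := by
      have : (-1 : ℤ) < k := by exact_mod_cast k1
      have : k < (1 : ℤ) := by exact_mod_cast k2
      omega
    rw [hk] at hm
    have h1 : b * d' = b' * d := by
      have : (b : ℤ) * d' = b' * d := by linarith
      exact_mod_cast this
    have h2 : d ∣ d' := hc.symm.dvd_of_dvd_mul_left ⟨b', by rw [h1]; ring⟩
    have h3 : d' ∣ d := hc'.symm.dvd_of_dvd_mul_left ⟨b, by rw [← h1]; ring⟩
    have h4 := Nat.dvd_antisymm h2 h3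
    subst h4
    have h5 := Nat.eq_of_mul_eq_mul_right hd1 h1
    subst h5
    exact hne rfl
  rw [heq, abs_div, abs_of_pos (by positivity : (0 : ℝ) < d * d')]
  have h1 : (1 : ℝ) ≤ |(m : ℝ)| := by exact_mod_cast Int.one_le_abs hm0
  have h2 : (d : ℝ) * d' ≤ (Q : ℝ) ^ 2 := by
    rw [pow_two]
    exact_mod_cast Nat.mul_le_mul hdQ hdQ'
  calc ((Q : ℝ) ^ 2)⁻¹ ≤ ((d : ℝ) * d')⁻¹ := inv_anti₀ (by positivity) h2
    _ = 1 / (d * d') := (one_div _).symm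
    _ ≤ _ := by gcongr

lemma sum_norm_primeExpSum_sq_le {x : ℝ} (hx : 3 ≤ x) {Q : ℕ} (hQ : 1 ≤ Q) (hQx : (Q : ℝ) ≤ x) :
    ∑ d ∈ Icc 1 Q, ∑ b ∈ range d with b.Coprime d, ‖primeExpSum x (b / d)‖ ^ 2 ≤
      x ^ 2 * Real.log x ^ 2 + 3 * x * Real.log x ^ 3 * (Q : ℝ) ^ 2 := by
  have hL := one_le_log_of_three_le hx
  have hQ1 : (1 : ℝ) ≤ Q := by exact_mod_cast hQ
  have h := large_sieve (by positivity) (spacedOn_fareyPairs Q) ⌊x⌋₊ fun n => (vonMangoldt n : ℂ)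
  rw [fareyPairs, sum_sigma] at h
  have h1 : ∑ n ∈ Icc 1 ⌊x⌋₊, ‖(vonMangoldt n : ℂ)‖ ^ 2 ≤ x * Real.log x ^ 2 := by
    have : ∀ n ∈ Icc 1 ⌊x⌋₊, ‖(vonMangoldt n : ℂ)‖ ^ 2 ≤ Real.log x ^ 2 := by
      intro n hn
      have e1 : 0 ≤ vonMangoldt n := ArithmeticFunction.vonMangoldt_nonneg
      rw [Complex.norm_real, Real.norm_of_nonneg e1]
      exact pow_le_pow_left₀ e1 (ArithmeticFunction.vonMangoldt_le_log.trans
        (log_le_log_of_mem (by linarith) hn).2) 2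
    refine (sum_le_card_nsmul _ _ _ this).trans ?_
    rw [nsmul_eq_mul, Nat.card_Icc, Nat.add_sub_cancel]
    exact mul_le_mul_of_nonneg_right (Nat.floor_le (by linarith)) (by positivity)
  have h2 : (⌊x⌋₊ : ℝ) + (((Q : ℝ) ^ 2)⁻¹)⁻¹ * harmonic ⌊(((Q : ℝ) ^ 2)⁻¹)⁻¹⌋₊ ≤
      x + (Q : ℝ) ^ 2 * (3 * Real.log x) := by
    rw [inv_inv]
    have e1 : ⌊(Q : ℝ) ^ 2⌋₊ = Q ^ 2 := by rw [← Nat.cast_pow, Nat.floor_natCast]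
    have e2 := harmonic_le_one_add_log (Q ^ 2)
    rw [Nat.cast_pow, Real.log_pow] at e2
    rw [e1]
    have e3 : Real.log Q ≤ Real.log x := Real.log_le_log (by linarith) hQx
    refine add_le_add (Nat.floor_le (by linarith)) (mul_le_mul_of_nonneg_left ?_ (by positivity))
    push_cast at e2
    linarith
  refine h.trans ((mul_le_mul h2 h1 (sum_nonneg fun _ _ => by positivity)
    (by positivity)).trans (le_of_eq (by ring)))

lemma sum_Ioc_div_le {g : ℕ → ℝ} (hg : ∀ d, 0 ≤ g d) {α β : ℝ} (hα : 0 ≤ α) (hβ : 0 ≤ β) {K Q : ℕ}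
    (hK : 1 ≤ K) (h : ∀ m, 1 ≤ m → m ≤ Q → ∑ d ∈ Icc 1 m, g d ≤ α + β * (m : ℝ) ^ 2) :
    ∑ d ∈ Ioc K Q, g d / d ≤ α / K + 2 * β * Q := by
  have hK0 : (0 : ℝ) < K := by exact_mod_cast hK
  rcases lt_or_ge Q K with hQ | hQ
  · rw [Ioc_eq_empty (by omega), sum_empty]
    positivity
  have key : ∀ m, K ≤ m → m ≤ Q → ∑ d ∈ Ioc K m, g d / d ≤
      (∑ d ∈ Icc 1 m, g d) / m + α * ((K : ℝ)⁻¹ - (m : ℝ)⁻¹) + β * (m - K) := by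
    intro m hm
    induction m, hm using Nat.le_induction with
    | base =>
      intro _
      have : 0 ≤ ∑ d ∈ Icc 1 K, g d := sum_nonneg fun d _ => hg d
      simp only [Ioc_self, sum_empty, sub_self, mul_zero, add_zero]
      positivity
    | succ m hm ih =>
      intro hmQ
      have h1 := ih (by omega)
      have h2 := h m (by omega) (by omega)
      have hm0 : (0 : ℝ) < m := by exact_mod_cast (by omega : 0 < m)
      rw [sum_Ioc_succ_top (by omega),
        sum_Icc_succ_top (by omega)]
      set G := ∑ d ∈ Icc 1 m, g d with hG
      push_cast
      have h3 : G / (m * (m + 1)) ≤ α / (m * (m + 1)) + β := by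
        rw [div_add' _ _ _ (by positivity)]
        gcongr
        nlinarith
      have h4 : (G + g (m + 1)) / ((m : ℝ) + 1) + α * ((K : ℝ)⁻¹ - ((m : ℝ) + 1)⁻¹) +
          β * (m + 1 - K) - (G / m + α * ((K : ℝ)⁻¹ - (m : ℝ)⁻¹) + β * (m - K) +
          g (m + 1) / (m + 1)) = α / (m * (m + 1)) + β - G / (m * (m + 1)) := by
        field_simp
        ring
      linarith
  have hk := key Q hQ le_rfl
  have hq0 : (0 : ℝ) < Q := by exact_mod_cast (by omega : 0 < Q)
  have h5 : (∑ d ∈ Icc 1 Q, g d) / Q ≤ α / Q + β * Q := by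
    rw [div_add' _ _ _ hq0.ne']
    gcongr
    have := h Q (by omega) le_rfl
    linarith [pow_two (Q : ℝ)]
  have h6 : α * ((K : ℝ)⁻¹ - (Q : ℝ)⁻¹) = α / K - α / Q := by ring
  have h7 : 0 ≤ β * K := by positivity
  linarith

lemma sum_psi_not_coprime (x : ℝ) {d : ℕ} (hd : 0 < d) :
    ∑ a ∈ range d with ¬ a.Coprime d, psi x d a =
      ∑ n ∈ Icc 1 ⌊x⌋₊ with ¬ n.Coprime d, vonMangoldt n := by
  have hc : ∀ n : ℕ, (n % d).Coprime d ↔ n.Coprime d := fun n => by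
    rw [Nat.Coprime, Nat.Coprime, ← Nat.gcd_rec, Nat.gcd_comm]
  rw [← sum_fiberwise_of_maps_to (s := (Icc 1 ⌊x⌋₊).filter fun n => ¬ n.Coprime d)
    (t := (range d).filter fun a => ¬ a.Coprime d)
    (g := fun n => n % d)]
  · refine sum_congr rfl fun a ha => ?_
    obtain ⟨h1, h2⟩ := mem_filter.1 ha
    rw [psi, filter_filter]
    refine sum_congr (filter_congr fun n _ => ?_) fun _ _ => rfl
    rw [Nat.mod_eq_of_lt (mem_range.1 h1)]
    constructor
    · rintro h
      refine ⟨?_, h⟩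
      rwa [← hc, h]
    · exact fun h => h.2
  · intro n hn
    rw [mem_filter, hc]
    exact ⟨mem_range.2 (Nat.mod_lt _ hd), (mem_filter.1 hn).2⟩

lemma discSq_le_of_small (A : ℕ) : ∃ C : ℝ, 0 < C ∧ ∀ x : ℝ, 3 ≤ x → ∀ d : ℕ, 1 ≤ d →
    (d : ℝ) ≤ Real.log x ^ A → ∀ b : ℕ, discSq x d b ≤ (C * d * (x / Real.log x ^ A)) ^ 2 := by
  obtain ⟨C, hC, h⟩ := siegel_walfisz A
  refine ⟨C + 3 * (A + 2).factorial, by positivity, fun x hx d hd hdA b => ?_⟩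
  have hL := one_le_log_of_three_le hx
  have hx0 : 0 < x := by linarith
  have hd1 : (1 : ℝ) ≤ d := by exact_mod_cast hd
  have hL0 : 0 < Real.log x ^ A := by positivity
  have e1 : primeExpSum x (b / d) - x * (ramanujanSum d b / d.totient) =
      ∑ a ∈ range d with a.Coprime d,
        ((psi x d a - x / (d.totient : ℝ) : ℝ) : ℂ) * expChar (a * (b / d)) +
      ∑ a ∈ range d with ¬ a.Coprime d, (psi x d a : ℂ) * expChar (a * (b / d)) := by
    rw [← sum_psi_mul_expChar x hd b, ← sum_filter_add_sum_filter_not (range d) (fun a => a.Coprime d),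
      ramanujanSum, add_sub_right_comm]
    congr 1
    rw [sum_div, mul_sum, ← sum_sub_distrib]
    refine sum_congr rfl fun a _ => ?_
    rw [show (b : ℝ) * (a / d) = a * (b / d) by ring]
    push_cast
    ring
  have e2 : ‖∑ a ∈ range d with a.Coprime d,
      ((psi x d a - x / (d.totient : ℝ) : ℝ) : ℂ) * expChar (a * (b / d))‖ ≤
      d * (C * x / Real.log x ^ A) := by
    refine (norm_sum_le _ _).trans ?_
    refine (sum_le_card_nsmul _ _ (C * x / Real.log x ^ A) fun a ha => ?_).trans ?_
    · rw [norm_mul, norm_expChar, mul_one, Complex.norm_real]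
      exact h x hx d hd hdA a (mem_filter.1 ha).2
    · rw [nsmul_eq_mul]
      gcongr
      exact (card_filter_le _ _).trans (card_range d).le
  have e3 : ‖∑ a ∈ range d with ¬ a.Coprime d, (psi x d a : ℂ) * expChar (a * (b / d))‖ ≤
      d * (3 * (A + 2).factorial * x / Real.log x ^ A) := by
    have f0 : ∀ a, 0 ≤ psi x d a := fun a =>
      sum_nonneg fun _ _ => ArithmeticFunction.vonMangoldt_nonneg
    calc _ ≤ ∑ a ∈ range d with ¬ a.Coprime d, psi x d a := by
          refine (norm_sum_le _ _).trans (le_of_eq (sum_congr rfl fun a _ => ?_))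
          rw [norm_mul, norm_expChar, mul_one, Complex.norm_real, Real.norm_of_nonneg (f0 a)]
      _ = ∑ n ∈ Icc 1 ⌊x⌋₊ with ¬ n.Coprime d, vonMangoldt n * Real.log n ^ 0 := by
          rw [sum_psi_not_coprime x hd]
          simp
      _ ≤ #d.primeFactors * (3 * Real.log x ^ (0 + 2)) := sum_not_coprime_le 0 d (by omega) hx
      _ ≤ d * (3 * Real.log x ^ 2) := by
          rw [zero_add]
          gcongr
          have := two_pow_card_primeFactors_le (by omega : d ≠ 0)
          exact (Nat.lt_two_pow_self).le.trans this
      _ ≤ _ := by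
          have := log_pow_le_factorial_mul (by linarith : 1 ≤ x) (A + 2)
          refine mul_le_mul_of_nonneg_left ?_ (by positivity)
          rw [le_div_iff₀ hL0, mul_assoc, ← pow_add, add_comm 2 A]
          linarith
  unfold discSq
  refine pow_le_pow_left₀ (norm_nonneg _) ?_ 2
  rw [e1]
  refine (norm_add_le _ _).trans ((add_le_add e2 e3).trans (le_of_eq (by ring)))

lemma sum_dvd_inv_le {d : ℕ} (hd : 0 < d) (N : ℕ) :
    ∑ q ∈ Icc 1 N with d ∣ q, 1 / (q : ℝ) ≤ (1 + Real.log N) / d := by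
  calc ∑ q ∈ Icc 1 N with d ∣ q, 1 / (q : ℝ) ≤
        ∑ q ∈ (Icc 1 N).image (fun m => d * m), 1 / (q : ℝ) := by
        refine sum_le_sum_of_subset_of_nonneg ?_ fun _ _ _ => by positivity
        intro q hq
        obtain ⟨h1, m, rfl⟩ := mem_filter.1 hq
        rw [mem_Icc] at h1
        refine mem_image.2 ⟨m, mem_Icc.2 ⟨Nat.pos_of_mul_pos_left h1.1, ?_⟩, rfl⟩
        exact (Nat.le_mul_of_pos_left m hd).trans h1.2
    _ = (harmonic N : ℝ) / d := by
        rw [sum_image fun m _ n _ hmn => Nat.eq_of_mul_eq_mul_left hd hmn, harmonic_eq_sum_Icc]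
        push_cast
        rw [sum_div]
        refine sum_congr rfl fun m _ => ?_
        rw [one_div, mul_inv, mul_comm, div_eq_mul_inv]
    _ ≤ _ := by
        gcongr
        exact harmonic_le_one_add_log N

end Hooley

namespace Hooley
open ArithmeticFunction (vonMangoldt)

lemma V_le_sum_discSq {x Q : ℝ} (hx : 3 ≤ x) (hQx : Q ≤ x) :
    V x Q ≤ (1 + Real.log x) *
      ∑ d ∈ Icc 1 ⌊Q⌋₊, (∑ b ∈ range d with b.Coprime d, discSq x d b) / d := by
  have hL := one_le_log_of_three_le hx
  set N := ⌊Q⌋₊ with hN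
  have hh0 : ∀ d, 0 ≤ ∑ b ∈ range d with b.Coprime d, discSq x d b := fun d =>
    sum_nonneg fun _ _ => by unfold discSq; positivity
  set h : ℕ → ℝ := fun d => ∑ b ∈ range d with b.Coprime d, discSq x d b with hh
  have hNx : Real.log N ≤ Real.log x := by
    rcases Nat.eq_zero_or_pos N with h0 | h0
    · rw [h0]; simp; linarith
    · have h1 : (1 : ℝ) ≤ N := by exact_mod_cast h0
      have hQ0 : 0 ≤ Q := (Nat.pos_of_floor_pos h0).le
      exact Real.log_le_log (by linarith) ((Nat.floor_le hQ0).trans hQx)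
  calc V x Q ≤ ∑ q ∈ Icc 1 N, 1 / q * ∑ d ∈ q.divisors, h d :=
        sum_le_sum fun q hq => sum_sq_psi_le x (mem_Icc.1 hq).1
    _ = ∑ q ∈ Icc 1 N, ∑ d ∈ Icc 1 N, if d ∣ q then 1 / (q : ℝ) * h d else 0 := by
        refine sum_congr rfl fun q hq => ?_
        rw [mem_Icc] at hq
        rw [← sum_filter, mul_sum]
        refine sum_congr ?_ fun _ _ => rfl
        ext d
        rw [Nat.mem_divisors, mem_filter, mem_Icc]
        constructor
        · rintro ⟨h1, h2⟩
          have := Nat.le_of_dvd (by omega) h1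
          exact ⟨⟨Nat.pos_of_dvd_of_pos h1 (by omega), by omega⟩, h1⟩
        · exact fun hd => ⟨hd.2, by omega⟩
    _ = ∑ d ∈ Icc 1 N, h d * ∑ q ∈ Icc 1 N with d ∣ q, 1 / (q : ℝ) := by
        rw [sum_comm]
        refine sum_congr rfl fun d _ => ?_
        rw [← sum_filter, mul_sum]
        exact sum_congr rfl fun q _ => mul_comm _ _
    _ ≤ ∑ d ∈ Icc 1 N, h d * ((1 + Real.log x) / d) := by
        refine sum_le_sum fun d hd => mul_le_mul_of_nonneg_left ?_ (hh0 d)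
        refine (sum_dvd_inv_le (mem_Icc.1 hd).1 N).trans ?_
        gcongr
    _ = _ := by
        rw [mul_sum]
        exact sum_congr rfl fun d _ => by ring

lemma sum_discSq_le {x : ℝ} (hx : 3 ≤ x) {d : ℕ} (hd : 1 ≤ d) (hdx : (d : ℝ) ≤ x) :
    ∑ b ∈ range d with b.Coprime d, discSq x d b ≤
      2 * ∑ b ∈ range d with b.Coprime d, ‖primeExpSum x (b / d)‖ ^ 2 +
        6 * x ^ 2 * Real.log x / d := by
  have hφ : (0 : ℝ) < d.totient := by exact_mod_cast Nat.totient_pos.2 hd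
  have h1 : ∀ b ∈ (range d).filter (fun b => b.Coprime d), discSq x d b ≤
      2 * ‖primeExpSum x (b / d)‖ ^ 2 + 2 * (x / d.totient) ^ 2 := by
    intro b hb
    have e1 : ‖(x : ℂ) * (ramanujanSum d b / d.totient)‖ ≤ x / d.totient := by
      rw [norm_mul, norm_div, Complex.norm_real, Complex.norm_natCast, Real.norm_of_nonneg (by linarith),
        ← mul_div_assoc]
      gcongr
      exact mul_le_of_le_one_right (by linarith) (norm_ramanujanSum_le_one hd (mem_filter.1 hb).2)
    have e2 := norm_sub_le (primeExpSum x (b / d)) (x * (ramanujanSum d b / d.totient))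
    have e3 := pow_le_pow_left₀ (norm_nonneg _) (e2.trans (add_le_add le_rfl e1)) 2
    unfold discSq
    nlinarith [sq_nonneg (‖primeExpSum x (b / d)‖ - x / d.totient)]
  refine (sum_le_sum h1).trans ?_
  rw [sum_add_distrib, ← mul_sum, sum_const, nsmul_eq_mul]
  refine add_le_add le_rfl ?_
  have hcard : #{b ∈ range d | b.Coprime d} = d.totient := by
    rw [Nat.totient_eq_card_coprime]
    congr 1
    exact filter_congr fun b _ => Nat.coprime_comm
  have h2 := inv_totient_le (by omega) hx hdx
  rw [hcard]
  calc (d.totient : ℝ) * (2 * (x / d.totient) ^ 2) = 2 * x ^ 2 * (1 / d.totient) := by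
        field_simp
    _ ≤ 2 * x ^ 2 * (3 * Real.log x / d) := by gcongr
    _ = _ := by ring

/-- The Barban–Davenport–Halberstam theorem. -/
theorem bdh (A : ℕ) : ∃ C : ℝ, 0 < C ∧ ∀ x : ℝ, 3 ≤ x → ∀ Q : ℝ,
    Q ≤ x / Real.log x ^ (A + 4) → V x Q ≤ C * x ^ 2 / Real.log x ^ A := by
  obtain ⟨C, hC, hsm⟩ := discSq_le_of_small (2 * A + 5)
  refine ⟨2 * (C ^ 2 + 28), by positivity, fun x hx Q hQ => ?_⟩
  have hL := one_le_log_of_three_le hx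
  have hx0 : 0 < x := by linarith
  have hQx : Q ≤ x := hQ.trans (div_le_self hx0.le (one_le_pow₀ hL))
  refine (V_le_sum_discSq hx hQx).trans ?_
  set L := Real.log x with hLdef
  have hL0 : 0 < L := by linarith
  set N := ⌊Q⌋₊ with hN
  set h : ℕ → ℝ := fun d => ∑ b ∈ range d with b.Coprime d, discSq x d b with hh
  have hh0 : ∀ d, 0 ≤ h d := fun d => sum_nonneg fun _ _ => by unfold discSq; positivity
  have hNQ : (N : ℝ) ≤ x / L ^ (A + 4) := by
    rcases Nat.eq_zero_or_pos N with h0 | h0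
    · rw [h0, Nat.cast_zero]; positivity
    · exact (Nat.floor_le (Nat.pos_of_floor_pos h0).le).trans hQ
  have hNx : (N : ℝ) ≤ x := hNQ.trans (div_le_self hx0.le (one_le_pow₀ hL))
  set K := ⌊L ^ (A + 3)⌋₊ with hK
  have hK1 : 1 ≤ K := Nat.le_floor (by simpa using one_le_pow₀ hL)
  have hKL : (K : ℝ) ≤ L ^ (A + 3) := Nat.floor_le (by positivity)
  have hKpos : (0 : ℝ) < K := by exact_mod_cast hK1
  have hKL2 : 1 / (K : ℝ) ≤ 2 / L ^ (A + 3) := by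
    rw [div_le_div_iff₀ hKpos (by positivity)]
    have := Nat.lt_floor_add_one (L ^ (A + 3))
    have : (1 : ℝ) ≤ K := by exact_mod_cast hK1
    linarith
  have hsplit : ∑ d ∈ Icc 1 N, h d / d ≤ ∑ d ∈ Icc 1 K, h d / d + ∑ d ∈ Ioc K N, h d / d := by
    rw [← sum_union (by
      rw [disjoint_left]
      intro d h1 h2
      rw [mem_Icc] at h1
      rw [mem_Ioc] at h2
      omega)]
    refine sum_le_sum_of_subset_of_nonneg (fun d hd => ?_) fun d _ _ =>
      div_nonneg (hh0 d) (by positivity)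
    rw [mem_union, mem_Icc, mem_Ioc]
    rw [mem_Icc] at hd
    omega
  have hp1 : ∑ d ∈ Icc 1 K, h d / d ≤ C ^ 2 * (x ^ 2 / L ^ (A + 1)) := by
    have e1 : ∀ d ∈ Icc 1 K, h d / d ≤ (C * K * (x / L ^ (2 * A + 5))) ^ 2 := by
      intro d hd
      rw [mem_Icc] at hd
      have hdK : (d : ℝ) ≤ K := by exact_mod_cast hd.2
      have hd0 : (0 : ℝ) < d := by exact_mod_cast hd.1
      rw [div_le_iff₀ hd0]
      have e2 : ∀ b ∈ (range d).filter (fun b => b.Coprime d),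
          discSq x d b ≤ (C * K * (x / L ^ (2 * A + 5))) ^ 2 := fun b _ =>
        (hsm x hx d hd.1 (hdK.trans (hKL.trans (pow_le_pow_right₀ hL (by omega)))) b).trans
          (by gcongr)
      refine (sum_le_card_nsmul _ _ _ e2).trans ?_
      rw [nsmul_eq_mul, mul_comm]
      gcongr
      exact (card_filter_le _ _).trans (card_range d).le
    refine (sum_le_card_nsmul _ _ _ e1).trans ?_
    rw [nsmul_eq_mul, Nat.card_Icc, Nat.add_sub_cancel]
    have e3 : (K : ℝ) ^ 3 ≤ (L ^ (A + 3)) ^ 3 := by gcongr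
    have e4 : (L ^ (A + 3)) ^ 3 * L ^ (A + 1) = (L ^ (2 * A + 5)) ^ 2 := by
      rw [← pow_mul, ← pow_mul, ← pow_add]; congr 1; ring
    calc (K : ℝ) * (C * K * (x / L ^ (2 * A + 5))) ^ 2 =
          C ^ 2 * (x ^ 2 * K ^ 3 / (L ^ (2 * A + 5)) ^ 2) := by ring
      _ ≤ C ^ 2 * (x ^ 2 * (L ^ (A + 3)) ^ 3 / (L ^ (2 * A + 5)) ^ 2) := by gcongr
      _ = _ := by rw [← e4]; field_simp
  have hp2 : ∑ d ∈ Ioc K N, h d / d ≤ 28 * (x ^ 2 / L ^ (A + 1)) := by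
    set g : ℕ → ℝ := fun d => ∑ b ∈ range d with b.Coprime d, ‖primeExpSum x (b / d)‖ ^ 2 with hg
    have e1 : ∀ d ∈ Ioc K N, h d / d ≤ 2 * (g d / d) + 6 * x ^ 2 * L * ((d : ℝ) ^ 2)⁻¹ := by
      intro d hd
      rw [mem_Ioc] at hd
      have hd0 : (0 : ℝ) < d := by exact_mod_cast (by omega : 0 < d)
      have hdN : (d : ℝ) ≤ N := by exact_mod_cast hd.2
      have := sum_discSq_le hx (by omega : 1 ≤ d) (hdN.trans hNx)
      rw [div_le_iff₀ hd0]
      refine this.trans (le_of_eq ?_)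
      field_simp
      rfl
    have e2 := sum_Ioc_div_le (g := g) (fun d => sum_nonneg fun _ _ => by positivity)
      (α := x ^ 2 * L ^ 2) (β := 3 * x * L ^ 3) (by positivity) (by positivity) hK1 (Q := N)
      (fun m h1 h2 => sum_norm_primeExpSum_sq_le hx h1
        ((by exact_mod_cast h2 : (m : ℝ) ≤ N).trans hNx))
    have e3 : ∑ d ∈ Ioc K N, ((d : ℝ) ^ 2)⁻¹ ≤ 1 / K := by
      rcases le_total K N with hKN | hKN
      · have := sum_Ioc_inv_sq_le_sub (α := ℝ) (by omega : K ≠ 0) hKN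
        have h0 : (0 : ℝ) ≤ (N : ℝ)⁻¹ := by positivity
        rw [one_div]
        linarith
      · rw [Ioc_eq_empty (by omega), sum_empty]
        positivity
    refine (sum_le_sum e1).trans ?_
    rw [sum_add_distrib, ← mul_sum, ← mul_sum]
    have f1 : x ^ 2 * L ^ 2 / K ≤ 2 * (x ^ 2 / L ^ (A + 1)) := by
      calc x ^ 2 * L ^ 2 / K = x ^ 2 * L ^ 2 * (1 / K) := by ring
        _ ≤ x ^ 2 * L ^ 2 * (2 / L ^ (A + 3)) := by gcongr
        _ = _ := by
          rw [show A + 3 = (A + 1) + 2 by ring, pow_add L (A + 1) 2]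
          field_simp
    have f2 : 2 * (3 * x * L ^ 3) * N ≤ 6 * (x ^ 2 / L ^ (A + 1)) := by
      calc 2 * (3 * x * L ^ 3) * N ≤ 2 * (3 * x * L ^ 3) * (x / L ^ (A + 4)) := by gcongr
        _ = _ := by
          rw [show A + 4 = (A + 1) + 3 by ring, pow_add L (A + 1) 3]
          field_simp
          norm_num
    have f3 : 6 * x ^ 2 * L * ∑ d ∈ Ioc K N, ((d : ℝ) ^ 2)⁻¹ ≤ 12 * (x ^ 2 / L ^ (A + 1)) := by
      calc 6 * x ^ 2 * L * ∑ d ∈ Ioc K N, ((d : ℝ) ^ 2)⁻¹ ≤ 6 * x ^ 2 * L * (2 / L ^ (A + 3)) := by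
            gcongr
            exact e3.trans hKL2
        _ = 12 * (x ^ 2 / L ^ (A + 2)) := by
          rw [show A + 3 = (A + 2) + 1 by ring, pow_add L (A + 2) 1]
          field_simp
          norm_num
        _ ≤ _ := by
          gcongr 12 * (x ^ 2 / ?_)
          exact pow_le_pow_right₀ hL (by omega)
    linarith
  calc (1 + L) * ∑ d ∈ Icc 1 N, h d / d ≤ (2 * L) * ((C ^ 2 + 28) * (x ^ 2 / L ^ (A + 1))) := by
        refine mul_le_mul (by linarith) ?_ (sum_nonneg fun d _ => div_nonneg (hh0 d) (by positivity))
          (by positivity)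
        linarith
    _ = _ := by
        rw [pow_succ L A]
        field_simp

end Hooley

namespace Hooley
open Filter Topology

lemma exists_limit {a ε : ℕ → ℝ} (hε : Tendsto ε atTop (𝓝 0))
    (h : ∀ n m, 1 ≤ n → n ≤ m → |a m - a n| ≤ ε n) :
    ∃ l : ℝ, Tendsto a atTop (𝓝 l) ∧ ∀ n, 1 ≤ n → |a n - l| ≤ ε n := by
  have hc : CauchySeq a := by
    rw [Metric.cauchySeq_iff']
    intro e he
    obtain ⟨N, hN⟩ := ((hε.eventually (gt_mem_nhds he)).and (eventually_ge_atTop 1)).exists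
    exact ⟨N, fun n hn => lt_of_le_of_lt (h N n hN.2 hn) hN.1⟩
  obtain ⟨l, hl⟩ := cauchySeq_tendsto_of_complete hc
  refine ⟨l, hl, fun n hn => ?_⟩
  have h1 : Tendsto (fun m => |a m - a n|) atTop (𝓝 |l - a n|) := (hl.sub_const _).abs
  rw [abs_sub_comm]
  exact le_of_tendsto h1 ((eventually_ge_atTop n).mono fun m hm => h n m hn hm)

lemma log_one_add_inv_bounds {n : ℕ} (hn : 1 ≤ n) :
    0 ≤ (1 / (n : ℝ) + 1 / (n + 1)) / 2 - Real.log ((n + 1 : ℝ) / n) ∧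
    (1 / (n : ℝ) + 1 / (n + 1)) / 2 - Real.log ((n + 1 : ℝ) / n) ≤
      1 / (n : ℝ) ^ 2 - 1 / ((n : ℝ) + 1) ^ 2 := by
  have hn0 : (0 : ℝ) < n := by exact_mod_cast hn
  constructor
  · have h1 : 0 ≤ Real.log ((n + 1 : ℝ) / n) := Real.log_nonneg (by rw [le_div_iff₀ hn0]; linarith)
    have h2 := Real.self_le_sinh_iff.2 h1
    rw [Real.sinh_log (by positivity)] at h2
    have h3 : (((n : ℝ) + 1) / n - (((n : ℝ) + 1) / n)⁻¹) / 2 = (1 / (n : ℝ) + 1 / (n + 1)) / 2 := by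
      field_simp
      ring
    linarith
  · have h1 := Real.le_log_one_add_of_nonneg (x := 1 / (n : ℝ)) (by positivity)
    have h2 : 1 + 1 / (n : ℝ) = (n + 1) / n := by field_simp
    rw [h2] at h1
    have h3 : 2 * (1 / (n : ℝ)) / (1 / n + 2) = 2 / (2 * n + 1) := by field_simp; ring
    rw [h3] at h1
    have h4 : (1 / (n : ℝ) + 1 / (n + 1)) / 2 - 2 / (2 * n + 1) =
        1 / (2 * n * (n + 1) * (2 * n + 1)) := by
      field_simp
      ring
    have h5 : 1 / (n : ℝ) ^ 2 - 1 / ((n : ℝ) + 1) ^ 2 = (2 * n + 1) / (n ^ 2 * (n + 1) ^ 2) := by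
      field_simp
      ring
    have h6 : 1 / (2 * (n : ℝ) * (n + 1) * (2 * n + 1)) ≤ (2 * n + 1) / (n ^ 2 * (n + 1) ^ 2) := by
      rw [div_le_div_iff₀ (by positivity) (by positivity)]
      have e1 : (n : ℝ) * (n + 1) ≤ 2 * (2 * n + 1) * (2 * n + 1) := by nlinarith
      have e2 : (0 : ℝ) < n * (n + 1) := by positivity
      nlinarith
    linarith

/-- The harmonic numbers to second order. -/
lemma exists_harmonic_asymp : ∃ γ : ℝ, ∀ n : ℕ, 1 ≤ n →
    |∑ m ∈ Icc 1 n, 1 / (m : ℝ) - Real.log n - 1 / (2 * n) - γ| ≤ 1 / (n : ℝ) ^ 2 := by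
  set a : ℕ → ℝ := fun n => ∑ m ∈ Icc 1 n, 1 / (m : ℝ) - Real.log n - 1 / (2 * n) with ha
  have hstep : ∀ n, 1 ≤ n → a (n + 1) - a n =
      (1 / (n : ℝ) + 1 / (n + 1)) / 2 - Real.log ((n + 1 : ℝ) / n) := by
    intro n hn
    have hn0 : (0 : ℝ) < n := by exact_mod_cast hn
    simp only [ha]
    rw [sum_Icc_succ_top (by omega), Real.log_div (by positivity) (by positivity)]
    push_cast
    field_simp
    ring
  have hd : ∀ n m, 1 ≤ n → n ≤ m → 0 ≤ a m - a n ∧ a m - a n ≤ 1 / (n : ℝ) ^ 2 - 1 / (m : ℝ) ^ 2 := by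
    intro n m hn hm
    induction m, hm using Nat.le_induction with
    | base => simp
    | succ m hm ih =>
      have h1 := hstep m (by omega)
      have h2 := log_one_add_inv_bounds (n := m) (by omega)
      push_cast
      constructor <;> linarith [h2.1, h2.2, ih.1, ih.2]
  obtain ⟨l, _, hl⟩ := exists_limit (a := a) (ε := fun n => 1 / (n : ℝ) ^ 2)
    (by simpa using tendsto_const_div_pow (1 : ℝ) 2 (by norm_num)) fun n m hn hm => by
      obtain ⟨h1, h2⟩ := hd n m hn hm
      rw [abs_of_nonneg h1]
      have : 0 ≤ 1 / (m : ℝ) ^ 2 := by positivity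
      linarith
  exact ⟨l, hl⟩

/-- The weighted sum `∑_{m ≤ y} (y - m)² / m`. -/
noncomputable def rieszInv (y : ℝ) : ℝ := ∑ m ∈ Icc 1 ⌊y⌋₊, (y - m) ^ 2 / m

lemma rieszInv_of_lt_one {y : ℝ} (hy : y < 1) : rieszInv y = 0 := by
  rw [rieszInv, Nat.floor_eq_zero.2 hy]
  simp

lemma rieszInv_eq_sum_max {y : ℝ} {N : ℕ} (hN : y < N + 1) :
    rieszInv y = ∑ m ∈ Icc 1 N, (max (y - m) 0) ^ 2 / m := by
  have h1 : ⌊y⌋₊ ≤ N := Nat.lt_succ_iff.1 ((Nat.floor_lt' (by omega)).2 (by push_cast; exact hN))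
  rw [rieszInv, ← sum_subset (Icc_subset_Icc_right h1)]
  · refine sum_congr rfl fun m hm => ?_
    rw [mem_Icc] at hm
    have := (Nat.le_floor_iff' (by omega)).1 hm.2
    rw [max_eq_left (by linarith)]
  · intro m hm hm'
    rw [mem_Icc] at hm hm'
    have : ⌊y⌋₊ < m := by omega
    have := (Nat.floor_lt' (by omega)).1 this
    rw [max_eq_right (by linarith)]
    simp

lemma rieszInv_nonneg (y : ℝ) : 0 ≤ rieszInv y := sum_nonneg fun _ _ => by positivity

lemma rieszInv_mono : Monotone rieszInv := by
  intro y z hyz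
  obtain ⟨N, hN⟩ := exists_nat_gt z
  rw [rieszInv_eq_sum_max (N := N) (by linarith), rieszInv_eq_sum_max (N := N) (by linarith)]
  refine sum_le_sum fun m _ => ?_
  have : max (y - m) 0 ≤ max (z - m) 0 := max_le_max (by linarith) le_rfl
  have : 0 ≤ max (y - (m : ℝ)) 0 := le_max_right _ _
  gcongr

lemma continuous_rieszInv : Continuous rieszInv := by
  rw [continuous_iff_continuousAt]
  intro y
  obtain ⟨N, hN⟩ := exists_nat_gt y
  have h1 : rieszInv =ᶠ[𝓝 y] fun z => ∑ m ∈ Icc 1 N, (max (z - m) 0) ^ 2 / m := by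
    filter_upwards [gt_mem_nhds hN] with z hz
    exact rieszInv_eq_sum_max (by linarith)
  refine ContinuousAt.congr ?_ h1.symm
  fun_prop

lemma abs_log_one_sub_add_le {s : ℝ} (_h0 : 0 ≤ s) (h1 : s ≤ 1 / 2) :
    |Real.log (1 - s) + s| ≤ 2 * s ^ 2 := by
  rw [abs_le]
  have h2 := Real.log_le_sub_one_of_pos (by linarith : 0 < 1 - s)
  have h3 := Real.one_sub_inv_le_log_of_pos (by linarith : 0 < 1 - s)
  have h4 : 1 - (1 - s)⁻¹ + s = -(s ^ 2 / (1 - s)) := by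
    have : 1 - s ≠ 0 := by linarith
    field_simp
    ring
  have h5 : s ^ 2 / (1 - s) ≤ 2 * s ^ 2 := by
    rw [div_le_iff₀ (by linarith)]
    nlinarith [sq_nonneg s]
  constructor <;> nlinarith [sq_nonneg s]

lemma exists_rieszInv_asymp_of_one_le {γ : ℝ} (hγ : ∀ n : ℕ, 1 ≤ n →
    |∑ m ∈ Icc 1 n, 1 / (m : ℝ) - Real.log n - 1 / (2 * n) - γ| ≤ 1 / (n : ℝ) ^ 2) {y : ℝ}
    (hy : 1 ≤ y) : |rieszInv y - (y ^ 2 * (Real.log y + (γ - 3 / 2)) + y)| ≤ 8 := by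
  set N := ⌊y⌋₊ with hN
  have hN1 : 1 ≤ N := Nat.le_floor (by simpa using hy)
  have hNy : (N : ℝ) ≤ y := Nat.floor_le (by linarith)
  have hyN : y < N + 1 := Nat.lt_floor_add_one y
  have hN0 : (1 : ℝ) ≤ N := by exact_mod_cast hN1
  set t := y - N with ht
  set e := ∑ m ∈ Icc 1 N, 1 / (m : ℝ) - Real.log N - 1 / (2 * N) - γ with he
  have hE := hγ N hN1
  have hsum : rieszInv y = y ^ 2 * (∑ m ∈ Icc 1 N, 1 / (m : ℝ)) - 2 * y * N + N * (N + 1) / 2 := by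
    have h1 : ∀ m ∈ Icc 1 N, (y - m) ^ 2 / m = y ^ 2 * (1 / (m : ℝ)) - 2 * y + m := by
      intro m hm
      have : (0 : ℝ) < m := by exact_mod_cast (mem_Icc.1 hm).1
      field_simp
      ring
    have h2 : ∀ n : ℕ, ∑ m ∈ Icc 1 n, (m : ℝ) = n * (n + 1) / 2 := by
      intro n
      induction n with
      | zero => simp
      | succ n ih => rw [sum_Icc_succ_top (by omega), ih]; push_cast; ring
    rw [rieszInv, sum_congr rfl h1, sum_add_distrib, sum_sub_distrib, ← mul_sum, h2, sum_const,
      Nat.card_Icc, nsmul_eq_mul]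
    simp only [Nat.add_sub_cancel]
    ring
  have hlogN : Real.log N = Real.log y + Real.log (1 - t / y) := by
    rw [← Real.log_mul (by positivity)]
    · congr 1
      rw [ht]
      field_simp
      ring
    · have : 1 - t / y = N / y := by rw [ht]; field_simp; ring
      rw [this]
      positivity
  set l := Real.log (1 - t / y) + t / y with hl
  have hs : |l| ≤ 2 * (t / y) ^ 2 := by
    refine abs_log_one_sub_add_le (by rw [ht]; exact div_nonneg (by linarith) (by linarith)) ?_
    rw [div_le_iff₀ (by linarith)]
    linarith
  have hkey : rieszInv y - (y ^ 2 * (Real.log y + (γ - 3 / 2)) + y) =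
      y ^ 2 * l + y ^ 2 * e + (y * t / (2 * N) + (t ^ 2 - t) / 2) := by
    have hH : ∑ m ∈ Icc 1 N, 1 / (m : ℝ) = Real.log y + (l - t / y) + 1 / (2 * N) + γ + e := by
      rw [he, hlogN, hl]
      ring
    rw [hsum, hH]
    have hNt : (N : ℝ) = y - t := by rw [ht]; ring
    have hyt : y - t ≠ 0 := by rw [← hNt]; positivity
    rw [hNt]
    field_simp
    ring
  rw [hkey]
  have ht0 : 0 ≤ t := by linarith
  have ht1 : t ≤ 1 := by linarith
  have b1 : |y ^ 2 * l| ≤ 2 := by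
    rw [abs_mul, abs_of_nonneg (by positivity)]
    calc y ^ 2 * |l| ≤ y ^ 2 * (2 * (t / y) ^ 2) := by gcongr
      _ = 2 * t ^ 2 := by field_simp
      _ ≤ 2 := by nlinarith
  have b2 : |y ^ 2 * e| ≤ 4 := by
    rw [abs_mul, abs_of_nonneg (by positivity)]
    calc y ^ 2 * |e| ≤ (2 * N) ^ 2 * (1 / (N : ℝ) ^ 2) := by gcongr; linarith
      _ = 4 := by field_simp; norm_num
  have b3 : |y * t / (2 * N) + (t ^ 2 - t) / 2| ≤ 2 := by
    have e1 : 0 ≤ y * t / (2 * N) := by positivity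
    have e2 : y * t / (2 * N) ≤ 1 := by
      rw [div_le_one (by positivity)]
      nlinarith
    rw [abs_le]
    constructor <;> nlinarith
  calc _ ≤ |y ^ 2 * l| + |y ^ 2 * e| + |y * t / (2 * N) + (t ^ 2 - t) / 2| := abs_add_three _ _ _
    _ ≤ 8 := by linarith

lemma exists_rieszInv_asymp : ∃ c C : ℝ, 0 < C ∧ ∀ y : ℝ, 0 < y →
    |rieszInv y - (y ^ 2 * (Real.log y + c) + y)| ≤ C := by
  obtain ⟨γ, hγ⟩ := exists_harmonic_asymp
  refine ⟨γ - 3 / 2, 8 + |γ - 3 / 2|, by positivity, fun y hy => ?_⟩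
  have h0 := abs_nonneg (γ - 3 / 2)
  rcases lt_or_ge y 1 with h | h
  · rw [rieszInv_of_lt_one h, zero_sub, abs_neg]
    have h1 : |y ^ 2 * Real.log y| ≤ 1 := by
      have := Real.abs_log_mul_self_lt y hy h.le
      rw [abs_mul, abs_of_pos hy] at this
      rw [abs_mul, abs_of_pos (by positivity)]
      nlinarith [abs_nonneg (Real.log y)]
    have h2 : |y ^ 2 * (γ - 3 / 2)| ≤ |γ - 3 / 2| := by
      rw [abs_mul, abs_of_pos (by positivity)]
      exact mul_le_of_le_one_left h0 (by nlinarith)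
    calc |y ^ 2 * (Real.log y + (γ - 3 / 2)) + y| =
          |y ^ 2 * Real.log y + y ^ 2 * (γ - 3 / 2) + y| := by ring_nf
      _ ≤ |y ^ 2 * Real.log y| + |y ^ 2 * (γ - 3 / 2)| + |y| := abs_add_three _ _ _
      _ ≤ _ := by rw [abs_of_pos hy]; linarith
  · exact (exists_rieszInv_asymp_of_one_le hγ h).trans (by linarith)

end Hooley

namespace Hooley
open Filter Topology

lemma rieszInv_le_cube {y : ℝ} (hy : 0 ≤ y) : rieszInv y ≤ y ^ 3 := by
  have h1 : rieszInv y ≤ ∑ _m ∈ Icc 1 ⌊y⌋₊, y ^ 2 := by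
    refine sum_le_sum fun m hm => ?_
    rw [mem_Icc] at hm
    have hm1 : (1 : ℝ) ≤ m := by exact_mod_cast hm.1
    have hm2 : (m : ℝ) ≤ y := (Nat.le_floor_iff hy).1 hm.2
    refine (div_le_self (sq_nonneg _) hm1).trans ?_
    exact pow_le_pow_left₀ (by linarith) (by linarith) 2
  refine h1.trans ?_
  rw [sum_const, Nat.card_Icc, nsmul_eq_mul, Nat.add_sub_cancel]
  have := Nat.floor_le hy
  nlinarith [sq_nonneg y]

lemma continuous_rieszInv_div_sq : Continuous fun u => rieszInv u / u ^ 2 := by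
  rw [continuous_iff_continuousAt]
  intro u
  rcases lt_or_ge u 1 with hu | hu
  · have h1 : (fun u => rieszInv u / u ^ 2) =ᶠ[𝓝 u] fun _ => 0 := by
      filter_upwards [gt_mem_nhds hu] with v hv
      rw [rieszInv_of_lt_one hv, zero_div]
    exact continuousAt_const.congr h1.symm
  · exact continuous_rieszInv.continuousAt.div (by fun_prop) (by positivity)

/-- The primitive of `rieszInv u / u ^ 2` vanishing for `v ≤ 1`. -/
noncomputable def rieszPrim (v : ℝ) : ℝ := ∫ u in (1 : ℝ)..v, rieszInv u / u ^ 2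

lemma hasDerivAt_rieszPrim (v : ℝ) : HasDerivAt rieszPrim (rieszInv v / v ^ 2) v :=
  (continuous_rieszInv_div_sq.integral_hasStrictDerivAt 1 v).hasDerivAt

lemma rieszPrim_of_lt_one {v : ℝ} (hv : v < 1) : rieszPrim v = 0 := by
  have h1 : ∫ u in (1 : ℝ)..v, rieszInv u / u ^ 2 = ∫ _u in (1 : ℝ)..v, (0 : ℝ) := by
    refine intervalIntegral.integral_congr fun u hu => ?_
    rw [Set.uIcc_of_ge hv.le] at hu
    rcases hu.2.lt_or_eq with h | h
    · simp only [rieszInv_of_lt_one h, zero_div]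
    · subst h
      simp [rieszInv]
  rw [rieszPrim, h1, intervalIntegral.integral_zero]

/-- A function whose derivative is at most `C / v ^ 2` in absolute value. -/
lemma abs_sub_le_of_deriv_inv_sq {D d : ℝ → ℝ} {C : ℝ}
    (hD : ∀ v, 0 < v → HasDerivAt D (d v) v) (hd : ∀ v, 0 < v → |d v| ≤ C / v ^ 2)
    {u v : ℝ} (hu : 0 < u) (huv : u ≤ v) : |D v - D u| ≤ C / u - C / v := by
  have hinv : ∀ w : ℝ, 0 < w → HasDerivAt (fun w => C / w) (-(C / w ^ 2)) w := by
    intro w hw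
    refine ((hasDerivAt_inv hw.ne').const_mul C).congr_deriv ?_
    rw [div_eq_mul_inv]
    ring
  have hpos : ∀ w ∈ Set.Icc u v, 0 < w := fun w hw => hu.trans_le hw.1
  have hm1 : MonotoneOn (fun w => D w - C / w) (Set.Icc u v) := by
    refine monotoneOn_of_hasDerivWithinAt_nonneg (convex_Icc u v) (f' := fun w => d w + C / w ^ 2)
      (fun w hw => ?_) (fun w hw => ?_) (fun w hw => ?_)
    · exact ((hD w (hpos w hw)).sub (hinv w (hpos w hw))).continuousAt.continuousWithinAt
    · have hw' := hpos w (interior_subset hw)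
      have := ((hD w hw').sub (hinv w hw')).hasDerivWithinAt (s := interior (Set.Icc u v))
      rwa [sub_neg_eq_add] at this
    · have := (abs_le.1 (hd w (hpos w (interior_subset hw)))).1
      linarith
  have hm2 : AntitoneOn (fun w => D w + C / w) (Set.Icc u v) := by
    refine antitoneOn_of_hasDerivWithinAt_nonpos (convex_Icc u v) (f' := fun w => d w + -(C / w ^ 2))
      (fun w hw => ?_) (fun w hw => ?_) (fun w hw => ?_)
    · exact ((hD w (hpos w hw)).add (hinv w (hpos w hw))).continuousAt.continuousWithinAt
    · have hw' := hpos w (interior_subset hw)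
      exact ((hD w hw').add (hinv w hw')).hasDerivWithinAt (s := interior (Set.Icc u v))
    · have := (abs_le.1 (hd w (hpos w (interior_subset hw)))).2
      linarith
  have h1 := hm1 (Set.left_mem_Icc.2 huv) (Set.right_mem_Icc.2 huv) huv
  have h2 := hm2 (Set.left_mem_Icc.2 huv) (Set.right_mem_Icc.2 huv) huv
  simp only at h1 h2
  rw [abs_le]
  constructor <;> linarith

lemma exists_rieszPrim_asymp {c C : ℝ} (hC : 0 < C)
    (h : ∀ y : ℝ, 0 < y → |rieszInv y - (y ^ 2 * (Real.log y + c) + y)| ≤ C) :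
    ∃ I : ℝ, ∀ v : ℝ, 0 < v →
      |rieszPrim v - (v * Real.log v + (c - 1) * v + Real.log v + I)| ≤ C / v := by
  set D : ℝ → ℝ := fun v => rieszPrim v - (v * Real.log v + (c - 1) * v + Real.log v) with hDdef
  set d : ℝ → ℝ := fun v => (rieszInv v - (v ^ 2 * (Real.log v + c) + v)) / v ^ 2 with hddef
  have hD : ∀ v, 0 < v → HasDerivAt D (d v) v := by
    intro v hv
    have h1 := (hasDerivAt_id v).mul (Real.hasDerivAt_log hv.ne')
    have h2 := (hasDerivAt_id v).const_mul (c - 1)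
    have h3 := (hasDerivAt_rieszPrim v).sub ((h1.add h2).add (Real.hasDerivAt_log hv.ne'))
    refine h3.congr_deriv ?_
    simp only [hddef, id]
    field_simp
    ring
  have hd : ∀ v, 0 < v → |d v| ≤ C / v ^ 2 := by
    intro v hv
    rw [hddef, abs_div, abs_of_pos (by positivity : (0 : ℝ) < v ^ 2)]
    exact div_le_div_of_nonneg_right (h v hv) (by positivity)
  have hle : ∀ u v : ℝ, 0 < u → u ≤ v → |D v - D u| ≤ C / u := by
    intro u v hu huv
    have h1 := abs_sub_le_of_deriv_inv_sq hD hd hu huv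
    have : 0 < C / v := div_pos hC (hu.trans_le huv)
    linarith
  obtain ⟨I, hI, -⟩ := exists_limit (a := fun n : ℕ => D n) (ε := fun n => C / n)
    (tendsto_const_div_atTop_nhds_zero_nat C)
    (fun n m hn hnm => hle n m (by exact_mod_cast hn) (by exact_mod_cast hnm))
  refine ⟨I, fun v hv => ?_⟩
  have h1 : Tendsto (fun n : ℕ => |D n - D v|) atTop (𝓝 |I - D v|) := (hI.sub_const _).abs
  have h2 : |I - D v| ≤ C / v := by
    refine le_of_tendsto h1 ?_
    filter_upwards [eventually_ge_atTop ⌈v⌉₊] with n hn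
    exact hle v n hv (Nat.ceil_le.1 hn)
  rw [abs_sub_comm] at h2
  convert h2 using 2
  simp only [hDdef]
  ring

/-- Comparison of a sum of an antitone function with its primitive. -/
lemma sum_antitone_bounds {f F : ℝ → ℝ} {K : ℕ}
    (hF : ∀ u : ℝ, (K : ℝ) ≤ u → HasDerivAt F (f u) u) (hf : AntitoneOn f (Set.Ici (K : ℝ)))
    {N : ℕ} (hN : K ≤ N) :
    ∑ k ∈ Icc (K + 1) N, f k ≤ F N - F K ∧
      F N - F K ≤ ∑ k ∈ Icc (K + 1) N, f k + f K - f N := by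
  induction N, hN using Nat.le_induction with
  | base => simp
  | succ N hN ih =>
    have hK : (K : ℝ) ≤ N := by exact_mod_cast hN
    rw [← Finset.insert_Icc_right_eq_Icc_add_one (by omega), sum_insert (by simp)]
    obtain ⟨ξ, hξ, h1⟩ := exists_hasDerivAt_eq_slope F f (a := (N : ℝ)) (b := N + 1) (by linarith)
      (fun u hu => (hF u (hK.trans hu.1)).continuousAt.continuousWithinAt)
      (fun u hu => hF u (hK.trans hu.1.le))
    rw [add_sub_cancel_left, div_one] at h1
    have h2 : f ξ ≤ f N := hf hK (hK.trans hξ.1.le) hξ.1.le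
    have h3 : f (N + 1) ≤ f ξ :=
      hf (hK.trans hξ.1.le) (Set.mem_Ici.2 (by linarith)) hξ.2.le
    push_cast
    constructor <;> linarith [ih.1, ih.2]

lemma exists_sum_antitone_asymp {f F : ℝ → ℝ}
    (hF : ∀ u : ℝ, 1 ≤ u → HasDerivAt F (f u) u) (hf : AntitoneOn f (Set.Ici 1))
    (h0 : ∀ u : ℝ, 1 ≤ u → 0 ≤ f u) (hlim : Tendsto f atTop (𝓝 0)) :
    ∃ l : ℝ, ∀ K : ℕ, 1 ≤ K → |∑ k ∈ Icc 1 K, f k - (F K + l)| ≤ f K := by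
  obtain ⟨l, -, hl⟩ := exists_limit (a := fun n : ℕ => ∑ k ∈ Icc 1 n, f k - F n)
    (ε := fun n : ℕ => f n) (hlim.comp tendsto_natCast_atTop_atTop) (by
      intro n m hn hnm
      have hn' : (1 : ℝ) ≤ n := by exact_mod_cast hn
      have hm' : (1 : ℝ) ≤ m := by exact_mod_cast hn.trans hnm
      obtain ⟨h1, h2⟩ := sum_antitone_bounds (K := n) (fun u hu => hF u (hn'.trans hu))
        (hf.mono fun u hu => hn'.trans hu) hnm
      have h3 : ∑ k ∈ Icc 1 m, f k = ∑ k ∈ Icc 1 n, f k + ∑ k ∈ Icc (n + 1) m, f k := by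
        have := Finset.sum_Ioc_consecutive (fun k : ℕ => f k) (Nat.zero_le n) hnm
        simp only [← Finset.Icc_add_one_left_eq_Ioc, zero_add] at this
        exact this.symm
      have := h0 m hm'
      rw [h3, abs_le]
      constructor <;> linarith)
  refine ⟨l, fun K hK => ?_⟩
  have := hl K hK
  rwa [sub_sub] at this

end Hooley

namespace Hooley
open Filter Topology

lemma exists_sum_inv_sq_asymp : ∃ l : ℝ, ∀ K : ℕ, 1 ≤ K →
    |∑ k ∈ Icc 1 K, 1 / (k : ℝ) ^ 2 - (l - 1 / K)| ≤ 1 / (K : ℝ) ^ 2 := by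
  obtain ⟨l, hl⟩ := exists_sum_antitone_asymp (f := fun u => 1 / u ^ 2) (F := fun u => -u⁻¹)
    (fun u hu => by
      refine (hasDerivAt_inv (by positivity)).neg.congr_deriv ?_
      rw [neg_neg, one_div])
    (fun u hu v _ huv => by
      have hu' : (1 : ℝ) ≤ u := hu
      exact one_div_le_one_div_of_le (by positivity) (pow_le_pow_left₀ (by linarith) huv 2))
    (fun u hu => by positivity)
    (by
      simp only [one_div]
      exact tendsto_inv_atTop_zero.comp (tendsto_pow_atTop (by norm_num)))
  refine ⟨l, fun K hK => ?_⟩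
  have := hl K hK
  rwa [neg_add_eq_sub, ← one_div] at this

lemma exists_sum_inv_asymp : ∃ l : ℝ, ∀ K : ℕ, 1 ≤ K →
    |∑ k ∈ Icc 1 K, 1 / (k : ℝ) - (Real.log K + l)| ≤ 1 / (K : ℝ) :=
  exists_sum_antitone_asymp (f := fun u => 1 / u) (F := Real.log)
    (fun u hu => by simpa using Real.hasDerivAt_log (by positivity))
    (fun u hu v _ huv => by
      have hu' : (1 : ℝ) ≤ u := hu
      exact one_div_le_one_div_of_le (by positivity) huv)
    (fun u hu => by positivity)
    (by simpa only [one_div] using tendsto_inv_atTop_zero)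

lemma exists_sum_log_div_sq_asymp : ∃ l : ℝ, ∀ K : ℕ, 1 ≤ K →
    |∑ k ∈ Icc 1 K, (Real.log k + 1) / (k : ℝ) ^ 2 - (l - (Real.log K + 2) / K)| ≤
      (Real.log K + 1) / (K : ℝ) ^ 2 := by
  obtain ⟨l, hl⟩ := exists_sum_antitone_asymp (f := fun u => (Real.log u + 1) / u ^ 2)
    (F := fun u => -((Real.log u + 2) / u))
    (fun u hu => by
      have hu0 : u ≠ 0 := by positivity
      refine (((Real.hasDerivAt_log hu0).add_const 2).div (hasDerivAt_id u) hu0).neg.congr_deriv ?_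
      simp only [id]
      field_simp
      ring)
    (fun u hu v _ huv => by
      have hu' : (1 : ℝ) ≤ u := hu
      have hu0 : 0 < u := by linarith
      have h0 := Real.log_nonneg hu'
      have h1 : Real.log v ≤ Real.log u + (v / u - 1) := by
        have := Real.log_le_sub_one_of_pos (div_pos (hu0.trans_le huv) hu0)
        rw [Real.log_div (by linarith) (by linarith)] at this
        linarith
      have h2 : 1 ≤ v / u := (one_le_div hu0).2 huv
      simp only
      rw [div_le_div_iff₀ (by nlinarith) (by positivity)]
      have h3 : v ^ 2 = u ^ 2 * (v / u) ^ 2 := by field_simp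
      rw [h3, mul_left_comm, mul_comm _ (u ^ 2)]
      refine mul_le_mul_of_nonneg_left ?_ (sq_nonneg u)
      nlinarith [mul_nonneg h0 (sub_nonneg.2 h2)])
    (fun u hu => by have := Real.log_nonneg hu; positivity)
    (by
      have h1 : Tendsto (fun u : ℝ => 1 / u) atTop (𝓝 0) := by
        simpa only [one_div] using tendsto_inv_atTop_zero
      refine squeeze_zero' ?_ ?_ h1
      · filter_upwards [eventually_ge_atTop 1] with u hu
        have := Real.log_nonneg hu
        positivity
      · filter_upwards [eventually_ge_atTop 1] with u hu
        rw [div_le_div_iff₀ (by positivity) (by positivity)]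
        have := Real.log_le_sub_one_of_pos (zero_lt_one.trans_le hu)
        nlinarith)
  refine ⟨l, fun K hK => ?_⟩
  have := hl K hK
  rwa [neg_add_eq_sub] at this

/-- `∑ (Y - j m)² / (j² m)` over `j m ≤ Y`, in the form of an iterated sum. -/
noncomputable def rieszU (Y : ℝ) : ℝ := ∑ k ∈ Icc 1 ⌊Y⌋₊, rieszInv (Y / k)

/-- `∑ 1 / (j² m)` over `j m ≤ Y`. -/
noncomputable def sumU (Y : ℝ) : ℝ :=
  ∑ j ∈ Icc 1 ⌊Y⌋₊, 1 / (j : ℝ) ^ 2 * ∑ m ∈ Icc 1 ⌊Y / j⌋₊, 1 / (m : ℝ)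

lemma abs_log_le_inv {s : ℝ} (h0 : 0 < s) (h1 : s ≤ 1) : |Real.log s| ≤ 1 / s := by
  rw [le_div_iff₀ h0]
  have := (Real.abs_log_mul_self_lt s h0 h1).le
  rwa [abs_mul, abs_of_pos h0] at this

lemma natCast_floor_bounds {t : ℝ} (ht : 1 ≤ t) :
    1 ≤ ⌊t⌋₊ ∧ t / 2 ≤ (⌊t⌋₊ : ℝ) ∧ (⌊t⌋₊ : ℝ) ≤ t := by
  have h1 : 1 ≤ ⌊t⌋₊ := (Nat.one_le_floor_iff t).2 ht
  refine ⟨h1, ?_, Nat.floor_le (by linarith)⟩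
  have h2 := Nat.lt_floor_add_one t
  have h3 : (1 : ℝ) ≤ ⌊t⌋₊ := by exact_mod_cast h1
  linarith

lemma rieszU_eq_add {Y : ℝ} {K : ℕ} (hK : K ≤ ⌊Y⌋₊) :
    rieszU Y = ∑ k ∈ Icc 1 K, rieszInv (Y / k) +
      ∑ k ∈ Icc (K + 1) (⌊Y⌋₊ + 1), rieszInv (Y / k) := by
  have h1 : rieszInv (Y / ((⌊Y⌋₊ + 1 : ℕ) : ℝ)) = 0 := by
    refine rieszInv_of_lt_one ?_
    rw [div_lt_one (by positivity)]
    exact_mod_cast Nat.lt_floor_add_one Y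
  rw [← Finset.insert_Icc_right_eq_Icc_add_one (a := K + 1) (b := ⌊Y⌋₊) (by omega), sum_insert (by simp), h1, zero_add]
  have := Finset.sum_Ioc_consecutive (fun k : ℕ => rieszInv (Y / k)) (Nat.zero_le K) hK
  simp only [← Finset.Icc_add_one_left_eq_Ioc, zero_add] at this
  exact this.symm

lemma abs_tail_rieszU_le {Y : ℝ} (hY : 0 < Y) {K : ℕ} (hK1 : 1 ≤ K) (hK : K ≤ ⌊Y⌋₊) :
    |∑ k ∈ Icc (K + 1) (⌊Y⌋₊ + 1), rieszInv (Y / k) - Y * rieszPrim (Y / K)| ≤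
      rieszInv (Y / K) := by
  have hK0 : (1 : ℝ) ≤ K := by exact_mod_cast hK1
  obtain ⟨h1, h2⟩ := sum_antitone_bounds (f := fun u => rieszInv (Y / u))
    (F := fun u => -(Y * rieszPrim (Y / u))) (K := K) (N := ⌊Y⌋₊ + 1)
    (fun u hu => by
      have hu0 : 0 < u := by linarith
      have h3 : HasDerivAt (fun u => Y / u) (-(Y / u ^ 2)) u := by
        refine ((hasDerivAt_inv hu0.ne').const_mul Y).congr_deriv ?_
        rw [div_eq_mul_inv]
        ring
      refine (((hasDerivAt_rieszPrim (Y / u)).comp u h3).const_mul Y).neg.congr_deriv ?_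
      field_simp)
    (fun u hu v _ huv => by
      have hu' : (K : ℝ) ≤ u := hu
      exact rieszInv_mono (div_le_div_of_nonneg_left hY.le (by linarith) huv))
    (by omega)
  have hlt : Y / ((⌊Y⌋₊ + 1 : ℕ) : ℝ) < 1 := by
    rw [div_lt_one (by positivity)]
    exact_mod_cast Nat.lt_floor_add_one Y
  rw [rieszPrim_of_lt_one hlt] at h1 h2
  rw [rieszInv_of_lt_one hlt] at h2
  have := rieszInv_nonneg (Y / K)
  rw [abs_le]
  constructor <;> linarith

end Hooley

namespace Hooley
open Filter Topology

lemma sum_rieszInv_main {Y c : ℝ} (hY : 0 < Y) (K : ℕ) :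
    ∑ k ∈ Icc 1 K, ((Y / k) ^ 2 * (Real.log (Y / k) + c) + Y / k) =
      Y ^ 2 * (Real.log Y + c + 1) * ∑ k ∈ Icc 1 K, 1 / (k : ℝ) ^ 2 -
        Y ^ 2 * ∑ k ∈ Icc 1 K, (Real.log k + 1) / (k : ℝ) ^ 2 +
        Y * ∑ k ∈ Icc 1 K, 1 / (k : ℝ) := by
  rw [mul_sum, mul_sum, mul_sum, ← sum_sub_distrib, ← sum_add_distrib]
  refine sum_congr rfl fun k hk => ?_
  have hk0 : (k : ℝ) ≠ 0 := by
    have := (mem_Icc.1 hk).1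
    positivity
  rw [Real.log_div hY.ne' hk0]
  field_simp
  ring

lemma abs_mul_le_of_le {a b A B : ℝ} (ha : |a| ≤ A) (hb : |b| ≤ B) : |a * b| ≤ A * B := by
  rw [abs_mul]
  exact mul_le_mul ha hb (abs_nonneg _) ((abs_nonneg _).trans ha)

lemma rieszU_asymp_of_one_le {c C I z2 z' γ : ℝ} (hC : 0 < C)
    (hT : ∀ y : ℝ, 0 < y → |rieszInv y - (y ^ 2 * (Real.log y + c) + y)| ≤ C)
    (hJ : ∀ v : ℝ, 0 < v →
      |rieszPrim v - (v * Real.log v + (c - 1) * v + Real.log v + I)| ≤ C / v)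
    (h2 : ∀ K : ℕ, 1 ≤ K → |∑ k ∈ Icc 1 K, 1 / (k : ℝ) ^ 2 - (z2 - 1 / K)| ≤ 1 / (K : ℝ) ^ 2)
    (h2' : ∀ K : ℕ, 1 ≤ K → |∑ k ∈ Icc 1 K, (Real.log k + 1) / (k : ℝ) ^ 2 -
      (z' - (Real.log K + 2) / K)| ≤ (Real.log K + 1) / (K : ℝ) ^ 2)
    (h1 : ∀ K : ℕ, 1 ≤ K → |∑ k ∈ Icc 1 K, 1 / (k : ℝ) - (Real.log K + γ)| ≤ 1 / (K : ℝ))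
    {s : ℝ} (hs : 1 ≤ s) :
    |rieszU (s ^ 4) - ((s ^ 4) ^ 2 * (z2 * Real.log (s ^ 4) + (z2 * (c + 1) - z')) +
        s ^ 4 * (Real.log (s ^ 4) + (γ + I)))| ≤ (46 + 4 * |c| + 2 * C) * s ^ 3 := by
  have hs0 : 0 < s := by linarith
  have hs1 : 1 ≤ s ^ 3 := one_le_pow₀ hs
  obtain ⟨hK1, hKl, hKu⟩ := natCast_floor_bounds hs1
  set K := ⌊s ^ 3⌋₊ with hK
  have hKN : K ≤ ⌊s ^ 4⌋₊ := Nat.floor_le_floor (pow_le_pow_right₀ hs (by norm_num))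
  set Y := s ^ 4 with hY
  have hY0 : 0 < Y := by positivity
  set k : ℝ := (K : ℝ) with hk
  have hk1 : 1 ≤ k := by rw [hk]; exact_mod_cast hK1
  have hk0 : 0 < k := by linarith
  have hlogs : Real.log s ≤ s := (Real.log_le_sub_one_of_pos hs0).trans (by linarith)
  have hlogs0 : 0 ≤ Real.log s := Real.log_nonneg hs
  have hL : Real.log Y = 4 * Real.log s := by rw [hY, Real.log_pow]; norm_num
  have hlk : Real.log k ≤ 3 * s := by
    have := Real.log_le_log hk0 hKu
    rw [Real.log_pow] at this
    push_cast at this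
    linarith
  have hlk0 : 0 ≤ Real.log k := Real.log_nonneg hk1
  have hk2 : 1 / k ≤ 2 / s ^ 3 := by
    rw [div_le_div_iff₀ hk0 (by positivity)]
    linarith
  have hk3 : 1 / k ^ 2 ≤ 4 / s ^ 6 := by
    have := pow_le_pow_left₀ (by positivity) hk2 2
    rw [div_pow, div_pow, one_pow, ← pow_mul] at this
    norm_num at this ⊢
    exact this
  have htail := abs_tail_rieszU_le hY0 hK1 hKN
  have hcube : rieszInv (Y / k) ≤ 8 * s ^ 3 := by
    refine (rieszInv_le_cube (by positivity)).trans ?_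
    have : Y / k ≤ 2 * s := by
      rw [div_eq_mul_one_div]
      refine (mul_le_mul_of_nonneg_left hk2 hY0.le).trans (le_of_eq ?_)
      rw [hY]
      field_simp
    refine (pow_le_pow_left₀ (by positivity) this 3).trans (le_of_eq ?_)
    ring
  have hS : |∑ j ∈ Icc 1 K, rieszInv (Y / j) -
      ∑ j ∈ Icc 1 K, ((Y / j) ^ 2 * (Real.log (Y / j) + c) + Y / j)| ≤ C * s ^ 3 := by
    rw [← sum_sub_distrib]
    refine (abs_sum_le_sum_abs _ _).trans ((sum_le_card_nsmul _ _ C fun j hj => ?_).trans ?_)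
    · have : 0 < (j : ℝ) := by exact_mod_cast (mem_Icc.1 hj).1
      exact hT _ (div_pos hY0 this)
    · rw [Nat.card_Icc, Nat.add_sub_cancel, nsmul_eq_mul, mul_comm]
      exact mul_le_mul_of_nonneg_left hKu hC.le
  rw [sum_rieszInv_main hY0] at hS
  have e2 := h2 K hK1
  have e2' := h2' K hK1
  have e1 := h1 K hK1
  have eJ := hJ (Y / k) (by positivity)
  rw [rieszU_eq_add hKN]
  rw [Real.log_div hY0.ne' hk0.ne'] at eJ
  rw [← hk] at e2 e2' e1 htail
  set S2 := ∑ k ∈ Icc 1 K, 1 / (k : ℝ) ^ 2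
  set S' := ∑ k ∈ Icc 1 K, (Real.log k + 1) / (k : ℝ) ^ 2
  set S1 := ∑ k ∈ Icc 1 K, 1 / (k : ℝ)
  set U1 := ∑ k ∈ Icc 1 K, rieszInv (Y / k)
  set U2 := ∑ k ∈ Icc (K + 1) (⌊Y⌋₊ + 1), rieszInv (Y / k)
  set P := rieszPrim (Y / k)
  set L := Real.log Y
  set l := Real.log k
  have f2 : |Y ^ 2 * (L + c + 1) * (S2 - (z2 - 1 / k))| ≤ (20 + 4 * |c|) * s ^ 3 := by
    have : |Y ^ 2 * (L + c + 1)| ≤ s ^ 8 * ((5 + |c|) * s) := by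
      rw [abs_mul, abs_of_pos (by positivity : 0 < Y ^ 2), hY, ← pow_mul]
      refine mul_le_mul_of_nonneg_left ?_ (by positivity)
      have h3 : |L + c + 1| ≤ L + |c| + 1 := by
        rw [abs_le]
        constructor <;> linarith [neg_abs_le c, le_abs_self c]
      nlinarith [abs_nonneg c]
    refine (abs_mul_le_of_le this (e2.trans hk3)).trans (le_of_eq ?_)
    field_simp
    ring
  have f2' : |Y ^ 2 * (S' - (z' - (l + 2) / k))| ≤ 16 * s ^ 3 := by
    have h3 : |S' - (z' - (l + 2) / k)| ≤ (4 * s) * (4 / s ^ 6) := by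
      refine e2'.trans ?_
      rw [div_eq_mul_one_div]
      exact mul_le_mul (by linarith) hk3 (by positivity) (by positivity)
    refine (abs_mul_le_of_le (abs_of_pos (by positivity : 0 < Y ^ 2)).le h3).trans (le_of_eq ?_)
    rw [hY]
    field_simp
    ring
  have f1 : |Y * (S1 - (l + γ))| ≤ 2 * s ^ 3 := by
    refine (abs_mul_le_of_le (abs_of_pos hY0).le (e1.trans hk2)).trans ?_
    have : Y * (2 / s ^ 3) = 2 * s := by rw [hY]; field_simp
    rw [this]
    nlinarith [pow_le_pow_right₀ hs (by norm_num : 1 ≤ 3)]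
  have fJ : |Y * (P - (Y / k * (L - l) + (c - 1) * (Y / k) + (L - l) + I))| ≤ C * s ^ 3 := by
    refine (abs_mul_le_of_le (abs_of_pos hY0).le eJ).trans ?_
    have : Y * (C / (Y / k)) = C * k := by field_simp
    rw [this]
    exact mul_le_mul_of_nonneg_left hKu hC.le
  have key : U1 + U2 - (Y ^ 2 * (z2 * L + (z2 * (c + 1) - z')) + Y * (L + (γ + I))) =
      (U1 - (Y ^ 2 * (L + c + 1) * S2 - Y ^ 2 * S' + Y * S1)) + (U2 - Y * P) +
      Y ^ 2 * (L + c + 1) * (S2 - (z2 - 1 / k)) - Y ^ 2 * (S' - (z' - (l + 2) / k)) +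
      Y * (S1 - (l + γ)) +
      Y * (P - (Y / k * (L - l) + (c - 1) * (Y / k) + (L - l) + I)) := by
    field_simp
    ring
  rw [key]
  have g := htail.trans hcube
  rw [abs_le] at g hS f2 f2' f1 fJ ⊢
  constructor <;> linarith [g.1, g.2, hS.1, hS.2, f2.1, f2.2, f2'.1, f2'.2, f1.1, f1.2, fJ.1, fJ.2]

lemma abs_sum_inv_floor_sub_le {γ : ℝ}
    (h1 : ∀ K : ℕ, 1 ≤ K → |∑ k ∈ Icc 1 K, 1 / (k : ℝ) - (Real.log K + γ)| ≤ 1 / (K : ℝ))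
    {v : ℝ} (hv : 1 ≤ v) :
    |∑ m ∈ Icc 1 ⌊v⌋₊, 1 / (m : ℝ) - (Real.log v + γ)| ≤ 4 / v := by
  obtain ⟨hn1, hnl, hnu⟩ := natCast_floor_bounds hv
  have hlt := Nat.lt_floor_add_one v
  have h := h1 _ hn1
  set n := ⌊v⌋₊
  have hn0 : (0 : ℝ) < n := by exact_mod_cast hn1
  have h2 : 1 / (n : ℝ) ≤ 2 / v := by
    rw [div_le_div_iff₀ hn0 (by linarith)]
    linarith
  have h3 := Real.log_le_log hn0 hnu
  have h4 : Real.log v ≤ Real.log n + 1 / n := by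
    have := Real.log_le_sub_one_of_pos (div_pos (by linarith : 0 < v) hn0)
    rw [Real.log_div (by linarith) hn0.ne'] at this
    have h5 : v / n ≤ 1 + 1 / n := by
      rw [div_le_iff₀ hn0]
      field_simp
      linarith
    linarith
  have h6 : 4 / v = 2 / v + 2 / v := by ring
  rw [h6]
  rw [abs_le] at h ⊢
  constructor <;> linarith [h.1, h.2]

lemma sumU_asymp_of_one_le {z2 z' γ : ℝ}
    (h2 : ∀ K : ℕ, 1 ≤ K → |∑ k ∈ Icc 1 K, 1 / (k : ℝ) ^ 2 - (z2 - 1 / K)| ≤ 1 / (K : ℝ) ^ 2)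
    (h2' : ∀ K : ℕ, 1 ≤ K → |∑ k ∈ Icc 1 K, (Real.log k + 1) / (k : ℝ) ^ 2 -
      (z' - (Real.log K + 2) / K)| ≤ (Real.log K + 1) / (K : ℝ) ^ 2)
    (h1 : ∀ K : ℕ, 1 ≤ K → |∑ k ∈ Icc 1 K, 1 / (k : ℝ) - (Real.log K + γ)| ≤ 1 / (K : ℝ))
    {s : ℝ} (hs : 1 ≤ s) :
    |sumU (s ^ 4) - (z2 * Real.log (s ^ 4) + ((γ + 1) * z2 - z'))| ≤
      (62 + 8 * |γ|) * (1 / s) := by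
  have hs0 : 0 < s := by linarith
  have hs1 : 1 ≤ s ^ 4 := one_le_pow₀ hs
  obtain ⟨hN1, hNl, hNu⟩ := natCast_floor_bounds hs1
  have hlogs : Real.log s ≤ s := (Real.log_le_sub_one_of_pos hs0).trans (by linarith)
  have hlogs0 : 0 ≤ Real.log s := Real.log_nonneg hs
  have hL : Real.log (s ^ 4) = 4 * Real.log s := by rw [Real.log_pow]; norm_num
  rw [sumU]
  set N := ⌊s ^ 4⌋₊ with hN
  set Y := s ^ 4 with hY
  have hY0 : 0 < Y := by positivity
  have hN0 : (1 : ℝ) ≤ N := by exact_mod_cast hN1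
  have hNinv : 1 / (N : ℝ) ≤ 2 / Y := by
    rw [div_le_div_iff₀ (by linarith) hY0]
    linarith
  have hNinv2 : 1 / (N : ℝ) ^ 2 ≤ 2 / Y := by
    refine le_trans ?_ hNinv
    exact one_div_le_one_div_of_le (by linarith) (by nlinarith)
  have hlN : Real.log N ≤ 4 * s := by
    have := Real.log_le_log (by linarith) hNu
    linarith
  have hlN0 : 0 ≤ Real.log N := Real.log_nonneg hN0
  have e2 := h2 N hN1
  have e2' := h2' N hN1
  have e1 := h1 N hN1
  have hsum : ∑ j ∈ Icc 1 N, 1 / (j : ℝ) ^ 2 * (Real.log (Y / j) + γ) =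
      (Real.log Y + γ + 1) * ∑ k ∈ Icc 1 N, 1 / (k : ℝ) ^ 2 -
        ∑ k ∈ Icc 1 N, (Real.log k + 1) / (k : ℝ) ^ 2 := by
    rw [mul_sum, ← sum_sub_distrib]
    refine sum_congr rfl fun j hj => ?_
    have hj0 : (j : ℝ) ≠ 0 := by
      have := (mem_Icc.1 hj).1
      positivity
    rw [Real.log_div hY0.ne' hj0]
    ring
  have hS : |∑ j ∈ Icc 1 N, 1 / (j : ℝ) ^ 2 * ∑ m ∈ Icc 1 ⌊Y / j⌋₊, 1 / (m : ℝ) -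
      ∑ j ∈ Icc 1 N, 1 / (j : ℝ) ^ 2 * (Real.log (Y / j) + γ)| ≤
        4 / Y * ∑ j ∈ Icc 1 N, 1 / (j : ℝ) := by
    rw [← sum_sub_distrib, mul_sum]
    refine (abs_sum_le_sum_abs _ _).trans (sum_le_sum fun j hj => ?_)
    have hj1 : (1 : ℝ) ≤ j := by exact_mod_cast (mem_Icc.1 hj).1
    have hj2 : (j : ℝ) ≤ Y := (Nat.cast_le.2 (mem_Icc.1 hj).2).trans hNu
    rw [← mul_sub]
    have := abs_sum_inv_floor_sub_le h1 ((one_le_div (by linarith)).2 hj2)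
    refine (abs_mul_le_of_le (abs_of_nonneg (by positivity)).le this).trans (le_of_eq ?_)
    field_simp
  rw [hsum] at hS
  set S2 := ∑ k ∈ Icc 1 N, 1 / (k : ℝ) ^ 2
  set S' := ∑ k ∈ Icc 1 N, (Real.log k + 1) / (k : ℝ) ^ 2
  set S1 := ∑ k ∈ Icc 1 N, 1 / (k : ℝ)
  set U := ∑ j ∈ Icc 1 N, 1 / (j : ℝ) ^ 2 * ∑ m ∈ Icc 1 ⌊Y / j⌋₊, 1 / (m : ℝ)
  set L := Real.log Y
  set l := Real.log N
  have hN1' : 1 / (N : ℝ) ≤ 1 := by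
    rw [div_le_one (by linarith)]
    exact hN0
  have hg := le_abs_self γ
  have hg0 := abs_nonneg γ
  have hgs : |γ| ≤ |γ| * s := le_mul_of_one_le_right hg0 hs
  have hS1 : S1 ≤ (5 + |γ|) * s := by
    have := (abs_le.1 e1).2
    linarith
  have g0 : 4 / Y * S1 ≤ (20 + 4 * |γ|) * (s / Y) := by
    refine (mul_le_mul_of_nonneg_left hS1 (by positivity)).trans (le_of_eq ?_)
    ring
  have g2 : |(L + γ + 1) * (S2 - z2)| ≤ (20 + 4 * |γ|) * (s / Y) := by
    have h3 : |L + γ + 1| ≤ (5 + |γ|) * s := by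
      rw [abs_le]
      constructor <;> linarith [neg_abs_le γ]
    have h4 : |S2 - z2| ≤ 4 / Y := by
      have h5 : 4 / Y = 2 / Y + 2 / Y := by ring
      rw [h5]
      have : 0 ≤ 1 / (N : ℝ) := by positivity
      rw [abs_le] at e2 ⊢
      constructor <;> linarith [e2.1, e2.2]
    refine (abs_mul_le_of_le h3 h4).trans (le_of_eq ?_)
    ring
  have g2' : |S' - z'| ≤ 22 * (s / Y) := by
    have h3 : (l + 2) / N ≤ 12 * (s / Y) := by
      rw [div_eq_mul_one_div]
      refine (mul_le_mul (by linarith : l + 2 ≤ 6 * s) hNinv (by positivity)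
        (by positivity)).trans (le_of_eq ?_)
      ring
    have h4 : (l + 1) / (N : ℝ) ^ 2 ≤ 10 * (s / Y) := by
      rw [div_eq_mul_one_div]
      refine (mul_le_mul (by linarith : l + 1 ≤ 5 * s) hNinv2 (by positivity)
        (by positivity)).trans (le_of_eq ?_)
      ring
    have : 0 ≤ (l + 2) / (N : ℝ) := by positivity
    rw [abs_le] at e2' ⊢
    constructor <;> linarith [e2'.1, e2'.2]
  have hfin : (62 + 8 * |γ|) * (s / Y) ≤ (62 + 8 * |γ|) * (1 / s) := by
    refine mul_le_mul_of_nonneg_left ?_ (by positivity)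
    rw [div_le_div_iff₀ hY0 hs0, one_mul, hY, ← sq]
    exact pow_le_pow_right₀ hs (by norm_num)
  refine le_trans ?_ hfin
  have key : U - (z2 * L + ((γ + 1) * z2 - z')) = (U - ((L + γ + 1) * S2 - S')) +
      (L + γ + 1) * (S2 - z2) - (S' - z') := by ring
  rw [key]
  have gS := hS.trans g0
  rw [abs_le] at gS g2 g2' ⊢
  constructor <;> linarith [gS.1, gS.2, g2.1, g2.2, g2'.1, g2'.2]

/-- Asymptotics of `rieszU` and `sumU` with a common leading constant. -/
lemma exists_rieszU_sumU_asymp : ∃ z a b c C : ℝ, 0 < C ∧ ∀ s : ℝ, 0 < s →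
    |rieszU (s ^ 4) - ((s ^ 4) ^ 2 * (z * Real.log (s ^ 4) + a) +
      s ^ 4 * (Real.log (s ^ 4) + b))| ≤ C * s ^ 3 ∧
    |sumU (s ^ 4) - (z * Real.log (s ^ 4) + c)| ≤ C * (1 / s) := by
  obtain ⟨c, C, hC, hT⟩ := exists_rieszInv_asymp
  obtain ⟨I, hJ⟩ := exists_rieszPrim_asymp hC hT
  obtain ⟨z2, h2⟩ := exists_sum_inv_sq_asymp
  obtain ⟨z', h2'⟩ := exists_sum_log_div_sq_asymp
  obtain ⟨γ, h1⟩ := exists_sum_inv_asymp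
  set a := z2 * (c + 1) - z' with ha
  set b := γ + I with hb
  set c' := (γ + 1) * z2 - z' with hc'
  set D := (46 + 4 * |c| + 2 * C) + (62 + 8 * |γ|) + (4 * |z2| + |a| + 4 + |b| + |c'|) with hD
  have h0a := abs_nonneg a
  have h0b := abs_nonneg b
  have h0c := abs_nonneg c
  have h0c' := abs_nonneg c'
  have h0z := abs_nonneg z2
  have h0g := abs_nonneg γ
  refine ⟨z2, a, b, c', D, by positivity, fun s hs0 => ?_⟩
  rcases le_or_gt 1 s with hs | hs
  · constructor
    · refine (rieszU_asymp_of_one_le hC hT hJ h2 h2' h1 hs).trans ?_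
      refine mul_le_mul_of_nonneg_right ?_ (by positivity)
      linarith
    · refine (sumU_asymp_of_one_le h2 h2' h1 hs).trans ?_
      refine mul_le_mul_of_nonneg_right ?_ (by positivity)
      linarith
  · have hfl : ⌊s ^ 4⌋₊ = 0 := Nat.floor_eq_zero.2 (pow_lt_one₀ hs0.le hs (by norm_num))
    have hU : rieszU (s ^ 4) = 0 := by simp [rieszU, hfl]
    have hU0 : sumU (s ^ 4) = 0 := by simp [sumU, hfl]
    have hl : |Real.log (s ^ 4)| ≤ 4 * (1 / s) := by
      rw [Real.log_pow, abs_mul]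
      have := abs_log_le_inv hs0 hs.le
      norm_num at this ⊢
      linarith
    have hs1 : 1 ≤ 1 / s := (one_le_div hs0).2 hs.le
    have hzl : |z2 * Real.log (s ^ 4) + a| ≤ (4 * |z2| + |a|) * (1 / s) := by
      refine (abs_add_le _ _).trans ?_
      rw [abs_mul]
      nlinarith
    have hzl' : |z2 * Real.log (s ^ 4) + c'| ≤ (4 * |z2| + |c'|) * (1 / s) := by
      refine (abs_add_le _ _).trans ?_
      rw [abs_mul]
      nlinarith
    have hlb : |Real.log (s ^ 4) + b| ≤ (4 + |b|) * (1 / s) := by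
      refine (abs_add_le _ _).trans ?_
      nlinarith
    rw [hU, hU0, zero_sub, zero_sub, abs_neg, abs_neg]
    constructor
    · have k1 := abs_mul_le_of_le (abs_of_pos (by positivity : 0 < (s ^ 4) ^ 2)).le hzl
      have k2 := abs_mul_le_of_le (abs_of_pos (by positivity : 0 < s ^ 4)).le hlb
      have k3 : (s ^ 4) ^ 2 * ((4 * |z2| + |a|) * (1 / s)) ≤ (4 * |z2| + |a|) * s ^ 3 := by
        have : (s ^ 4) ^ 2 * ((4 * |z2| + |a|) * (1 / s)) = (4 * |z2| + |a|) * s ^ 7 := by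
          field_simp
        rw [this]
        exact mul_le_mul_of_nonneg_left
          (pow_le_pow_of_le_one hs0.le hs.le (by norm_num)) (by positivity)
      have k4 : s ^ 4 * ((4 + |b|) * (1 / s)) = (4 + |b|) * s ^ 3 := by field_simp
      refine (abs_add_le _ _).trans ?_
      have k5 : (4 * |z2| + |a| + (4 + |b|)) * s ^ 3 ≤ D * s ^ 3 :=
        mul_le_mul_of_nonneg_right (by linarith) (by positivity)
      linarith
    · refine hzl'.trans (mul_le_mul_of_nonneg_right (by linarith) (by positivity))

end Hooley

namespace Hooley
open Filter Topology
open scoped ArithmeticFunction.Moebius ArithmeticFunction.zeta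

lemma sum_Icc_sum_divisors {M : Type*} [AddCommMonoid M] {X : ℝ} (hX : 0 ≤ X) (f : ℕ → ℕ → M) :
    ∑ r ∈ Icc 1 ⌊X⌋₊, ∑ d ∈ r.divisors, f d r =
      ∑ d ∈ Icc 1 ⌊X⌋₊, ∑ m ∈ Icc 1 ⌊X / d⌋₊, f d (d * m) := by
  rw [sum_sigma', sum_sigma']
  have key : ∀ d m : ℕ, 1 ≤ d → (m ≤ ⌊X / d⌋₊ ↔ d * m ≤ ⌊X⌋₊) := by
    intro d m hd
    have hd0 : (0 : ℝ) < d := by exact_mod_cast hd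
    rw [Nat.le_floor_iff (by positivity), Nat.le_floor_iff hX, le_div_iff₀ hd0]
    push_cast
    rw [mul_comm]
  refine sum_bij' (fun p _ => (⟨p.2, p.1 / p.2⟩ : Σ _ : ℕ, ℕ))
    (fun p _ => (⟨p.1 * p.2, p.1⟩ : Σ _ : ℕ, ℕ)) ?_ ?_ ?_ ?_ ?_
  · rintro ⟨r, d⟩ h
    simp only [mem_sigma, mem_Icc, Nat.mem_divisors] at h ⊢
    have hd : 1 ≤ d := Nat.pos_of_dvd_of_pos h.2.1 h.1.1
    refine ⟨⟨hd, (Nat.le_of_dvd h.1.1 h.2.1).trans h.1.2⟩,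
      Nat.div_pos (Nat.le_of_dvd h.1.1 h.2.1) hd, ?_⟩
    rw [key d _ hd, Nat.mul_div_cancel' h.2.1]
    exact h.1.2
  · rintro ⟨d, m⟩ h
    simp only [mem_sigma, mem_Icc, Nat.mem_divisors] at h ⊢
    exact ⟨⟨Nat.mul_pos h.1.1 h.2.1, (key d m h.1.1).1 h.2.2⟩, dvd_mul_right _ _,
      (Nat.mul_pos h.1.1 h.2.1).ne'⟩
  · rintro ⟨r, d⟩ h
    simp only [mem_sigma, mem_Icc, Nat.mem_divisors] at h
    simp only [Nat.mul_div_cancel' h.2.1]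
  · rintro ⟨d, m⟩ h
    simp only [mem_sigma, mem_Icc] at h
    simp only [Nat.mul_div_cancel_left _ h.1.1]
  · rintro ⟨r, d⟩ h
    simp only [mem_sigma, mem_Icc, Nat.mem_divisors] at h
    simp only [Nat.mul_div_cancel' h.2.1]

/-- `μ²(n) n / φ(n)`. -/
noncomputable def sqfreeRatio : ArithmeticFunction ℝ :=
  ⟨fun n => if Squarefree n then (n : ℝ) / n.totient else 0, by simp⟩

lemma sqfreeRatio_apply (n : ℕ) :
    sqfreeRatio n = if Squarefree n then (n : ℝ) / n.totient else 0 := rfl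

lemma isMultiplicative_sqfreeRatio : sqfreeRatio.IsMultiplicative := by
  refine ⟨by simp [sqfreeRatio_apply], fun {m n} hmn => ?_⟩
  simp only [sqfreeRatio_apply, Nat.squarefree_mul hmn, Nat.totient_mul hmn]
  by_cases hm : Squarefree m <;> by_cases hn : Squarefree n <;> simp [hm, hn, mul_div_mul_comm]

lemma sqfreeRatio_prime {p : ℕ} (hp : p.Prime) : sqfreeRatio p = (p : ℝ) / (p - 1) := by
  rw [sqfreeRatio_apply, if_pos hp.squarefree, Nat.totient_prime hp, Nat.cast_sub hp.one_le,
    Nat.cast_one]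

lemma sqfreeRatio_prime_pow {p : ℕ} (hp : p.Prime) (k : ℕ) : sqfreeRatio (p ^ (k + 2)) = 0 := by
  rw [sqfreeRatio_apply, if_neg]
  intro h
  have := h p ⟨p ^ k, by ring⟩
  exact hp.not_isUnit this

/-- `n / φ(n)` as a divisor sum. -/
lemma div_totient_eq_sum_divisors (r : ℕ) :
    (r : ℝ) / r.totient = ∑ d ∈ r.divisors, sqfreeRatio d / d := by
  set F : ArithmeticFunction ℝ := ⟨fun n => (n : ℝ) / n.totient, by simp⟩ with hF
  set G : ArithmeticFunction ℝ := ⟨fun n => sqfreeRatio n / n, by simp⟩ with hG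
  have hFm : F.IsMultiplicative := by
    refine ⟨by simp [hF], fun {m n} hmn => ?_⟩
    simp [hF, Nat.totient_mul hmn, mul_div_mul_comm]
  have hGm : G.IsMultiplicative := by
    refine ⟨by simp [hG, isMultiplicative_sqfreeRatio.1], fun {m n} hmn => ?_⟩
    simp only [hG, ArithmeticFunction.coe_mk, isMultiplicative_sqfreeRatio.2 hmn]
    push_cast
    rw [mul_div_mul_comm]
  have hζ : (ζ : ArithmeticFunction ℝ).IsMultiplicative :=
    ArithmeticFunction.isMultiplicative_zeta.natCast
  have h : F = G * (ζ : ArithmeticFunction ℝ) := by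
    rw [hFm.eq_iff_eq_on_prime_powers _ _ (hGm.mul hζ)]
    intro p k hp
    have hp1 : (1 : ℝ) < p := by exact_mod_cast hp.one_lt
    have hp0 : (p : ℝ) - 1 ≠ 0 := by linarith
    rw [ArithmeticFunction.coe_mul_zeta_apply, Nat.sum_divisors_prime_pow hp]
    rcases k with _ | k
    · simp [hF, hG, isMultiplicative_sqfreeRatio.1]
    · rw [sum_range_succ', sum_range_succ', sum_eq_zero]
      · simp only [hF, hG, ArithmeticFunction.coe_mk, zero_add, pow_one, pow_zero,
          isMultiplicative_sqfreeRatio.1, sqfreeRatio_prime hp, Nat.cast_one, div_one,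
          Nat.totient_prime_pow_succ hp]
        push_cast [hp.one_le]
        field_simp
        ring
      · intro i _
        simp only [hG, ArithmeticFunction.coe_mk, sqfreeRatio_prime_pow hp, zero_div]
  have := congrArg (fun f => f r) h
  simp only [ArithmeticFunction.coe_mul_zeta_apply] at this
  exact this

/-- The Dirichlet quotient of `sqfreeRatio` by `ζ`. -/
noncomputable def sqfreeCorr : ArithmeticFunction ℝ := sqfreeRatio * (μ : ArithmeticFunction ℝ)

lemma sqfreeRatio_eq_sum_divisors (n : ℕ) : sqfreeRatio n = ∑ e ∈ n.divisors, sqfreeCorr e := by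
  rw [← ArithmeticFunction.coe_mul_zeta_apply, sqfreeCorr, mul_assoc,
    ArithmeticFunction.coe_moebius_mul_coe_zeta, mul_one]

lemma isMultiplicative_sqfreeCorr : sqfreeCorr.IsMultiplicative :=
  isMultiplicative_sqfreeRatio.mul ArithmeticFunction.isMultiplicative_moebius.intCast

lemma sqfreeCorr_prime_pow_succ {p : ℕ} (hp : p.Prime) (k : ℕ) :
    sqfreeCorr (p ^ (k + 1)) = sqfreeRatio (p ^ (k + 1)) - sqfreeRatio (p ^ k) := by
  rw [sqfreeRatio_eq_sum_divisors (p ^ (k + 1)), sqfreeRatio_eq_sum_divisors (p ^ k),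
    Nat.sum_divisors_prime_pow hp, Nat.sum_divisors_prime_pow hp, sum_range_succ]
  ring

lemma sqfreeCorr_prime {p : ℕ} (hp : p.Prime) : sqfreeCorr p = 1 / ((p : ℝ) - 1) := by
  have h := sqfreeCorr_prime_pow_succ hp 0
  have hp1 : (1 : ℝ) < p := by exact_mod_cast hp.one_lt
  have hp0 : (p : ℝ) - 1 ≠ 0 := by linarith
  rw [zero_add, pow_one, pow_zero, sqfreeRatio_prime hp, isMultiplicative_sqfreeRatio.1] at h
  rw [h]
  field_simp
  ring

lemma sqfreeCorr_prime_sq {p : ℕ} (hp : p.Prime) : sqfreeCorr (p ^ 2) = -(p / ((p : ℝ) - 1)) := by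
  have h := sqfreeCorr_prime_pow_succ hp 1
  rw [sqfreeRatio_prime_pow hp 0, pow_one, sqfreeRatio_prime hp, zero_sub] at h
  exact h

lemma sqfreeCorr_prime_pow {p : ℕ} (hp : p.Prime) (k : ℕ) : sqfreeCorr (p ^ (k + 3)) = 0 := by
  have h := sqfreeRatio_prime_pow hp (k + 1)
  rw [show k + 1 + 2 = k + 2 + 1 by ring] at h
  rw [sqfreeCorr_prime_pow_succ hp (k + 2), h, sqfreeRatio_prime_pow hp, sub_zero]

lemma hasSum_sqfreeCorr_prime {p : ℕ} (hp : p.Prime) {F : ℕ → ℝ}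
    (hF : ∀ n, sqfreeCorr n = 0 → F n = 0) :
    HasSum (fun k => F (p ^ k)) (F 1 + F p + F (p ^ 2)) := by
  have h := hasSum_sum_of_ne_finset_zero (f := fun k => F (p ^ k)) (s := range 3)
    (L := SummationFilter.unconditional ℕ) (fun k hk => by
    rw [mem_range, not_lt] at hk
    obtain ⟨j, rfl⟩ := Nat.exists_eq_add_of_le' hk
    exact hF _ (sqfreeCorr_prime_pow hp j))
  rw [sum_range_succ, sum_range_succ, sum_range_one, pow_zero, pow_one] at h
  exact h

lemma summable_sqfreeCorr : Summable fun n : ℕ => |sqfreeCorr n| * (n : ℝ) ^ (-(3 / 4) : ℝ) := by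
  set f : ℕ → ℝ := fun n => |sqfreeCorr n| * (n : ℝ) ^ (-(3 / 4) : ℝ) with hf
  have hf0 : ∀ n, 0 ≤ f n := fun n => by positivity
  have hf1 : f 1 = 1 := by simp [hf, isMultiplicative_sqfreeCorr.1]
  have hfm : ∀ {m n : ℕ}, m.Coprime n → f (m * n) = f m * f n := by
    intro m n hmn
    simp only [hf, isMultiplicative_sqfreeCorr.2 hmn, abs_mul, Nat.cast_mul]
    rw [Real.mul_rpow (by positivity) (by positivity)]
    ring
  have hz : ∀ n, sqfreeCorr n = 0 → f n = 0 := fun n hn => by simp [hf, hn]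
  have hsum : Summable fun n : ℕ => (n : ℝ) ^ (-(3 / 2) : ℝ) :=
    Real.summable_nat_rpow.2 (by norm_num)
  set S := ∑' n : ℕ, (n : ℝ) ^ (-(3 / 2) : ℝ)
  have hloc : ∀ {p : ℕ}, p.Prime →
      ∑' k, f (p ^ k) ≤ Real.exp (4 * (p : ℝ) ^ (-(3 / 2) : ℝ)) := by
    intro p hp
    rw [(hasSum_sqfreeCorr_prime hp hz).tsum_eq, hf1]
    have hp2 : (2 : ℝ) ≤ p := by exact_mod_cast hp.two_le
    have hp0 : (0 : ℝ) < p := by linarith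
    set u := (p : ℝ) ^ (-(3 / 2) : ℝ) with hu
    have hu0 : 0 < u := Real.rpow_pos_of_pos hp0 _
    have e1 : f p ≤ 2 * u := by
      simp only [hf, sqfreeCorr_prime hp]
      rw [abs_of_pos (by apply div_pos <;> linarith)]
      have h1 : 1 / ((p : ℝ) - 1) ≤ 2 * (p : ℝ) ^ (-1 : ℝ) := by
        rw [Real.rpow_neg_one, ← div_eq_mul_inv, div_le_div_iff₀ (by linarith) hp0]
        linarith
      have h2 : (p : ℝ) ^ (-1 : ℝ) * (p : ℝ) ^ (-(3 / 4) : ℝ) ≤ u := by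
        rw [← Real.rpow_add hp0, hu]
        exact Real.rpow_le_rpow_of_exponent_le (by linarith) (by norm_num)
      calc _ ≤ 2 * (p : ℝ) ^ (-1 : ℝ) * (p : ℝ) ^ (-(3 / 4) : ℝ) :=
            mul_le_mul_of_nonneg_right h1 (by positivity)
        _ ≤ _ := by rw [mul_assoc]; linarith
    have e2 : f (p ^ 2) ≤ 2 * u := by
      simp only [hf, sqfreeCorr_prime_sq hp, abs_neg]
      rw [abs_of_pos (by apply div_pos <;> linarith)]
      have h1 : (p : ℝ) / (p - 1) ≤ 2 := by
        rw [div_le_iff₀ (by linarith)]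
        linarith
      have h2 : ((p ^ 2 : ℕ) : ℝ) ^ (-(3 / 4) : ℝ) = u := by
        push_cast
        rw [← Real.rpow_natCast, ← Real.rpow_mul hp0.le, hu]
        norm_num
      rw [h2]
      exact mul_le_mul_of_nonneg_right h1 hu0.le
    have := Real.add_one_le_exp (4 * u)
    linarith
  refine summable_of_sum_range_le (c := Real.exp (4 * S)) hf0 fun N => ?_
  have hE := (EulerProduct.summable_and_hasSum_smoothNumbers_prod_primesBelow_tsum hf1 hfm
    (fun {p} hp => by
      simp only [Real.norm_of_nonneg (hf0 _)]
      exact (hasSum_sqfreeCorr_prime hp hz).summable) N).2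
  have hE' : HasSum ((N.smoothNumbers : Set ℕ).indicator f)
      (∏ p ∈ N.primesBelow, ∑' n : ℕ, f (p ^ n)) := hasSum_subtype_iff_indicator.1 hE
  have h1 : ∑ n ∈ range N, f n ≤ ∏ p ∈ N.primesBelow, ∑' n : ℕ, f (p ^ n) := by
    refine le_trans (le_of_eq ?_) (sum_le_hasSum (range N)
      (fun n _ => Set.indicator_nonneg (fun n _ => hf0 n) n) hE')
    refine sum_congr rfl fun n hn => ?_
    rcases Nat.eq_zero_or_pos n with h0 | h0
    · subst h0
      have : f 0 = 0 := by simp [hf]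
      rw [this, Set.indicator_apply, this, ite_self]
    · rw [Set.indicator_of_mem]
      exact Nat.mem_smoothNumbers_of_lt h0 (mem_range.1 hn)
  refine h1.trans ((prod_le_prod (fun p _ => tsum_nonneg fun k => hf0 _) fun p hp =>
    hloc (Nat.prime_of_mem_primesBelow hp)).trans ?_)
  rw [← Real.exp_sum, ← mul_sum]
  refine Real.exp_le_exp.2 (mul_le_mul_of_nonneg_left ?_ (by norm_num))
  exact hsum.sum_le_tsum _ fun n _ => by positivity

lemma summable_sqfreeCorr_mul {w : ℕ → ℝ} {C : ℝ}
    (hw : ∀ n : ℕ, 1 ≤ n → |w n| ≤ C * (n : ℝ) ^ (-(3 / 4) : ℝ)) :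
    Summable fun n : ℕ => sqfreeCorr n * w n := by
  refine Summable.of_norm_bounded (summable_sqfreeCorr.mul_left C) fun n => ?_
  rcases Nat.eq_zero_or_pos n with h0 | h0
  · simp [h0]
  · rw [Real.norm_eq_abs, abs_mul]
    have := mul_le_mul_of_nonneg_left (hw n h0) (abs_nonneg (sqfreeCorr n))
    linarith

lemma rpow_neg_le_rpow_neg {n : ℕ} (hn : 1 ≤ n) {a : ℝ} (ha : a ≤ -(3 / 4)) :
    (n : ℝ) ^ a ≤ (n : ℝ) ^ (-(3 / 4) : ℝ) :=
  Real.rpow_le_rpow_of_exponent_le (by exact_mod_cast hn) ha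

lemma abs_inv_le_rpow {n : ℕ} (hn : 1 ≤ n) : |1 / (n : ℝ)| ≤ 1 * (n : ℝ) ^ (-(3 / 4) : ℝ) := by
  rw [abs_of_nonneg (by positivity), one_mul, one_div, ← Real.rpow_neg_one]
  exact rpow_neg_le_rpow_neg hn (by norm_num)

lemma tsum_sqfreeCorr_div : ∑' n : ℕ, sqfreeCorr n * (1 / (n : ℝ)) = 1 := by
  set f : ℕ → ℝ := fun n => sqfreeCorr n * (1 / (n : ℝ)) with hf
  have hsum : Summable f := summable_sqfreeCorr_mul (C := 1) fun n hn => abs_inv_le_rpow hn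
  have hf1 : f 1 = 1 := by simp [hf, isMultiplicative_sqfreeCorr.1]
  have hfm : ∀ {m n : ℕ}, m.Coprime n → f (m * n) = f m * f n := by
    intro m n hmn
    simp only [hf, isMultiplicative_sqfreeCorr.2 hmn, Nat.cast_mul]
    rw [← one_div_mul_one_div]
    ring
  have h := EulerProduct.eulerProduct_tprod hf1 hfm hsum.norm (by simp [hf])
  rw [← h]
  have : ∀ p : Nat.Primes, ∑' e, f ((p : ℕ) ^ e) = 1 := by
    intro ⟨p, hp⟩
    rw [(hasSum_sqfreeCorr_prime hp (F := f) (fun n hn => by simp [hf, hn])).tsum_eq, hf1]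
    simp only [hf, sqfreeCorr_prime hp, sqfreeCorr_prime_sq hp]
    have hp1 : (1 : ℝ) < p := by exact_mod_cast hp.one_lt
    have hp0 : (p : ℝ) - 1 ≠ 0 := by linarith
    push_cast
    field_simp
    ring
  simp only [this, tprod_one]

end Hooley

namespace Hooley
open Filter Topology

/-- `∑_{r ≤ R} (R - r)² / φ(r)`. -/
noncomputable def totRiesz (R : ℝ) : ℝ := ∑ r ∈ Icc 1 ⌊R⌋₊, (R - r) ^ 2 / (r.totient : ℝ)

/-- `∑_{q ≤ X} 1 / φ(q)`. -/
noncomputable def totSum (X : ℝ) : ℝ := ∑ q ∈ Icc 1 ⌊X⌋₊, 1 / (q.totient : ℝ)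

lemma inv_totient_eq_sum_divisors {r : ℕ} (hr : 1 ≤ r) :
    1 / (r.totient : ℝ) = ∑ d ∈ r.divisors, sqfreeRatio d / (d * r) := by
  have hr0 : (r : ℝ) ≠ 0 := by positivity
  have h := div_totient_eq_sum_divisors r
  have h1 : 1 / (r.totient : ℝ) = (r / r.totient) / r := by field_simp
  rw [h1, h, sum_div]
  exact sum_congr rfl fun d _ => by rw [div_div]

lemma sum_sqfreeRatio_mul {X : ℝ} (hX : 0 ≤ X) (F : ℕ → ℝ) :
    ∑ d ∈ Icc 1 ⌊X⌋₊, sqfreeRatio d * F d =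
      ∑ e ∈ Icc 1 ⌊X⌋₊, sqfreeCorr e * ∑ j ∈ Icc 1 ⌊X / e⌋₊, F (e * j) := by
  simp only [sqfreeRatio_eq_sum_divisors, sum_mul]
  rw [sum_Icc_sum_divisors hX (fun e d => sqfreeCorr e * F d)]
  simp only [mul_sum]

lemma totRiesz_eq {R : ℝ} (hR : 0 ≤ R) :
    totRiesz R = ∑ e ∈ Icc 1 ⌊R⌋₊, sqfreeCorr e * rieszU (R / e) := by
  have h1 : totRiesz R = ∑ r ∈ Icc 1 ⌊R⌋₊, ∑ d ∈ r.divisors,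
      (R - r) ^ 2 * (sqfreeRatio d / (d * r)) := by
    refine sum_congr rfl fun r hr => ?_
    rw [← mul_sum, ← inv_totient_eq_sum_divisors (mem_Icc.1 hr).1, mul_one_div]
  rw [h1, sum_Icc_sum_divisors hR (fun d r => (R - r) ^ 2 * (sqfreeRatio d / (d * r)))]
  have h2 : ∀ d ∈ Icc 1 ⌊R⌋₊, ∑ m ∈ Icc 1 ⌊R / d⌋₊,
      (R - ((d * m : ℕ) : ℝ)) ^ 2 * (sqfreeRatio d / (d * ((d * m : ℕ) : ℝ))) =
        sqfreeRatio d * rieszInv (R / d) := by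
    intro d hd
    rw [rieszInv, mul_sum]
    refine sum_congr rfl fun m hm => ?_
    have hd0 : (d : ℝ) ≠ 0 := by
      have := (mem_Icc.1 hd).1
      positivity
    have hm0 : (m : ℝ) ≠ 0 := by
      have := (mem_Icc.1 hm).1
      positivity
    push_cast
    field_simp
  rw [sum_congr rfl h2, sum_sqfreeRatio_mul hR (fun d => rieszInv (R / d))]
  refine sum_congr rfl fun e _ => ?_
  rw [rieszU]
  simp only [Nat.cast_mul, div_div]

lemma totSum_eq {X : ℝ} (hX : 0 ≤ X) :
    totSum X = ∑ e ∈ Icc 1 ⌊X⌋₊, sqfreeCorr e * (1 / (e : ℝ) ^ 2 * sumU (X / e)) := by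
  have h1 : totSum X = ∑ r ∈ Icc 1 ⌊X⌋₊, ∑ d ∈ r.divisors, sqfreeRatio d / (d * r) :=
    sum_congr rfl fun r hr => inv_totient_eq_sum_divisors (mem_Icc.1 hr).1
  rw [h1, sum_Icc_sum_divisors hX (fun d r => sqfreeRatio d / (d * r))]
  have h2 : ∀ d ∈ Icc 1 ⌊X⌋₊, ∑ m ∈ Icc 1 ⌊X / d⌋₊, sqfreeRatio d / (d * ((d * m : ℕ) : ℝ)) =
      sqfreeRatio d * (1 / (d : ℝ) ^ 2 * ∑ m ∈ Icc 1 ⌊X / d⌋₊, 1 / (m : ℝ)) := by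
    intro d _
    rw [mul_sum, mul_sum]
    refine sum_congr rfl fun m _ => ?_
    push_cast
    rw [← mul_assoc, ← sq, one_div_mul_one_div, mul_one_div]
  rw [sum_congr rfl h2,
    sum_sqfreeRatio_mul hX (fun d => 1 / (d : ℝ) ^ 2 * ∑ m ∈ Icc 1 ⌊X / d⌋₊, 1 / (m : ℝ))]
  refine sum_congr rfl fun e _ => ?_
  congr 1
  rw [sumU, mul_sum]
  refine sum_congr rfl fun j _ => ?_
  simp only [Nat.cast_mul, div_div]
  rw [mul_pow, ← mul_assoc, one_div_mul_one_div]

lemma hasSum_sqfreeCorr_of_vanish {X : ℝ} {F : ℕ → ℝ}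
    (hF : ∀ e : ℕ, X < e → F e = 0) (hX : 0 ≤ X) :
    HasSum (fun e => sqfreeCorr e * F e) (∑ e ∈ Icc 1 ⌊X⌋₊, sqfreeCorr e * F e) := by
  refine hasSum_sum_of_ne_finset_zero fun e he => ?_
  rcases Nat.eq_zero_or_pos e with h0 | h0
  · simp [h0]
  · rw [hF e, mul_zero]
    rw [mem_Icc, not_and, not_le] at he
    exact (Nat.floor_lt hX).1 (he h0)

lemma rieszU_of_lt_one {Y : ℝ} (hY : Y < 1) : rieszU Y = 0 := by
  simp [rieszU, Nat.floor_eq_zero.2 hY]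

lemma sumU_of_lt_one {Y : ℝ} (hY : Y < 1) : sumU Y = 0 := by
  simp [sumU, Nat.floor_eq_zero.2 hY]

lemma log_natCast_le_rpow {n : ℕ} (hn : 1 ≤ n) : Real.log n ≤ 4 * (n : ℝ) ^ (1 / 4 : ℝ) := by
  have := Real.log_le_rpow_div (x := (n : ℝ)) (ε := 1 / 4) (by positivity) (by norm_num)
  linarith

lemma abs_log_div_le_rpow {n : ℕ} (hn : 1 ≤ n) :
    |Real.log n / (n : ℝ)| ≤ 4 * (n : ℝ) ^ (-(3 / 4) : ℝ) := by
  have hn0 : (0 : ℝ) < n := by exact_mod_cast hn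
  have h0 : 0 ≤ Real.log n := Real.log_natCast_nonneg n
  rw [abs_of_nonneg (by positivity), div_le_iff₀ hn0, mul_assoc]
  nth_rewrite 3 [← Real.rpow_one (n : ℝ)]
  rw [← Real.rpow_add hn0]
  norm_num
  have := log_natCast_le_rpow hn
  norm_num at this
  exact this

lemma abs_log_div_sq_le_rpow {n : ℕ} (hn : 1 ≤ n) :
    |Real.log n / (n : ℝ) ^ 2| ≤ 4 * (n : ℝ) ^ (-(3 / 4) : ℝ) := by
  refine le_trans ?_ (abs_log_div_le_rpow hn)
  have hn0 : (1 : ℝ) ≤ n := by exact_mod_cast hn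
  have h0 : 0 ≤ Real.log n := Real.log_natCast_nonneg n
  rw [abs_of_nonneg (by positivity), abs_of_nonneg (by positivity)]
  exact div_le_div_of_nonneg_left h0 (by positivity) (by nlinarith)

lemma abs_inv_sq_le_rpow {n : ℕ} (hn : 1 ≤ n) :
    |1 / (n : ℝ) ^ 2| ≤ 1 * (n : ℝ) ^ (-(3 / 4) : ℝ) := by
  refine le_trans ?_ (abs_inv_le_rpow hn)
  have hn0 : (1 : ℝ) ≤ n := by exact_mod_cast hn
  rw [abs_of_nonneg (by positivity), abs_of_nonneg (by positivity)]
  exact one_div_le_one_div_of_le (by positivity) (by nlinarith)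

/-- Asymptotics of `totRiesz` and `totSum` with a common leading constant. -/
lemma exists_tot_asymp : ∃ α β δ β' C : ℝ, 0 < C ∧ ∀ s : ℝ, 1 ≤ s →
    |totRiesz (s ^ 4) - ((s ^ 4) ^ 2 * (α * Real.log (s ^ 4) + β) +
      s ^ 4 * (Real.log (s ^ 4) + δ))| ≤ C * s ^ 3 ∧
    |totSum (s ^ 4) - (α * Real.log (s ^ 4) + β')| ≤ C * (1 / s) := by
  obtain ⟨z, a, b, c, C, hC, h⟩ := exists_rieszU_sumU_asymp
  have s1 := (summable_sqfreeCorr_mul (C := 1) fun n hn => abs_inv_le_rpow hn).hasSum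
  rw [tsum_sqfreeCorr_div] at s1
  have s2 := (summable_sqfreeCorr_mul (C := 1) fun n hn => abs_inv_sq_le_rpow hn).hasSum
  have t1 := (summable_sqfreeCorr_mul (C := 4) fun n hn => abs_log_div_le_rpow hn).hasSum
  have t2 := (summable_sqfreeCorr_mul (C := 4) fun n hn => abs_log_div_sq_le_rpow hn).hasSum
  have s0 := summable_sqfreeCorr.hasSum
  set A2 := ∑' n : ℕ, sqfreeCorr n * (1 / (n : ℝ) ^ 2)
  set B1 := ∑' n : ℕ, sqfreeCorr n * (Real.log n / (n : ℝ))
  set B2 := ∑' n : ℕ, sqfreeCorr n * (Real.log n / (n : ℝ) ^ 2)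
  set S := ∑' n : ℕ, |sqfreeCorr n| * (n : ℝ) ^ (-(3 / 4) : ℝ)
  have hS : 0 ≤ S := tsum_nonneg fun n => by positivity
  refine ⟨z * A2, a * A2 - z * B2, b - B1, c * A2 - z * B2, C * (S + 1), by positivity,
    fun s hs => ?_⟩
  have hs0 : 0 < s := by linarith
  set R := s ^ 4 with hR
  have hR0 : 0 < R := by positivity
  have hroot : ∀ e : ℕ, 1 ≤ e → ∃ t : ℝ, 0 < t ∧ t ^ 4 = R / e ∧
      t ^ 3 = s ^ 3 * (e : ℝ) ^ (-(3 / 4) : ℝ) ∧ t ≤ s ∧ 1 / t = 1 / s * (e : ℝ) ^ (1 / 4 : ℝ) := by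
    intro e he
    have he1 : (1 : ℝ) ≤ e := by exact_mod_cast he
    have he0 : (0 : ℝ) < e := by linarith
    refine ⟨s * (e : ℝ) ^ (-(1 / 4) : ℝ), by positivity, ?_, ?_, ?_, ?_⟩
    · have h1 : R / e = s ^ 4 * (e : ℝ) ^ (-1 : ℝ) := by
        rw [Real.rpow_neg_one, div_eq_mul_inv]
      rw [h1, mul_pow, ← Real.rpow_natCast ((e : ℝ) ^ _), ← Real.rpow_mul he0.le]
      norm_num
    · rw [mul_pow, ← Real.rpow_natCast ((e : ℝ) ^ _), ← Real.rpow_mul he0.le]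
      norm_num
    · exact mul_le_of_le_one_right hs0.le (Real.rpow_le_one_of_one_le_of_nonpos he1 (by norm_num))
    · rw [Real.rpow_neg he0.le]
      field_simp
  have hlt : ∀ e : ℕ, R < e → R / e < 1 := by
    intro e he
    rwa [div_lt_one (hR0.trans he)]
  constructor
  · have hW := hasSum_sqfreeCorr_of_vanish (X := R) (F := fun e => rieszU (R / e))
      (fun e he => rieszU_of_lt_one (hlt e he)) hR0.le
    rw [← totRiesz_eq hR0.le] at hW
    have hM := (((s2.mul_left (R ^ 2 * (z * Real.log R + a))).sub (t2.mul_left (R ^ 2 * z))).add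
      (s1.mul_left (R * (Real.log R + b)))).sub (t1.mul_left R)
    have hd := (hW.sub hM).norm_le_of_bounded (s0.mul_left (C * s ^ 3)) (fun e => by
      rcases Nat.eq_zero_or_pos e with he | he
      · simp [he]
      obtain ⟨t, ht0, ht4, ht3, -, -⟩ := hroot e he
      have he0 : (e : ℝ) ≠ 0 := by positivity
      have hb := (h t ht0).1
      rw [ht4, ht3, Real.log_div hR0.ne' he0] at hb
      have hb' := mul_le_mul_of_nonneg_left hb (abs_nonneg (sqfreeCorr e))
      rw [← abs_mul] at hb'
      rw [Real.norm_eq_abs]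
      refine le_trans (le_of_eq ?_) (hb'.trans (le_of_eq ?_))
      · congr 1
        field_simp
        ring
      · ring)
    rw [Real.norm_eq_abs] at hd
    have hfin : C * s ^ 3 * S ≤ C * (S + 1) * s ^ 3 := by
      have : 0 ≤ C * s ^ 3 := by positivity
      linarith
    refine le_trans (le_of_eq ?_) (hd.trans hfin)
    congr 1
    ring
  · have hW := hasSum_sqfreeCorr_of_vanish (X := R)
      (F := fun e => 1 / (e : ℝ) ^ 2 * sumU (R / e))
      (fun e he => by rw [sumU_of_lt_one (hlt e he), mul_zero]) hR0.le
    rw [← totSum_eq hR0.le] at hW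
    have hM := (s2.mul_left (z * Real.log R + c)).sub (t2.mul_left z)
    have hd := (hW.sub hM).norm_le_of_bounded (s0.mul_left (C * (1 / s))) (fun e => by
      rcases Nat.eq_zero_or_pos e with he | he
      · simp [he]
      obtain ⟨t, ht0, ht4, -, -, ht1⟩ := hroot e he
      have he1 : (1 : ℝ) ≤ e := by exact_mod_cast he
      have he0 : (e : ℝ) ≠ 0 := by positivity
      have hb := (h t ht0).2
      rw [ht4, ht1, Real.log_div hR0.ne' he0] at hb
      have hb' := mul_le_mul_of_nonneg_left hb (abs_nonneg (sqfreeCorr e * (1 / (e : ℝ) ^ 2)))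
      rw [← abs_mul] at hb'
      rw [Real.norm_eq_abs]
      have hpow : 1 / (e : ℝ) ^ 2 * (e : ℝ) ^ (1 / 4 : ℝ) ≤ (e : ℝ) ^ (-(3 / 4) : ℝ) := by
        have h2 : 1 / (e : ℝ) ^ 2 = (e : ℝ) ^ (-2 : ℝ) := by
          rw [Real.rpow_neg (by positivity), one_div]
          norm_num
        rw [h2, ← Real.rpow_add (by positivity)]
        exact rpow_neg_le_rpow_neg he (by norm_num)
      have hb₂ : |sqfreeCorr e * (1 / (e : ℝ) ^ 2)| * (C * (1 / s * (e : ℝ) ^ (1 / 4 : ℝ))) ≤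
          C * (1 / s) * (|sqfreeCorr e| * (e : ℝ) ^ (-(3 / 4) : ℝ)) := by
        rw [abs_mul, abs_of_nonneg (by positivity : 0 ≤ 1 / (e : ℝ) ^ 2)]
        have := mul_le_mul_of_nonneg_left hpow
          (by positivity : 0 ≤ C * (1 / s) * |sqfreeCorr e|)
        linarith
      refine le_trans (le_of_eq ?_) (hb'.trans hb₂)
      congr 1
      field_simp
      ring)
    rw [Real.norm_eq_abs] at hd
    have hfin : C * (1 / s) * S ≤ C * (S + 1) * (1 / s) := by
      have : 0 ≤ C * (1 / s) := by positivity
      linarith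
    refine le_trans (le_of_eq ?_) (hd.trans hfin)
    congr 1
    ring

end Hooley

namespace Hooley
open ArithmeticFunction

lemma psi_one_eq (y : ℝ) (a : ℕ) : psi y 1 a = ∑ n ∈ Icc 1 ⌊y⌋₊, vonMangoldt n := by
  simp [psi, Nat.mod_one]

lemma psi_nonneg (y : ℝ) (q a : ℕ) : 0 ≤ psi y q a :=
  sum_nonneg fun _ _ => vonMangoldt_nonneg

lemma sum_vonMangoldt_mul_log_le {y : ℝ} (hy : 1 ≤ y) :
    ∑ n ∈ Icc 1 ⌊y⌋₊, vonMangoldt n ≤ y * Real.log y := by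
  calc ∑ n ∈ Icc 1 ⌊y⌋₊, vonMangoldt n ≤ ∑ _n ∈ Icc 1 ⌊y⌋₊, Real.log y :=
        sum_le_sum fun n hn => vonMangoldt_le_log.trans (log_le_log_of_mem hy hn).2
    _ = ⌊y⌋₊ * Real.log y := by simp
    _ ≤ y * Real.log y := by
        have := Nat.floor_le (by linarith : 0 ≤ y)
        have := Real.log_nonneg hy
        gcongr

lemma psi_le_mul_log {y : ℝ} (hy : 1 ≤ y) (q a : ℕ) : psi y q a ≤ y * Real.log y :=
  (sum_le_sum_of_subset_of_nonneg (filter_subset _ _) fun _ _ _ => vonMangoldt_nonneg).trans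
    (sum_vonMangoldt_mul_log_le hy)

lemma sqrt_le_div_log_pow (m : ℕ) {x : ℝ} (hx : 3 ≤ x) :
    √x ≤ m.factorial * 2 ^ m * x / Real.log x ^ m := by
  have hL := one_le_log_of_three_le hx
  have h1 : 1 ≤ √x := Real.one_le_sqrt.2 (by linarith)
  have h2 := log_pow_le_factorial_mul h1 m
  rw [Real.log_sqrt (by linarith), div_pow, div_le_iff₀ (by positivity)] at h2
  rw [le_div_iff₀ (by positivity)]
  have h3 := Real.mul_self_sqrt (by linarith : 0 ≤ x)
  calc √x * Real.log x ^ m ≤ √x * (m.factorial * √x * 2 ^ m) := by gcongr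
    _ = m.factorial * 2 ^ m * (√x * √x) := by ring
    _ = _ := by rw [h3]

/-- A form of the Siegel–Walfisz theorem that is uniform over all initial segments of `[0, x]`. -/
lemma siegel_walfisz_uniform (A B : ℕ) : ∃ C : ℝ, 0 < C ∧ ∀ x : ℝ, 55 ≤ x → ∀ y : ℝ, 0 ≤ y →
    y ≤ x → ∀ r : ℕ, 1 ≤ r → (r : ℝ) ≤ Real.log x ^ B → ∀ a : ℕ, a.Coprime r →
    |psi y r a - y / (r.totient : ℝ)| ≤ C * (x / Real.log x ^ A) := by
  obtain ⟨C₀, hC₀, hsw⟩ := siegel_walfisz (2 * B + A)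
  refine ⟨C₀ * 2 ^ A + (A + 1).factorial * 2 ^ (A + 1) * 2, by positivity, ?_⟩
  intro x hx y hy0 hyx r hr hrB a ha
  have hx3 : 3 ≤ x := by linarith
  have hL4 : 4 ≤ Real.log x := by
    rw [Real.le_log_iff_exp_le (by linarith)]
    have h := Real.exp_one_lt_d9
    have h2 : Real.exp 4 = Real.exp 1 ^ 4 := by rw [← Real.exp_nat_mul]; norm_num
    rw [h2]
    calc Real.exp 1 ^ 4 ≤ 2.7182818286 ^ 4 := by gcongr
      _ ≤ x := by norm_num; linarith
  have hL : 0 < Real.log x := by linarith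
  have hq : 0 < x / Real.log x ^ A := by positivity
  have hφ : (1 : ℝ) ≤ r.totient := by exact_mod_cast Nat.totient_pos.2 hr
  rcases le_or_gt (√x) y with h | h
  · have hsx : 3 ≤ √x := Real.le_sqrt_of_sq_le (by linarith)
    have hy3 : 3 ≤ y := hsx.trans h
    have hly : Real.log x / 2 ≤ Real.log y := by
      rw [← Real.log_sqrt (by linarith)]
      exact Real.log_le_log (by linarith) h
    have hly2 : 2 ≤ Real.log y := by linarith
    have h1 : (r : ℝ) ≤ Real.log y ^ (2 * B + A) := by
      calc (r : ℝ) ≤ Real.log x ^ B := hrB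
        _ ≤ (Real.log y ^ 2) ^ B := by
            gcongr
            nlinarith
        _ = Real.log y ^ (2 * B) := by rw [pow_mul]
        _ ≤ _ := pow_le_pow_right₀ (by linarith) (by omega)
    refine (hsw y hy3 r hr h1 a ha).trans ?_
    have h2 : C₀ * y / Real.log y ^ (2 * B + A) ≤ C₀ * x / (Real.log x / 2) ^ A := by
      gcongr
      calc (Real.log x / 2) ^ A ≤ Real.log y ^ A := by gcongr
        _ ≤ _ := pow_le_pow_right₀ (by linarith) (by omega)
    calc C₀ * y / Real.log y ^ (2 * B + A) ≤ C₀ * x / (Real.log x / 2) ^ A := h2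
      _ = C₀ * 2 ^ A * (x / Real.log x ^ A) := by rw [div_pow]; field_simp
      _ ≤ _ := by
        gcongr
        have : (0 : ℝ) ≤ (A + 1).factorial * 2 ^ (A + 1) * 2 := by positivity
        linarith
  · have hs1 : 1 ≤ √x := Real.one_le_sqrt.2 (by linarith)
    have h1 : psi y r a ≤ √x * Real.log x := by
      calc psi y r a ≤ psi (√x) r a := by
            refine sum_le_sum_of_subset_of_nonneg (filter_subset_filter _ ?_)
              fun _ _ _ => vonMangoldt_nonneg
            exact Icc_subset_Icc_right (Nat.floor_le_floor h.le)
        _ ≤ √x * Real.log (√x) := psi_le_mul_log hs1 r a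
        _ ≤ √x * Real.log x := by
            refine mul_le_mul_of_nonneg_left ?_ (by linarith)
            rw [Real.log_sqrt (by linarith)]
            linarith
    have h2 : y / (r.totient : ℝ) ≤ √x := by
      rw [div_le_iff₀ (by linarith)]
      nlinarith
    have h3 : (0 : ℝ) ≤ y / r.totient := by positivity
    have h4 := psi_nonneg y r a
    have h5 : |psi y r a - y / (r.totient : ℝ)| ≤ √x * Real.log x * 2 := by
      rw [abs_le]
      constructor <;> nlinarith
    refine h5.trans ?_
    have h6 := sqrt_le_div_log_pow (A + 1) hx3
    calc √x * Real.log x * 2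
        ≤ ((A + 1).factorial * 2 ^ (A + 1) * x / Real.log x ^ (A + 1)) * Real.log x * 2 := by
          gcongr
      _ = (A + 1).factorial * 2 ^ (A + 1) * 2 * (x / Real.log x ^ A) := by
          rw [pow_succ (Real.log x)]
          field_simp
      _ ≤ _ := by
        gcongr
        have : 0 ≤ C₀ * 2 ^ A := by positivity
        linarith

lemma sum_mul_natCast_sub (f : ℕ → ℝ) (N : ℕ) :
    ∑ n ∈ Icc 1 N, f n * ((N : ℝ) - n) = ∑ m ∈ range N, ∑ n ∈ Icc 1 m, f n := by
  induction N with
  | zero => simp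
  | succ N ih =>
    rw [sum_range_succ, ← ih, sum_Icc_succ_top (by omega), ← sum_add_distrib]
    push_cast
    rw [sub_self, mul_zero, add_zero]
    exact sum_congr rfl fun n _ => by ring

lemma abs_sum_vonMangoldt_mul_sub_le {z E : ℝ} (hz : 0 ≤ z)
    (hE : ∀ y : ℝ, 0 ≤ y → y ≤ z → |psi y 1 1 - y| ≤ E) :
    |∑ n ∈ Icc 1 ⌊z⌋₊, vonMangoldt n * (z - n) - z ^ 2 / 2| ≤ (z + 1) * E + 3 * z := by
  set N := ⌊z⌋₊ with hN
  have hNz : (N : ℝ) ≤ z := Nat.floor_le hz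
  have hzN : z < N + 1 := Nat.lt_floor_add_one z
  have hN0 : (0 : ℝ) ≤ N := Nat.cast_nonneg N
  have hE' : ∀ m : ℕ, m ≤ N → |∑ n ∈ Icc 1 m, vonMangoldt n - m| ≤ E := by
    intro m hm
    have h := hE m (Nat.cast_nonneg m) ((Nat.cast_le.2 hm).trans hNz)
    rwa [psi_one_eq, Nat.floor_natCast] at h
  have hE0 : 0 ≤ E := (abs_nonneg _).trans (hE' 0 (Nat.zero_le _))
  have h1 : ∑ n ∈ Icc 1 N, vonMangoldt n * (z - n) =
      ∑ m ∈ range N, ∑ n ∈ Icc 1 m, vonMangoldt n + (z - N) * ∑ n ∈ Icc 1 N, vonMangoldt n := by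
    rw [← sum_mul_natCast_sub, mul_sum, ← sum_add_distrib]
    exact sum_congr rfl fun n _ => by ring
  have h2 : |∑ m ∈ range N, ∑ n ∈ Icc 1 m, vonMangoldt n - ∑ m ∈ range N, (m : ℝ)| ≤ N * E := by
    rw [← sum_sub_distrib]
    refine (abs_sum_le_sum_abs _ _).trans ?_
    calc _ ≤ ∑ _m ∈ range N, E := sum_le_sum fun m hm => hE' m (mem_range.1 hm).le
      _ = N * E := by simp
  have h3 : ∑ m ∈ range N, (m : ℝ) = N * (N - 1) / 2 := by
    have : ∀ M : ℕ, ∑ m ∈ range M, (m : ℝ) = M * (M - 1) / 2 := by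
      intro M
      induction M with
      | zero => simp
      | succ M ih => rw [sum_range_succ, ih]; push_cast; ring
    exact this N
  have h4 := hE' N le_rfl
  rw [h1]
  rw [h3] at h2
  set S := ∑ m ∈ range N, ∑ n ∈ Icc 1 m, vonMangoldt n
  set P := ∑ n ∈ Icc 1 N, vonMangoldt n
  rw [abs_le] at h2 h4 ⊢
  have h5 : 0 ≤ z - N := by linarith
  have h6 : z - N ≤ 1 := by linarith
  have h7 : (z - N) * P ≤ N + E := by nlinarith
  have h8 : -E ≤ (z - N) * P := by nlinarith
  constructor <;> nlinarith

lemma abs_sum_mul_log_le {a : ℕ → ℝ} {E : ℝ} {N : ℕ} (hN : 1 ≤ N)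
    (hE : ∀ m ≤ N, |∑ n ∈ Icc 1 m, a n| ≤ E) :
    |∑ n ∈ Icc 1 N, a n * Real.log n| ≤ 2 * E * Real.log N := by
  have hE0 : 0 ≤ E := (abs_nonneg _).trans (hE 0 (Nat.zero_le _))
  have key : ∀ M : ℕ, 1 ≤ M → M ≤ N →
      |(∑ n ∈ Icc 1 M, a n) * Real.log M - ∑ n ∈ Icc 1 M, a n * Real.log n| ≤
        E * Real.log M := by
    intro M hM
    induction M, hM using Nat.le_induction with
    | base => intro; simp
    | succ M hM ih =>
      intro hMN
      rw [sum_Icc_succ_top (by omega), sum_Icc_succ_top (by omega)]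
      have h1 := ih (by omega)
      have h2 := hE M (by omega)
      have h3 : 0 ≤ Real.log (M + 1 : ℕ) - Real.log M := by
        rw [sub_nonneg]
        exact Real.log_le_log (by positivity) (by push_cast; linarith)
      set S := ∑ n ∈ Icc 1 M, a n
      set T := ∑ n ∈ Icc 1 M, a n * Real.log n
      have h4 : (S + a (M + 1)) * Real.log (M + 1 : ℕ) - (T + a (M + 1) * Real.log (M + 1 : ℕ)) =
          (S * Real.log M - T) + S * (Real.log (M + 1 : ℕ) - Real.log M) := by ring
      rw [h4]
      calc _ ≤ |S * Real.log M - T| + |S * (Real.log (M + 1 : ℕ) - Real.log M)| := abs_add_le _ _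
        _ ≤ E * Real.log M + E * (Real.log (M + 1 : ℕ) - Real.log M) := by
            rw [abs_mul, abs_of_nonneg h3]
            gcongr
        _ = _ := by ring
  have h1 := key N hN le_rfl
  have h2 := hE N le_rfl
  have h3 : 0 ≤ Real.log N := Real.log_natCast_nonneg N
  rw [abs_le] at h1 h2 ⊢
  constructor <;> nlinarith

lemma abs_sum_log_sub_le {x : ℝ} (hx : 1 ≤ x) :
    |∑ n ∈ Icc 1 ⌊x⌋₊, Real.log n - (x * Real.log x - x)| ≤ 2 * Real.log x + 2 := by
  set N := ⌊x⌋₊ with hN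
  have hN1 : 1 ≤ N := (Nat.le_floor_iff (by linarith)).2 (by simpa using hx)
  have hNx : (N : ℝ) ≤ x := Nat.floor_le (by linarith)
  have hxN : x < N + 1 := Nat.lt_floor_add_one x
  have hN0 : (1 : ℝ) ≤ N := by exact_mod_cast hN1
  have h := sum_antitone_bounds (f := fun u => -Real.log u) (F := fun u => u - u * Real.log u)
    (K := 1) (fun u hu => by
      have hu0 : u ≠ 0 := by
        push_cast at hu
        positivity
      have h1 := (hasDerivAt_id u).sub ((hasDerivAt_id u).mul (Real.hasDerivAt_log hu0))
      have h2 : -Real.log u = 1 - (1 * Real.log u + id u * u⁻¹) := by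
        simp [hu0]
      rw [h2]
      exact h1)
    (fun u hu v hv huv => by
      simp only [Set.mem_Ici, Nat.cast_one] at hu
      exact neg_le_neg (Real.log_le_log (by linarith) huv)) hN1
  simp only [sum_neg_distrib, Nat.cast_one, Real.log_one, mul_zero, neg_zero] at h
  have h2 : ∑ n ∈ Icc 1 N, Real.log n = ∑ n ∈ Icc (1 + 1) N, Real.log n := by
    rw [← add_sum_Ioc_eq_sum_Icc hN1]
    simp only [Nat.cast_one, Real.log_one, zero_add]
    rfl
  rw [h2]
  have h3 : 0 ≤ Real.log N := Real.log_nonneg hN0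
  have h4 : Real.log N ≤ Real.log x := Real.log_le_log (by linarith) hNx
  have h5 : Real.log x - Real.log N ≤ (x - N) / N := by
    rw [← Real.log_div (by linarith) (by linarith)]
    have := Real.log_le_sub_one_of_pos (x := x / N) (by positivity)
    rw [sub_div, div_self (by linarith : (N : ℝ) ≠ 0)]
    exact this
  have h6 : N * (Real.log x - Real.log N) ≤ 1 := by
    rw [le_div_iff₀ (by linarith)] at h5
    nlinarith
  have h7 : (x - N) * Real.log x ≤ Real.log x := by nlinarith
  have h8 : 0 ≤ (x - N) * Real.log x := mul_nonneg (by linarith) (by linarith)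
  have h9 : 0 ≤ N * (Real.log x - Real.log N) := mul_nonneg (by linarith) (by linarith)
  rw [abs_le]
  constructor <;> nlinarith [h.1, h.2]

/-- The mean square of `Λ` in terms of the error term of the prime number theorem. -/
lemma abs_sum_vonMangoldt_sq_sub_le {x E : ℝ} (hx : 3 ≤ x)
    (hE : ∀ y : ℝ, 0 ≤ y → y ≤ x → |psi y 1 1 - y| ≤ E) :
    |∑ n ∈ Icc 1 ⌊x⌋₊, vonMangoldt n ^ 2 - (x * Real.log x - x)| ≤
      2 * E * Real.log x + 6 * √x * Real.log x ^ 2 := by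
  have hL := one_le_log_of_three_le hx
  have hN1 : 1 ≤ ⌊x⌋₊ := (Nat.le_floor_iff (by linarith)).2 (by norm_num; linarith)
  have hNx : (⌊x⌋₊ : ℝ) ≤ x := Nat.floor_le (by linarith)
  have h1 := abs_sum_mul_log_le (a := fun n => vonMangoldt n - 1) (E := E) hN1 (by
    intro m hm
    have h := hE m (Nat.cast_nonneg m) ((Nat.cast_le.2 hm).trans hNx)
    rw [psi_one_eq, Nat.floor_natCast] at h
    simpa using h)
  have hE0 : 0 ≤ E := (abs_nonneg _).trans (hE 0 le_rfl (by linarith))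
  have h1' : |∑ n ∈ Icc 1 ⌊x⌋₊, (vonMangoldt n - 1) * Real.log n| ≤ 2 * E * Real.log x :=
    h1.trans (by gcongr)
  have h2 := abs_sum_log_sub_le (by linarith : 1 ≤ x)
  have h3 : 0 ≤ ∑ n ∈ Icc 1 ⌊x⌋₊, (vonMangoldt n * Real.log n - vonMangoldt n ^ 2) :=
    sum_nonneg fun n _ => by
      have := vonMangoldt_le_log (n := n)
      have := vonMangoldt_nonneg (n := n)
      nlinarith
  have h4 : ∑ n ∈ Icc 1 ⌊x⌋₊, (vonMangoldt n * Real.log n - vonMangoldt n ^ 2) ≤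
      2 * √x * Real.log x * Real.log x := by
    calc _ ≤ ∑ n ∈ Icc 1 ⌊x⌋₊ with ¬ n.Prime, vonMangoldt n * Real.log x := by
          rw [sum_filter]
          refine sum_le_sum fun n hn => ?_
          by_cases h : n.Prime
          · rw [if_neg (not_not.2 h), vonMangoldt_apply_prime h]
            linarith [sq (Real.log (n : ℝ))]
          · rw [if_pos h]
            have := (log_le_log_of_mem (by linarith) hn).2
            have := vonMangoldt_nonneg (n := n)
            nlinarith [sq_nonneg (vonMangoldt n)]
      _ = (Chebyshev.psi x - Chebyshev.theta x) * Real.log x := by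
          rw [Chebyshev.psi_sub_theta_eq_sum_not_prime, sum_mul]
          rfl
      _ ≤ 2 * √x * Real.log x * Real.log x := by
          gcongr
          exact Chebyshev.psi_sub_theta_le (by linarith)
  have h5 : ∑ n ∈ Icc 1 ⌊x⌋₊, vonMangoldt n ^ 2 =
      ∑ n ∈ Icc 1 ⌊x⌋₊, (vonMangoldt n - 1) * Real.log n + ∑ n ∈ Icc 1 ⌊x⌋₊, Real.log n -
      ∑ n ∈ Icc 1 ⌊x⌋₊, (vonMangoldt n * Real.log n - vonMangoldt n ^ 2) := by
    rw [← sum_add_distrib, ← sum_sub_distrib]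
    exact sum_congr rfl fun n _ => by ring
  rw [h5]
  have h6 : 1 ≤ √x := Real.one_le_sqrt.2 (by linarith)
  have h7 : Real.log x ≤ √x * Real.log x ^ 2 := by nlinarith
  rw [abs_le] at *
  constructor <;> nlinarith

end Hooley

namespace Hooley
open ArithmeticFunction

/-- `∑_{n ≤ x, (n, q) ≠ 1} Λ(n)`. -/
noncomputable def notCoprimeSum (x : ℝ) (q : ℕ) : ℝ :=
  ∑ n ∈ Icc 1 ⌊x⌋₊ with ¬ n.Coprime q, vonMangoldt n

/-- `∑_{n < m ≤ x, q ∣ m - n} Λ(n) Λ(m)`. -/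
noncomputable def offDiag (x : ℝ) (q : ℕ) : ℝ :=
  ∑ n ∈ Icc 1 ⌊x⌋₊, ∑ m ∈ Icc 1 ⌊x⌋₊ with n < m ∧ q ∣ m - n, vonMangoldt n * vonMangoldt m

lemma notCoprimeSum_nonneg (x : ℝ) (q : ℕ) : 0 ≤ notCoprimeSum x q :=
  sum_nonneg fun _ _ => vonMangoldt_nonneg

lemma notCoprimeSum_le {x : ℝ} (hx : 3 ≤ x) {q : ℕ} (hq : q ≠ 0) (hqx : (q : ℝ) ≤ x) :
    notCoprimeSum x q ≤ 9 * Real.log x ^ 3 := by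
  have hL := one_le_log_of_three_le hx
  have h1 := sum_not_coprime_le 0 q hq hx
  have h2 := card_primeFactors_add_one_le_log hq hx hqx
  simp only [pow_zero, mul_one, zero_add] at h1
  calc notCoprimeSum x q ≤ #q.primeFactors * (3 * Real.log x ^ 2) := h1
    _ ≤ (3 * Real.log x) * (3 * Real.log x ^ 2) := by
        gcongr
        linarith
    _ = _ := by ring

lemma sum_filter_symm {s : Finset ℕ} {P : ℕ → ℕ → Prop} [∀ a b, Decidable (P a b)]
    (hr : ∀ a, P a a) (hs : ∀ a b, P a b → P b a) {F : ℕ → ℕ → ℝ} (hF : ∀ a b, F a b = F b a) :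
    ∑ n ∈ s, ∑ m ∈ s with P n m, F n m =
      ∑ n ∈ s, F n n + 2 * ∑ n ∈ s, ∑ m ∈ s with n < m ∧ P n m, F n m := by
  have h1 : ∑ n ∈ s, ∑ m ∈ s with m < n ∧ P n m, F n m =
      ∑ n ∈ s, ∑ m ∈ s with n < m ∧ P n m, F n m := by
    simp only [sum_filter]
    rw [sum_comm]
    refine sum_congr rfl fun n _ => sum_congr rfl fun m _ => ?_
    have : (n < m ∧ P m n) ↔ (n < m ∧ P n m) := and_congr_right fun _ => ⟨hs _ _, hs _ _⟩
    simp only [this, hF m n]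
  rw [two_mul]
  nth_rewrite 1 [← h1]
  rw [← sum_add_distrib, ← sum_add_distrib]
  refine sum_congr rfl fun n hn => ?_
  have h2 : F n n = ∑ m ∈ s, if n = m then F n m else 0 := by
    rw [sum_ite_eq, if_pos hn]
  rw [h2]
  simp only [sum_filter]
  rw [← sum_add_distrib, ← sum_add_distrib]
  refine sum_congr rfl fun m _ => ?_
  rcases lt_trichotomy n m with h | h | h
  · simp [h, h.ne, h.not_gt]
  · subst h
    simp [hr]
  · simp [h, h.ne', h.not_gt]

lemma psi_mod_congr (x : ℝ) {q a b : ℕ} (h : a % q = b % q) : psi x q a = psi x q b := by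
  simp only [psi, h]

lemma sum_psi_mul_eq (x : ℝ) {q : ℕ} (hq : 0 < q) {w : ℕ → ℝ} (hw : ∀ n, w (n % q) = w n) :
    ∑ a ∈ range q, psi x q a * w a = ∑ n ∈ Icc 1 ⌊x⌋₊, vonMangoldt n * w n := by
  rw [← sum_fiberwise_of_maps_to (s := Icc 1 ⌊x⌋₊) (t := range q) (g := fun n => n % q)
    fun n _ => mem_range.2 (Nat.mod_lt n hq)]
  refine sum_congr rfl fun a ha => ?_
  rw [psi, sum_mul]
  rw [Nat.mod_eq_of_lt (mem_range.1 ha)]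
  refine sum_congr rfl fun n hn => ?_
  rw [← (mem_filter.1 hn).2, hw]

lemma sum_psi_sq (x : ℝ) {q : ℕ} (hq : 0 < q) :
    ∑ a ∈ range q, psi x q a ^ 2 =
      ∑ n ∈ Icc 1 ⌊x⌋₊, vonMangoldt n ^ 2 + 2 * offDiag x q := by
  simp only [sq]
  rw [sum_psi_mul_eq x hq fun n => psi_mod_congr x (Nat.mod_mod _ _)]
  simp only [psi, mul_sum]
  have h := sum_filter_symm (s := Icc 1 ⌊x⌋₊) (P := fun n m => m % q = n % q)
    (fun _ => rfl) (fun _ _ h => h.symm) (F := fun n m => vonMangoldt n * vonMangoldt m)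
    (fun _ _ => mul_comm _ _)
  rw [h, offDiag]
  congr 2
  refine sum_congr rfl fun n _ => ?_
  refine sum_congr (filter_congr fun m _ => ?_) fun _ _ => rfl
  refine and_congr_right fun hnm => ?_
  exact ⟨fun h => (Nat.modEq_iff_dvd' hnm.le).1 h.symm, fun h => ((Nat.modEq_iff_dvd' hnm.le).2 h).symm⟩

lemma sum_psi (x : ℝ) {q : ℕ} (hq : 0 < q) :
    ∑ a ∈ range q, psi x q a = psi x 1 1 := by
  have h := sum_psi_mul_eq x hq (w := fun _ => 1) fun _ => rfl
  simpa [psi_one_eq] using h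

lemma sum_coprime_sq_eq (x : ℝ) {q : ℕ} (hq : 0 < q) :
    ∑ a ∈ (Icc 1 q).filter (fun a => Nat.gcd a q = 1), (psi x q a - x / (q.totient : ℝ)) ^ 2 =
      ∑ a ∈ range q with a.Coprime q, (psi x q a - x / (q.totient : ℝ)) ^ 2 := by
  rw [sum_filter, sum_filter, sum_Icc_one_eq_sum_range hq]
  rw [psi_mod_congr x (by simp : q % q = 0 % q)]
  simp

lemma abs_sum_coprime_sq_sub_le {x E : ℝ} (hx : 0 ≤ x) (hE : |psi x 1 1 - x| ≤ E) {q : ℕ}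
    (hq : 0 < q) :
    |∑ a ∈ (Icc 1 q).filter (fun a => Nat.gcd a q = 1), (psi x q a - x / (q.totient : ℝ)) ^ 2 -
      (∑ n ∈ Icc 1 ⌊x⌋₊, vonMangoldt n ^ 2 + 2 * offDiag x q - x ^ 2 * (1 / (q.totient : ℝ)))| ≤
      notCoprimeSum x q ^ 2 + 2 * x * (1 / (q.totient : ℝ)) * (E + notCoprimeSum x q) := by
  have hφ : (0 : ℝ) < q.totient := by exact_mod_cast Nat.totient_pos.2 hq
  have h0 := notCoprimeSum_nonneg x q
  rw [sum_coprime_sq_eq x hq, ← sum_psi_sq x hq]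
  have hs := sum_psi x hq
  rw [← sum_filter_add_sum_filter_not (range q) (fun a => a.Coprime q)] at hs
  rw [← sum_filter_add_sum_filter_not (range q) (fun a => a.Coprime q) (fun a => psi x q a ^ 2)]
  have h1 := sum_psi_not_coprime x hq
  rw [← notCoprimeSum] at h1
  have h2 : ∑ a ∈ range q with ¬ a.Coprime q, psi x q a ^ 2 ≤ notCoprimeSum x q ^ 2 := by
    rw [← h1]
    exact sum_sq_le_sq_sum_of_nonneg fun _ _ => psi_nonneg _ _ _
  have h3 : 0 ≤ ∑ a ∈ range q with ¬ a.Coprime q, psi x q a ^ 2 :=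
    sum_nonneg fun _ _ => sq_nonneg _
  have hcard : (#((range q).filter fun a => a.Coprime q) : ℝ) = q.totient := by
    rw [Nat.totient_eq_card_coprime]
    congr 2
    exact filter_congr fun a _ => Nat.coprime_comm
  have h4 : ∑ a ∈ range q with a.Coprime q, (psi x q a - x / (q.totient : ℝ)) ^ 2 =
      ∑ a ∈ range q with a.Coprime q, psi x q a ^ 2 -
        2 * (x / q.totient) * ∑ a ∈ range q with a.Coprime q, psi x q a +
        x ^ 2 * (1 / q.totient) := by
    have h5 : x ^ 2 * (1 / (q.totient : ℝ)) =
        ∑ a ∈ range q with a.Coprime q, (x / (q.totient : ℝ)) ^ 2 := by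
      rw [sum_const, nsmul_eq_mul, hcard]
      field_simp
    rw [h5, mul_sum, ← sum_sub_distrib, ← sum_add_distrib]
    exact sum_congr rfl fun a _ => by ring
  rw [h4]
  rw [h1] at hs
  rw [eq_sub_of_add_eq hs]
  set S := ∑ a ∈ range q with a.Coprime q, psi x q a ^ 2
  set T := ∑ a ∈ range q with ¬ a.Coprime q, psi x q a ^ 2
  have h6 : S - 2 * (x / q.totient) * (psi x 1 1 - notCoprimeSum x q) + x ^ 2 * (1 / q.totient) -
      (S + T - x ^ 2 * (1 / (q.totient : ℝ))) =
      -T - 2 * x * (1 / (q.totient : ℝ)) * ((psi x 1 1 - x) - notCoprimeSum x q) := by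
    field_simp
    ring
  rw [h6]
  refine (abs_sub _ _).trans ?_
  rw [abs_neg, abs_of_nonneg h3, abs_mul, abs_of_nonneg (by positivity)]
  gcongr
  refine (abs_sub _ _).trans ?_
  rw [abs_of_nonneg h0]
  gcongr

end Hooley

namespace Hooley
open ArithmeticFunction

/-- `∑_{Y < q ≤ x} ∑_{n < m ≤ x, q ∣ m - n} Λ(n) Λ(m)`. -/
noncomputable def offDiagTail (x Y : ℝ) : ℝ :=
  ∑ q ∈ Icc 1 ⌊x⌋₊ with Y < (q : ℕ), offDiag x q

/-- `∑_{n + t < m ≤ x, m ≡ n (mod r)} Λ(m)`. -/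
noncomputable def apTail (x t : ℝ) (r n : ℕ) : ℝ :=
  ∑ m ∈ Icc 1 ⌊x⌋₊ with m % r = n % r ∧ (n : ℝ) + t < (m : ℕ), vonMangoldt m

lemma apTail_nonneg (x t : ℝ) (r n : ℕ) : 0 ≤ apTail x t r n :=
  sum_nonneg fun _ _ => vonMangoldt_nonneg

lemma sum_dvd_switch {x Y : ℝ} (hY : 0 < Y) {h : ℕ} (h1 : 1 ≤ h) (hx : (h : ℝ) ≤ x) :
    (∑ q ∈ Icc 1 ⌊x⌋₊, if Y < (q : ℕ) ∧ q ∣ h then (1 : ℝ) else 0) =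
      ∑ r ∈ Icc 1 ⌊x / Y⌋₊, if r ∣ h ∧ r * Y < h then (1 : ℝ) else 0 := by
  have hx0 : 0 ≤ x := (Nat.cast_nonneg h).trans hx
  have e1 : (∑ q ∈ Icc 1 ⌊x⌋₊, if Y < (q : ℕ) ∧ q ∣ h then (1 : ℝ) else 0) =
      ∑ q ∈ h.divisors, if Y < (q : ℕ) then (1 : ℝ) else 0 := by
    rw [← sum_filter, ← sum_filter]
    refine sum_congr ?_ fun _ _ => rfl
    ext q
    simp only [mem_filter, mem_Icc, Nat.mem_divisors]
    constructor
    · rintro ⟨_, h3, h4⟩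
      exact ⟨⟨h4, by omega⟩, h3⟩
    · rintro ⟨⟨h3, _⟩, h4⟩
      exact ⟨⟨Nat.pos_of_dvd_of_pos h3 h1,
        (Nat.le_of_dvd h1 h3).trans ((Nat.le_floor_iff hx0).2 hx)⟩, h4, h3⟩
  have e2 : (∑ r ∈ Icc 1 ⌊x / Y⌋₊, if r ∣ h ∧ r * Y < h then (1 : ℝ) else 0) =
      ∑ r ∈ h.divisors, if Y < (h / r : ℕ) then (1 : ℝ) else 0 := by
    rw [← sum_filter, ← sum_filter]
    refine sum_congr ?_ fun _ _ => rfl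
    ext r
    simp only [mem_filter, mem_Icc, Nat.mem_divisors]
    have key : r ∣ h → (r * Y < h ↔ Y < (h / r : ℕ)) := by
      intro hr
      have hr0 : (0 : ℝ) < r := by exact_mod_cast Nat.pos_of_dvd_of_pos hr h1
      rw [Nat.cast_div hr hr0.ne', lt_div_iff₀ hr0, mul_comm]
    constructor
    · rintro ⟨_, h3, h4⟩
      exact ⟨⟨h3, by omega⟩, (key h3).1 h4⟩
    · rintro ⟨⟨h3, _⟩, h4⟩
      have h5 := (key h3).2 h4
      refine ⟨⟨Nat.pos_of_dvd_of_pos h3 h1, ?_⟩, h3, h5⟩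
      rw [Nat.le_floor_iff (by positivity), le_div_iff₀ hY]
      linarith
  rw [e1, e2, ← Nat.sum_div_divisors]

lemma offDiagTail_eq {x Y : ℝ} (hY : 0 < Y) :
    offDiagTail x Y = ∑ r ∈ Icc 1 ⌊x / Y⌋₊, ∑ n ∈ Icc 1 ⌊x⌋₊,
      vonMangoldt n * apTail x (r * Y) r n := by
  rw [offDiagTail, sum_filter]
  have e1 : ∀ q : ℕ, (if Y < (q : ℕ) then offDiag x q else 0) =
      ∑ n ∈ Icc 1 ⌊x⌋₊, ∑ m ∈ Icc 1 ⌊x⌋₊, if n < m then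
        vonMangoldt n * vonMangoldt m * (if Y < (q : ℕ) ∧ q ∣ m - n then 1 else 0) else 0 := by
    intro q
    by_cases h : Y < q
    · rw [if_pos h, offDiag]
      refine sum_congr rfl fun n _ => ?_
      rw [sum_filter]
      refine sum_congr rfl fun m _ => ?_
      by_cases h1 : n < m <;> by_cases h2 : q ∣ m - n <;> simp [h, h1, h2]
    · simp [h]
  have e2 : ∀ r : ℕ, ∑ n ∈ Icc 1 ⌊x⌋₊, vonMangoldt n * apTail x (r * Y) r n =
      ∑ n ∈ Icc 1 ⌊x⌋₊, ∑ m ∈ Icc 1 ⌊x⌋₊, if n < m then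
        vonMangoldt n * vonMangoldt m *
          (if r ∣ m - n ∧ r * Y < (m - n : ℕ) then 1 else 0) else 0 := by
    intro r
    refine sum_congr rfl fun n _ => ?_
    rw [apTail, mul_sum, sum_filter]
    refine sum_congr rfl fun m _ => ?_
    by_cases h1 : n < m
    · have h2 : (m % r = n % r ∧ (n : ℝ) + r * Y < m) ↔
          (r ∣ m - n ∧ r * Y < (m - n : ℕ)) := by
        rw [Nat.cast_sub h1.le, lt_sub_iff_add_lt']
        exact and_congr_left fun _ => ⟨fun h => (Nat.modEq_iff_dvd' h1.le).1 h.symm,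
          fun h => ((Nat.modEq_iff_dvd' h1.le).2 h).symm⟩
      simp only [h1, h2, if_true, mul_ite, mul_one, mul_zero]
    · have h2 : ¬ ((n : ℝ) + r * Y < m) := by
        have h3 : (m : ℝ) ≤ n := by exact_mod_cast not_lt.1 h1
        have h4 : 0 ≤ r * Y := by positivity
        linarith
      simp [h1, h2]
  rw [sum_congr rfl fun q _ => e1 q, sum_congr rfl fun r _ => e2 r, sum_comm]
  rw [sum_comm (s := Icc 1 ⌊x / Y⌋₊)]
  refine sum_congr rfl fun n hn => ?_
  rw [sum_comm, sum_comm (s := Icc 1 ⌊x / Y⌋₊)]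
  refine sum_congr rfl fun m hm => ?_
  by_cases h : n < m
  · simp only [h, if_true]
    rw [← mul_sum, ← mul_sum, sum_dvd_switch hY (by omega)]
    have hm2 := (mem_Icc.1 hm).2
    have := (Nat.le_floor_iff' (by omega)).1 hm2
    rw [Nat.cast_sub h.le]
    have : (0 : ℝ) ≤ n := Nat.cast_nonneg n
    linarith
  · simp [h]

lemma apTail_eq_sub {x t : ℝ} (ht : 0 ≤ t) {r n : ℕ} (h : (n : ℝ) + t ≤ x) :
    apTail x t r n = psi x r n - psi (n + t) r n := by
  have h0 : (0 : ℝ) ≤ n + t := by positivity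
  rw [eq_sub_iff_add_eq, apTail, psi, psi]
  rw [← sum_filter_add_sum_filter_not ((Icc 1 ⌊x⌋₊).filter fun m => m % r = n % r)
    (fun m => (n : ℝ) + t < (m : ℕ))]
  congr 1
  · rw [filter_filter]
  · rw [filter_filter]
    refine sum_congr ?_ fun _ _ => rfl
    ext m
    simp only [mem_filter, mem_Icc, not_lt]
    have h1 := Nat.floor_le_floor h
    rw [← Nat.le_floor_iff h0]
    constructor
    · rintro ⟨⟨h2, h3⟩, h4⟩
      exact ⟨⟨h2, h3.trans h1⟩, h4, h3⟩
    · rintro ⟨⟨h2, h3⟩, h4, h5⟩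
      exact ⟨⟨h2, h5⟩, h4⟩

lemma apTail_eq_zero {x t : ℝ} (hx : 0 ≤ x) {r n : ℕ} (h : x < (n : ℝ) + t) :
    apTail x t r n = 0 := by
  rw [apTail, filter_eq_empty_iff.2, sum_empty]
  rintro m hm ⟨_, h2⟩
  have := (Nat.le_floor_iff hx).1 (mem_Icc.1 hm).2
  linarith

lemma apTail_le_notCoprimeSum (x t : ℝ) {r n : ℕ} (h : ¬ n.Coprime r) :
    apTail x t r n ≤ notCoprimeSum x r := by
  refine sum_le_sum_of_subset_of_nonneg (fun m hm => ?_) fun _ _ _ => vonMangoldt_nonneg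
  obtain ⟨h1, h2, -⟩ := mem_filter.1 hm
  refine mem_filter.2 ⟨h1, fun h3 => h ?_⟩
  exact (Nat.ModEq.gcd_eq h2).symm.trans h3

lemma abs_apTail_sub_le {x t E : ℝ} (ht : 0 ≤ t) {r n : ℕ}
    (hE : ∀ y : ℝ, 0 ≤ y → y ≤ x → |psi y r n - y / (r.totient : ℝ)| ≤ E)
    (h : (n : ℝ) + t ≤ x) :
    |apTail x t r n - (x - t - n) / (r.totient : ℝ)| ≤ 2 * E := by
  have hn : (0 : ℝ) ≤ n := Nat.cast_nonneg n
  rw [apTail_eq_sub ht h]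
  have h1 := hE x (by linarith) le_rfl
  have h2 := hE (n + t) (by positivity) h
  have h3 : psi x r n - psi (n + t) r n - (x - t - n) / (r.totient : ℝ) =
      (psi x r n - x / r.totient) - (psi (n + t) r n - (n + t) / r.totient) := by ring
  rw [h3]
  refine (abs_sub _ _).trans ?_
  linarith

lemma abs_sum_apTail_sub_le {x t E : ℝ} (hx : 1 ≤ x) (ht : 0 ≤ t) (htx : t ≤ x) {r : ℕ}
    (hr : 1 ≤ r) (hEx : E ≤ x)
    (hE1 : ∀ y : ℝ, 0 ≤ y → y ≤ x → |psi y 1 1 - y| ≤ E)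
    (hE : ∀ n : ℕ, n.Coprime r → ∀ y : ℝ, 0 ≤ y → y ≤ x →
      |psi y r n - y / (r.totient : ℝ)| ≤ E) :
    |∑ n ∈ Icc 1 ⌊x⌋₊, vonMangoldt n * apTail x t r n -
      (x - t) ^ 2 / 2 * (1 / (r.totient : ℝ))| ≤
      6 * E * x + 3 * x + notCoprimeSum x r ^ 2 + notCoprimeSum x r * x := by
  set K := notCoprimeSum x r with hK
  have hK0 : 0 ≤ K := notCoprimeSum_nonneg x r
  have hE0 : 0 ≤ E := (abs_nonneg _).trans (hE1 0 le_rfl (by linarith))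
  have hφ : (1 : ℝ) ≤ r.totient := by exact_mod_cast Nat.totient_pos.2 hr
  have hφ' : 1 / (r.totient : ℝ) ≤ 1 := (div_le_one (by linarith)).2 hφ
  have hφ0 : 0 ≤ 1 / (r.totient : ℝ) := by positivity
  set z := x - t with hz
  have hz0 : 0 ≤ z := by linarith
  have hzx : z ≤ x := by linarith
  have hsub : Icc 1 ⌊z⌋₊ ⊆ Icc 1 ⌊x⌋₊ := Icc_subset_Icc_right (Nat.floor_le_floor hzx)
  have e1 : ∑ n ∈ Icc 1 ⌊x⌋₊, vonMangoldt n * apTail x t r n =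
      ∑ n ∈ Icc 1 ⌊z⌋₊, vonMangoldt n * apTail x t r n := by
    symm
    refine sum_subset hsub fun n hn hn' => ?_
    rw [apTail_eq_zero (by linarith), mul_zero]
    have h2 : ¬ n ≤ ⌊z⌋₊ := fun h => hn' (mem_Icc.2 ⟨(mem_Icc.1 hn).1, h⟩)
    rw [Nat.le_floor_iff hz0] at h2
    linarith
  have h1 := abs_sum_vonMangoldt_mul_sub_le hz0 fun y h3 h4 => hE1 y h3 (h4.trans hzx)
  have h2 : |∑ n ∈ Icc 1 ⌊z⌋₊, vonMangoldt n * apTail x t r n -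
      (∑ n ∈ Icc 1 ⌊z⌋₊, vonMangoldt n * (z - n)) * (1 / (r.totient : ℝ))| ≤
      ∑ n ∈ Icc 1 ⌊x⌋₊, (vonMangoldt n * (2 * E) +
        if ¬ n.Coprime r then vonMangoldt n * (K + x) else 0) := by
    rw [sum_mul, ← sum_sub_distrib]
    refine (abs_sum_le_sum_abs _ _).trans ?_
    refine le_trans (sum_le_sum fun n hn => ?_)
      (sum_le_sum_of_subset_of_nonneg hsub fun n _ _ => ?_)
    · have hΛ := vonMangoldt_nonneg (n := n)
      have hn2 : (n : ℝ) ≤ z := (Nat.le_floor_iff hz0).1 (mem_Icc.1 hn).2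
      have hn0 : (0 : ℝ) ≤ n := Nat.cast_nonneg n
      rw [mul_assoc, ← mul_sub, abs_mul, abs_of_nonneg hΛ]
      by_cases hc : n.Coprime r
      · rw [if_neg (not_not.2 hc), add_zero]
        gcongr
        rw [mul_one_div]
        exact abs_apTail_sub_le ht (hE n hc) (by linarith)
      · rw [if_pos hc, ← mul_add]
        gcongr
        have h3 := apTail_le_notCoprimeSum x t hc
        have h4 := apTail_nonneg x t r n
        have h5 : 0 ≤ (z - n) * (1 / (r.totient : ℝ)) := mul_nonneg (by linarith) hφ0
        have h6 : (z - n) * (1 / (r.totient : ℝ)) ≤ x * 1 := by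
          gcongr
          linarith
        rw [abs_le]
        constructor <;> linarith
    · have hΛ := vonMangoldt_nonneg (n := n)
      have : 0 ≤ K + x := by linarith
      split_ifs <;> positivity
  rw [sum_add_distrib, ← sum_mul, ← sum_filter, ← sum_mul, ← psi_one_eq x 1, ← notCoprimeSum,
    ← hK] at h2
  have h3 := hE1 x (by linarith) le_rfl
  have h4 : psi x 1 1 * (2 * E) ≤ 4 * E * x := by
    rw [abs_le] at h3
    nlinarith
  rw [e1]
  set S := ∑ n ∈ Icc 1 ⌊z⌋₊, vonMangoldt n * apTail x t r n
  set T := ∑ n ∈ Icc 1 ⌊z⌋₊, vonMangoldt n * (z - n)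
  have h5 : S - z ^ 2 / 2 * (1 / (r.totient : ℝ)) =
      (S - T * (1 / (r.totient : ℝ))) + (T - z ^ 2 / 2) * (1 / (r.totient : ℝ)) := by ring
  rw [h5]
  have h6 : |(T - z ^ 2 / 2) * (1 / (r.totient : ℝ))| ≤ ((x + 1) * E + 3 * x) * 1 := by
    refine abs_mul_le_of_le (h1.trans ?_) (by rwa [abs_of_nonneg hφ0])
    gcongr
  refine (abs_add_le _ _).trans ?_
  nlinarith

/-- Divisor switching for the off-diagonal terms with large moduli. -/
lemma abs_offDiagTail_sub_le {x Y E K : ℝ} (hx : 1 ≤ x) (hY : 0 < Y) (hEx : E ≤ x)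
    (hE : ∀ r : ℕ, 1 ≤ r → (r : ℝ) ≤ x / Y → ∀ n : ℕ, n.Coprime r → ∀ y : ℝ, 0 ≤ y → y ≤ x →
      |psi y r n - y / (r.totient : ℝ)| ≤ E)
    (hE1 : ∀ y : ℝ, 0 ≤ y → y ≤ x → |psi y 1 1 - y| ≤ E)
    (hK0 : 0 ≤ K) (hK : ∀ r : ℕ, 1 ≤ r → (r : ℝ) ≤ x / Y → notCoprimeSum x r ≤ K) :
    |2 * offDiagTail x Y - Y ^ 2 * totRiesz (x / Y)| ≤
      x / Y * (2 * (6 * E * x + 3 * x + K ^ 2 + K * x)) := by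
  have hxY : 0 ≤ x / Y := by positivity
  have hE0 : 0 ≤ E := (abs_nonneg _).trans (hE1 0 le_rfl (by linarith))
  rw [offDiagTail_eq hY, totRiesz, mul_sum, mul_sum, ← sum_sub_distrib]
  refine (abs_sum_le_sum_abs _ _).trans ?_
  have hterm : ∀ r ∈ Icc 1 ⌊x / Y⌋₊,
      |2 * ∑ n ∈ Icc 1 ⌊x⌋₊, vonMangoldt n * apTail x (r * Y) r n -
        Y ^ 2 * ((x / Y - r) ^ 2 / (r.totient : ℝ))| ≤
        2 * (6 * E * x + 3 * x + K ^ 2 + K * x) := by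
    intro r hr
    have hr1 := (mem_Icc.1 hr).1
    have hr2 : (r : ℝ) ≤ x / Y := (Nat.le_floor_iff hxY).1 (mem_Icc.1 hr).2
    have h1 := abs_sum_apTail_sub_le (t := r * Y) hx (by positivity)
      ((le_div_iff₀ hY).1 hr2) hr1 hEx hE1 (hE r hr1 hr2)
    have h2 := hK r hr1 hr2
    have h3 := notCoprimeSum_nonneg x r
    have h4 : 2 * ∑ n ∈ Icc 1 ⌊x⌋₊, vonMangoldt n * apTail x (r * Y) r n -
        Y ^ 2 * ((x / Y - r) ^ 2 / (r.totient : ℝ)) =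
        2 * (∑ n ∈ Icc 1 ⌊x⌋₊, vonMangoldt n * apTail x (r * Y) r n -
          (x - r * Y) ^ 2 / 2 * (1 / (r.totient : ℝ))) := by
      field_simp
    rw [h4, abs_mul, abs_two]
    gcongr
    refine h1.trans ?_
    gcongr
  refine (sum_le_sum hterm).trans ?_
  rw [sum_const, Nat.card_Icc, nsmul_eq_mul, Nat.add_sub_cancel]
  gcongr
  exact Nat.floor_le hxY

end Hooley

namespace Hooley
open ArithmeticFunction

lemma sum_Icc_sub_sum_Icc (f : ℕ → ℝ) {M N : ℕ} (h : M ≤ N) :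
    ∑ q ∈ Icc 1 N, f q - ∑ q ∈ Icc 1 M, f q = ∑ q ∈ Ioc M N, f q := by
  have h1 := sum_Ioc_consecutive f (Nat.zero_le M) h
  have h2 : ∀ K : ℕ, Ioc 0 K = Icc 1 K := fun _ => rfl
  rw [h2, h2] at h1
  linarith

lemma offDiagTail_eq_sum_Ioc {x Y : ℝ} (hY : 0 ≤ Y) :
    offDiagTail x Y = ∑ q ∈ Ioc ⌊Y⌋₊ ⌊x⌋₊, offDiag x q := by
  rw [offDiagTail]
  refine sum_congr ?_ fun _ _ => rfl
  ext q
  simp only [mem_filter, mem_Icc, mem_Ioc, Nat.floor_lt hY]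
  constructor
  · rintro ⟨⟨_, h2⟩, h3⟩
    exact ⟨h3, h2⟩
  · rintro ⟨h1, h2⟩
    have : (0 : ℝ) < q := hY.trans_lt h1
    exact ⟨⟨by exact_mod_cast this, h2⟩, h1⟩

lemma totSum_le {x : ℝ} (hx : 3 ≤ x) : totSum x ≤ 6 * Real.log x ^ 2 := by
  have hL := one_le_log_of_three_le hx
  have h1 : totSum x ≤ ∑ q ∈ Icc 1 ⌊x⌋₊, 3 * Real.log x * (q : ℝ)⁻¹ :=
    sum_le_sum fun q hq => by
      have h2 := mem_Icc.1 hq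
      have h3 := (Nat.le_floor_iff (by linarith : 0 ≤ x)).1 h2.2
      exact inv_totient_le (by omega) hx h3
  rw [← mul_sum] at h1
  have h2 : ∑ q ∈ Icc 1 ⌊x⌋₊, (q : ℝ)⁻¹ ≤ 1 + Real.log x := by
    have h3 := harmonic_floor_le_one_add_log x (by linarith)
    rw [harmonic_eq_sum_Icc] at h3
    push_cast at h3
    exact h3
  calc totSum x ≤ 3 * Real.log x * (1 + Real.log x) := h1.trans (by gcongr)
    _ ≤ _ := by nlinarith

lemma abs_V_sub_le {x Y Q E : ℝ} (hx : 3 ≤ x) (hY : 0 ≤ Y) (hYQ : Y ≤ Q) (hQx : Q ≤ x)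
    (hE : |psi x 1 1 - x| ≤ E) :
    |V x Q - V x Y - (((⌊Q⌋₊ : ℝ) - ⌊Y⌋₊) * ∑ n ∈ Icc 1 ⌊x⌋₊, vonMangoldt n ^ 2 +
      (2 * offDiagTail x Y - 2 * offDiagTail x Q) - x ^ 2 * (totSum Q - totSum Y))| ≤
      81 * x * Real.log x ^ 6 + 12 * x * Real.log x ^ 2 * (E + 9 * Real.log x ^ 3) := by
  have hL := one_le_log_of_three_le hx
  have hE0 : 0 ≤ E := (abs_nonneg _).trans hE
  set D := ∑ n ∈ Icc 1 ⌊x⌋₊, vonMangoldt n ^ 2 with hD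
  have hfl : ⌊Y⌋₊ ≤ ⌊Q⌋₊ := Nat.floor_le_floor hYQ
  have hflx : ⌊Q⌋₊ ≤ ⌊x⌋₊ := Nat.floor_le_floor hQx
  have e1 : ((⌊Q⌋₊ : ℝ) - ⌊Y⌋₊) * D = ∑ _q ∈ Ioc ⌊Y⌋₊ ⌊Q⌋₊, D := by
    rw [sum_const, Nat.card_Ioc, nsmul_eq_mul, Nat.cast_sub hfl]
  have e2 : 2 * offDiagTail x Y - 2 * offDiagTail x Q =
      ∑ q ∈ Ioc ⌊Y⌋₊ ⌊Q⌋₊, 2 * offDiag x q := by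
    rw [offDiagTail_eq_sum_Ioc hY, offDiagTail_eq_sum_Ioc (hY.trans hYQ), ← mul_sum,
      ← sum_Ioc_consecutive _ hfl hflx]
    ring
  have e3 : totSum Q - totSum Y = ∑ q ∈ Ioc ⌊Y⌋₊ ⌊Q⌋₊, 1 / (q.totient : ℝ) :=
    sum_Icc_sub_sum_Icc (fun q => 1 / (q.totient : ℝ)) hfl
  rw [e1, e2, e3, mul_sum, ← sum_add_distrib, ← sum_sub_distrib]
  rw [V, V, sum_Icc_sub_sum_Icc _ hfl, ← sum_sub_distrib]
  refine (abs_sum_le_sum_abs _ _).trans ?_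
  have hterm : ∀ q ∈ Ioc ⌊Y⌋₊ ⌊Q⌋₊, notCoprimeSum x q ^ 2 +
      2 * x * (1 / (q.totient : ℝ)) * (E + notCoprimeSum x q) ≤
      81 * Real.log x ^ 6 + 2 * x * (E + 9 * Real.log x ^ 3) * (1 / (q.totient : ℝ)) := by
    intro q hq
    have h1 := mem_Ioc.1 hq
    have hq0 : q ≠ 0 := by omega
    have hqx : (q : ℝ) ≤ x := ((Nat.le_floor_iff' hq0).1 h1.2).trans hQx
    have h2 := notCoprimeSum_le hx hq0 hqx
    have h3 := notCoprimeSum_nonneg x q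
    have h4 : notCoprimeSum x q ^ 2 ≤ (9 * Real.log x ^ 3) ^ 2 := by gcongr
    have h5 : 2 * x * (1 / (q.totient : ℝ)) * (E + notCoprimeSum x q) ≤
        2 * x * (1 / (q.totient : ℝ)) * (E + 9 * Real.log x ^ 3) := by gcongr
    calc _ ≤ (9 * Real.log x ^ 3) ^ 2 +
          2 * x * (1 / (q.totient : ℝ)) * (E + 9 * Real.log x ^ 3) := add_le_add h4 h5
      _ = _ := by ring
  refine (sum_le_sum fun q hq => (abs_sum_coprime_sq_sub_le (by linarith) hE
    (by have := mem_Ioc.1 hq; omega)).trans (hterm q hq)).trans ?_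
  rw [sum_add_distrib, sum_const, nsmul_eq_mul, ← mul_sum, Nat.card_Ioc]
  have h6 : ((⌊Q⌋₊ - ⌊Y⌋₊ : ℕ) : ℝ) ≤ x := by
    have h7 : ((⌊Q⌋₊ - ⌊Y⌋₊ : ℕ) : ℝ) ≤ ⌊Q⌋₊ := by exact_mod_cast Nat.sub_le _ _
    exact h7.trans ((Nat.floor_le (hY.trans hYQ)).trans hQx)
  have h7 : ∑ q ∈ Ioc ⌊Y⌋₊ ⌊Q⌋₊, 1 / (q.totient : ℝ) ≤ 6 * Real.log x ^ 2 := by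
    refine le_trans ?_ (totSum_le hx)
    refine sum_le_sum_of_subset_of_nonneg (fun q hq => ?_) fun _ _ _ => by positivity
    have := mem_Ioc.1 hq
    exact mem_Icc.2 ⟨by omega, by omega⟩
  calc _ ≤ x * (81 * Real.log x ^ 6) +
        2 * x * (E + 9 * Real.log x ^ 3) * (6 * Real.log x ^ 2) := by gcongr
    _ = _ := by ring

/-- The asymptotics of `totRiesz (x / Y)` and `totSum Y`, uniformly in `1 ≤ Y ≤ x`. -/
lemma exists_tot_asymp_uniform : ∃ α β δ β' C : ℝ, 0 < C ∧
    (∀ x Y : ℝ, 0 < Y → Y ≤ x →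
      |Y ^ 2 * totRiesz (x / Y) - (x ^ 2 * (α * (Real.log x - Real.log Y) + β) +
        x * Y * (Real.log x - Real.log Y + δ))| ≤
        C * (Y ^ ((5 : ℝ) / 4) * x ^ ((3 : ℝ) / 4))) ∧
    ∀ Y : ℝ, 1 ≤ Y → |totSum Y - (α * Real.log Y + β')| ≤ C / Y ^ ((1 : ℝ) / 4) := by
  obtain ⟨α, β, δ, β', C, hC, h⟩ := exists_tot_asymp
  have hroot : ∀ u : ℝ, 1 ≤ u → 1 ≤ u ^ ((1 : ℝ) / 4) ∧ (u ^ ((1 : ℝ) / 4)) ^ 4 = u := by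
    intro u hu
    refine ⟨Real.one_le_rpow hu (by norm_num), ?_⟩
    rw [← Real.rpow_natCast, ← Real.rpow_mul (by linarith)]
    norm_num
  refine ⟨α, β, δ, β', C, hC, fun x Y hY hYx => ?_, fun Y hY => ?_⟩
  · have hx : 0 < x := hY.trans_le hYx
    obtain ⟨h1, h2⟩ := hroot (x / Y) ((one_le_div hY).2 hYx)
    have h3 := (h _ h1).1
    rw [h2] at h3
    have h4 : Y ^ 2 * totRiesz (x / Y) - (x ^ 2 * (α * (Real.log x - Real.log Y) + β) +
        x * Y * (Real.log x - Real.log Y + δ)) =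
        Y ^ 2 * (totRiesz (x / Y) - ((x / Y) ^ 2 * (α * Real.log (x / Y) + β) +
          x / Y * (Real.log (x / Y) + δ))) := by
      rw [Real.log_div hx.ne' hY.ne']
      field_simp
    rw [h4, abs_mul, abs_of_nonneg (by positivity)]
    calc _ ≤ Y ^ 2 * (C * ((x / Y) ^ ((1 : ℝ) / 4)) ^ 3) := by gcongr
      _ = _ := by
        rw [← Real.rpow_natCast ((x / Y) ^ ((1 : ℝ) / 4)), ← Real.rpow_mul (by positivity),
          Real.div_rpow hx.le hY.le, ← Real.rpow_natCast Y]
        have h5 : (5 : ℝ) / 4 = ((2 : ℕ) : ℝ) - 1 / 4 * (3 : ℕ) := by norm_num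
        have h6 : (3 : ℝ) / 4 = 1 / 4 * (3 : ℕ) := by norm_num
        rw [h5, h6, Real.rpow_sub hY]
        ring
  · obtain ⟨h1, h2⟩ := hroot Y hY
    have h3 := (h _ h1).2
    rw [h2, mul_one_div] at h3
    exact h3

end Hooley

namespace Hooley
open ArithmeticFunction

lemma abs_sub_main_le {V V₁ f D ΩY ΩQ tY tQ RY RQ x Y Q L lY lQ α β δ β' e₁ e₂ e₃ e₄ e₅ e₆ : ℝ}
    (hx : 1 ≤ x) (hY : 0 ≤ Y) (hYQ : Y ≤ Q) (hQx : Q ≤ x) (hL : 1 ≤ L) (hlY : 0 ≤ lY)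
    (hlYL : lY ≤ L)
    (hV : |V - V₁ - (f * D + (2 * ΩY - 2 * ΩQ) - x ^ 2 * (tQ - tY))| ≤ e₁)
    (hΩY : |2 * ΩY - RY| ≤ e₂) (hΩQ : |2 * ΩQ - RQ| ≤ e₂)
    (hRY : |RY - (x ^ 2 * (α * (L - lY) + β) + x * Y * (L - lY + δ))| ≤ e₃)
    (hRQ : |RQ - (x ^ 2 * (α * (L - lQ) + β) + x * Q * (L - lQ + δ))| ≤ e₃)
    (htY : |tY - (α * lY + β')| ≤ e₄) (htQ : |tQ - (α * lQ + β')| ≤ e₄)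
    (hD : |D - (x * L - x)| ≤ e₅) (hf : |f - (Q - Y)| ≤ 1) (hV₁ : |V₁| ≤ e₆) :
    |V - Q * x * lQ + (1 + δ) * Q * x| ≤
      e₁ + 2 * e₂ + 2 * e₃ + 2 * (x ^ 2 * e₄) + x * L + 2 * (x * e₅) + e₆ +
        x * Y * (1 + |δ| + L) := by
  have he₅ : 0 ≤ e₅ := (abs_nonneg _).trans hD
  have hDabs : |D| ≤ x * L + e₅ := by
    rw [abs_le] at hD ⊢
    constructor <;> nlinarith
  have h1 : |(f - (Q - Y)) * D| ≤ 1 * (x * L + e₅) := abs_mul_le_of_le hf hDabs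
  have h2 : |(Q - Y) * (D - (x * L - x))| ≤ x * e₅ :=
    abs_mul_le_of_le (by rw [abs_of_nonneg] <;> linarith) hD
  have h3 : |x ^ 2 * (tQ - (α * lQ + β'))| ≤ x ^ 2 * e₄ :=
    abs_mul_le_of_le (by rw [abs_of_nonneg (sq_nonneg x)]) htQ
  have h4 : |x ^ 2 * (tY - (α * lY + β'))| ≤ x ^ 2 * e₄ :=
    abs_mul_le_of_le (by rw [abs_of_nonneg (sq_nonneg x)]) htY
  have h5 : |x * Y * (1 - lY + δ)| ≤ x * Y * (1 + |δ| + L) := by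
    refine abs_mul_le_of_le (by rw [abs_of_nonneg (by positivity)]) ?_
    have := neg_abs_le δ
    have := le_abs_self δ
    rw [abs_le]
    constructor <;> linarith
  have h6 : e₅ ≤ x * e₅ := le_mul_of_one_le_left he₅ hx
  rw [abs_le] at *
  constructor <;> nlinarith

lemma mul_log_pow_le (A k : ℕ) {x : ℝ} (hx : 3 ≤ x) :
    x * Real.log x ^ k ≤ (A + k).factorial * (x ^ 2 / Real.log x ^ A) := by
  have hL := one_le_log_of_three_le hx
  have h1 := log_pow_le_factorial_mul (by linarith : 1 ≤ x) (A + k)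
  rw [mul_div_assoc', le_div_iff₀ (by positivity)]
  calc x * Real.log x ^ k * Real.log x ^ A = x * Real.log x ^ (A + k) := by ring
    _ ≤ x * ((A + k).factorial * x) := by gcongr
    _ = _ := by ring

lemma sq_div_rpow_le (A B : ℕ) {x : ℝ} (hx : 3 ≤ x) :
    x ^ 2 / (x / Real.log x ^ B) ^ ((1 : ℝ) / 4) ≤
      (4 * A + B).factorial * (x ^ 2 / Real.log x ^ A) := by
  have hL := one_le_log_of_three_le hx
  set F : ℝ := ((4 * A + B).factorial : ℝ) with hF
  have hF1 : 1 ≤ F := by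
    rw [hF]
    exact_mod_cast Nat.one_le_iff_ne_zero.2 (Nat.factorial_ne_zero _)
  have hq : 0 < x / Real.log x ^ B := by positivity
  set s := (x / Real.log x ^ B) ^ ((1 : ℝ) / 4) with hs
  have hs0 : 0 < s := Real.rpow_pos_of_pos hq _
  have hs4 : s ^ 4 = x / Real.log x ^ B := by
    rw [hs, ← Real.rpow_natCast, ← Real.rpow_mul hq.le]
    norm_num
  have h1 := log_pow_le_factorial_mul (by linarith : 1 ≤ x) (4 * A + B)
  have h2 : (Real.log x ^ A) ^ 4 ≤ (F * s) ^ 4 := by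
    rw [mul_pow, hs4]
    calc (Real.log x ^ A) ^ 4 ≤ F * (x / Real.log x ^ B) := by
          rw [mul_div_assoc', le_div_iff₀ (by positivity)]
          calc _ = Real.log x ^ (4 * A + B) := by ring
            _ ≤ _ := h1
      _ ≤ F ^ 4 * (x / Real.log x ^ B) := by
          gcongr
          exact le_self_pow₀ hF1 (by norm_num)
  have h3 : Real.log x ^ A ≤ F * s := le_of_pow_le_pow_left₀ (by norm_num) (by positivity) h2
  rw [mul_div_assoc', div_le_div_iff₀ hs0 (by positivity)]
  calc x ^ 2 * Real.log x ^ A ≤ x ^ 2 * (F * s) := by gcongr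
    _ = _ := by ring

lemma V_nonneg (x Q : ℝ) : 0 ≤ V x Q :=
  sum_nonneg fun _ _ => sum_nonneg fun _ _ => sq_nonneg _

set_option maxHeartbeats 1000000 in
theorem exists_V_asymp : ∃ c : ℝ, ∀ A : ℕ, ∃ x₀ C : ℝ, 0 < C ∧ 55 ≤ x₀ ∧
    ∀ x Q : ℝ, x₀ < x → 1 ≤ Q → Q ≤ x →
      |V x Q - Q * x * Real.log Q + c * Q * x| ≤
        C * (Q ^ ((5 : ℝ) / 4) * x ^ ((3 : ℝ) / 4) + x ^ 2 / Real.log x ^ A) := by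
  obtain ⟨α, β, δ, β', C₁, hC₁, hriesz, htot⟩ := exists_tot_asymp_uniform
  refine ⟨1 + δ, fun A => ?_⟩
  obtain ⟨B, hB⟩ : ∃ B, B = A + 4 := ⟨_, rfl⟩
  obtain ⟨C₂, hC₂, hsw⟩ := siegel_walfisz_uniform (A + B) B
  obtain ⟨C₃, hC₃, hbdh⟩ := bdh A
  rw [← hB] at hbdh
  obtain ⟨F, hFdef⟩ : ∃ F : ℕ → ℝ, ∀ k, F k = k.factorial := ⟨_, fun _ => rfl⟩
  have hF : ∀ k, 0 < F k := fun k => by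
    rw [hFdef]
    exact_mod_cast Nat.factorial_pos k
  obtain ⟨G, hG⟩ : ∃ G : ℝ, G = (189 * F (A + 6) + 12 * C₂) + 2 * (12 * C₂ + 186 * F (A + (B + 6))) +
    2 * (C₁ * F (4 * A + B)) + F (A + 1) +
    2 * (2 * C₂ + 6 * (F (A + 2) * 2 ^ (A + 2))) + C₃ + (2 + |δ|) := ⟨_, rfl⟩
  have hGC₃ : C₃ + (2 + |δ|) ≤ G := by
    have := hF (A + 6)
    have := hF (A + (B + 6))
    have := mul_pos hC₁ (hF (4 * A + B))
    have := hF (A + 1)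
    have := mul_pos (hF (A + 2)) (by positivity : (0 : ℝ) < 2 ^ (A + 2))
    linarith
  have hG0 : 0 < G := by
    have := abs_nonneg δ
    linarith
  refine ⟨max 55 (Real.exp (C₂ + F (B + 1))), 2 * C₁ + G, by positivity, le_max_left _ _, ?_⟩
  intro x Q hx₀ hQ1 hQx
  have hx55 : 55 ≤ x := (le_max_left _ _).trans hx₀.le
  have hx3 : 3 ≤ x := by linarith
  have hx0 : 0 < x := by linarith
  have hL := one_le_log_of_three_le hx3
  have hLC : C₂ + F (B + 1) ≤ Real.log x := by
    rw [Real.le_log_iff_exp_le hx0]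
    exact (le_max_right _ _).trans hx₀.le
  have hpowB := log_pow_le_factorial_mul (by linarith : 1 ≤ x) (B + 1)
  rw [← hFdef] at hpowB
  have hQ0 : 0 < Q := by linarith
  have hlQ : 0 ≤ Real.log Q := Real.log_nonneg hQ1
  have hlQL : Real.log Q ≤ Real.log x := Real.log_le_log hQ0 hQx
  set L := Real.log x with hLdef
  set M := x ^ 2 / L ^ A with hM
  set P := Q ^ ((5 : ℝ) / 4) * x ^ ((3 : ℝ) / 4) with hP
  have hM0 : 0 < M := by positivity
  have hP0 : 0 < P := mul_pos (Real.rpow_pos_of_pos hQ0 _) (Real.rpow_pos_of_pos hx0 _)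
  set Y := x / L ^ B with hY
  have hY0 : 0 < Y := by positivity
  have hxY : x / Y = L ^ B := by
    rw [hY]
    field_simp
  have hres : x * Y * (1 + |δ| + L) ≤ (2 + |δ|) * M := by
    have h1 : 1 + |δ| + L ≤ (2 + |δ|) * L ^ 4 := by
      have h2 : L ≤ L ^ 4 := le_self_pow₀ hL (by norm_num)
      have := abs_nonneg δ
      nlinarith
    calc x * Y * (1 + |δ| + L) ≤ x * Y * ((2 + |δ|) * L ^ 4) := by gcongr
      _ = (2 + |δ|) * M := by
        rw [hY, hM, hB, pow_add]
        field_simp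
  rcases le_or_gt Q Y with hQY | hYQ
  · have h1 := hbdh x hx3 Q hQY
    have h2 := V_nonneg x Q
    have h3 : |V x Q - Q * x * Real.log Q + (1 + δ) * Q * x| ≤
        C₃ * M + x * Y * (1 + |δ| + L) := by
      have h4 : Q * x * |1 + δ - Real.log Q| ≤ x * Y * (1 + |δ| + L) := by
        rw [mul_comm Q x]
        gcongr
        have := neg_abs_le δ
        have := le_abs_self δ
        rw [abs_le]
        constructor <;> linarith
      have h5 : V x Q - Q * x * Real.log Q + (1 + δ) * Q * x =
          V x Q + Q * x * (1 + δ - Real.log Q) := by ring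
      rw [h5]
      refine (abs_add_le _ _).trans ?_
      rw [abs_of_nonneg h2, abs_mul, abs_of_nonneg (by positivity : 0 ≤ Q * x), hM,
        mul_div_assoc']
      exact add_le_add h1 h4
    nlinarith [mul_pos hC₁ hP0, mul_pos hC₁ hM0, mul_pos hG0 hP0]
  have hYx : Y ≤ x := hYQ.le.trans hQx
  have hY1 : 1 ≤ Y := by
    rw [hY, le_div_iff₀ (by positivity), one_mul]
    have h1 : F (B + 1) * L ^ B ≤ L ^ (B + 1) := by
      rw [pow_succ L B, mul_comm]
      gcongr
      linarith
    exact le_of_mul_le_mul_left (h1.trans hpowB) (hF _)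
  have hlY : 0 ≤ Real.log Y := Real.log_nonneg hY1
  have hlYL : Real.log Y ≤ L := Real.log_le_log hY0 hYx
  set E := C₂ * (x / L ^ (A + B)) with hE
  have hE0 : 0 ≤ E := by positivity
  have hEx : E ≤ x := by
    rw [hE, mul_div_assoc', div_le_iff₀ (by positivity), mul_comm]
    have h1 : L ≤ L ^ (A + B) := le_self_pow₀ hL (by omega)
    have := hF (B + 1)
    gcongr
    linarith
  have hEL : ∀ k ≤ B, E * x * L ^ k ≤ C₂ * M := by
    intro k hk
    have h1 : L ^ k ≤ L ^ B := pow_le_pow_right₀ hL hk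
    calc E * x * L ^ k ≤ E * x * L ^ B := by gcongr
      _ = C₂ * M := by
        rw [hE, hM, pow_add]
        field_simp
  have hE1 : ∀ y : ℝ, 0 ≤ y → y ≤ x → |psi y 1 1 - y| ≤ E := by
    intro y h1 h2
    have h := hsw x hx55 y h1 h2 1 le_rfl (by simpa using one_le_pow₀ hL) 1 (by simp)
    simpa using h
  have hEr : ∀ r : ℕ, 1 ≤ r → (r : ℝ) ≤ L ^ B → ∀ n : ℕ, n.Coprime r → ∀ y : ℝ, 0 ≤ y →
      y ≤ x → |psi y r n - y / (r.totient : ℝ)| ≤ E :=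
    fun r h1 h2 n h3 y h4 h5 => hsw x hx55 y h4 h5 r h1 h2 n h3
  have hxL : ∀ k, x * L ^ k ≤ F (A + k) * M := fun k => by
    rw [hFdef]
    exact mul_log_pow_le A k hx3
  have htail : ∀ Z : ℝ, Y ≤ Z → Z ≤ x → |2 * offDiagTail x Z - Z ^ 2 * totRiesz (x / Z)| ≤
      (12 * C₂ + 186 * F (A + (B + 6))) * M := by
    intro Z hYZ hZx
    have hZ0 : 0 < Z := hY0.trans_le hYZ
    have hxZ : x / Z ≤ L ^ B := by
      rw [← hxY]
      gcongr
    have hxZx : x / Z ≤ x := div_le_self hx0.le (hY1.trans hYZ)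
    have h := abs_offDiagTail_sub_le (E := E) (K := 9 * L ^ 3) (by linarith) hZ0 hEx
      (fun r h1 h2 => hEr r h1 (h2.trans hxZ)) hE1 (by positivity)
      (fun r h1 h2 => notCoprimeSum_le hx3 (by omega) (h2.trans hxZx))
    refine h.trans ?_
    have h1 : x / Z * (2 * (6 * E * x + 3 * x + (9 * L ^ 3) ^ 2 + 9 * L ^ 3 * x)) ≤
        L ^ B * (12 * (E * x) + 186 * (x * L ^ 6)) := by
      have h2 : x ≤ x * L ^ 6 := le_mul_of_one_le_right hx0.le (one_le_pow₀ hL)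
      have h3 : L ^ 6 ≤ x * L ^ 6 := le_mul_of_one_le_left (by positivity) (by linarith)
      have h4 : L ^ 3 * x ≤ x * L ^ 6 := by
        rw [mul_comm]
        have : L ^ 3 ≤ L ^ 6 := pow_le_pow_right₀ hL (by norm_num)
        gcongr
      refine mul_le_mul hxZ ?_ (by positivity) (by positivity)
      linarith
    refine h1.trans ?_
    have h2 := hEL B le_rfl
    have h3 := hxL (B + 6)
    calc L ^ B * (12 * (E * x) + 186 * (x * L ^ 6))
        = 12 * (E * x * L ^ B) + 186 * (x * L ^ (B + 6)) := by ring
      _ ≤ 12 * (C₂ * M) + 186 * (F (A + (B + 6)) * M) := by gcongr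
      _ = _ := by ring
  have hV := abs_V_sub_le hx3 hY0.le hYQ.le hQx (hE1 x hx0.le le_rfl)
  have hD := abs_sum_vonMangoldt_sq_sub_le hx3 hE1
  have hfloor : |((⌊Q⌋₊ : ℝ) - ⌊Y⌋₊) - (Q - Y)| ≤ 1 := by
    have h1 := Nat.floor_le hQ0.le
    have h2 := Nat.lt_floor_add_one Q
    have h3 := Nat.floor_le hY0.le
    have h4 := Nat.lt_floor_add_one Y
    rw [abs_le]
    constructor <;> linarith
  have hV₁ : |V x Y| ≤ C₃ * M := by
    rw [abs_of_nonneg (V_nonneg x Y), hM, mul_div_assoc']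
    exact hbdh x hx3 Y le_rfl
  have hRY : |Y ^ 2 * totRiesz (x / Y) - (x ^ 2 * (α * (L - Real.log Y) + β) +
      x * Y * (L - Real.log Y + δ))| ≤ C₁ * P := by
    refine (hriesz x Y hY0 hYx).trans ?_
    have h1 : Y ^ ((5 : ℝ) / 4) ≤ Q ^ ((5 : ℝ) / 4) :=
      Real.rpow_le_rpow hY0.le hYQ.le (by norm_num)
    rw [hP]
    gcongr
  have htQ : |totSum Q - (α * Real.log Q + β')| ≤ C₁ / Y ^ ((1 : ℝ) / 4) := by
    refine (htot Q hQ1).trans ?_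
    have h1 : Y ^ ((1 : ℝ) / 4) ≤ Q ^ ((1 : ℝ) / 4) :=
      Real.rpow_le_rpow hY0.le hYQ.le (by norm_num)
    have h2 : 0 < Y ^ ((1 : ℝ) / 4) := Real.rpow_pos_of_pos hY0 _
    gcongr
  have hmain := abs_sub_main_le (by linarith : 1 ≤ x) hY0.le hYQ.le hQx hL hlY hlYL hV
    (htail Y le_rfl hYx) (htail Q hYQ.le hQx) hRY (hriesz x Q hQ0 hQx) (htot Y hY1) htQ hD
    hfloor hV₁
  have he₁ : 81 * x * L ^ 6 + 12 * x * L ^ 2 * (E + 9 * L ^ 3) ≤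
      (189 * F (A + 6) + 12 * C₂) * M := by
    have h1 := hEL 2 (by omega)
    have h2 := hxL 6
    have h3 : x * L ^ 5 ≤ x * L ^ 6 := by
      have : L ^ 5 ≤ L ^ 6 := pow_le_pow_right₀ hL (by norm_num)
      gcongr
    calc _ = 81 * (x * L ^ 6) + 12 * (E * x * L ^ 2) + 108 * (x * L ^ 5) := by ring
      _ ≤ 189 * (F (A + 6) * M) + 12 * (C₂ * M) := by linarith
      _ = _ := by ring
  have he₄ : x ^ 2 * (C₁ / Y ^ ((1 : ℝ) / 4)) ≤ C₁ * F (4 * A + B) * M := by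
    have h1 := sq_div_rpow_le A B hx3
    rw [← hFdef] at h1
    calc x ^ 2 * (C₁ / Y ^ ((1 : ℝ) / 4)) = C₁ * (x ^ 2 / Y ^ ((1 : ℝ) / 4)) := by ring
      _ ≤ C₁ * (F (4 * A + B) * M) := by gcongr
      _ = _ := by ring
  have he₅ : x * (2 * E * L + 6 * √x * L ^ 2) ≤
      (2 * C₂ + 6 * (F (A + 2) * 2 ^ (A + 2))) * M := by
    have h1 := hEL 1 (by omega)
    rw [pow_one] at h1
    have h2 := sqrt_le_div_log_pow (A + 2) hx3
    rw [← hFdef] at h2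
    calc x * (2 * E * L + 6 * √x * L ^ 2) = 2 * (E * x * L) + 6 * (x * √x * L ^ 2) := by ring
      _ ≤ 2 * (C₂ * M) + 6 * (x * (F (A + 2) * 2 ^ (A + 2) * x / L ^ (A + 2)) * L ^ 2) := by
          gcongr
      _ = _ := by
        rw [hM, pow_add L A 2]
        field_simp
  have hxL1 := hxL 1
  rw [pow_one] at hxL1
  refine hmain.trans ?_
  have hfin : 2 * (C₁ * P) + G * M ≤ (2 * C₁ + G) * (P + M) := by
    nlinarith [mul_pos hC₁ hM0, mul_pos hG0 hP0]
  refine le_trans ?_ hfin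
  rw [hG]
  linarith

end Hooley

/-- Hooley's refinement: there is a constant c such that for every A > 0 there
are x₀, C with |V(x,Q) − Qx log Q + cQx| ≤ C(Q^{5/4} x^{3/4} + x²(log x)^{-A})
for all x > x₀ and 1 ≤ Q ≤ x. -/
theorem hooley_formula :
    ∃ c : ℝ, ∀ A : ℝ, 0 < A → ∃ x₀ C : ℝ, 0 < C ∧ ∀ x Q : ℝ, x₀ < x → 1 ≤ Q → Q ≤ x →
      |V x Q - Q * x * Real.log Q + c * Q * x| ≤
        C * (Q ^ ((5 : ℝ) / 4) * x ^ ((3 : ℝ) / 4) + x ^ 2 * Real.log x ^ (-A)) := by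
  obtain ⟨c, h⟩ := Hooley.exists_V_asymp
  refine ⟨c, fun A hA => ?_⟩
  obtain ⟨x₀, C, hC, hx₀, hmain⟩ := h ⌈A⌉₊
  refine ⟨x₀, C, hC, fun x Q hx hQ hQx => (hmain x Q hx hQ hQx).trans ?_⟩
  have hL := Hooley.one_le_log_of_three_le (by linarith : 3 ≤ x)
  have h1 : 1 / Real.log x ^ ⌈A⌉₊ ≤ Real.log x ^ (-A) := by
    rw [one_div, ← Real.rpow_natCast, ← Real.rpow_neg (by linarith)]
    exact Real.rpow_le_rpow_of_exponent_le hL (neg_le_neg (Nat.le_ceil A))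
  rw [div_eq_mul_one_div (x ^ 2)]
  gcongr
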